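/- Let n ≥ 1, s ∈ ℝ, 0 < p < ∞, 0 < q ≤ ∞ and let m ∈ ℝ satisfy m < m_c(p). Let a ∈ S^m(ℝ^n) be such that a(x,ξ) = 0 for all x outside a fixed compact set K ⊂ ℝ^n, and let φ ∈ C^∞(ℝ^n × (ℝ^n ∖ {0})) be real-valued, positively homogeneous of degree 1 in ξ, and non-degenerate on K. Then there exists a constant C such that for every Schwartz function f on ℝ^n one has ‖T_a^φ f‖_{F^s_{p,q}} ≤ C ‖f‖_{F^s_{p,q}}. -/

import Mathlib

noncomputable section

open MeasureTheory Complex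
open scoped ENNReal NNReal InnerProductSpace

/-- Euclidean space `ℝ^n`. -/
abbrev Rn (n : ℕ) := EuclideanSpace ℝ (Fin n)

/-- The Fourier transform `f̂(ξ) = ∫ e^{-i x·ξ} f(x) dx`. -/
def ftransform (n : ℕ) (f : Rn n → ℂ) (ξ : Rn n) : ℂ :=
  ∫ x : Rn n, Complex.exp (-(Complex.I * ((⟪x, ξ⟫_ℝ : ℝ) : ℂ))) * f x

/-- The Fourier integral operator `T_a^φ f(x) = (2π)^{-n} ∫ a(x,ξ) e^{iφ(x,ξ)} f̂(ξ) dξ`. -/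
def fio (n : ℕ) (a : Rn n → Rn n → ℂ) (φ : Rn n → Rn n → ℝ) (f : Rn n → ℂ) (x : Rn n) : ℂ :=
  ((((2 * Real.pi) ^ n)⁻¹ : ℝ) : ℂ) *
    ∫ ξ : Rn n, a x ξ * Complex.exp (Complex.I * ((φ x ξ : ℝ) : ℂ)) * ftransform n f ξ

/-- The Littlewood–Paley pieces `ψ_j` built from `ψ_0`. -/
def lpPiece (n : ℕ) (ψ0 : Rn n → ℝ) (j : ℕ) (ξ : Rn n) : ℝ :=
  if j = 0 then ψ0 ξ
  else ψ0 ((2 : ℝ) ^ (-(j : ℤ)) • ξ) - ψ0 ((2 : ℝ) ^ (-(j : ℤ) + 1) • ξ)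

/-- Hypotheses on the base function `ψ_0` of a Littlewood–Paley partition of unity. -/
def IsLPBase (n : ℕ) (ψ0 : Rn n → ℝ) : Prop :=
  ContDiff ℝ (⊤ : ℕ∞) ψ0 ∧ (∀ ξ : Rn n, ‖ξ‖ ≤ 1 → ψ0 ξ = 1) ∧ (∀ ξ : Rn n, 2 < ‖ξ‖ → ψ0 ξ = 0)

/-- Inverse Fourier transform of a real-valued function. -/
def invFT (n : ℕ) (h : Rn n → ℝ) (x : Rn n) : ℂ :=
  ((((2 * Real.pi) ^ n)⁻¹ : ℝ) : ℂ) *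
    ∫ ξ : Rn n, Complex.exp (Complex.I * ((⟪x, ξ⟫_ℝ : ℝ) : ℂ)) * ((h ξ : ℝ) : ℂ)

/-- The operator `h(D) g`: convolution of `g` with the inverse Fourier transform of `h`. -/
def smoothOp (n : ℕ) (h : Rn n → ℝ) (g : Rn n → ℂ) (x : Rn n) : ℂ :=
  ∫ y : Rn n, invFT n h (x - y) * g y

/-- `ℓ^q`-norm of a sequence in `ℝ≥0∞`, for `0 < q ≤ ∞`. -/
def lqSum (q : ℝ≥0∞) (u : ℕ → ℝ≥0∞) : ℝ≥0∞ :=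
  if q = ∞ then ⨆ j, u j else (∑' j, u j ^ q.toReal) ^ (1 / q.toReal)

/-- Besov–Lipschitz quasi-norm `‖g‖_{B^s_{p,q}}`. -/
def besovNorm (n : ℕ) (ψ0 : Rn n → ℝ) (s : ℝ) (p q : ℝ≥0∞) (g : Rn n → ℂ) : ℝ≥0∞ :=
  lqSum q fun j =>
    ENNReal.ofReal ((2 : ℝ) ^ ((j : ℝ) * s)) * eLpNorm (smoothOp n (lpPiece n ψ0 j) g) p volume

/-- Triebel–Lizorkin quasi-norm `‖g‖_{F^s_{p,q}}`. -/
def tlNorm (n : ℕ) (ψ0 : Rn n → ℝ) (s : ℝ) (p q : ℝ≥0∞) (g : Rn n → ℂ) : ℝ≥0∞ :=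
  if p = ∞ then
    essSup (fun x : Rn n => lqSum q fun j =>
      ENNReal.ofReal ((2 : ℝ) ^ ((j : ℝ) * s)) *
        (‖smoothOp n (lpPiece n ψ0 j) g x‖₊ : ℝ≥0∞)) volume
  else
    (∫⁻ x : Rn n, (lqSum q fun j =>
      ENNReal.ofReal ((2 : ℝ) ^ ((j : ℝ) * s)) *
        (‖smoothOp n (lpPiece n ψ0 j) g x‖₊ : ℝ≥0∞)) ^ p.toReal ∂volume) ^ (1 / p.toReal)

/-- Critical order `m_c(p) = -(n-1)|1/p - 1/2|`. -/
def criticalOrder (n : ℕ) (p : ℝ≥0∞) : ℝ := -((n : ℝ) - 1) * |p⁻¹.toReal - 1 / 2|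

/-- The symbol class `S^m(ℝ^n)`. -/
def SymbolClass (n : ℕ) (m : ℝ) (a : Rn n → Rn n → ℂ) : Prop :=
  ContDiff ℝ (⊤ : ℕ∞) (fun p : Rn n × Rn n => a p.1 p.2) ∧
  ∀ k l : ℕ, ∃ C : ℝ, ∀ x ξ : Rn n,
    ‖iteratedFDeriv ℝ k (fun ξ' => iteratedFDeriv ℝ l (fun x' => a x' ξ') x) ξ‖ ≤
      C * (1 + ‖ξ‖ ^ 2) ^ ((m - (k : ℝ)) / 2)

/-- Smoothness away from `ξ = 0` and positive homogeneity of degree 1 in `ξ` of a phase. -/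
def PhaseSmoothHomog (n : ℕ) (φ : Rn n → Rn n → ℝ) : Prop :=
  ContDiffOn ℝ (⊤ : ℕ∞) (fun p : Rn n × Rn n => φ p.1 p.2) {p : Rn n × Rn n | p.2 ≠ 0} ∧
  ∀ (x ξ : Rn n) (t : ℝ), 0 < t → φ x (t • ξ) = t * φ x ξ

/-- The phase class `Φ^k`. -/
def PhaseClass (n : ℕ) (k : ℕ) (φ : Rn n → Rn n → ℝ) : Prop :=
  PhaseSmoothHomog n φ ∧
  ∀ a b : ℕ, k ≤ a + b → ∃ C : ℝ, ∀ x ξ : Rn n, ξ ≠ 0 →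
    ‖ξ‖ ^ ((a : ℝ) - 1) *
      ‖iteratedFDerivWithin ℝ a
        (fun ξ' => iteratedFDeriv ℝ b (fun x' => φ x' ξ') x) {ξ' : Rn n | ξ' ≠ 0} ξ‖ ≤ C

/-- Determinant of the mixed Hessian `(∂²φ/∂x_i∂ξ_k)`. -/
def mixedHessianDet (n : ℕ) (φ : Rn n → Rn n → ℝ) (x ξ : Rn n) : ℝ :=
  Matrix.det (Matrix.of fun i k : Fin n =>
    fderiv ℝ (fun x' => fderiv ℝ (fun ξ' => φ x' ξ') ξ (EuclideanSpace.single k 1)) x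
      (EuclideanSpace.single i 1))

/-- The strong non-degeneracy (SND) condition. -/
def SNDCondition (n : ℕ) (φ : Rn n → Rn n → ℝ) : Prop :=
  ∃ δ : ℝ, 0 < δ ∧ ∀ x ξ : Rn n, ξ ≠ 0 → δ ≤ |mixedHessianDet n φ x ξ|

/-- Non-degeneracy of the phase on a compact set `K`. -/
def NonDegenerateOn (n : ℕ) (φ : Rn n → Rn n → ℝ) (K : Set (Rn n)) : Prop :=
  ∀ x ∈ K, ∀ ξ : Rn n, ξ ≠ 0 → mixedHessianDet n φ x ξ ≠ 0

section
open scoped ContDiff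

section UniformBounds
variable {ι E F G : Type*} [NormedAddCommGroup E] [NormedSpace ℝ E]
  [NormedAddCommGroup F] [NormedSpace ℝ F] [NormedAddCommGroup G] [NormedSpace ℝ G]

/-- A family of smooth functions all of whose derivatives are bounded on `s`, uniformly in the
index. -/
def UB (s : Set E) (f : ι → E → F) : Prop :=
  (∀ i, ContDiff ℝ ∞ (f i)) ∧ ∀ k : ℕ, ∃ C : ℝ, ∀ i, ∀ x ∈ s, ‖iteratedFDeriv ℝ k (f i) x‖ ≤ C

namespace UB
variable {s : Set E} {f g : ι → E → F}

theorem mono {t : Set E} (hf : UB s f) (h : t ⊆ s) : UB t f :=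
  ⟨hf.1, fun k => (hf.2 k).imp fun _ hC i x hx => hC i x (h hx)⟩

theorem reindex {κ : Type*} (hf : UB s f) (σ : κ → ι) : UB s (fun k => f (σ k)) :=
  ⟨fun _ => hf.1 _, fun k => (hf.2 k).imp fun _ hC _ x hx => hC _ x hx⟩

theorem bound (hf : UB s f) (k : ℕ) :
    ∃ C : ℝ, 0 < C ∧ ∀ i, ∀ x ∈ s, ‖iteratedFDeriv ℝ k (f i) x‖ ≤ C := by
  obtain ⟨C, hC⟩ := hf.2 k
  exact ⟨max C 1, by positivity, fun i x hx => (hC i x hx).trans (le_max_left _ _)⟩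

theorem bound_zero (hf : UB s f) : ∃ C : ℝ, 0 < C ∧ ∀ i, ∀ x ∈ s, ‖f i x‖ ≤ C := by
  obtain ⟨C, h0, hC⟩ := hf.bound 0
  exact ⟨C, h0, fun i x hx => by simpa using hC i x hx⟩

/-- One bound for all derivatives of order at most `k`. -/
theorem bound_le (hf : UB s f) (k : ℕ) :
    ∃ C : ℝ, 1 ≤ C ∧ ∀ j ≤ k, ∀ i, ∀ x ∈ s, ‖iteratedFDeriv ℝ j (f i) x‖ ≤ C := by
  choose C h0 hC using hf.bound
  refine ⟨1 + ∑ j ∈ Finset.range (k + 1), C j, ?_, fun j hj i x hx => (hC j i x hx).trans ?_⟩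
  · have := Finset.sum_nonneg (s := Finset.range (k + 1)) fun j _ => (h0 j).le
    linarith
  · have := Finset.single_le_sum (s := Finset.range (k + 1)) (f := C) (fun j _ => (h0 j).le)
      (Finset.mem_range.2 (by omega : j < k + 1))
    linarith

theorem add (hf : UB s f) (hg : UB s g) : UB s (fun i x => f i x + g i x) := by
  refine ⟨fun i => (hf.1 i).add (hg.1 i), fun k => ?_⟩
  obtain ⟨C, hC⟩ := hf.2 k
  obtain ⟨D, hD⟩ := hg.2 k
  refine ⟨C + D, fun i x hx => ?_⟩
  have hfi : ContDiff ℝ k (f i) := (hf.1 i).of_le (by exact_mod_cast le_top)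
  have hgi : ContDiff ℝ k (g i) := (hg.1 i).of_le (by exact_mod_cast le_top)
  rw [fun_iteratedFDeriv_add_apply hfi.contDiffAt hgi.contDiffAt]
  exact (norm_add_le _ _).trans (add_le_add (hC i x hx) (hD i x hx))

theorem clm (hf : UB s f) (L : F →L[ℝ] G) : UB s (fun i x => L (f i x)) := by
  refine ⟨fun i => L.contDiff.comp (hf.1 i), fun k => ?_⟩
  obtain ⟨C, hC⟩ := hf.2 k
  refine ⟨‖L‖ * C, fun i x hx => ?_⟩
  have := L.norm_iteratedFDeriv_comp_left (f := f i) (x := x) (n := k)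
    (hf.1 i).contDiffAt (by exact_mod_cast le_top)
  exact this.trans (mul_le_mul_of_nonneg_left (hC i x hx) (norm_nonneg _))

theorem neg (hf : UB s f) : UB s (fun i x => -f i x) := by
  simpa using hf.clm (-ContinuousLinearMap.id ℝ F)

theorem sub (hf : UB s f) (hg : UB s g) : UB s (fun i x => f i x - g i x) := by
  simpa only [sub_eq_add_neg] using hf.add hg.neg

theorem const {c : ι → F} {C : ℝ} (h : ∀ i, ‖c i‖ ≤ C) : UB s (fun i (_ : E) => c i) := by
  refine ⟨fun i => contDiff_const, fun k => ⟨max C 0, fun i x _ => ?_⟩⟩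
  rcases Nat.eq_zero_or_pos k with rfl | hk
  · simpa using Or.inl (h i)
  · rw [iteratedFDeriv_const_of_ne hk.ne']; simp

theorem sum {κ : Type*} {t : Finset κ} {f : κ → ι → E → F} (h : ∀ l ∈ t, UB s (f l)) :
    UB s (fun i x => ∑ l ∈ t, f l i x) := by
  classical
  induction t using Finset.induction_on with
  | empty => simpa using const (s := s) (c := fun _ : ι => (0 : F)) (C := 0) (by simp)
  | insert a t ha ih =>
    simp only [Finset.sum_insert ha]
    exact (h a (by simp)).add (ih fun l hl => h l (by simp [hl]))

theorem mul {A : Type*} [NormedRing A] [NormedAlgebra ℝ A] {f g : ι → E → A}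
    (hf : UB s f) (hg : UB s g) : UB s (fun i x => f i x * g i x) := by
  refine ⟨fun i => (hf.1 i).mul (hg.1 i), fun k => ?_⟩
  obtain ⟨C, hC1, hC⟩ := hf.bound_le k
  obtain ⟨D, hD1, hD⟩ := hg.bound_le k
  refine ⟨∑ j ∈ Finset.range (k + 1), (k.choose j : ℝ) * C * D, fun i x hx => ?_⟩
  refine (norm_iteratedFDeriv_mul_le (N := ∞) (hf.1 i) (hg.1 i) x
    (by exact_mod_cast le_top)).trans (Finset.sum_le_sum fun j hj => ?_)
  have hj' : j ≤ k := by simpa [Nat.lt_succ_iff] using hj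
  gcongr
  · exact hC j hj' i x hx
  · exact hD _ (Nat.sub_le _ _) i x hx

theorem fderiv_apply (hf : UB s f) (e : E) : UB s (fun i x => fderiv ℝ (f i) x e) := by
  have h1 : UB s (fun i x => fderiv ℝ (f i) x) := by
    refine ⟨fun i => (hf.1 i).fderiv_right (by simp), fun k => ?_⟩
    obtain ⟨C, hC⟩ := hf.2 (k + 1)
    exact ⟨C, fun i x hx => by
      have := hC i x hx
      rwa [← norm_iteratedFDeriv_fderiv] at this⟩
  exact h1.clm (ContinuousLinearMap.apply ℝ F e)

/-- Composition; only the derivatives of positive order of the inner family need to be bounded. -/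
theorem comp' {t : Set F} {g : ι → F → G} (hg : UB t g) (hc : ∀ i, ContDiff ℝ ∞ (f i))
    (hf : ∀ k : ℕ, ∃ C : ℝ, ∀ i, ∀ x ∈ s, ‖iteratedFDeriv ℝ (k + 1) (f i) x‖ ≤ C)
    (hst : ∀ i, ∀ x ∈ s, f i x ∈ t) : UB s (fun i x => g i (f i x)) := by
  refine ⟨fun i => (hg.1 i).comp (hc i), fun k => ?_⟩
  obtain ⟨C, hC1, hC⟩ := hg.bound_le k
  choose D hD using hf
  set M := 1 + ∑ j ∈ Finset.range (k + 1), |D j| with hM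
  have hDM : ∀ j < k + 1, D j ≤ M := fun j hj => by
    have := Finset.single_le_sum (s := Finset.range (k + 1)) (f := fun j => |D j|)
      (fun j _ => abs_nonneg _) (Finset.mem_range.2 hj)
    have := le_abs_self (D j)
    simp only [hM]; linarith
  have hM1 : 1 ≤ M := by
    have := Finset.sum_nonneg (s := Finset.range (k + 1)) fun j _ => abs_nonneg (D j)
    simp only [hM]; linarith
  refine ⟨k.factorial * C * M ^ k, fun i x hx => ?_⟩
  refine norm_iteratedFDeriv_comp_le (N := ∞) (hg.1 i) (hc i) (by exact_mod_cast le_top) x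
    (fun j hj => hC j hj i _ (hst i x hx)) fun j hj1 hjk => ?_
  obtain ⟨j, rfl⟩ : ∃ l, j = l + 1 := ⟨j - 1, by omega⟩
  exact (hD j i x hx).trans ((hDM j (by omega)).trans (le_self_pow₀ hM1 (by omega)))

theorem comp {t : Set F} {g : ι → F → G} (hg : UB t g) (hf : UB s f)
    (hst : ∀ i, ∀ x ∈ s, f i x ∈ t) : UB s (fun i x => g i (f i x)) :=
  hg.comp' hf.1 (fun k => hf.2 (k + 1)) hst

/-- A single smooth function is uniformly bounded on a compact set. -/
theorem of_compact {f : E → F} (hf : ContDiff ℝ ∞ f) (hs : IsCompact s) :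
    UB s (fun _ : ι => f) := by
  refine ⟨fun _ => hf, fun k => ?_⟩
  obtain ⟨C, hC⟩ := hs.exists_bound_of_continuousOn
    (hf.continuous_iteratedFDeriv (m := k) (by exact_mod_cast le_top)).continuousOn
  exact ⟨C, fun _ x hx => hC x hx⟩

theorem of_hasCompactSupport {f : E → F} (hf : ContDiff ℝ ∞ f) (hs : HasCompactSupport f) :
    UB Set.univ (fun _ : ι => f) := by
  refine ⟨fun _ => hf, fun k => ?_⟩
  obtain ⟨C, hC⟩ := (hs.iteratedFDeriv (𝕜 := ℝ) k).exists_bound_of_continuous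
    (hf.continuous_iteratedFDeriv (m := k) (by exact_mod_cast le_top))
  exact ⟨C, fun _ x _ => hC x⟩

/-- A scalar function applied to a bounded family. -/
theorem comp_real {f : ι → E → ℝ} (hf : UB s f) {ρ : ℝ → ℝ} (hρ : ContDiff ℝ ∞ ρ) :
    UB s (fun i x => ρ (f i x)) := by
  obtain ⟨C, _, hC⟩ := hf.bound_zero
  exact (of_compact (ι := ι) hρ (isCompact_closedBall (0 : ℝ) C)).comp hf fun i x hx => by
    simpa using hC i x hx

theorem ofReal {f : ι → E → ℝ} (hf : UB s f) : UB s (fun i x => (f i x : ℂ)) :=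
  hf.clm Complex.ofRealCLM

theorem conj {f : ι → E → ℂ} (hf : UB s f) :
    UB s (fun i x => (starRingEnd ℂ) (f i x)) :=
  hf.clm Complex.conjCLE.toContinuousLinearMap

end UB

theorem exists_smooth_inv {c : ℝ} (hc : 0 < c) :
    ∃ ρ : ℝ → ℝ, ContDiff ℝ ∞ ρ ∧ ∀ u, c ≤ u → ρ u = u⁻¹ := by
  refine ⟨fun u => Real.smoothTransition (2 * u / c - 1) * u⁻¹, ?_, fun u hu => ?_⟩
  · rw [contDiff_iff_contDiffAt]
    intro u
    rcases lt_or_ge u (c / 2) with h | h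
    · refine (contDiffAt_const (c := (0 : ℝ))).congr_of_eventuallyEq ?_
      filter_upwards [gt_mem_nhds h] with v hv
      rw [Real.smoothTransition.zero_of_nonpos, zero_mul]
      rw [sub_nonpos, div_le_one hc]; linarith
    · refine ContDiffAt.mul ?_ (contDiffAt_inv _ (ne_of_gt (by linarith [half_pos hc])))
      exact (Real.smoothTransition.contDiff.comp
        (((contDiff_const.mul contDiff_id).div_const _).sub contDiff_const)).contDiffAt
  · simp only
    rw [Real.smoothTransition.one_of_one_le, one_mul]
    rw [le_sub_iff_add_le, le_div_iff₀ hc]; linarith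

end UniformBounds

section NonStationaryPhase
variable {ι E : Type*} [NormedAddCommGroup E] [NormedSpace ℝ E]
  [MeasurableSpace E]

theorem UB.exists_integral_bound {μ : Measure E} [IsFiniteMeasureOnCompacts μ] {s : Set E}
    (hs : IsCompact s) {b : ι → E → ℂ} (hb : UB s b) (hsupp : ∀ i, tsupport (b i) ⊆ s) :
    ∃ C : ℝ, 0 ≤ C ∧ ∀ i, ∫ x, ‖b i x‖ ∂μ ≤ C := by
  obtain ⟨C, hC0, hC⟩ := hb.bound_zero
  refine ⟨C * μ.real s, by positivity, fun i => ?_⟩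
  rw [← setIntegral_eq_integral_of_forall_compl_eq_zero (s := s)]
  · have := norm_setIntegral_le_of_norm_le_const (μ := μ) (s := s) (f := fun x => ‖b i x‖) (C := C)
      hs.measure_lt_top (fun x hx => by simpa using hC i x hx)
    exact (le_abs_self _).trans this
  · intro x hx
    rw [image_eq_zero_of_notMem_tsupport fun h => hx (hsupp i h), norm_zero]

variable [FiniteDimensional ℝ E] [BorelSpace E]

theorem integral_fderiv_apply_eq_zero {μ : Measure E} [μ.IsAddHaarMeasure] {f : E → ℂ}
    (hf : ContDiff ℝ ∞ f) (hc : HasCompactSupport f) (e : E) : ∫ x, fderiv ℝ f x e ∂μ = 0 := by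
  have hd : Continuous fun x => fderiv ℝ f x e :=
    (hf.continuous_fderiv (by simp)).clm_apply continuous_const
  have hcd : HasCompactSupport fun x => fderiv ℝ f x e := hc.fderiv_apply (𝕜 := ℝ) e
  have := integral_bilinear_hasLineDerivAt_right_eq_neg_left_of_integrable (μ := μ)
    (f := f) (f' := fun x => fderiv ℝ f x e) (g := fun _ => (1 : ℂ)) (g' := fun _ => 0) (v := e)
    (B := ContinuousLinearMap.mul ℝ ℂ) (by simpa using hd.integrable_of_hasCompactSupport hcd)
    (by simp) (by simpa using hf.continuous.integrable_of_hasCompactSupport hc)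
    (fun x _ => ((hf.differentiable (by simp)) x).hasFDerivAt.hasLineDerivAt e)
    (fun x _ => by simpa using (hasFDerivAt_const (1 : ℂ) x).hasLineDerivAt e)
  simpa using this

/-- Non-stationary phase, uniformly over a family. -/
theorem nonstationary_phase (μ : Measure E) [μ.IsAddHaarMeasure] {s : Set E} (hs : IsCompact s)
    {L : Type*} [Fintype L] (e : L → E) {Ψ : ι → E → ℝ} (hΨ : ∀ i, ContDiff ℝ ∞ (Ψ i))
    (hΨ' : ∀ l, UB s (fun i x => fderiv ℝ (Ψ i) x (e l))) {c : ℝ} (hc : 0 < c) (N : ℕ) :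
    ∀ b : ι → E → ℂ, UB s b → (∀ i, tsupport (b i) ⊆ s) →
      (∀ i, ∀ x ∈ tsupport (b i), c ≤ ∑ l, (fderiv ℝ (Ψ i) x (e l)) ^ 2) →
      ∃ C : ℝ, 0 ≤ C ∧ ∀ i, ∀ Λ : ℝ, 0 < Λ →
        ‖∫ x, cexp (I * ((Λ * Ψ i x : ℝ) : ℂ)) * b i x ∂μ‖ ≤ C / Λ ^ N := by
  have hexp : ∀ (r : ℝ) (z : ℂ), ‖cexp (I * (r : ℂ)) * z‖ = ‖z‖ := fun r z => by
    rw [norm_mul, mul_comm I, norm_exp_ofReal_mul_I, one_mul]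
  induction N with
  | zero =>
    intro b hb hsupp _
    obtain ⟨C, hC0, hC⟩ := hb.exists_integral_bound (μ := μ) hs hsupp
    refine ⟨C, hC0, fun i Λ _ => (norm_integral_le_integral_norm _).trans ?_⟩
    simpa only [hexp, pow_zero, div_one] using hC i
  | succ N ih =>
    intro b hb hsupp hlow
    obtain ⟨ρ, hρ, hρc⟩ := exists_smooth_inv hc
    have hu : UB s (fun i x => ρ (∑ l, (fderiv ℝ (Ψ i) x (e l)) ^ 2)) := by
      refine UB.comp_real (UB.sum fun l _ => ?_) hρ
      simpa only [pow_two] using (hΨ' l).mul (hΨ' l)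
    set w : L → ι → E → ℂ := fun l i x =>
      b i x * (((fderiv ℝ (Ψ i) x (e l)) * ρ (∑ l, (fderiv ℝ (Ψ i) x (e l)) ^ 2) : ℝ) : ℂ) with hw
    have hwUB : ∀ l, UB s (w l) := fun l => hb.mul ((hΨ' l).mul hu).ofReal
    have hwts : ∀ l i, tsupport (w l i) ⊆ tsupport (b i) := fun l i => tsupport_mul_subset_left
    have hb' : UB s (fun i x => ∑ l, fderiv ℝ (w l i) x (e l)) :=
      UB.sum fun l _ => (hwUB l).fderiv_apply (e l)
    have hb's : ∀ i, tsupport (fun x => ∑ l, fderiv ℝ (w l i) x (e l)) ⊆ tsupport (b i) := by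
      intro i
      refine closure_minimal ?_ (isClosed_tsupport _)
      intro x hx
      obtain ⟨l, -, hl⟩ := Finset.exists_ne_zero_of_sum_ne_zero hx
      by_contra hxb
      refine hl ?_
      have : fderiv ℝ (w l i) x = 0 := by
        by_contra h0
        exact hxb (hwts l i (support_fderiv_subset ℝ h0))
      simp [this]
    obtain ⟨C, hC0, hC⟩ := ih _ hb' (fun i => (hb's i).trans (hsupp i))
      (fun i x hx => hlow i x (hb's i hx))
    refine ⟨C, hC0, fun i Λ hΛ => ?_⟩
    have hbc : HasCompactSupport (b i) := hs.of_isClosed_subset (isClosed_tsupport _) (hsupp i)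
    have hwc : ∀ l, HasCompactSupport (w l i) := fun l => hbc.mul_right
    set ex : E → ℂ := fun x => cexp (I * ((Λ * Ψ i x : ℝ) : ℂ)) with hex
    have hexs : ContDiff ℝ ∞ ex :=
      (contDiff_const.mul (ofRealCLM.contDiff.comp (contDiff_const.mul (hΨ i)))).cexp
    have hder : ∀ x v, fderiv ℝ ex x v = ex x * (I * Λ * (fderiv ℝ (Ψ i) x v : ℝ)) := by
      intro x v
      have h1 : HasFDerivAt (Ψ i) (fderiv ℝ (Ψ i) x) x :=
        ((hΨ i).differentiable (by simp) x).hasFDerivAt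
      have h2 : HasFDerivAt ex _ x :=
        ((ofRealCLM.hasFDerivAt.comp x (h1.const_mul Λ)).const_mul I).cexp
      rw [h2.fderiv]
      simp [hex]; ring
    have hkey : ∀ x, ∑ l, fderiv ℝ (fun y => ex y * w l i y) x (e l) =
        I * Λ * (ex x * b i x) + ex x * ∑ l, fderiv ℝ (w l i) x (e l) := by
      intro x
      have h1 : ∀ l, fderiv ℝ (fun y => ex y * w l i y) x (e l) =
          ex x * fderiv ℝ (w l i) x (e l) + I * Λ * ex x * (b i x *
            (((fderiv ℝ (Ψ i) x (e l)) ^ 2 *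
              ρ (∑ l, (fderiv ℝ (Ψ i) x (e l)) ^ 2) : ℝ) : ℂ)) := by
        intro l
        rw [fderiv_fun_mul (hexs.differentiable (by simp) x)
          (((hwUB l).1 i).differentiable (by simp) x)]
        simp only [add_apply, smul_apply, smul_eq_mul, hder]
        simp only [hw]; push_cast; ring
      simp only [h1, Finset.sum_add_distrib, ← Finset.mul_sum]
      rw [← ofReal_sum, ← Finset.sum_mul]
      by_cases hx : x ∈ tsupport (b i)
      · rw [hρc _ (hlow i x hx), mul_inv_cancel₀ (ne_of_gt (hc.trans_le (hlow i x hx)))]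
        push_cast; ring
      · rw [image_eq_zero_of_notMem_tsupport hx]; ring
    have hint : ∀ l, ∫ x, fderiv ℝ (fun y => ex y * w l i y) x (e l) ∂μ = 0 := fun l =>
      integral_fderiv_apply_eq_zero (hexs.mul ((hwUB l).1 i)) (hwc l).mul_left (e l)
    have hi1 : Integrable (fun x => I * Λ * (ex x * b i x)) μ :=
      ((hexs.continuous.mul (hb.1 i).continuous).integrable_of_hasCompactSupport
        hbc.mul_left).const_mul _
    have hi2 : Integrable (fun x => ex x * ∑ l, fderiv ℝ (w l i) x (e l)) μ :=
      (hexs.continuous.mul (hb'.1 i).continuous).integrable_of_hasCompactSupport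
        (HasCompactSupport.mul_left
          (hs.of_isClosed_subset (isClosed_tsupport _) ((hb's i).trans (hsupp i))))
    have hsum : ∫ x, (I * Λ * (ex x * b i x) + ex x * ∑ l, fderiv ℝ (w l i) x (e l)) ∂μ = 0 := by
      simp only [← hkey]
      rw [integral_finsetSum _ fun l _ => ?_]
      · simp [hint]
      · exact (((hexs.mul ((hwUB l).1 i)).continuous_fderiv (by simp)).clm_apply
          continuous_const).integrable_of_hasCompactSupport
          ((hwc l).mul_left.fderiv_apply (𝕜 := ℝ) (e l))
    rw [integral_add hi1 hi2, integral_const_mul] at hsum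
    have hn := congrArg norm (eq_neg_of_add_eq_zero_left hsum)
    rw [norm_neg, norm_mul, norm_mul, norm_I, one_mul, norm_real, Real.norm_of_nonneg hΛ.le] at hn
    have hCi := hC i Λ hΛ
    rw [← hn] at hCi
    rw [pow_succ, ← div_div, le_div_iff₀ hΛ, mul_comm]
    exact hCi

end NonStationaryPhase

section Slices
variable {E F G : Type*} [NormedAddCommGroup E] [NormedSpace ℝ E]
  [NormedAddCommGroup F] [NormedSpace ℝ F] [NormedAddCommGroup G] [NormedSpace ℝ G]

theorem iteratedFDeriv_slice_right {f : E × F → G} (hf : ContDiff ℝ ∞ f) (k : ℕ) (x : E) (v : F) :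
    iteratedFDeriv ℝ k (fun w => f (x, w)) v =
      (iteratedFDeriv ℝ k f (x, v)).compContinuousLinearMap
        fun _ => ContinuousLinearMap.inr ℝ E F := by
  have h1 : (fun w => f (x, w)) = (fun p => f ((x, 0) + p)) ∘ ContinuousLinearMap.inr ℝ E F := by
    ext w; simp
  have h2 : ContDiff ℝ ∞ (fun p => f ((x, 0) + p)) := hf.comp (contDiff_const.add contDiff_id)
  rw [h1, ContinuousLinearMap.iteratedFDeriv_comp_right _ h2 _ (by exact_mod_cast le_top),
    iteratedFDeriv_comp_add_left]
  simp

theorem iteratedFDeriv_slice_left {f : E × F → G} (hf : ContDiff ℝ ∞ f) (k : ℕ) (x : E) (v : F) :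
    iteratedFDeriv ℝ k (fun w => f (w, v)) x =
      (iteratedFDeriv ℝ k f (x, v)).compContinuousLinearMap
        fun _ => ContinuousLinearMap.inl ℝ E F := by
  have h1 : (fun w => f (w, v)) = (fun p => f ((0, v) + p)) ∘ ContinuousLinearMap.inl ℝ E F := by
    ext w; simp
  have h2 : ContDiff ℝ ∞ (fun p => f ((0, v) + p)) := hf.comp (contDiff_const.add contDiff_id)
  rw [h1, ContinuousLinearMap.iteratedFDeriv_comp_right _ h2 _ (by exact_mod_cast le_top),
    iteratedFDeriv_comp_add_left]
  simp

theorem norm_compContinuousLinearMap_le_of_norm_le_one {k : ℕ}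
    (A : ContinuousMultilinearMap ℝ (fun _ : Fin k => E) G) (L : F →L[ℝ] E) (hL : ‖L‖ ≤ 1) :
    ‖A.compContinuousLinearMap fun _ => L‖ ≤ ‖A‖ := by
  refine (A.norm_compContinuousLinearMap_le _).trans ?_
  exact mul_le_of_le_one_right (norm_nonneg _)
    (Finset.prod_le_one (fun _ _ => norm_nonneg _) fun _ _ => hL)

theorem UB.slice_right {f : E × F → G} (hf : ContDiff ℝ ∞ f) (hc : HasCompactSupport f) :
    UB Set.univ (fun (x : E) (v : F) => f (x, v)) := by
  refine ⟨fun x => hf.comp (contDiff_const.prodMk contDiff_id), fun k => ?_⟩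
  obtain ⟨C, hC⟩ := (UB.of_hasCompactSupport (ι := Unit) hf hc).2 k
  refine ⟨C, fun x v _ => ?_⟩
  rw [iteratedFDeriv_slice_right hf]
  exact (norm_compContinuousLinearMap_le_of_norm_le_one _ _
    (ContinuousLinearMap.norm_inr_le_one ℝ E F)).trans (hC () _ trivial)

theorem UB.slice_left {f : E × F → G} (hf : ContDiff ℝ ∞ f) (hc : HasCompactSupport f) :
    UB Set.univ (fun (v : F) (x : E) => f (x, v)) := by
  refine ⟨fun x => hf.comp (contDiff_id.prodMk contDiff_const), fun k => ?_⟩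
  obtain ⟨C, hC⟩ := (UB.of_hasCompactSupport (ι := Unit) hf hc).2 k
  refine ⟨C, fun x v _ => ?_⟩
  rw [iteratedFDeriv_slice_left hf]
  exact (norm_compContinuousLinearMap_le_of_norm_le_one _ _
    (ContinuousLinearMap.norm_inl_le_one ℝ E F)).trans (hC () _ trivial)

/-- Derivatives of slices are Lipschitz in the frozen variable. -/
theorem exists_lipschitz_iteratedFDeriv_slice {f : E × F → G} (hf : ContDiff ℝ ∞ f)
    (hc : HasCompactSupport f) (k : ℕ) : ∃ C : ℝ, 0 ≤ C ∧ ∀ (x x' : E) (v v' : F),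
      ‖iteratedFDeriv ℝ k (fun w => f (x, w)) v - iteratedFDeriv ℝ k (fun w => f (x', w)) v'‖ ≤
        C * ‖(x, v) - (x', v')‖ := by
  obtain ⟨C, hC0, hC⟩ := (UB.of_hasCompactSupport (ι := Unit) hf hc).bound (k + 1)
  refine ⟨C, hC0.le, fun x x' v v' => ?_⟩
  have hd : Differentiable ℝ (iteratedFDeriv ℝ k f) :=
    hf.differentiable_iteratedFDeriv (by exact_mod_cast WithTop.coe_lt_top k)
  have h1 := convex_univ.norm_image_sub_le_of_norm_fderiv_le (𝕜 := ℝ) (f := iteratedFDeriv ℝ k f)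
    (C := C) (fun p _ => hd p) (fun p _ => by
      rw [norm_fderiv_iteratedFDeriv]; exact hC () p trivial)
    (Set.mem_univ (x', v')) (Set.mem_univ (x, v))
  rw [iteratedFDeriv_slice_right hf, iteratedFDeriv_slice_right hf]
  have h2 : ∀ A B : ContinuousMultilinearMap ℝ (fun _ : Fin k => E × F) G,
      (A.compContinuousLinearMap fun _ => ContinuousLinearMap.inr ℝ E F) -
        (B.compContinuousLinearMap fun _ => ContinuousLinearMap.inr ℝ E F) =
      (A - B).compContinuousLinearMap fun _ => ContinuousLinearMap.inr ℝ E F := by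
    intro A B; ext m; simp
  rw [h2]
  exact (norm_compContinuousLinearMap_le_of_norm_le_one _ _
    (ContinuousLinearMap.norm_inr_le_one ℝ E F)).trans h1

end Slices

/-- The closed annulus `R⁻¹ ≤ |v| ≤ R`. -/
def ann (n : ℕ) (R : ℝ) : Set (Rn n) := {v | R⁻¹ ≤ ‖v‖ ∧ ‖v‖ ≤ R}

theorem isCompact_ann (n : ℕ) (R : ℝ) : IsCompact (ann n R) := by
  refine (isCompact_closedBall (0 : Rn n) R).of_isClosed_subset ?_ fun v hv => by simpa using hv.2
  exact (isClosed_le continuous_const continuous_norm).inter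
    (isClosed_le continuous_norm continuous_const)

theorem ann_mono {n : ℕ} {R S : ℝ} (hR : 0 < R) (h : R ≤ S) : ann n R ⊆ ann n S := fun _ hv =>
  ⟨(inv_anti₀ hR h).trans hv.1, hv.2.trans h⟩

theorem ne_zero_of_mem_ann {n : ℕ} {R : ℝ} (hR : 0 < R) {v : Rn n} (hv : v ∈ ann n R) : v ≠ 0 := by
  rintro rfl
  have := hv.1
  rw [norm_zero] at this
  exact absurd this (not_le.2 (inv_pos.2 hR))

/-- The spatial coordinate map `v ↦ ∇_ξ Φ(x, v)`. -/
def kap {n : ℕ} (Φ : Rn n → Rn n → ℝ) (x v : Rn n) : Rn n := gradient (Φ x) v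

theorem inner_kap {n : ℕ} (Φ : Rn n → Rn n → ℝ) (x v h : Rn n) :
    ⟪kap Φ x v, h⟫_ℝ = fderiv ℝ (Φ x) v h := by
  rw [kap, gradient, InnerProductSpace.toDual_symm_apply]

theorem sum_sq_apply_basis {n : ℕ} (L : Rn n →L[ℝ] ℝ) :
    ∑ l, (L (EuclideanSpace.single l 1)) ^ 2 = ‖L‖ ^ 2 := by
  have h := (EuclideanSpace.basisFun (Fin n) ℝ).sum_sq_norm_inner_left
    ((InnerProductSpace.toDual ℝ (Rn n)).symm L)
  rw [LinearIsometryEquiv.norm_map] at h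
  rw [← h]
  refine Finset.sum_congr rfl fun l _ => ?_
  rw [EuclideanSpace.basisFun_apply, InnerProductSpace.toDual_symm_apply]
  simp

/-- A smooth compactly supported phase which near `K` and on a large annulus is homogeneous,
non-degenerate, and has non-vanishing spatial gradient. -/
structure GoodPhase (n : ℕ) (K : Set (Rn n)) (Φ : Rn n → Rn n → ℝ) : Prop where
  smooth : ContDiff ℝ ∞ (fun p : Rn n × Rn n => Φ p.1 p.2)
  supp : HasCompactSupport (fun p : Rn n × Rn n => Φ p.1 p.2)
  homog : ∀ x ∈ Metric.cthickening 1 K, ∀ (v : Rn n) (r : ℝ), 0 < r → v ∈ ann n 1024 →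
    r • v ∈ ann n 1024 → Φ x (r • v) = r * Φ x v
  anti : ∃ r₀ c : ℝ, 0 < r₀ ∧ r₀ ≤ 1 ∧ 0 < c ∧ ∀ x₀ ∈ K, ∀ x ∈ Metric.ball x₀ r₀,
    ∀ x' ∈ Metric.ball x₀ r₀, ∀ v ∈ ann n 64, c * ‖x - x'‖ ≤ ‖kap Φ x v - kap Φ x' v‖
  grad : ∃ c : ℝ, 0 < c ∧ ∀ z ∈ K, ∀ v ∈ ann n 64, c ≤ ‖fderiv ℝ (fun z' => Φ z' v) z‖

section PhaseConstruction
variable {n : ℕ} {K : Set (Rn n)} {Φ : Rn n → Rn n → ℝ}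

theorem fderiv_slice_right {F : Rn n × Rn n → ℝ} (hF : ContDiff ℝ ∞ F) (x v : Rn n) :
    fderiv ℝ (fun w => F (x, w)) v = (fderiv ℝ F (x, v)).comp (ContinuousLinearMap.inr ℝ _ _) := by
  have h : HasFDerivAt (fun w => F (x, w)) _ v :=
    ((hF.differentiable (by simp)) (x, v)).hasFDerivAt.comp v (hasFDerivAt_prodMk_right x v)
  exact h.fderiv

theorem fderiv_slice_left {G : Type*} [NormedAddCommGroup G] [NormedSpace ℝ G]
    {F : Rn n × Rn n → G} (hF : ContDiff ℝ ∞ F) (x v : Rn n) :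
    fderiv ℝ (fun w => F (w, v)) x = (fderiv ℝ F (x, v)).comp (ContinuousLinearMap.inl ℝ _ _) := by
  have h : HasFDerivAt (fun w => F (w, v)) _ x :=
    ((hF.differentiable (by simp)) (x, v)).hasFDerivAt.comp x (hasFDerivAt_prodMk_left x v)
  exact h.fderiv

theorem contDiff_kap (hΦ : ContDiff ℝ ∞ (fun p : Rn n × Rn n => Φ p.1 p.2)) :
    ContDiff ℝ ∞ (fun p : Rn n × Rn n => kap Φ p.1 p.2) := by
  have h1 : (fun p : Rn n × Rn n => kap Φ p.1 p.2) = fun p =>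
      (InnerProductSpace.toDual ℝ (Rn n)).symm
        ((fderiv ℝ (fun p : Rn n × Rn n => Φ p.1 p.2) p).comp
          (ContinuousLinearMap.inr ℝ (Rn n) (Rn n))) := by
    ext1 p
    have := fderiv_slice_right hΦ p.1 p.2
    simp only at this
    rw [kap, gradient, ← this]
  rw [h1]
  exact (InnerProductSpace.toDual ℝ (Rn n)).symm.contDiff.comp
    ((hΦ.fderiv_right (by simp)).clm_comp contDiff_const)

theorem hasCompactSupport_kap (hΦ : ContDiff ℝ ∞ (fun p : Rn n × Rn n => Φ p.1 p.2))
    (hc : HasCompactSupport (fun p : Rn n × Rn n => Φ p.1 p.2)) :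
    HasCompactSupport (fun p : Rn n × Rn n => kap Φ p.1 p.2) := by
  refine (hc.fderiv (𝕜 := ℝ)).mono fun p hp => ?_
  contrapose! hp
  have := fderiv_slice_right hΦ p.1 p.2
  simp only [Function.mem_support, ne_eq, not_not] at this hp ⊢
  rw [kap, gradient, this, hp]
  simp

/-- Euler's identity for a homogeneous phase. -/
theorem euler_kap (hΦ : ContDiff ℝ ∞ (fun p : Rn n × Rn n => Φ p.1 p.2))
    (hom : ∀ x ∈ Metric.cthickening 1 K, ∀ (v : Rn n) (r : ℝ), 0 < r → v ∈ ann n 1024 →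
      r • v ∈ ann n 1024 → Φ x (r • v) = r * Φ x v)
    {x : Rn n} (hx : x ∈ Metric.cthickening 1 K) {v : Rn n} (hv : v ∈ ann n 64) :
    ⟪kap Φ x v, v⟫_ℝ = Φ x v := by
  rw [inner_kap]
  have h0 : ContDiff ℝ ∞ (Φ x) := hΦ.comp (contDiff_const.prodMk contDiff_id)
  have h1 : HasDerivAt (fun r : ℝ => Φ x (r • v)) (fderiv ℝ (Φ x) v v) 1 := by
    have hd : HasFDerivAt (Φ x) (fderiv ℝ (Φ x) v) ((1 : ℝ) • v) := by
      rw [one_smul]; exact (h0.differentiable (by simp) v).hasFDerivAt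
    have := hd.comp_hasDerivAt (1 : ℝ) ((hasDerivAt_id (1 : ℝ)).smul_const v)
    simp only [id, one_smul] at this
    exact this
  have h2 : HasDerivAt (fun r : ℝ => r * Φ x v) (Φ x v) 1 := by
    simpa using (hasDerivAt_id (1 : ℝ)).mul_const (Φ x v)
  refine h1.unique (h2.congr_of_eventuallyEq ?_)
  filter_upwards [Ioo_mem_nhds (show (1 / 2 : ℝ) < 1 by norm_num) (show (1 : ℝ) < 2 by norm_num)]
    with r hr
  have hv' := hv
  simp only [ann, Set.mem_ofPred_eq] at hv'
  refine hom x hx v r (by linarith [hr.1]) (ann_mono (by norm_num) (by norm_num) hv) ?_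
  simp only [ann, Set.mem_ofPred_eq, norm_smul, Real.norm_eq_abs,
    abs_of_pos (show 0 < r by linarith [hr.1])]
  have := hr.1; have := hr.2
  constructor <;> nlinarith [hv'.1, hv'.2, norm_nonneg v]

theorem exists_cutoff_phase {φ : Rn n → Rn n → ℝ} (hφ : PhaseSmoothHomog n φ) (hK : IsCompact K) :
    ∃ Φ : Rn n → Rn n → ℝ, ContDiff ℝ ∞ (fun p : Rn n × Rn n => Φ p.1 p.2) ∧
      HasCompactSupport (fun p : Rn n × Rn n => Φ p.1 p.2) ∧
      ∀ x ∈ Metric.cthickening 1 K, ∀ v ∈ ann n 1024, Φ x v = φ x v := by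
  obtain ⟨R, hR0, hR⟩ := (hK.isBounded.cthickening (δ := 1)).exists_pos_norm_le
  let c₁ : ContDiffBump (0 : Rn n) := ⟨R, R + 1, hR0, by linarith⟩
  let c₂ : ContDiffBump (0 : Rn n) := ⟨1024, 2048, by norm_num, by norm_num⟩
  let c₃ : ContDiffBump (0 : Rn n) := ⟨1 / 4096, 1 / 2048, by norm_num, by norm_num⟩
  have hopen : IsOpen {p : Rn n × Rn n | p.2 ≠ 0} := isOpen_ne_fun continuous_snd continuous_const
  refine ⟨fun x v => c₁ x * (c₂ v - c₃ v) * φ x v, ?_, ?_, ?_⟩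
  · rw [contDiff_iff_contDiffAt]
    intro p
    by_cases hp : p.2 = 0
    · refine (contDiffAt_const (c := (0 : ℝ))).congr_of_eventuallyEq ?_
      have : ∀ᶠ q : Rn n × Rn n in nhds p, q.2 ∈ Metric.ball (0 : Rn n) (1 / 4096) := by
        refine continuous_snd.continuousAt.eventually (Metric.isOpen_ball.mem_nhds ?_)
        simp [hp]
      filter_upwards [this] with q hq
      have hq' : ‖q.2‖ < 1 / 4096 := by simpa using hq
      rw [c₂.one_of_mem_closedBall (by simp [c₂]; linarith),
        c₃.one_of_mem_closedBall (by simp [c₃]; linarith)]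
      simp
    · refine ContDiffAt.mul (ContDiff.contDiffAt ?_) (hφ.1.contDiffAt (hopen.mem_nhds hp))
      exact (c₁.contDiff.comp contDiff_fst).mul
        ((c₂.contDiff.comp contDiff_snd).sub (c₃.contDiff.comp contDiff_snd))
  · refine HasCompactSupport.of_support_subset_isCompact
      ((isCompact_closedBall (0 : Rn n) (R + 1)).prod (isCompact_closedBall (0 : Rn n) 2048)) ?_
    intro p hp
    by_contra hcon
    apply hp
    simp only [Set.mem_prod, Metric.mem_closedBall, dist_zero_right, not_and_or, not_le] at hcon
    rcases hcon with h | h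
    · simp only
      rw [c₁.zero_of_le_dist (by simpa [c₁] using h.le)]; ring
    · simp only
      rw [c₂.zero_of_le_dist (by simpa [c₂] using h.le),
        c₃.zero_of_le_dist (by simp [c₃]; linarith)]; ring
  · intro x hx v hv
    simp only [ann, Set.mem_ofPred_eq] at hv
    simp only
    rw [c₁.one_of_mem_closedBall (by simpa [c₁] using hR x hx),
      c₂.one_of_mem_closedBall (by simpa [c₂] using hv.2),
      c₃.zero_of_le_dist (by simp [c₃]; linarith [hv.1])]
    ring

theorem exists_goodPhase {φ : Rn n → Rn n → ℝ} (hφ : PhaseSmoothHomog n φ) (hK : IsCompact K)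
    (hnd : NonDegenerateOn n φ K) :
    ∃ Φ : Rn n → Rn n → ℝ, GoodPhase n K Φ ∧ ∀ x ∈ K, ∀ v ∈ ann n 64, Φ x v = φ x v := by
  obtain ⟨Φ, hsm, hcs, hEq⟩ := exists_cutoff_phase hφ hK
  have hom : ∀ x ∈ Metric.cthickening 1 K, ∀ (v : Rn n) (r : ℝ), 0 < r → v ∈ ann n 1024 →
      r • v ∈ ann n 1024 → Φ x (r • v) = r * Φ x v := fun x hx v r hr hv hrv => by
    rw [hEq x hx v hv, hEq x hx _ hrv, hφ.2 x v r hr]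
  have hKc : K ⊆ Metric.cthickening 1 K := Metric.self_subset_cthickening K
  have hKn : ∀ z ∈ K, Metric.cthickening 1 K ∈ nhds z := fun z hz =>
    Filter.mem_of_superset (Metric.isOpen_thickening.mem_nhds
      (Metric.self_subset_thickening one_pos K hz)) (Metric.thickening_subset_cthickening 1 K)
  have hAn : ∀ v ∈ ann n 64, ann n 1024 ∈ nhds v := fun v hv => by
    simp only [ann, Set.mem_ofPred_eq] at hv
    have h1 : IsOpen {w : Rn n | (1024 : ℝ)⁻¹ < ‖w‖ ∧ ‖w‖ < 1024} :=
      (isOpen_lt continuous_const continuous_norm).inter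
        (isOpen_lt continuous_norm continuous_const)
    exact Filter.mem_of_superset (h1.mem_nhds ⟨by norm_num at hv ⊢; linarith [hv.1],
      by linarith [hv.2]⟩) fun w hw => ⟨hw.1.le, hw.2.le⟩
  set κ : Rn n × Rn n → Rn n := fun p => kap Φ p.1 p.2 with hκ
  have hκs : ContDiff ℝ ∞ κ := contDiff_kap hsm
  set J : Rn n × Rn n → Rn n →L[ℝ] Rn n := fun p =>
    (fderiv ℝ κ p).comp (ContinuousLinearMap.inl ℝ _ _) with hJ
  have hJc : Continuous J := (hκs.continuous_fderiv (by simp)).clm_comp continuous_const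
  have hJd : ∀ z v, fderiv ℝ (fun z' => kap Φ z' v) z = J (z, v) := fun z v =>
    fderiv_slice_left hκs z v
  have hJd' : ∀ z v, DifferentiableAt ℝ (fun z' => kap Φ z' v) z := fun z v =>
    (hκs.comp (contDiff_id.prodMk contDiff_const)).differentiable (by simp) z
  have hJinj : ∀ z ∈ K, ∀ v ∈ ann n 64, Function.Injective (J (z, v)) := by
    intro z hz v hv
    have hdet := hnd z hz v (ne_zero_of_mem_ann (by norm_num) hv)
    have hent : ∀ i k : Fin n,
        fderiv ℝ (fun x' => fderiv ℝ (fun ξ' => φ x' ξ') v (EuclideanSpace.single k 1)) z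
          (EuclideanSpace.single i 1) =
        ⟪J (z, v) (EuclideanSpace.single i 1), EuclideanSpace.single k 1⟫_ℝ := by
      intro i k
      have h1 : (fun x' => fderiv ℝ (fun ξ' => φ x' ξ') v (EuclideanSpace.single k 1)) =ᶠ[nhds z]
          fun x' => ⟪kap Φ x' v, EuclideanSpace.single k 1⟫_ℝ := by
        filter_upwards [hKn z hz] with x' hx'
        rw [inner_kap]
        have h2 : (fun ξ' => φ x' ξ') =ᶠ[nhds v] Φ x' := by
          filter_upwards [hAn v hv] with w hw using (hEq x' hx' w hw).symm
        rw [h2.fderiv_eq]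
      rw [h1.fderiv_eq, fderiv_inner_apply (𝕜 := ℝ) (hJd' z v) (differentiableAt_const _), hJd]
      simp
    rw [← ContinuousLinearMap.coe_coe, ← LinearMap.ker_eq_bot, LinearMap.ker_eq_bot']
    intro h hh
    have hh' : J (z, v) h = 0 := hh
    have hv0 : Matrix.vecMul (h : Fin n → ℝ) (Matrix.of fun i k : Fin n =>
        fderiv ℝ (fun x' => fderiv ℝ (fun ξ' => φ x' ξ') v (EuclideanSpace.single k 1)) z
          (EuclideanSpace.single i 1)) = 0 := by
      ext k
      simp only [Matrix.vecMul, dotProduct, Matrix.of_apply, hent, Pi.zero_apply]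
      have hsum : h = ∑ i, h i • EuclideanSpace.single i (1 : ℝ) := by
        ext j
        simp [Finset.sum_apply, Pi.single_apply]
      calc ∑ i, h i * ⟪J (z, v) (EuclideanSpace.single i 1), EuclideanSpace.single k 1⟫_ℝ
          = ⟪J (z, v) (∑ i, h i • EuclideanSpace.single i (1 : ℝ)),
              EuclideanSpace.single k 1⟫_ℝ := by
            rw [map_sum, sum_inner]
            refine Finset.sum_congr rfl fun i _ => ?_
            rw [map_smul, real_inner_smul_left]
        _ = 0 := by rw [← hsum, hh', inner_zero_left]
    have := Matrix.eq_zero_of_vecMul_eq_zero hdet hv0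
    ext i
    exact congrFun this i
  refine ⟨Φ, ⟨hsm, hcs, hom, ?_, ?_⟩, fun x hx v hv =>
    hEq x (hKc hx) v (ann_mono (by norm_num) (by norm_num) hv)⟩
  · obtain ⟨c, hc0, hc⟩ := ((hK.prod (isCompact_ann n 64)).prod
      (isCompact_sphere (0 : Rn n) 1)).exists_forall_le'
      (f := fun q : (Rn n × Rn n) × Rn n => ‖J q.1 q.2‖) (a := 0)
      ((hJc.comp continuous_fst).clm_apply continuous_snd).norm.continuousOn (by
        rintro ⟨⟨z, v⟩, h⟩ ⟨⟨hz, hv⟩, hh⟩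
        refine norm_pos_iff.2 fun h0 => ?_
        have : h = 0 := hJinj z hz v hv (by rw [map_zero]; exact h0)
        simp [this] at hh)
    have hlow : ∀ z ∈ K, ∀ v ∈ ann n 64, ∀ h, c * ‖h‖ ≤ ‖J (z, v) h‖ := by
      intro z hz v hv h
      rcases eq_or_ne h 0 with rfl | hh
      · simp
      have h1 := hc ((z, v), ‖h‖⁻¹ • h) ⟨⟨hz, hv⟩, by simp [norm_smul, hh]⟩
      simp only [map_smul, norm_smul, norm_inv, norm_norm] at h1
      rwa [inv_mul_eq_div, le_div_iff₀ (norm_pos_iff.2 hh)] at h1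
    have huc : UniformContinuous (fderiv ℝ κ) :=
      ((hasCompactSupport_kap hsm hcs).fderiv (𝕜 := ℝ)).uniformContinuous_of_continuous
        (hκs.continuous_fderiv (by simp))
    obtain ⟨d, hd0, hd⟩ := Metric.uniformContinuous_iff.1 huc (c / 2) (by linarith)
    refine ⟨min d 1, c / 2, lt_min hd0 one_pos, min_le_right _ _, by linarith, ?_⟩
    intro x₀ hx₀ x hx x' hx' v hv
    have h1 := (convex_ball x₀ (min d 1)).norm_image_sub_le_of_norm_fderiv_le' (𝕜 := ℝ)
      (f := fun z' => kap Φ z' v) (φ := J (x₀, v)) (C := c / 2)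
      (fun z _ => hJd' z v) (fun z hz => by
        rw [hJd]
        have h3 : J (z, v) - J (x₀, v) = (fderiv ℝ κ (z, v) - fderiv ℝ κ (x₀, v)).comp
            (ContinuousLinearMap.inl ℝ _ _) := by simp [hJ]
        rw [h3]
        refine (ContinuousLinearMap.opNorm_comp_le _ _).trans ?_
        refine (mul_le_of_le_one_right (norm_nonneg _)
          (ContinuousLinearMap.norm_inl_le_one ℝ _ _)).trans ?_
        rw [← dist_eq_norm]
        refine (hd ?_).le
        rw [Prod.dist_eq, dist_self, max_eq_left dist_nonneg]
        exact lt_of_lt_of_le hz (min_le_left _ _)) hx' hx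
    have h2 := hlow x₀ hx₀ v hv (x - x')
    have h3 := norm_sub_norm_le (J (x₀, v) (x - x')) (kap Φ x v - kap Φ x' v)
    rw [norm_sub_rev (J (x₀, v) (x - x'))] at h3
    linarith
  · have hgl : ∀ z v, fderiv ℝ (fun z' => Φ z' v) z =
        (fderiv ℝ (fun p : Rn n × Rn n => Φ p.1 p.2) (z, v)).comp
          (ContinuousLinearMap.inl ℝ _ _) := fun z v => fderiv_slice_left hsm z v
    obtain ⟨c, hc0, hc⟩ := (hK.prod (isCompact_ann n 64)).exists_forall_le'
      (f := fun q : Rn n × Rn n => ‖fderiv ℝ (fun z' => Φ z' q.2) q.1‖) (a := 0) (by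
        simp only [hgl]
        exact ((hsm.continuous_fderiv (by simp)).clm_comp continuous_const).norm.continuousOn) (by
        rintro ⟨z, v⟩ ⟨hz, hv⟩
        simp only at hz hv ⊢
        refine norm_pos_iff.2 fun h0 => ?_
        have h1 : (fun z' => Φ z' v) =ᶠ[nhds z] fun z' => ⟪kap Φ z' v, v⟫_ℝ := by
          filter_upwards [hKn z hz] with x' hx' using (euler_kap hsm hom hx' hv).symm
        obtain ⟨h, hh⟩ := (LinearMap.injective_iff_surjective (f := (J (z, v)).toLinearMap)).1
          (hJinj z hz v hv) v
        have hh' : J (z, v) h = v := hh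
        have h2 := congrArg (fun L => L h) h0
        simp only [h1.fderiv_eq] at h2
        rw [fderiv_inner_apply (𝕜 := ℝ) (hJd' z v) (differentiableAt_const _), hJd, hh'] at h2
        simp at h2
        exact ne_zero_of_mem_ann (by norm_num) hv h2)
    exact ⟨c, hc0, fun z hz v hv => hc (z, v) ⟨hz, hv⟩⟩

end PhaseConstruction

/-- A family of amplitudes `b λ`, `λ > 0`, supported in `K × {1/4 ≤ |v| ≤ 4}`, smooth in each
variable with bounds uniform in `λ` and in the other variable. -/
structure GoodAmp (n : ℕ) (K : Set (Rn n)) (b : ℝ → Rn n → Rn n → ℂ) : Prop where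
  ub_right : UB Set.univ (fun (i : {l : ℝ // 0 < l} × Rn n) v => b i.1 i.2 v)
  ub_left : UB Set.univ (fun (i : {l : ℝ // 0 < l} × Rn n) z => b i.1 z i.2)
  cont : ∀ l : ℝ, 0 < l → Continuous fun p : Rn n × Rn n => b l p.1 p.2
  mem_left : ∀ l z v, b l z v ≠ 0 → z ∈ K
  mem_right : ∀ l z v, b l z v ≠ 0 → v ∈ ann n 4

/-- The rescaled oscillating amplitude `b_λ(z, v) e^{iλΦ(z, v)}`. -/
def osc {n : ℕ} (b : ℝ → Rn n → Rn n → ℂ) (Φ : Rn n → Rn n → ℝ) (l : ℝ) (z v : Rn n) : ℂ :=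
  cexp (I * ((l * Φ z v : ℝ) : ℂ)) * b l z v

/-- The rescaled kernel `∫ b_λ(z, v) e^{iλ(Φ(z, v) - y·v)} dv`. -/
def ker {n : ℕ} (b : ℝ → Rn n → Rn n → ℂ) (Φ : Rn n → Rn n → ℝ) (l : ℝ) (z y : Rn n) : ℂ :=
  ∫ v, osc b Φ l z v * cexp (-(I * ((l * ⟪y, v⟫_ℝ : ℝ) : ℂ)))

theorem norm_cexp_I_mul (r : ℝ) (z : ℂ) : ‖cexp (I * (r : ℂ)) * z‖ = ‖z‖ := by
  rw [norm_mul, mul_comm I, norm_exp_ofReal_mul_I, one_mul]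

theorem norm_mul_cexp_neg_I (z : ℂ) (r : ℝ) : ‖z * cexp (-(I * (r : ℂ)))‖ = ‖z‖ := by
  have := norm_cexp_I_mul (-r) z
  rwa [ofReal_neg, mul_neg, mul_comm] at this

section KernelBounds
variable {n : ℕ} {K : Set (Rn n)} {Φ : Rn n → Rn n → ℝ} {b : ℝ → Rn n → Rn n → ℂ}

theorem norm_osc (l : ℝ) (z v : Rn n) : ‖osc b Φ l z v‖ = ‖b l z v‖ := norm_cexp_I_mul _ _

theorem ker_eq (l : ℝ) (z y : Rn n) :
    ker b Φ l z y = ∫ v, cexp (I * ((l * (Φ z v - ⟪y, v⟫_ℝ) : ℝ) : ℂ)) * b l z v := by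
  refine integral_congr_ae (Filter.Eventually.of_forall fun v => ?_)
  simp only [osc]
  rw [mul_right_comm, ← Complex.exp_add]
  congr 2
  push_cast; ring

namespace GoodPhase

theorem ub_right (hΦ : GoodPhase n K Φ) : UB Set.univ (fun (x : Rn n) v => Φ x v) :=
  UB.slice_right hΦ.smooth hΦ.supp

theorem ub_left (hΦ : GoodPhase n K Φ) : UB Set.univ (fun (v : Rn n) x => Φ x v) :=
  UB.slice_left hΦ.smooth hΦ.supp

theorem exists_norm_kap_le (hΦ : GoodPhase n K Φ) :
    ∃ C : ℝ, 0 < C ∧ ∀ x v, ‖kap Φ x v‖ ≤ C := by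
  obtain ⟨C, h0, hC⟩ := hΦ.ub_right.bound 1
  refine ⟨C, h0, fun x v => ?_⟩
  rw [kap, gradient, LinearIsometryEquiv.norm_map, ← norm_iteratedFDeriv_one]
  exact hC x v trivial

theorem exists_norm_fderiv_left_le (hΦ : GoodPhase n K Φ) :
    ∃ C : ℝ, 0 < C ∧ ∀ z v, ‖fderiv ℝ (fun z' => Φ z' v) z‖ ≤ C := by
  obtain ⟨C, h0, hC⟩ := hΦ.ub_left.bound 1
  refine ⟨C, h0, fun z v => ?_⟩
  rw [← norm_iteratedFDeriv_one]
  exact hC v z trivial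

end GoodPhase

theorem div_pow_le_of_bounds {A X C D : ℝ} {N : ℕ} (hX : 0 ≤ X) (hC : 0 ≤ C) (hD : 0 ≤ D)
    (h0 : A ≤ C) (h1 : 0 < X → A ≤ D / X ^ N) : A ≤ 2 ^ N * (C + D) / (1 + X) ^ N := by
  rw [le_div_iff₀ (by positivity)]
  rcases le_or_gt X 1 with hX1 | hX1
  · have h2 : (1 + X) ^ N ≤ 2 ^ N := by gcongr; linarith
    nlinarith [mul_le_mul_of_nonneg_right h0 (by positivity : 0 ≤ (1 + X) ^ N),
      mul_le_mul_of_nonneg_left h2 hC, mul_nonneg (by positivity : (0 : ℝ) ≤ 2 ^ N) hD]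
  · have h2 : (1 + X) ^ N ≤ 2 ^ N * X ^ N := by rw [← mul_pow]; gcongr; linarith
    have hXp : 0 < X ^ N := by positivity
    have h3 : D / X ^ N * (1 + X) ^ N ≤ 2 ^ N * D := by
      rw [div_mul_eq_mul_div, div_le_iff₀ hXp]
      nlinarith [mul_le_mul_of_nonneg_left h2 hD]
    nlinarith [mul_le_mul_of_nonneg_right (h1 (by linarith)) (by positivity : 0 ≤ (1 + X) ^ N),
      mul_nonneg (by positivity : (0 : ℝ) ≤ 2 ^ N) hC]

theorem exists_exp_integral_bound_of_UB {ι : Type*} {s : Set (Rn n)} (hs : IsCompact s)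
    {b : ι → Rn n → ℂ} (hb : UB s b) (hsupp : ∀ i, tsupport (b i) ⊆ s) :
    ∃ C : ℝ, 0 ≤ C ∧ ∀ i (θ : Rn n → ℝ), ‖∫ x, cexp (I * ((θ x : ℝ) : ℂ)) * b i x‖ ≤ C := by
  obtain ⟨C, h0, hC⟩ := hb.exists_integral_bound (μ := volume) hs hsupp
  refine ⟨C, h0, fun i θ => (norm_integral_le_integral_norm _).trans ?_⟩
  simpa only [norm_cexp_I_mul] using hC i

namespace GoodAmp

theorem tsupport_right (hb : GoodAmp n K b) (l : ℝ) (z : Rn n) :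
    tsupport (fun v => b l z v) ⊆ ann n 4 :=
  closure_minimal (fun v hv => hb.mem_right l z v hv) (isCompact_ann n 4).isClosed

theorem tsupport_left (hb : GoodAmp n K b) (hK : IsCompact K) (l : ℝ) (v : Rn n) :
    tsupport (fun z => b l z v) ⊆ K :=
  closure_minimal (fun z hz => hb.mem_left l z v hz) hK.isClosed

theorem exists_norm_le (hb : GoodAmp n K b) :
    ∃ C : ℝ, 0 < C ∧ ∀ l : ℝ, 0 < l → ∀ z v, ‖b l z v‖ ≤ C := by
  obtain ⟨C, h0, hC⟩ := hb.ub_right.bound_zero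
  exact ⟨C, h0, fun l hl z v => hC (⟨l, hl⟩, z) v trivial⟩

theorem continuous_osc (hb : GoodAmp n K b) (hΦ : GoodPhase n K Φ) {l : ℝ} (hl : 0 < l) :
    Continuous fun p : Rn n × Rn n => osc b Φ l p.1 p.2 := by
  have := hb.cont l hl
  have := hΦ.smooth.continuous
  unfold osc
  fun_prop

theorem exists_ker_le (hb : GoodAmp n K b) (Φ : Rn n → Rn n → ℝ) :
    ∃ C : ℝ, 0 ≤ C ∧ ∀ l : ℝ, 0 < l → ∀ z y, ‖ker b Φ l z y‖ ≤ C := by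
  obtain ⟨C, h0, hC⟩ := exists_exp_integral_bound_of_UB (isCompact_ann n 4)
    (hb.ub_right.mono (Set.subset_univ _)) (fun i => hb.tsupport_right _ _)
  exact ⟨C, h0, fun l hl z y => by rw [ker_eq]; exact hC (⟨l, hl⟩, z) _⟩

/-- Rapid decay of the kernel away from the bounded set containing all `∇_v Φ`. -/
theorem exists_ker_decay (hb : GoodAmp n K b) (hΦ : GoodPhase n K Φ) (N : ℕ) :
    ∃ C : ℝ, 0 ≤ C ∧ ∀ l : ℝ, 0 < l → ∀ z y,
      ‖ker b Φ l z y‖ ≤ C * (1 + l) ^ N / (1 + l * ‖y‖) ^ N := by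
  obtain ⟨R, hR0, hR⟩ := hΦ.exists_norm_kap_le
  obtain ⟨C₀, hC₀, hC₀'⟩ := hb.exists_ker_le Φ
  let ι := {i : ({l : ℝ // 0 < l} × Rn n) × Rn n // 2 * R + 1 ≤ ‖i.2‖}
  have hpos : ∀ i : ι, 0 < ‖i.1.2‖ := fun i => by linarith [i.2]
  set Ψ : ι → Rn n → ℝ := fun i v => ‖i.1.2‖⁻¹ * (Φ i.1.1.2 v - ⟪i.1.2, v⟫_ℝ) with hΨ
  have hslice : ∀ x, ContDiff ℝ ∞ (Φ x) := hΦ.ub_right.1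
  have hΨs : ∀ i, ContDiff ℝ ∞ (Ψ i) := fun i =>
    contDiff_const.mul ((hslice _).sub (contDiff_const.inner ℝ contDiff_id))
  have hΨd : ∀ i v e, fderiv ℝ (Ψ i) v e =
      ‖i.1.2‖⁻¹ * fderiv ℝ (Φ i.1.1.2) v e - ‖i.1.2‖⁻¹ * ⟪i.1.2, e⟫_ℝ := by
    intro i v e
    have h1 : HasFDerivAt (Φ i.1.1.2) (fderiv ℝ (Φ i.1.1.2) v) v :=
      ((hslice _).differentiable (by simp) v).hasFDerivAt
    have h2 : HasFDerivAt (Ψ i) _ v := (h1.sub (innerSL ℝ i.1.2).hasFDerivAt).const_mul _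
    rw [h2.fderiv]
    simp [mul_sub]
  have hinv : ∀ i : ι, ‖i.1.2‖⁻¹ ≤ 1 := fun i => inv_le_one_of_one_le₀ (by linarith [i.2])
  have hΨ' : ∀ l : Fin n, UB (ann n 4)
      (fun i v => fderiv ℝ (Ψ i) v (EuclideanSpace.single l 1)) := by
    intro l
    simp only [hΨd]
    refine UB.sub (UB.mul (UB.const (c := fun i : ι => ‖i.1.2‖⁻¹) (C := 1) fun i => ?_) ?_)
      (UB.const (c := fun i : ι => ‖i.1.2‖⁻¹ * ⟪i.1.2, EuclideanSpace.single l (1 : ℝ)⟫_ℝ)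
        (C := 1) fun i => ?_)
    · rw [norm_inv, norm_norm]; exact hinv i
    · exact ((hΦ.ub_right.fderiv_apply _).reindex fun i : ι => i.1.1.2).mono (Set.subset_univ _)
    · rw [norm_mul, norm_inv, norm_norm, inv_mul_le_iff₀ (hpos i)]
      exact (norm_inner_le_norm _ _).trans (by simp)
  obtain ⟨D, hD0, hD⟩ := nonstationary_phase (volume : Measure (Rn n)) (isCompact_ann n 4)
    (fun l : Fin n => EuclideanSpace.single l (1 : ℝ)) hΨs hΨ' (c := 1 / 4) (by norm_num) N
    (fun (i : ι) v => b i.1.1.1 i.1.1.2 v)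
    ((hb.ub_right.reindex fun i : ι => i.1.1).mono (Set.subset_univ _))
    (fun i => hb.tsupport_right _ _) (fun i v _ => by
      rw [sum_sq_apply_basis]
      have h1 : fderiv ℝ (Ψ i) v = ‖i.1.2‖⁻¹ • (InnerProductSpace.toDual ℝ (Rn n)
          (kap Φ i.1.1.2 v - i.1.2)) := by
        ext e
        rw [hΨd]
        simp [inner_kap, mul_sub]
      rw [h1, norm_smul, LinearIsometryEquiv.norm_map, norm_inv, norm_norm]
      have h2 : ‖i.1.2‖ / 2 ≤ ‖kap Φ i.1.1.2 v - i.1.2‖ := by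
        have := norm_sub_norm_le i.1.2 (kap Φ i.1.1.2 v)
        rw [norm_sub_rev] at this
        linarith [hR i.1.1.2 v, i.2]
      have h3 : (1 / 2 : ℝ) ≤ ‖i.1.2‖⁻¹ * ‖kap Φ i.1.1.2 v - i.1.2‖ := by
        rw [inv_mul_eq_div, le_div_iff₀ (hpos i)]; linarith
      nlinarith)
  have hfar : ∀ l : ℝ, 0 < l → ∀ z y, 2 * R + 1 ≤ ‖y‖ → ‖ker b Φ l z y‖ ≤ D / (l * ‖y‖) ^ N := by
    intro l hl z y hy
    have hy0 : 0 < ‖y‖ := by linarith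
    have := hD ⟨((⟨l, hl⟩, z), y), hy⟩ (l * ‖y‖) (mul_pos hl hy0)
    have h1 : ∀ v, l * ‖y‖ * (‖y‖⁻¹ * (Φ z v - ⟪y, v⟫_ℝ)) = l * (Φ z v - ⟪y, v⟫_ℝ) := fun v => by
      field_simp
    simp only [hΨ, h1] at this
    rwa [ker_eq]
  refine ⟨(2 * R + 1) ^ N * C₀ + 2 ^ N * (C₀ + D), by positivity, fun l hl z y => ?_⟩
  rcases le_or_gt (2 * R + 1) ‖y‖ with hy | hy
  · refine (div_pow_le_of_bounds (by positivity) hC₀ hD0 (hC₀' l hl z y)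
      fun _ => hfar l hl z y hy).trans ?_
    refine div_le_div_of_nonneg_right ?_ (by positivity)
    have hl1 : 1 ≤ (1 + l) ^ N := one_le_pow₀ (by linarith)
    refine le_trans ?_ (le_mul_of_one_le_right (by positivity) hl1)
    have : 0 ≤ (2 * R + 1) ^ N * C₀ := by positivity
    linarith
  · rw [le_div_iff₀ (by positivity)]
    have h1 : (1 + l * ‖y‖) ^ N ≤ (2 * R + 1) ^ N * (1 + l) ^ N := by
      rw [← mul_pow]; gcongr
      nlinarith [norm_nonneg y]
    calc ‖ker b Φ l z y‖ * (1 + l * ‖y‖) ^ N ≤ C₀ * ((2 * R + 1) ^ N * (1 + l) ^ N) :=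
          mul_le_mul (hC₀' l hl z y) h1 (by positivity) hC₀
      _ ≤ _ := by
        have : 0 ≤ 2 ^ N * (C₀ + D) * (1 + l) ^ N := by positivity
        linarith

end GoodAmp
end KernelBounds

/-- The Fourier transform of the oscillating amplitude in the spatial variable. -/
def zft {n : ℕ} (b : ℝ → Rn n → Rn n → ℂ) (Φ : Rn n → Rn n → ℝ) (l : ℝ) (v η : Rn n) : ℂ :=
  ∫ z, osc b Φ l z v * cexp (-(I * ((⟪z, η⟫_ℝ : ℝ) : ℂ)))

section SpatialFrequency
variable {n : ℕ} {K : Set (Rn n)} {Φ : Rn n → Rn n → ℝ} {b : ℝ → Rn n → Rn n → ℂ}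

theorem zft_eq (l : ℝ) (v η : Rn n) :
    zft b Φ l v η = ∫ z, cexp (I * ((l * Φ z v - ⟪z, η⟫_ℝ : ℝ) : ℂ)) * b l z v := by
  refine integral_congr_ae (Filter.Eventually.of_forall fun z => ?_)
  simp only [osc]
  rw [mul_right_comm, ← Complex.exp_add]
  congr 2
  push_cast; ring

namespace GoodAmp

theorem exists_zft_le (hb : GoodAmp n K b) (hK : IsCompact K) (Φ : Rn n → Rn n → ℝ) :
    ∃ C : ℝ, 0 ≤ C ∧ ∀ l : ℝ, 0 < l → ∀ v η, ‖zft b Φ l v η‖ ≤ C := by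
  obtain ⟨C, h0, hC⟩ := exists_exp_integral_bound_of_UB hK
    (hb.ub_left.mono (Set.subset_univ _)) (fun i => hb.tsupport_left hK _ _)
  exact ⟨C, h0, fun l hl v η => by rw [zft_eq]; exact hC (⟨l, hl⟩, v) _⟩

/-- The spatial frequencies of `osc b Φ l` are comparable to `l`, up to rapidly decaying errors. -/
theorem exists_zft_decay (hb : GoodAmp n K b) (hK : IsCompact K) (hΦ : GoodPhase n K Φ) :
    ∃ C₁ c₁ : ℝ, 1 ≤ C₁ ∧ 0 < c₁ ∧ ∀ N : ℕ, ∃ C : ℝ, 0 ≤ C ∧ ∀ l : ℝ, 0 < l → ∀ v η : Rn n,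
      (C₁ * l ≤ ‖η‖ ∨ ‖η‖ ≤ c₁ * l ∨ l ≤ 2) → ‖zft b Φ l v η‖ ≤ C / (1 + (l + ‖η‖)) ^ N := by
  obtain ⟨S, hS0, hS⟩ := hΦ.exists_norm_fderiv_left_le
  obtain ⟨c, hc0, hc⟩ := hΦ.grad
  obtain ⟨C₀, hC₀, hC₀'⟩ := hb.exists_zft_le hK Φ
  set C₁ := 2 * S + 1 with hC₁
  set c₁ := min (c / 2) 1 with hc₁
  have hc₁0 : 0 < c₁ := lt_min (by linarith) one_pos
  refine ⟨C₁, c₁, by linarith, hc₁0, fun N => ?_⟩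
  let ι := {i : ({l : ℝ // 0 < l} × Rn n) × Rn n //
    C₁ * i.1.1 ≤ ‖i.2‖ ∨ ‖i.2‖ ≤ c₁ * i.1.1}
  let T : ι → ℝ := fun i => i.1.1.1 + ‖i.1.2‖
  have hl0 : ∀ i : ι, 0 < (i.1.1.1 : ℝ) := fun i => i.1.1.1.2
  have hT : ∀ i, 0 < T i := fun i => add_pos_of_pos_of_nonneg (hl0 i) (norm_nonneg _)
  set Ψ : ι → Rn n → ℝ := fun i z =>
    (T i)⁻¹ * (i.1.1.1 * Φ z i.1.1.2 - ⟪i.1.2, z⟫_ℝ) with hΨ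
  have hslice : ∀ v, ContDiff ℝ ∞ (fun z => Φ z v) := hΦ.ub_left.1
  have hΨs : ∀ i, ContDiff ℝ ∞ (Ψ i) := fun i =>
    contDiff_const.mul ((contDiff_const.mul (hslice _)).sub (contDiff_const.inner ℝ contDiff_id))
  have hΨd : ∀ i z e, fderiv ℝ (Ψ i) z e =
      (T i)⁻¹ * i.1.1.1 * fderiv ℝ (fun z => Φ z i.1.1.2) z e - (T i)⁻¹ * ⟪i.1.2, e⟫_ℝ := by
    intro i z e
    have h1 : HasFDerivAt (fun z => Φ z i.1.1.2) (fderiv ℝ (fun z => Φ z i.1.1.2) z) z :=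
      ((hslice _).differentiable (by simp) z).hasFDerivAt
    have h2 : HasFDerivAt (Ψ i) _ z :=
      ((h1.const_mul _).sub (innerSL ℝ i.1.2).hasFDerivAt).const_mul _
    rw [h2.fderiv]
    simp [mul_sub, mul_assoc]
  have hΨ' : ∀ j : Fin n, UB K (fun i z => fderiv ℝ (Ψ i) z (EuclideanSpace.single j 1)) := by
    intro j
    simp only [hΨd]
    refine UB.sub (UB.mul (UB.const (c := fun i : ι => (T i)⁻¹ * i.1.1.1) (C := 1) fun i => ?_) ?_)
      (UB.const (c := fun i : ι => (T i)⁻¹ * ⟪i.1.2, EuclideanSpace.single j (1 : ℝ)⟫_ℝ)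
        (C := 1) fun i => ?_)
    · rw [norm_mul, norm_inv, Real.norm_of_nonneg (hT i).le, Real.norm_of_nonneg (hl0 i).le,
        inv_mul_le_iff₀ (hT i)]
      simp [T]
    · exact ((hΦ.ub_left.fderiv_apply _).reindex fun i : ι => i.1.1.2).mono (Set.subset_univ _)
    · rw [norm_mul, norm_inv, Real.norm_of_nonneg (hT i).le, inv_mul_le_iff₀ (hT i)]
      refine (norm_inner_le_norm _ _).trans ?_
      simpa [T] using (hl0 i).le
  have hmin0 : 0 < min 1 c / 4 := by positivity
  obtain ⟨D, hD0, hD⟩ := nonstationary_phase (volume : Measure (Rn n)) hK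
    (fun j : Fin n => EuclideanSpace.single j (1 : ℝ)) hΨs hΨ' (c := (min 1 c / 4) ^ 2)
    (by positivity) N (fun (i : ι) z => b i.1.1.1 z i.1.1.2)
    ((hb.ub_left.reindex fun i : ι => i.1.1).mono (Set.subset_univ _))
    (fun i => hb.tsupport_left hK _ _) (fun i z hz => by
      have hzK : z ∈ K := hb.tsupport_left hK _ _ hz
      have hv : i.1.1.2 ∈ ann n 64 := by
        obtain ⟨w, hw⟩ : ∃ w, b i.1.1.1 w i.1.1.2 ≠ 0 := by
          by_contra hcon
          push Not at hcon
          have h0 : (fun z => b i.1.1.1 z i.1.1.2) = fun _ => 0 := funext hcon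
          simp [h0, tsupport] at hz
        exact ann_mono (by norm_num) (by norm_num) (hb.mem_right _ _ _ hw)
      rw [sum_sq_apply_basis]
      have h1 : fderiv ℝ (Ψ i) z = (T i)⁻¹ • ((i.1.1.1 : ℝ) • fderiv ℝ (fun z => Φ z i.1.1.2) z -
          innerSL ℝ i.1.2) := by
        ext e
        rw [hΨd]
        simp [mul_sub, mul_assoc]
      have hη : ‖innerSL ℝ i.1.2‖ = ‖i.1.2‖ := innerSL_apply_norm ℝ i.1.2
      have hlf : ‖(i.1.1.1 : ℝ) • fderiv ℝ (fun z => Φ z i.1.1.2) z‖ =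
          i.1.1.1 * ‖fderiv ℝ (fun z => Φ z i.1.1.2) z‖ := by
        rw [norm_smul, Real.norm_of_nonneg (hl0 i).le]
      refine pow_le_pow_left₀ hmin0.le ?_ 2
      rw [h1, norm_smul, norm_inv, Real.norm_of_nonneg (hT i).le, inv_mul_eq_div,
        le_div_iff₀ (hT i)]
      have hm1 : min 1 c ≤ 1 := min_le_left _ _
      have hm2 : min 1 c ≤ c := min_le_right _ _
      have hl := hl0 i
      have hTe : T i = i.1.1.1 + ‖i.1.2‖ := rfl
      rcases i.2 with h | h
      · have h3 := norm_sub_norm_le (innerSL ℝ i.1.2)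
          ((i.1.1.1 : ℝ) • fderiv ℝ (fun z => Φ z i.1.1.2) z)
        rw [norm_sub_rev, hη, hlf] at h3
        have h4 := mul_le_mul_of_nonneg_left (hS z i.1.1.2) hl.le
        nlinarith [norm_nonneg i.1.2, mul_pos hl hS0]
      · have h3 := norm_sub_norm_le ((i.1.1.1 : ℝ) • fderiv ℝ (fun z => Φ z i.1.1.2) z)
          (innerSL ℝ i.1.2)
        rw [hη, hlf] at h3
        have h4 := mul_le_mul_of_nonneg_left (hc z hzK _ hv) hl.le
        have h5 : ‖i.1.2‖ ≤ c / 2 * i.1.1.1 :=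
          h.trans (mul_le_mul_of_nonneg_right (min_le_left _ _) hl.le)
        have h6 : ‖i.1.2‖ ≤ i.1.1.1 := by
          refine h.trans (mul_le_of_le_one_left hl.le (min_le_right _ _))
        have h7 : min 1 c * T i ≤ c * (2 * i.1.1.1) := by
          rw [hTe]
          exact mul_le_mul hm2 (by linarith) (by positivity) hc0.le
        linarith)
  have hfar : ∀ l : ℝ, 0 < l → ∀ v η : Rn n, (C₁ * l ≤ ‖η‖ ∨ ‖η‖ ≤ c₁ * l) →
      ‖zft b Φ l v η‖ ≤ D / (l + ‖η‖) ^ N := by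
    intro l hl v η h
    have hp : 0 < l + ‖η‖ := by positivity
    have := hD ⟨((⟨l, hl⟩, v), η), h⟩ (l + ‖η‖) hp
    have h1 : ∀ z, (l + ‖η‖) * ((l + ‖η‖)⁻¹ * (l * Φ z v - ⟪η, z⟫_ℝ)) =
        l * Φ z v - ⟪z, η⟫_ℝ := fun z => by
      rw [mul_inv_cancel_left₀ hp.ne', real_inner_comm z η]
    simp only [hΨ, T, h1] at this
    rwa [zft_eq]
  refine ⟨2 ^ N * (C₀ + D) + C₀ * (3 + 2 * C₁) ^ N, by positivity, fun l hl v η h => ?_⟩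
  by_cases h' : C₁ * l ≤ ‖η‖ ∨ ‖η‖ ≤ c₁ * l
  · refine (div_pow_le_of_bounds (by positivity) hC₀ hD0 (hC₀' l hl v η)
      fun _ => hfar l hl v η h').trans (div_le_div_of_nonneg_right ?_ (by positivity))
    have : 0 ≤ C₀ * (3 + 2 * C₁) ^ N := by positivity
    linarith
  · have hl2 : l ≤ 2 := by tauto
    have hη : ‖η‖ < C₁ * l := lt_of_not_ge fun h => h' (Or.inl h)
    rw [le_div_iff₀ (by positivity)]
    have h1 : (1 + (l + ‖η‖)) ^ N ≤ (3 + 2 * C₁) ^ N := by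
      have : C₁ * l ≤ C₁ * 2 := by gcongr
      exact pow_le_pow_left₀ (by positivity) (by linarith) N
    have h2 := mul_le_mul (hC₀' l hl v η) h1 (by positivity) hC₀
    have : 0 ≤ 2 ^ N * (C₀ + D) := by positivity
    linarith

end GoodAmp
end SpatialFrequency

end

section
open scoped ContDiff FourierTransform SchwartzMap

section FourierBridge
variable {n : ℕ}

theorem ftransform_eq_fourier (f : Rn n → ℂ) (ξ : Rn n) :
    ftransform n f ξ = 𝓕 f ((2 * Real.pi)⁻¹ • ξ) := by
  rw [ftransform, Real.fourier_eq']
  refine integral_congr_ae (Filter.Eventually.of_forall fun x => ?_)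
  simp only [smul_eq_mul]
  congr 2
  rw [real_inner_smul_right]
  push_cast
  field_simp

theorem invFT_eq_fourierInv (h : Rn n → ℝ) (x : Rn n) :
    invFT n h x = ((((2 * Real.pi) ^ n)⁻¹ : ℝ) : ℂ) *
      𝓕⁻ (fun ξ => (h ξ : ℂ)) ((2 * Real.pi)⁻¹ • x) := by
  rw [invFT, Real.fourierInv_eq']
  congr 1
  refine integral_congr_ae (Filter.Eventually.of_forall fun ξ => ?_)
  simp only [smul_eq_mul]
  congr 2
  rw [real_inner_smul_right, real_inner_comm]
  push_cast
  field_simp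

/-- A smooth compactly supported real function, as a complex Schwartz function. -/
def testSchwartz {h : Rn n → ℝ} (hs : ContDiff ℝ ∞ h) (hc : HasCompactSupport h) :
    𝓢(Rn n, ℂ) :=
  HasCompactSupport.toSchwartzMap (f := fun ξ => (h ξ : ℂ))
    (hc.comp_left (g := ((↑) : ℝ → ℂ)) ofReal_zero) (Complex.ofRealCLM.contDiff.comp hs)

theorem invFT_eq_schwartz {h : Rn n → ℝ} (hs : ContDiff ℝ ∞ h) (hc : HasCompactSupport h)
    (x : Rn n) : invFT n h x = ((((2 * Real.pi) ^ n)⁻¹ : ℝ) : ℂ) *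
      (𝓕⁻ (testSchwartz hs hc)) ((2 * Real.pi)⁻¹ • x) := by
  rw [invFT_eq_fourierInv, SchwartzMap.fourierInv_coe]; rfl

theorem continuous_invFT {h : Rn n → ℝ} (hs : ContDiff ℝ ∞ h) (hc : HasCompactSupport h) :
    Continuous (invFT n h) := by
  have : invFT n h = fun x => ((((2 * Real.pi) ^ n)⁻¹ : ℝ) : ℂ) *
      (𝓕⁻ (testSchwartz hs hc)) ((2 * Real.pi)⁻¹ • x) := funext (invFT_eq_schwartz hs hc)
  rw [this]
  have := (𝓕⁻ (testSchwartz hs hc)).continuous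
  fun_prop

theorem exists_invFT_decay {h : Rn n → ℝ} (hs : ContDiff ℝ ∞ h) (hc : HasCompactSupport h)
    (N : ℕ) : ∃ C : ℝ, 0 ≤ C ∧ ∀ x, ‖invFT n h x‖ ≤ C / (1 + ‖x‖) ^ N := by
  set g := 𝓕⁻ (testSchwartz hs hc) with hg
  have hb := fun x => SchwartzMap.one_add_le_sup_seminorm_apply (𝕜 := ℝ) (m := (N, 0)) le_rfl
    le_rfl g x
  obtain ⟨C, hC⟩ : ∃ C : ℝ, ∀ x, (1 + ‖x‖) ^ N * ‖g x‖ ≤ C := ⟨_, fun x => by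
    simpa using hb x⟩
  have hC0 : 0 ≤ C := le_trans (by positivity) (hC 0)
  have hpi : 1 ≤ 2 * Real.pi := by linarith [Real.pi_gt_three]
  refine ⟨((2 * Real.pi) ^ n)⁻¹ * ((2 * Real.pi) ^ N * C), by positivity, fun x => ?_⟩
  rw [invFT_eq_schwartz hs hc, norm_mul, norm_real, Real.norm_of_nonneg (by positivity),
    mul_div_assoc]
  refine mul_le_mul_of_nonneg_left ?_ (by positivity)
  rw [le_div_iff₀ (by positivity)]
  have h1 : 1 + ‖x‖ ≤ (2 * Real.pi) * (1 + ‖(2 * Real.pi)⁻¹ • x‖) := by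
    rw [norm_smul, norm_inv, Real.norm_of_nonneg (by positivity), mul_add,
      mul_inv_cancel_left₀ (by positivity)]
    linarith
  calc ‖g ((2 * Real.pi)⁻¹ • x)‖ * (1 + ‖x‖) ^ N
      ≤ ‖g ((2 * Real.pi)⁻¹ • x)‖ * ((2 * Real.pi) * (1 + ‖(2 * Real.pi)⁻¹ • x‖)) ^ N := by gcongr
    _ = (2 * Real.pi) ^ N * ((1 + ‖(2 * Real.pi)⁻¹ • x‖) ^ N * ‖g ((2 * Real.pi)⁻¹ • x)‖) := by
      rw [mul_pow]; ring
    _ ≤ _ := by gcongr; exact hC _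

theorem integrable_inv_one_add_pow : Integrable fun x : Rn n => 1 / (1 + ‖x‖) ^ (n + 1) := by
  have := integrable_one_add_norm (E := Rn n) (μ := volume) (r := (n + 1 : ℕ)) (by simp)
  refine this.congr (Filter.Eventually.of_forall fun x => ?_)
  simp only
  rw [Real.rpow_neg (by positivity), Real.rpow_natCast, one_div]

theorem integrable_invFT {h : Rn n → ℝ} (hs : ContDiff ℝ ∞ h) (hc : HasCompactSupport h) :
    Integrable (invFT n h) := by
  obtain ⟨C, _, hC⟩ := exists_invFT_decay hs hc (n + 1)
  refine (integrable_inv_one_add_pow.const_mul C).mono'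
    (continuous_invFT hs hc).aestronglyMeasurable (Filter.Eventually.of_forall fun x => ?_)
  simpa [div_eq_mul_inv] using hC x

theorem invFT_dilate (h : Rn n → ℝ) {t : ℝ} (ht : 0 < t) (x : Rn n) :
    invFT n (fun ξ => h (t⁻¹ • ξ)) x = ((t ^ n : ℝ) : ℂ) * invFT n h (t • x) := by
  have h1 := Measure.integral_comp_inv_smul (volume : Measure (Rn n))
    (fun ξ => cexp (I * ((⟪t • x, ξ⟫_ℝ : ℝ) : ℂ)) * ((h ξ : ℝ) : ℂ)) t
  simp only [finrank_euclideanSpace, Fintype.card_fin] at h1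
  have h2 : ∀ ξ : Rn n, ⟪t • x, t⁻¹ • ξ⟫_ℝ = ⟪x, ξ⟫_ℝ := fun ξ => by
    rw [real_inner_smul_left, real_inner_smul_right, mul_inv_cancel_left₀ ht.ne']
  simp only [h2] at h1
  rw [invFT, invFT, h1, abs_of_pos (by positivity), Complex.real_smul]
  ring

end FourierBridge

section LittlewoodPaley
variable {n : ℕ} {ψ0 : Rn n → ℝ}

namespace IsLPBase

theorem hasCompactSupport (h : IsLPBase n ψ0) : HasCompactSupport ψ0 :=
  HasCompactSupport.intro (isCompact_closedBall (0 : Rn n) 2) fun ξ hξ =>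
    h.2.2 ξ (by simpa using hξ)

end IsLPBase

/-- The annular profile `ψ0(ξ) - ψ0(2ξ)`. -/
def lpProfile (ψ0 : Rn n → ℝ) (ξ : Rn n) : ℝ := ψ0 ξ - ψ0 ((2 : ℝ) • ξ)

theorem hasCompactSupport_comp_smul {F : Type*} [Zero F] {f : Rn n → F} (hf : HasCompactSupport f)
    {t : ℝ} (ht : t ≠ 0) : HasCompactSupport fun ξ => f (t • ξ) :=
  hf.comp_homeomorph (Homeomorph.smulOfNeZero t ht)

namespace IsLPBase

theorem contDiff_profile (h : IsLPBase n ψ0) : ContDiff ℝ ∞ (lpProfile ψ0) :=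
  h.1.sub (h.1.comp (contDiff_const_smul (2 : ℝ)))

theorem hasCompactSupport_profile (h : IsLPBase n ψ0) : HasCompactSupport (lpProfile ψ0) :=
  h.hasCompactSupport.sub (hasCompactSupport_comp_smul h.hasCompactSupport two_ne_zero)

end IsLPBase

theorem lpPiece_zero : lpPiece n ψ0 0 = ψ0 := by ext; simp [lpPiece]

theorem lpPiece_of_ne {k : ℕ} (hk : k ≠ 0) :
    lpPiece n ψ0 k = fun ξ => lpProfile ψ0 (((2 : ℝ) ^ k)⁻¹ • ξ) := by
  ext ξ
  rw [lpPiece, if_neg hk, lpProfile, smul_smul, zpow_add₀ two_ne_zero, zpow_neg, zpow_natCast,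
    zpow_one, mul_comm]

namespace IsLPBase

theorem contDiff_piece (h : IsLPBase n ψ0) (k : ℕ) : ContDiff ℝ ∞ (lpPiece n ψ0 k) := by
  rcases eq_or_ne k 0 with rfl | hk
  · rw [lpPiece_zero]; exact h.1
  · rw [lpPiece_of_ne hk]; exact h.contDiff_profile.comp (contDiff_const_smul _)

theorem hasCompactSupport_piece (h : IsLPBase n ψ0) (k : ℕ) :
    HasCompactSupport (lpPiece n ψ0 k) := by
  rcases eq_or_ne k 0 with rfl | hk
  · rw [lpPiece_zero]; exact h.hasCompactSupport
  · rw [lpPiece_of_ne hk]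
    exact hasCompactSupport_comp_smul h.hasCompactSupport_profile (by positivity)

theorem profile_ne_zero (h : IsLPBase n ψ0) {ξ : Rn n} (hξ : lpProfile ψ0 ξ ≠ 0) :
    1 / 2 ≤ ‖ξ‖ ∧ ‖ξ‖ ≤ 2 := by
  constructor
  · by_contra hc
    push Not at hc
    refine hξ ?_
    rw [lpProfile, h.2.1 _ (by linarith), h.2.1, sub_self]
    rw [norm_smul, Real.norm_of_nonneg zero_le_two]; linarith
  · by_contra hc
    push Not at hc
    refine hξ ?_
    rw [lpProfile, h.2.2 _ hc, h.2.2, sub_self]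
    rw [norm_smul, Real.norm_of_nonneg zero_le_two]; linarith

theorem piece_ne_zero (h : IsLPBase n ψ0) {k : ℕ} {ξ : Rn n} (hξ : lpPiece n ψ0 k ξ ≠ 0) :
    (k = 0 ∨ 2 ^ k / 2 ≤ ‖ξ‖) ∧ ‖ξ‖ ≤ 2 * 2 ^ k := by
  rcases eq_or_ne k 0 with rfl | hk
  · rw [lpPiece_zero] at hξ
    refine ⟨Or.inl rfl, ?_⟩
    by_contra hc
    exact hξ (h.2.2 _ (by simpa using hc))
  · rw [lpPiece_of_ne hk] at hξ
    have := h.profile_ne_zero hξ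
    rw [norm_smul, norm_inv, norm_pow, Real.norm_of_nonneg zero_le_two, inv_mul_eq_div,
      le_div_iff₀ (by positivity), div_le_iff₀ (by positivity)] at this
    exact ⟨Or.inr (by linarith [this.1]), this.2⟩

theorem exists_piece_le (h : IsLPBase n ψ0) : ∃ C : ℝ, 0 ≤ C ∧ ∀ k ξ, |lpPiece n ψ0 k ξ| ≤ C := by
  obtain ⟨C, hC⟩ := h.hasCompactSupport.exists_bound_of_continuous h.1.continuous
  have hC0 := (norm_nonneg _).trans (hC 0)
  simp only [Real.norm_eq_abs] at hC
  refine ⟨C + C, by positivity, fun k ξ => ?_⟩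
  rw [lpPiece]
  split_ifs
  · linarith [hC ξ]
  · exact (abs_sub _ _).trans (add_le_add (hC _) (hC _))

/-- Uniform bounds for the Littlewood–Paley convolution kernels. -/
theorem exists_kernel_decay (h : IsLPBase n ψ0) (N : ℕ) : ∃ C : ℝ, 0 ≤ C ∧ ∀ (k : ℕ) x,
    ‖invFT n (lpPiece n ψ0 k) x‖ ≤ C * ((2 : ℝ) ^ k) ^ n / (1 + 2 ^ k * ‖x‖) ^ N := by
  obtain ⟨C, hC0, hC⟩ := exists_invFT_decay h.1 h.hasCompactSupport N
  obtain ⟨D, hD0, hD⟩ := exists_invFT_decay h.contDiff_profile h.hasCompactSupport_profile N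
  refine ⟨C + D, by positivity, fun k x => ?_⟩
  rcases eq_or_ne k 0 with rfl | hk
  · rw [lpPiece_zero]
    refine (hC x).trans ?_
    simp only [pow_zero, one_pow, one_mul, mul_one]
    gcongr; linarith
  · rw [lpPiece_of_ne hk, invFT_dilate _ (by positivity), norm_mul, norm_real,
      Real.norm_of_nonneg (by positivity)]
    refine (mul_le_mul_of_nonneg_left (hD _) (by positivity)).trans ?_
    rw [norm_smul, norm_pow, Real.norm_of_nonneg zero_le_two, mul_div_assoc', mul_comm]
    gcongr; linarith

end IsLPBase

/-- `∫ |x|`-decaying bumps of height `t^n` and width `t⁻¹` have bounded mass. -/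
theorem integral_dilate_inv_pow {t : ℝ} (ht : 0 < t) :
    ∫ x : Rn n, t ^ n / (1 + t * ‖x‖) ^ (n + 1) = ∫ x : Rn n, 1 / (1 + ‖x‖) ^ (n + 1) := by
  have h1 := Measure.integral_comp_smul (volume : Measure (Rn n))
    (fun x => 1 / (1 + ‖x‖) ^ (n + 1)) t
  simp only [finrank_euclideanSpace, Fintype.card_fin, norm_smul, Real.norm_of_nonneg ht.le] at h1
  simp_rw [div_eq_mul_one_div (t ^ n)]
  rw [integral_const_mul, h1, abs_of_pos (by positivity), smul_eq_mul,
    mul_inv_cancel_left₀ (by positivity)]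

theorem integrable_dilate_inv_pow {t : ℝ} (ht : 0 < t) :
    Integrable fun x : Rn n => t ^ n / (1 + t * ‖x‖) ^ (n + 1) := by
  have h1 := ((integrable_inv_one_add_pow (n := n)).comp_smul ht.ne').const_mul (t ^ n)
  refine h1.congr (Filter.Eventually.of_forall fun x => ?_)
  simp [norm_smul, abs_of_pos ht, div_eq_mul_inv]

end LittlewoodPaley

end

section
open scoped ContDiff

/-- The Littlewood–Paley piece, in `x`, of the oscillating amplitude. -/
def pieceOsc {n : ℕ} (ψ0 : Rn n → ℝ) (b : ℝ → Rn n → Rn n → ℂ) (Φ : Rn n → Rn n → ℝ)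
    (k : ℕ) (l : ℝ) (x v : Rn n) : ℂ :=
  ∫ z, invFT n (lpPiece n ψ0 k) (x - z) * osc b Φ l z v

/-- The Littlewood–Paley piece, in `x`, of the rescaled kernel. -/
def pieceKer {n : ℕ} (ψ0 : Rn n → ℝ) (b : ℝ → Rn n → Rn n → ℂ) (Φ : Rn n → Rn n → ℝ)
    (k : ℕ) (l : ℝ) (x y : Rn n) : ℂ :=
  ∫ z, invFT n (lpPiece n ψ0 k) (x - z) * ker b Φ l z y

theorem continuous_integral_of_support {X : Type*} [TopologicalSpace X] [FirstCountableTopology X]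
    [LocallyCompactSpace X]
    {n : ℕ} {F : X → Rn n → ℂ}
    (hF : Continuous fun p : X × Rn n => F p.1 p.2) {s : Set (Rn n)} (hs : IsCompact s)
    (hsupp : ∀ x v, F x v ≠ 0 → v ∈ s) : Continuous fun x => ∫ v, F x v := by
  have h1 : (fun x => ∫ v, F x v) = fun x => ∫ v in s, F x v := by
    ext x
    refine (setIntegral_eq_integral_of_forall_compl_eq_zero fun v hv => ?_).symm
    by_contra hc
    exact hv (hsupp x v hc)
  rw [h1]
  exact continuous_parametric_integral_of_continuous hF hs

section OffDiagonal
variable {n : ℕ} {K : Set (Rn n)} {Φ : Rn n → Rn n → ℝ} {b : ℝ → Rn n → Rn n → ℂ}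
  {ψ0 : Rn n → ℝ}

theorem osc_ne_zero {l : ℝ} {z v : Rn n} (h : osc b Φ l z v ≠ 0) : b l z v ≠ 0 :=
  fun h0 => h (by rw [osc, h0, mul_zero])

namespace GoodAmp

theorem continuous_ker (hb : GoodAmp n K b) (hΦ : GoodPhase n K Φ) {l : ℝ} (hl : 0 < l) :
    Continuous fun p : Rn n × Rn n => ker b Φ l p.1 p.2 := by
  refine continuous_integral_of_support (F := fun (p : Rn n × Rn n) v =>
    osc b Φ l p.1 v * cexp (-(I * ((l * ⟪p.2, v⟫_ℝ : ℝ) : ℂ)))) ?_ (isCompact_ann n 4) ?_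
  · have := hb.continuous_osc hΦ hl
    have h2 : Continuous fun q : (Rn n × Rn n) × Rn n => osc b Φ l q.1.1 q.2 :=
      this.comp (f := fun q : (Rn n × Rn n) × Rn n => (q.1.1, q.2)) (by fun_prop)
    refine h2.mul ?_
    fun_prop
  · intro p v h
    exact hb.mem_right l p.1 v (osc_ne_zero (left_ne_zero_of_mul h))

theorem ker_ne_zero (hb : GoodAmp n K b) {l : ℝ} {z y : Rn n} (h : ker b Φ l z y ≠ 0) :
    z ∈ K := by
  by_contra hz
  refine h ?_
  have : ∀ v, osc b Φ l z v = 0 := fun v => by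
    by_contra hc
    exact hz (hb.mem_left l z v (osc_ne_zero hc))
  simp [ker, this]

theorem continuous_pieceKer (hb : GoodAmp n K b) (hΦ : GoodPhase n K Φ) (hK : IsCompact K)
    (hψ : IsLPBase n ψ0) (k : ℕ) {l : ℝ} (hl : 0 < l) :
    Continuous fun p : Rn n × Rn n => pieceKer ψ0 b Φ k l p.1 p.2 := by
  refine continuous_integral_of_support (F := fun (p : Rn n × Rn n) z =>
    invFT n (lpPiece n ψ0 k) (p.1 - z) * ker b Φ l z p.2) ?_ hK ?_
  · have h1 := continuous_invFT (hψ.contDiff_piece k) (hψ.hasCompactSupport_piece k)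
    have h2 : Continuous fun q : (Rn n × Rn n) × Rn n => ker b Φ l q.2 q.1.2 :=
      (hb.continuous_ker hΦ hl).comp (f := fun q : (Rn n × Rn n) × Rn n => (q.2, q.1.2))
        (by fun_prop)
    exact (h1.comp (by fun_prop)).mul h2
  · intro p z h
    exact hb.ker_ne_zero (right_ne_zero_of_mul h)

theorem integrable_prod_osc (hb : GoodAmp n K b) (hΦ : GoodPhase n K Φ) (hK : IsCompact K)
    {l : ℝ} (hl : 0 < l) {g : Rn n × Rn n → ℂ} (hg : Continuous g) :
    Integrable (fun p : Rn n × Rn n => osc b Φ l p.1 p.2 * g p)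
      ((volume : Measure (Rn n)).prod volume) := by
  refine ((hb.continuous_osc hΦ hl).mul hg).integrable_of_hasCompactSupport
    (HasCompactSupport.intro (hK.prod (isCompact_ann n 4)) fun p hp => ?_)
  by_contra hc
  have h := osc_ne_zero (left_ne_zero_of_mul hc)
  exact hp ⟨hb.mem_left _ _ _ h, hb.mem_right _ _ _ h⟩

theorem pieceKer_eq (hb : GoodAmp n K b) (hΦ : GoodPhase n K Φ) (hK : IsCompact K)
    (hψ : IsLPBase n ψ0) (k : ℕ) {l : ℝ} (hl : 0 < l) (x y : Rn n) :
    pieceKer ψ0 b Φ k l x y =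
      ∫ v, pieceOsc ψ0 b Φ k l x v * cexp (-(I * ((l * ⟪y, v⟫_ℝ : ℝ) : ℂ))) := by
  have h1 := continuous_invFT (hψ.contDiff_piece k) (hψ.hasCompactSupport_piece k)
  have hint := hb.integrable_prod_osc hΦ hK hl (g := fun p : Rn n × Rn n =>
    invFT n (lpPiece n ψ0 k) (x - p.1) * cexp (-(I * ((l * ⟪y, p.2⟫_ℝ : ℝ) : ℂ))))
    (by fun_prop)
  simp only [pieceKer, pieceOsc, ker, ← integral_const_mul, ← integral_mul_const]
  rw [integral_integral_swap]
  · simp only [mul_assoc]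
  · refine hint.congr (Filter.Eventually.of_forall fun p => ?_)
    simp only [Function.uncurry]; ring

theorem pieceOsc_eq (hb : GoodAmp n K b) (hΦ : GoodPhase n K Φ) (hK : IsCompact K)
    (hψ : IsLPBase n ψ0) (k : ℕ) {l : ℝ} (hl : 0 < l) (x v : Rn n) :
    pieceOsc ψ0 b Φ k l x v = ((((2 * Real.pi) ^ n)⁻¹ : ℝ) : ℂ) *
      ∫ η, cexp (I * ((⟪x, η⟫_ℝ : ℝ) : ℂ)) * ((lpPiece n ψ0 k η : ℝ) : ℂ) * zft b Φ l v η := by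
  have h1 := (hψ.contDiff_piece k).continuous
  have h2 := hb.continuous_osc hΦ hl
  have h3 : Continuous fun z => osc b Φ l z v := h2.comp (f := fun z => (z, v)) (by fun_prop)
  have hint : Integrable (fun p : Rn n × Rn n => osc b Φ l p.1 v *
      (cexp (I * ((⟪x - p.1, p.2⟫_ℝ : ℝ) : ℂ)) * ((lpPiece n ψ0 k p.2 : ℝ) : ℂ)))
      ((volume : Measure (Rn n)).prod volume) := by
    refine Continuous.integrable_of_hasCompactSupport (by fun_prop)
      (HasCompactSupport.intro (hK.prod (hψ.hasCompactSupport_piece k)) fun p hp => ?_)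
    by_contra hc
    refine hp ⟨hb.mem_left _ _ _ (osc_ne_zero (left_ne_zero_of_mul hc)), ?_⟩
    have := right_ne_zero_of_mul (right_ne_zero_of_mul hc)
    exact subset_tsupport _ (by simpa using this)
  have h4 : pieceOsc ψ0 b Φ k l x v = ((((2 * Real.pi) ^ n)⁻¹ : ℝ) : ℂ) *
      ∫ z, ∫ η, osc b Φ l z v *
      (cexp (I * ((⟪x - z, η⟫_ℝ : ℝ) : ℂ)) * ((lpPiece n ψ0 k η : ℝ) : ℂ)) := by
    rw [← integral_const_mul]
    refine integral_congr_ae (Filter.Eventually.of_forall fun z => ?_)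
    simp only [invFT]
    rw [integral_const_mul]; ring
  rw [h4, integral_integral_swap hint]
  congr 1
  refine integral_congr_ae (Filter.Eventually.of_forall fun η => ?_)
  simp only [zft, ← integral_const_mul]
  refine integral_congr_ae (Filter.Eventually.of_forall fun z => ?_)
  simp only [inner_sub_left]
  push_cast
  rw [mul_sub, sub_eq_add_neg, Complex.exp_add]
  ring

theorem pieceOsc_eq_zero (hb : GoodAmp n K b) {k : ℕ} {l : ℝ} {x v : Rn n}
    (hv : v ∉ ann n 4) : pieceOsc ψ0 b Φ k l x v = 0 := by
  have : ∀ z, osc b Φ l z v = 0 := fun z => by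
    by_contra hc
    exact hv (hb.mem_right _ _ _ (osc_ne_zero hc))
  simp [pieceOsc, this]

end GoodAmp
end OffDiagonal

/-- The frequency scales `2^k` and `l` are not comparable (or `l` is bounded). -/
def OffDiag (C₁ c₁ : ℝ) (k : ℕ) (l : ℝ) : Prop :=
  2 * (C₁ * l) ≤ 2 ^ k ∨ 2 * 2 ^ k ≤ c₁ * l ∨ l ≤ 2

theorem norm_integral_le_of_support {n : ℕ} {F : Rn n → ℂ} {s : Set (Rn n)} (hs : IsCompact s)
    {C : ℝ} (hsupp : ∀ x, F x ≠ 0 → x ∈ s) (hF : ∀ x ∈ s, ‖F x‖ ≤ C) :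
    ‖∫ x, F x‖ ≤ C * volume.real s := by
  rw [← setIntegral_eq_integral_of_forall_compl_eq_zero (s := s) fun v hv => by
    by_contra hc
    exact hv (hsupp v hc)]
  exact norm_setIntegral_le_of_norm_le_const hs.measure_lt_top hF

section OffDiagonalBounds
variable {n : ℕ} {K : Set (Rn n)} {Φ : Rn n → Rn n → ℝ} {b : ℝ → Rn n → Rn n → ℂ}
  {ψ0 : Rn n → ℝ}

namespace GoodAmp

theorem exists_pieceOsc_off (hb : GoodAmp n K b) (hΦ : GoodPhase n K Φ) (hK : IsCompact K)
    (hψ : IsLPBase n ψ0) : ∃ C₁ c₁ : ℝ, 1 ≤ C₁ ∧ 0 < c₁ ∧ ∀ M : ℕ, ∃ C : ℝ, 0 ≤ C ∧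
      ∀ (k : ℕ) (l : ℝ), 0 < l → OffDiag C₁ c₁ k l → ∀ x v,
        ‖pieceOsc ψ0 b Φ k l x v‖ ≤ C / (1 + (l + 2 ^ k)) ^ M := by
  obtain ⟨C₁, c₁, hC₁, hc₁, hz⟩ := hb.exists_zft_decay hK hΦ
  obtain ⟨P, hP0, hP⟩ := hψ.exists_piece_le
  refine ⟨C₁, c₁, hC₁, hc₁, fun M => ?_⟩
  obtain ⟨D, hD0, hD⟩ := hz (M + n)
  set V := (volume : Measure (Rn n)).real (Metric.ball 0 1) with hV
  refine ⟨((2 * Real.pi) ^ n)⁻¹ * (P * (D * 2 ^ (M + n)) * (2 ^ n * V)), by positivity,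
    fun k l hl hoff x v => ?_⟩
  set S := 1 + (l + 2 ^ k) with hS
  have hS0 : 0 < S := by positivity
  rw [hb.pieceOsc_eq hΦ hK hψ k hl, norm_mul, norm_real, Real.norm_of_nonneg (by positivity),
    mul_div_assoc]
  refine mul_le_mul_of_nonneg_left ?_ (by positivity)
  have hpt : ∀ η ∈ Metric.closedBall (0 : Rn n) (2 * 2 ^ k),
      ‖cexp (I * ((⟪x, η⟫_ℝ : ℝ) : ℂ)) * ((lpPiece n ψ0 k η : ℝ) : ℂ) * zft b Φ l v η‖ ≤
        P * (D * 2 ^ (M + n) / S ^ (M + n)) := by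
    intro η _
    rw [mul_assoc, norm_cexp_I_mul, norm_mul, norm_real, Real.norm_eq_abs]
    by_cases h0 : lpPiece n ψ0 k η = 0
    · rw [h0, abs_zero, zero_mul]; positivity
    obtain ⟨h1, h2⟩ := hψ.piece_ne_zero h0
    refine mul_le_mul (hP k η) ((hD l hl v η ?_).trans ?_) (norm_nonneg _) hP0
    · rcases hoff with h | h | h
      · rcases h1 with rfl | h1
        · right; right; rw [pow_zero] at h; nlinarith
        · left; linarith
      · right; left; linarith
      · exact Or.inr (Or.inr h)
    · rw [div_le_div_iff₀ (by positivity) (by positivity), mul_assoc, ← mul_pow]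
      refine mul_le_mul_of_nonneg_left (pow_le_pow_left₀ (by positivity) ?_ _) hD0
      rcases h1 with rfl | h1
      · rw [hS, pow_zero]; linarith [norm_nonneg η]
      · rw [hS]; linarith
  refine (norm_integral_le_of_support (isCompact_closedBall (0 : Rn n) (2 * 2 ^ k))
    (fun η hη => ?_) hpt).trans ?_
  · have : lpPiece n ψ0 k η ≠ 0 := by
      simpa using right_ne_zero_of_mul (left_ne_zero_of_mul hη)
    simpa using (hψ.piece_ne_zero this).2
  · rw [Measure.addHaar_real_closedBall _ _ (by positivity)]
    simp only [finrank_euclideanSpace, Fintype.card_fin]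
    rw [← hV, mul_pow, pow_add S]
    have h2 : ((2 : ℝ) ^ k) ^ n ≤ S ^ n := by
      gcongr; rw [hS]; linarith
    rw [le_div_iff₀ (by positivity)]
    have e : P * (D * 2 ^ (M + n) / (S ^ M * S ^ n)) * (2 ^ n * (2 ^ k) ^ n * V) * S ^ M =
        P * (D * 2 ^ (M + n)) * (2 ^ n * V) * ((2 ^ k) ^ n / S ^ n) := by
      field_simp
    rw [e]
    refine mul_le_of_le_one_right (by positivity) ((div_le_one (by positivity)).2 h2)

theorem exists_pieceKer_decay_left (hb : GoodAmp n K b) (Φ : Rn n → Rn n → ℝ) (hK : IsCompact K)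
    (hψ : IsLPBase n ψ0) (N : ℕ) : ∃ C : ℝ, 0 ≤ C ∧ ∀ (k : ℕ) (l : ℝ), 0 < l → ∀ x y,
      ‖pieceKer ψ0 b Φ k l x y‖ ≤ C * ((2 : ℝ) ^ k) ^ n / (1 + ‖x‖) ^ N := by
  obtain ⟨R, hR0, hR⟩ := hK.isBounded.exists_pos_norm_le
  obtain ⟨P, hP0, hP⟩ := hψ.exists_kernel_decay N
  obtain ⟨D, hD0, hD⟩ := hb.exists_ker_le Φ
  refine ⟨P * (1 + R) ^ N * D * volume.real K, by positivity, fun k l hl x y => ?_⟩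
  have := norm_integral_le_of_support (F := fun z => invFT n (lpPiece n ψ0 k) (x - z) *
    ker b Φ l z y) hK (C := P * (2 ^ k) ^ n * (1 + R) ^ N / (1 + ‖x‖) ^ N * D)
    (fun z hz => hb.ker_ne_zero (right_ne_zero_of_mul hz)) (fun z hz => ?_)
  · refine this.trans (le_of_eq ?_)
    field_simp
  · rw [norm_mul]
    refine mul_le_mul ((hP k _).trans ?_) (hD l hl z y) (norm_nonneg _) (by positivity)
    rw [div_le_div_iff₀ (by positivity) (by positivity), mul_assoc _ ((1 + R) ^ N), ← mul_pow]
    refine mul_le_mul_of_nonneg_left (pow_le_pow_left₀ (by positivity) ?_ _) (by positivity)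
    have h1 : ‖x‖ ≤ ‖x - z‖ + ‖z‖ := by simpa using norm_add_le (x - z) z
    have h2 := hR z hz
    have h3 : (1 : ℝ) ≤ 2 ^ k := one_le_pow₀ (by norm_num)
    have h4 : ‖x - z‖ ≤ 2 ^ k * ‖x - z‖ := le_mul_of_one_le_left (norm_nonneg _) h3
    nlinarith [norm_nonneg (x - z)]

theorem exists_pieceKer_decay_right (hb : GoodAmp n K b) (hΦ : GoodPhase n K Φ)
    (hK : IsCompact K) (hψ : IsLPBase n ψ0) (N : ℕ) : ∃ C : ℝ, 0 ≤ C ∧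
      ∀ (k : ℕ) (l : ℝ), 0 < l → ∀ x y, ‖pieceKer ψ0 b Φ k l x y‖ ≤
        C * ((2 : ℝ) ^ k) ^ n * (1 + l) ^ N / (1 + l * ‖y‖) ^ N := by
  obtain ⟨P, hP0, hP⟩ := hψ.exists_kernel_decay 0
  obtain ⟨D, hD0, hD⟩ := hb.exists_ker_decay hΦ N
  refine ⟨P * D * volume.real K, by positivity, fun k l hl x y => ?_⟩
  have := norm_integral_le_of_support (F := fun z => invFT n (lpPiece n ψ0 k) (x - z) *
    ker b Φ l z y) hK (C := P * (2 ^ k) ^ n * (D * (1 + l) ^ N / (1 + l * ‖y‖) ^ N))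
    (fun z hz => hb.ker_ne_zero (right_ne_zero_of_mul hz)) (fun z hz => ?_)
  · refine this.trans (le_of_eq ?_)
    field_simp
  · rw [norm_mul]
    refine mul_le_mul ((hP k _).trans ?_) (hD l hl z y) (norm_nonneg _) (by positivity)
    simp

theorem exists_pieceKer_off (hb : GoodAmp n K b) (hΦ : GoodPhase n K Φ) (hK : IsCompact K)
    (hψ : IsLPBase n ψ0) : ∃ C₁ c₁ : ℝ, 1 ≤ C₁ ∧ 0 < c₁ ∧ ∀ N : ℕ, ∃ C : ℝ, 0 ≤ C ∧
      ∀ (k : ℕ) (l : ℝ), 0 < l → OffDiag C₁ c₁ k l → ∀ x y, ‖pieceKer ψ0 b Φ k l x y‖ ≤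
        C / ((1 + (l + 2 ^ k)) ^ N * (1 + ‖x‖) ^ N * (1 + l * ‖y‖) ^ N) := by
  obtain ⟨C₁, c₁, hC₁, hc₁, hz⟩ := hb.exists_pieceOsc_off hΦ hK hψ
  refine ⟨C₁, c₁, hC₁, hc₁, fun N => ?_⟩
  obtain ⟨A, hA0, hA⟩ := hz (6 * N + 2 * n)
  obtain ⟨B, hB0, hB⟩ := hb.exists_pieceKer_decay_left Φ hK hψ (3 * N)
  obtain ⟨D, hD0, hD⟩ := hb.exists_pieceKer_decay_right hΦ hK hψ (3 * N)
  set V := volume.real (ann n 4)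
  set E := A * V * B * D
  refine ⟨E + 1, by positivity, fun k l hl hoff x y => ?_⟩
  set S := 1 + (l + 2 ^ k) with hS
  set X := 1 + ‖x‖
  set Y := 1 + l * ‖y‖
  have hS0 : 0 < S := by positivity
  have hX0 : 0 < X := by positivity
  have hY0 : 0 < Y := by positivity
  set h := ‖pieceKer ψ0 b Φ k l x y‖ with hh
  have h1 : h ≤ A / S ^ (6 * N + 2 * n) * V := by
    rw [hh, hb.pieceKer_eq hΦ hK hψ k hl]
    refine norm_integral_le_of_support (isCompact_ann n 4) (fun v hv => ?_) (fun v _ => ?_)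
    · by_contra hc
      exact left_ne_zero_of_mul hv (hb.pieceOsc_eq_zero hc)
    · rw [norm_mul_cexp_neg_I]
      exact hA k l hl hoff x v
  have hμ : ((2 : ℝ) ^ k) ^ n ≤ S ^ n := by gcongr; rw [hS]; linarith
  have h2 : h ≤ B * S ^ n / X ^ (3 * N) := (hB k l hl x y).trans (by gcongr)
  have h3 : h ≤ D * S ^ n * S ^ (3 * N) / Y ^ (3 * N) := (hD k l hl x y).trans (by
    gcongr; rw [hS]; linarith [show (0 : ℝ) < 2 ^ k by positivity])
  have hpos : 0 ≤ h := norm_nonneg _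
  have h4 : h ^ 3 ≤ E / (S ^ N * X ^ N * Y ^ N) ^ 3 := by
    calc h ^ 3 = h * h * h := by ring
      _ ≤ (A / S ^ (6 * N + 2 * n) * V) * (B * S ^ n / X ^ (3 * N)) *
          (D * S ^ n * S ^ (3 * N) / Y ^ (3 * N)) := by gcongr
      _ = E / (S ^ N * X ^ N * Y ^ N) ^ 3 := by
        simp only [E]
        field_simp
        ring
  have h5 : E / (S ^ N * X ^ N * Y ^ N) ^ 3 ≤ ((E + 1) / (S ^ N * X ^ N * Y ^ N)) ^ 3 := by
    rw [div_pow]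
    have : 0 ≤ E := by positivity
    gcongr
    nlinarith [pow_nonneg this 3, pow_nonneg this 2]
  exact le_of_pow_le_pow_left₀ three_ne_zero (by positivity) (h4.trans h5)

end GoodAmp
end OffDiagonalBounds

end

section
open scoped ContDiff ComplexConjugate

section Gram
variable {n : ℕ}

theorem lintegral_mul_mul_le_schur {f : Rn n → ℝ≥0∞} (hf : AEMeasurable f)
    {k : Rn n → ℝ≥0∞} (hk : Measurable k) :
    ∫⁻ p : Rn n × Rn n, f p.1 * f p.2 * k (p.1 - p.2) ≤ (∫⁻ x, k x) * ∫⁻ x, f x ^ 2 := by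
  have key : ∀ a b : ℝ≥0∞, a * b ≤ (a ^ 2 + b ^ 2) / 2 := by
    intro a b
    rw [ENNReal.le_div_iff_mul_le (by simp) (by simp)]
    rcases eq_or_ne a ∞ with rfl | ha
    · simp
    rcases eq_or_ne b ∞ with rfl | hb
    · simp
    lift a to ℝ≥0 using ha
    lift b to ℝ≥0 using hb
    norm_cast
    rw [← NNReal.coe_le_coe]
    push_cast
    nlinarith [sq_nonneg ((a : ℝ) - b)]
  have hf1 : AEMeasurable (fun p : Rn n × Rn n => f p.1) (volume.prod volume) := hf.comp_fst
  have hf2 : AEMeasurable (fun p : Rn n × Rn n => f p.2) (volume.prod volume) := hf.comp_snd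
  have hk' : Measurable fun p : Rn n × Rn n => k (p.1 - p.2) := hk.comp (by fun_prop)
  have h1 : ∫⁻ p : Rn n × Rn n, f p.1 ^ 2 * k (p.1 - p.2) = (∫⁻ x, k x) * ∫⁻ x, f x ^ 2 := by
    rw [Measure.volume_eq_prod, lintegral_prod (fun p : Rn n × Rn n => f p.1 ^ 2 * k (p.1 - p.2))
      ((hf1.pow_const 2).mul hk'.aemeasurable)]
    have : ∀ x, ∫⁻ y, f x ^ 2 * k (x - y) = f x ^ 2 * ∫⁻ y, k y := fun x => by
      have hm : Measurable fun y => k (x - y) := hk.comp (measurable_const.sub measurable_id)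
      rw [lintegral_const_mul _ hm, lintegral_sub_left_eq_self]
    simp only [this]
    rw [lintegral_mul_const'' _ (hf.pow_const 2), mul_comm]
  have h2 : ∫⁻ p : Rn n × Rn n, f p.2 ^ 2 * k (p.1 - p.2) = (∫⁻ x, k x) * ∫⁻ x, f x ^ 2 := by
    rw [Measure.volume_eq_prod, lintegral_prod_symm (fun p : Rn n × Rn n =>
        f p.2 ^ 2 * k (p.1 - p.2))
      ((hf2.pow_const 2).mul hk'.aemeasurable)]
    have : ∀ y, ∫⁻ x, f y ^ 2 * k (x - y) = f y ^ 2 * ∫⁻ x, k x := fun y => by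
      have hm : Measurable fun x => k (x - y) := hk.comp (measurable_id.sub measurable_const)
      rw [lintegral_const_mul _ hm, lintegral_sub_right_eq_self]
    simp only [this]
    rw [lintegral_mul_const'' _ (hf.pow_const 2), mul_comm]
  calc ∫⁻ p : Rn n × Rn n, f p.1 * f p.2 * k (p.1 - p.2)
      ≤ ∫⁻ p : Rn n × Rn n, (f p.1 ^ 2 * k (p.1 - p.2) + f p.2 ^ 2 * k (p.1 - p.2)) / 2 := by
        refine lintegral_mono fun p => ?_
        rw [← add_mul, ENNReal.mul_div_right_comm]
        gcongr
        exact key _ _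
    _ = ((∫⁻ x, k x) * (∫⁻ x, f x ^ 2) + (∫⁻ x, k x) * (∫⁻ x, f x ^ 2)) / 2 := by
        simp only [div_eq_mul_inv]
        rw [lintegral_mul_const' _ _ (by simp), lintegral_add_left', h1, h2]
        rw [Measure.volume_eq_prod]
        exact (hf1.pow_const 2).mul hk'.aemeasurable
    _ = _ := by
        rw [← two_mul, mul_comm, mul_div_assoc,
          ENNReal.div_self (by simp) (by simp), mul_one]

/-- An almost-orthogonality (`TT*`) bound: the Gram matrix controls superpositions. -/
theorem lintegral_sq_integral_le_of_gram {e : Rn n → Rn n → ℂ}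
    (he : Continuous fun p : Rn n × Rn n => e p.1 p.2) {s : Set (Rn n)} (hs : IsCompact s)
    (hsupp : ∀ x v, e x v ≠ 0 → v ∈ s) {C₀ : ℝ} (hC₀ : ∀ x v, ‖e x v‖ ≤ C₀)
    {f : Rn n → ℂ} (hf : Integrable f) {k : Rn n → ℝ≥0∞} (hk : Measurable k)
    (hgram : ∀ x x', f x ≠ 0 → f x' ≠ 0 → ‖∫ v, e x v * conj (e x' v)‖ₑ ≤ k (x - x')) :
    ∫⁻ v, ‖∫ x, f x * e x v‖ₑ ^ 2 ≤ (∫⁻ x, k x) * ∫⁻ x, ‖f x‖ₑ ^ 2 := by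
  set G : Rn n → ℂ := fun v => ∫ x, f x * e x v with hG
  set F : Rn n → Rn n × Rn n → ℂ := fun v p =>
    (f p.1 * e p.1 v) * conj (f p.2 * e p.2 v) with hF
  have hGG : ∀ v, G v * conj (G v) = ∫ p, F v p := fun v => by
    simp only [hG, hF]
    rw [← integral_conj, Measure.volume_eq_prod, integral_prod_mul (fun x => f x * e x v)
      (fun x => conj (f x * e x v))]
  have hC0 : 0 ≤ C₀ := (norm_nonneg _).trans (hC₀ 0 0)
  have hFint : Integrable (Function.uncurry F) ((volume : Measure (Rn n)).prod volume) := by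
    have hb : Integrable (fun q : Rn n × (Rn n × Rn n) =>
        s.indicator (fun _ => C₀ * C₀) q.1 * (‖f q.2.1‖ * ‖f q.2.2‖))
        ((volume : Measure (Rn n)).prod volume) := by
      refine Integrable.mul_prod (f := s.indicator fun _ => C₀ * C₀)
        (g := fun p : Rn n × Rn n => ‖f p.1‖ * ‖f p.2‖) ?_ ?_
      · exact (integrable_indicator_iff hs.measurableSet).2
          (integrableOn_const hs.measure_lt_top.ne)
      · exact hf.norm.mul_prod hf.norm
    refine hb.mono' ?_ (Filter.Eventually.of_forall fun q => ?_)
    · have hfm := hf.aestronglyMeasurable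
      have m1 : AEStronglyMeasurable (fun q : Rn n × (Rn n × Rn n) => f q.2.1)
          ((volume : Measure (Rn n)).prod ((volume : Measure (Rn n)).prod volume)) :=
        AEStronglyMeasurable.comp_snd (f := fun p : Rn n × Rn n => f p.1) hfm.comp_fst
      have m2 : AEStronglyMeasurable (fun q : Rn n × (Rn n × Rn n) => f q.2.2)
          ((volume : Measure (Rn n)).prod ((volume : Measure (Rn n)).prod volume)) :=
        AEStronglyMeasurable.comp_snd (f := fun p : Rn n × Rn n => f p.2) hfm.comp_snd
      have c1 : Continuous fun q : Rn n × (Rn n × Rn n) => e q.2.1 q.1 :=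
        he.comp (f := fun q : Rn n × (Rn n × Rn n) => (q.2.1, q.1)) (by fun_prop)
      have c2 : Continuous fun q : Rn n × (Rn n × Rn n) => e q.2.2 q.1 :=
        he.comp (f := fun q : Rn n × (Rn n × Rn n) => (q.2.2, q.1)) (by fun_prop)
      exact (m1.mul c1.aestronglyMeasurable).mul
        (continuous_conj.comp_aestronglyMeasurable (m2.mul c2.aestronglyMeasurable))
    · simp only [Function.uncurry, hF]
      by_cases hq : q.1 ∈ s
      · rw [Set.indicator_of_mem hq, norm_mul, norm_mul, RCLike.norm_conj, norm_mul]
        have := mul_le_mul (hC₀ q.2.1 q.1) (hC₀ q.2.2 q.1) (norm_nonneg _) hC0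
        nlinarith [mul_nonneg (norm_nonneg (f q.2.1)) (norm_nonneg (f q.2.2))]
      · have : e q.2.1 q.1 = 0 := by
          by_contra hc
          exact hq (hsupp _ _ hc)
        simp [this, Set.indicator_of_notMem hq]
  have hnn : ∀ v, G v * conj (G v) = ((‖G v‖ ^ 2 : ℝ) : ℂ) := fun v => by
    rw [Complex.mul_conj, Complex.normSq_eq_norm_sq]
  have hGint : Integrable fun v => ‖G v‖ ^ 2 := by
    have h := hFint.integral_prod_left
    have h2 : (fun v => ∫ p, Function.uncurry F (v, p)) = fun v => ((‖G v‖ ^ 2 : ℝ) : ℂ) := by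
      ext v; rw [← hnn, hGG]; rfl
    rw [h2] at h
    have h3 := h.re
    refine h3.congr (Filter.Eventually.of_forall fun v => ?_)
    simp only [RCLike.re_eq_complex_re, ofReal_re]
  have h1 : ∫⁻ v, ‖G v‖ₑ ^ 2 = ‖∫ v, ((‖G v‖ ^ 2 : ℝ) : ℂ)‖ₑ := by
    rw [integral_complex_ofReal, ← ofReal_norm, norm_real,
      Real.norm_of_nonneg (integral_nonneg fun v => by positivity),
      ofReal_integral_eq_lintegral_ofReal hGint
        (Filter.Eventually.of_forall fun v => by positivity)]
    refine lintegral_congr fun v => ?_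
    rw [ENNReal.ofReal_pow (norm_nonneg _), ofReal_norm]
  rw [h1]
  simp only [← hnn, hGG]
  rw [integral_integral_swap hFint]
  refine (enorm_integral_le_lintegral_enorm _).trans ((lintegral_mono fun p => ?_).trans
    (lintegral_mul_mul_le_schur hf.aestronglyMeasurable.enorm hk))
  have h2 : ∫ v, F v p = f p.1 * conj (f p.2) * ∫ v, e p.1 v * conj (e p.2 v) := by
    rw [← integral_const_mul]
    refine integral_congr_ae (Filter.Eventually.of_forall fun v => ?_)
    simp only [hF, map_mul]; ring
  rw [h2, enorm_mul, enorm_mul]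
  have h3 : ‖conj (f p.2)‖ₑ = ‖f p.2‖ₑ := by
    rw [← ofReal_norm, RCLike.norm_conj, ofReal_norm]
  rw [h3]
  by_cases ha : f p.1 = 0
  · simp [ha]
  by_cases hb : f p.2 = 0
  · simp [hb]
  gcongr
  exact hgram _ _ ha hb

/-- The mass of `C (1 + l|x|)^{-n-1}`. -/
theorem exists_lintegral_inv_pow_le (n : ℕ) : ∃ C : ℝ, 0 < C ∧ ∀ l : ℝ, 0 < l →
    ∫⁻ x : Rn n, ENNReal.ofReal (1 / (1 + l * ‖x‖) ^ (n + 1)) ≤ ENNReal.ofReal (C / l ^ n) := by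
  refine ⟨(∫ x : Rn n, 1 / (1 + ‖x‖) ^ (n + 1)) + 1, ?_, fun l hl => ?_⟩
  · have : 0 ≤ ∫ x : Rn n, 1 / (1 + ‖x‖) ^ (n + 1) := integral_nonneg fun x => by positivity
    linarith
  have e : ∀ x : Rn n, 1 / (1 + l * ‖x‖) ^ (n + 1) =
      (l ^ n)⁻¹ * (l ^ n / (1 + l * ‖x‖) ^ (n + 1)) := fun x => by field_simp
  have hi : Integrable fun x : Rn n => 1 / (1 + l * ‖x‖) ^ (n + 1) := by
    simp only [e]
    exact (integrable_dilate_inv_pow hl).const_mul _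
  rw [← ofReal_integral_eq_lintegral_ofReal hi
    (Filter.Eventually.of_forall fun v => by positivity)]
  refine ENNReal.ofReal_le_ofReal ?_
  simp only [e]
  rw [integral_const_mul, integral_dilate_inv_pow hl, inv_mul_eq_div]
  gcongr; linarith

end Gram

section LTwo
variable {n : ℕ} {K : Set (Rn n)} {Φ : Rn n → Rn n → ℝ} {b : ℝ → Rn n → Rn n → ℂ}

/-- Gram bound in the form used for kernels with a decaying Gram matrix. -/
theorem lintegral_sq_integral_le_of_gram_decay {C₁ : ℝ} (hC₁ : ∀ l : ℝ, 0 < l →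
      ∫⁻ x : Rn n, ENNReal.ofReal (1 / (1 + l * ‖x‖) ^ (n + 1)) ≤ ENNReal.ofReal (C₁ / l ^ n))
    {e : Rn n → Rn n → ℂ}
    (he : Continuous fun p : Rn n × Rn n => e p.1 p.2) {s : Set (Rn n)} (hs : IsCompact s)
    (hsupp : ∀ x v, e x v ≠ 0 → v ∈ s) {C₀ : ℝ} (hC₀ : ∀ x v, ‖e x v‖ ≤ C₀)
    {f : Rn n → ℂ} (hf : Integrable f) {C l : ℝ} (hC : 0 ≤ C) (hl : 0 < l)
    (hgram : ∀ x x', f x ≠ 0 → f x' ≠ 0 →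
      ‖∫ v, e x v * conj (e x' v)‖ ≤ C / (1 + l * ‖x - x'‖) ^ (n + 1)) :
    ∫⁻ v, ‖∫ x, f x * e x v‖ₑ ^ 2 ≤ ENNReal.ofReal (C * C₁ / l ^ n) * ∫⁻ x, ‖f x‖ₑ ^ 2 := by
  have hm : Measurable fun x : Rn n => ENNReal.ofReal (1 / (1 + l * ‖x‖) ^ (n + 1)) := by fun_prop
  refine (lintegral_sq_integral_le_of_gram he hs hsupp hC₀ hf
    (k := fun x => ENNReal.ofReal C * ENNReal.ofReal (1 / (1 + l * ‖x‖) ^ (n + 1)))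
    (hm.const_mul _) fun x x' hx hx' => ?_).trans ?_
  · rw [← ENNReal.ofReal_mul hC, mul_one_div, ← ofReal_norm]
    exact ENNReal.ofReal_le_ofReal (hgram x x' hx hx')
  · rw [lintegral_const_mul _ hm, mul_div_assoc, ENNReal.ofReal_mul hC]
    gcongr
    exact hC₁ l hl

theorem exists_fourier_restrict_le (n : ℕ) : ∃ C : ℝ, 0 < C ∧ ∀ l : ℝ, 0 < l →
    ∀ f : Rn n → ℂ, Integrable f →
    ∫⁻ v in ann n 4, ‖∫ y, f y * cexp (-(I * ((l * ⟪y, v⟫_ℝ : ℝ) : ℂ)))‖ₑ ^ 2 ≤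
      ENNReal.ofReal (C / l ^ n) * ∫⁻ y, ‖f y‖ₑ ^ 2 := by
  let χ : ContDiffBump (0 : Rn n) := ⟨4, 8, by norm_num, by norm_num⟩
  have hχ : ContDiff ℝ ∞ fun v => χ v ^ 2 := χ.contDiff.pow 2
  have hχc : HasCompactSupport fun v => χ v ^ 2 :=
    χ.hasCompactSupport.comp_left (g := fun r : ℝ => r ^ 2) (by simp)
  obtain ⟨D, hD0, hD⟩ := exists_invFT_decay hχ hχc (n + 1)
  obtain ⟨C₁, hC₁0, hC₁⟩ := exists_lintegral_inv_pow_le n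
  refine ⟨((2 * Real.pi) ^ n * D) * C₁ + 1, by positivity, fun l hl f hf => ?_⟩
  set e : Rn n → Rn n → ℂ := fun y v => cexp (-(I * ((l * ⟪y, v⟫_ℝ : ℝ) : ℂ))) * (χ v : ℂ) with he
  have hcont : Continuous fun p : Rn n × Rn n => e p.1 p.2 := by
    have := χ.continuous
    simp only [he]; fun_prop
  have hG := lintegral_sq_integral_le_of_gram_decay hC₁ hcont (isCompact_closedBall (0 : Rn n) 8)
    (fun x v hv => by
      have : χ v ≠ 0 := by
        intro h; simp [he, h] at hv
      have h2 : v ∈ Function.support χ := this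
      rw [χ.support_eq] at h2
      exact Metric.ball_subset_closedBall h2) (C₀ := 1) (fun x v => by
      simp only [he]
      rw [mul_comm, norm_mul_cexp_neg_I, norm_real, Real.norm_of_nonneg χ.nonneg]
      exact χ.le_one) hf (C := (2 * Real.pi) ^ n * D) (by positivity) hl (fun x x' _ _ => by
      have h1 : ∀ v, e x v * conj (e x' v) =
          cexp (I * ((⟪l • (x' - x), v⟫_ℝ : ℝ) : ℂ)) * ((χ v ^ 2 : ℝ) : ℂ) := fun v => by
        simp only [he, map_mul, ← Complex.exp_conj, map_neg, conj_I, conj_ofReal]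
        rw [mul_mul_mul_comm, ← Complex.exp_add, inner_smul_left, inner_sub_left]
        congr 2
        · simp; ring
        · push_cast; ring
      have h2 : ∫ v, e x v * conj (e x' v) =
          (((2 * Real.pi) ^ n : ℝ) : ℂ) * invFT n (fun v => χ v ^ 2) (l • (x' - x)) := by
        rw [invFT, ← mul_assoc, ← ofReal_mul, mul_inv_cancel₀ (by positivity), ofReal_one, one_mul]
        exact integral_congr_ae (Filter.Eventually.of_forall h1)
      rw [h2, norm_mul, norm_real, Real.norm_of_nonneg (by positivity), mul_div_assoc]
      gcongr
      refine (hD _).trans_eq ?_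
      rw [norm_smul, Real.norm_of_nonneg hl.le, norm_sub_rev])
  refine le_trans (le_trans ?_ hG) ?_
  · calc ∫⁻ v in ann n 4, ‖∫ y, f y * cexp (-(I * ((l * ⟪y, v⟫_ℝ : ℝ) : ℂ)))‖ₑ ^ 2
        = ∫⁻ v in ann n 4, ‖∫ x, f x * e x v‖ₑ ^ 2 := by
          refine setLIntegral_congr_fun (isCompact_ann n 4).isClosed.measurableSet fun v hv => ?_
          have : χ v = 1 := χ.one_of_mem_closedBall (by simpa using hv.2)
          simp [he, this]
      _ ≤ _ := setLIntegral_le_lintegral _ _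
  · gcongr; linarith

/-- The Gram matrix of the oscillating amplitudes decays, locally in the base point. -/
theorem GoodAmp.exists_osc_gram (hb : GoodAmp n K b) (hΦ : GoodPhase n K Φ) :
    ∃ r₀ C : ℝ, 0 < r₀ ∧ 0 ≤ C ∧ ∀ x₀ ∈ K, ∀ l : ℝ, 0 < l → ∀ x ∈ Metric.ball x₀ r₀,
      ∀ x' ∈ Metric.ball x₀ r₀,
      ‖∫ v, osc b Φ l x v * conj (osc b Φ l x' v)‖ ≤ C / (1 + l * ‖x - x'‖) ^ (n + 1) := by
  obtain ⟨r₀, c, hr0, _, hc0, hanti⟩ := hΦ.anti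
  let ι := {i : {l : ℝ // 0 < l} × (Rn n × Rn n) // i.2.1 ≠ i.2.2 ∧
    ∃ x₀ ∈ K, i.2.1 ∈ Metric.ball x₀ r₀ ∧ i.2.2 ∈ Metric.ball x₀ r₀}
  have hE : ∀ l x x', ∫ v, osc b Φ l x v * conj (osc b Φ l x' v) =
      ∫ v, cexp (I * ((l * (Φ x v - Φ x' v) : ℝ) : ℂ)) * (b l x v * conj (b l x' v)) := by
    intro l x x'
    refine integral_congr_ae (Filter.Eventually.of_forall fun v => ?_)
    simp only [osc, map_mul, ← Complex.exp_conj, conj_I, conj_ofReal]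
    rw [mul_mul_mul_comm, ← Complex.exp_add]
    congr 2
    push_cast; ring
  have hamp : UB Set.univ (fun (i : {l : ℝ // 0 < l} × (Rn n × Rn n)) v =>
      b i.1 i.2.1 v * conj (b i.1 i.2.2 v)) :=
    (hb.ub_right.reindex fun i : {l : ℝ // 0 < l} × (Rn n × Rn n) => (i.1, i.2.1)).mul
      (hb.ub_right.reindex fun i : {l : ℝ // 0 < l} × (Rn n × Rn n) => (i.1, i.2.2)).conj
  have hts : ∀ i : {l : ℝ // 0 < l} × (Rn n × Rn n),
      tsupport (fun v => b i.1 i.2.1 v * conj (b i.1 i.2.2 v)) ⊆ ann n 4 := fun i =>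
    closure_minimal (fun v hv => hb.mem_right i.1 i.2.1 v (left_ne_zero_of_mul hv))
      (isCompact_ann n 4).isClosed
  obtain ⟨C₀, hC₀, hC₀'⟩ := exists_exp_integral_bound_of_UB (isCompact_ann n 4)
    (hamp.mono (Set.subset_univ _)) hts
  set Ψ : ι → Rn n → ℝ := fun i v => ‖i.1.2.1 - i.1.2.2‖⁻¹ * (Φ i.1.2.1 v - Φ i.1.2.2 v) with hΨ
  have hpos : ∀ i : ι, 0 < ‖i.1.2.1 - i.1.2.2‖ := fun i => norm_pos_iff.2 (sub_ne_zero.2 i.2.1)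
  have hsm : ∀ x : Rn n, ContDiff ℝ ∞ (fun v => Φ x v) := fun x => hΦ.ub_right.1 x
  have hΨs : ∀ i, ContDiff ℝ ∞ (Ψ i) := fun i =>
    contDiff_const.mul ((hsm _).sub (hsm _))
  have hΨub : UB Set.univ Ψ := by
    refine ⟨hΨs, fun k => ?_⟩
    obtain ⟨C, hC0, hC⟩ := exists_lipschitz_iteratedFDeriv_slice hΦ.smooth hΦ.supp k
    refine ⟨C, fun i v _ => ?_⟩
    have h1 : Ψ i = ‖i.1.2.1 - i.1.2.2‖⁻¹ • ((fun v => Φ i.1.2.1 v) - fun v => Φ i.1.2.2 v) := by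
      ext v; simp [hΨ]
    have hk : ∀ x : Rn n, ContDiffAt ℝ k (fun v => Φ x v) v := fun x =>
      ((hsm x).of_le (by exact_mod_cast le_top)).contDiffAt
    rw [h1, iteratedFDeriv_const_smul_apply (show ContDiffAt ℝ k
      ((fun v => Φ i.1.2.1 v) - fun v => Φ i.1.2.2 v) v from (hk _).sub (hk _)), norm_smul,
        norm_inv, norm_norm,
      iteratedFDeriv_sub_apply (hk _) (hk _), inv_mul_le_iff₀ (hpos i)]
    refine (hC i.1.2.1 i.1.2.2 v v).trans_eq ?_
    rw [mul_comm]; simp [Prod.norm_def]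
  obtain ⟨D, hD0, hD⟩ := nonstationary_phase (volume : Measure (Rn n)) (isCompact_ann n 4)
    (fun l : Fin n => EuclideanSpace.single l (1 : ℝ)) hΨs
    (fun l => (hΨub.fderiv_apply _).mono (Set.subset_univ _)) (c := c ^ 2) (by positivity) (n + 1)
    (fun (i : ι) v => b i.1.1 i.1.2.1 v * conj (b i.1.1 i.1.2.2 v))
    ((hamp.reindex fun i : ι => i.1).mono (Set.subset_univ _))
    (fun i => hts i.1) (fun i v hv => by
      rw [sum_sq_apply_basis]
      have hv4 : v ∈ ann n 64 := ann_mono (by norm_num) (by norm_num) (hts i.1 hv)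
      have hdx : ∀ x : Rn n, DifferentiableAt ℝ (fun v => Φ x v) v := fun x =>
        (hsm x).differentiable (by simp) v
      have h1 : fderiv ℝ (Ψ i) v = ‖i.1.2.1 - i.1.2.2‖⁻¹ • (InnerProductSpace.toDual ℝ (Rn n)
          (kap Φ i.1.2.1 v - kap Φ i.1.2.2 v)) := by
        have h2 : fderiv ℝ (Ψ i) v =
            ‖i.1.2.1 - i.1.2.2‖⁻¹ • (fderiv ℝ (fun v => Φ i.1.2.1 v) v -
              fderiv ℝ (fun v => Φ i.1.2.2 v) v) :=
          (((hdx _).hasFDerivAt.sub (hdx _).hasFDerivAt).const_mul _).fderiv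
        rw [h2]
        ext e
        simp [inner_kap]
      rw [h1, norm_smul, LinearIsometryEquiv.norm_map, norm_inv, norm_norm]
      obtain ⟨x₀, hx₀, hx, hx'⟩ := i.2.2
      have h3 : c ≤ ‖i.1.2.1 - i.1.2.2‖⁻¹ * ‖kap Φ i.1.2.1 v - kap Φ i.1.2.2 v‖ := by
        rw [inv_mul_eq_div, le_div_iff₀ (hpos i)]
        exact hanti x₀ hx₀ _ hx _ hx' v hv4
      gcongr)
  refine ⟨r₀, 2 ^ (n + 1) * (C₀ + D), hr0, by positivity, fun x₀ hx₀ l hl x hx x' hx' => ?_⟩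
  refine div_pow_le_of_bounds (by positivity) hC₀ hD0 ?_ fun h => ?_
  · rw [hE]; exact hC₀' (⟨l, hl⟩, x, x') fun v => l * (Φ x v - Φ x' v)
  · have hne : x ≠ x' := by rintro rfl; simp at h
    have h1 := hD ⟨(⟨l, hl⟩, x, x'), hne, x₀, hx₀, hx, hx'⟩ (l * ‖x - x'‖) h
    have h2 : 0 < ‖x - x'‖ := norm_pos_iff.2 (sub_ne_zero.2 hne)
    have h3 : ∀ v, l * ‖x - x'‖ * (‖x - x'‖⁻¹ * (Φ x v - Φ x' v)) = l * (Φ x v - Φ x' v) :=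
      fun v => by field_simp
    simp only [hΨ, h3] at h1
    rwa [hE]

theorem le_of_enorm_integral_mul {s : Set (Rn n)} (hs : MeasurableSet s) {g G : Rn n → ℂ}
    (hg : Continuous g) (hG0 : ∀ v, v ∉ s → G v = 0) {X : ℝ≥0∞} (hXfin : X ≠ ⊤)
    (hX : X = ‖∫ v, g v * G v‖ₑ) {a : ℝ} (ha0 : 0 < a)
    (hG : ∫⁻ v, ‖G v‖ₑ ^ 2 ≤ ENNReal.ofReal a * X) :
    X ≤ ENNReal.ofReal a * ∫⁻ v in s, ‖g v‖ₑ ^ 2 := by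
  have e2 : ∫⁻ v, ‖g v * G v‖ₑ = ∫⁻ v in s, ‖g v * G v‖ₑ := by
    rw [← lintegral_indicator hs]
    refine lintegral_congr fun v => ?_
    by_cases hv : v ∈ s
    · rw [Set.indicator_of_mem hv]
    · rw [Set.indicator_of_notMem hv, hG0 v hv]; simp
  have hX2 : X ≤ (ENNReal.ofReal a * (∫⁻ v in s, ‖g v‖ₑ ^ 2) + X) / 2 := by
    calc X = ‖∫ v, g v * G v‖ₑ := hX
      _ ≤ ∫⁻ v in s, ‖g v * G v‖ₑ := (enorm_integral_le_lintegral_enorm _).trans e2.le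
      _ ≤ ∫⁻ v in s,
          (ENNReal.ofReal a * ‖g v‖ₑ ^ 2 + ENNReal.ofReal a⁻¹ * ‖G v‖ₑ ^ 2) / 2 := by
        refine lintegral_mono fun v => ?_
        rw [ENNReal.le_div_iff_mul_le (by simp) (by simp), ← ofReal_norm (g v * G v), norm_mul,
          ← ofReal_norm, ← ofReal_norm, ← ENNReal.ofReal_pow (norm_nonneg _),
          ← ENNReal.ofReal_pow (norm_nonneg _), ← ENNReal.ofReal_mul ha0.le,
          ← ENNReal.ofReal_mul (by positivity), ← ENNReal.ofReal_add (by positivity)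
          (by positivity), show (2 : ℝ≥0∞) = ENNReal.ofReal 2 by simp,
          ← ENNReal.ofReal_mul (by positivity)]
        refine ENNReal.ofReal_le_ofReal ?_
        have := mul_nonneg (inv_pos.2 ha0).le (sq_nonneg (a * ‖g v‖ - ‖G v‖))
        have e : a⁻¹ * (a * ‖g v‖ - ‖G v‖) ^ 2 =
            a * ‖g v‖ ^ 2 + a⁻¹ * ‖G v‖ ^ 2 - ‖g v‖ * ‖G v‖ * 2 := by field_simp; ring
        linarith
      _ = (ENNReal.ofReal a * (∫⁻ v in s, ‖g v‖ₑ ^ 2) +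
          ENNReal.ofReal a⁻¹ * ∫⁻ v in s, ‖G v‖ₑ ^ 2) / 2 := by
        simp only [div_eq_mul_inv]
        rw [lintegral_mul_const' _ _ (by simp), lintegral_add_left (by fun_prop),
          lintegral_const_mul _ (by fun_prop), lintegral_const_mul' _ _ ENNReal.ofReal_ne_top]
      _ ≤ _ := by
        gcongr
        calc ENNReal.ofReal a⁻¹ * ∫⁻ v in s, ‖G v‖ₑ ^ 2
            ≤ ENNReal.ofReal a⁻¹ * (ENNReal.ofReal a * X) := by
              gcongr
              refine (setLIntegral_le_lintegral _ _).trans hG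
          _ = X := by
            rw [← mul_assoc, ← ENNReal.ofReal_mul (by positivity), inv_mul_cancel₀ ha0.ne',
              ENNReal.ofReal_one, one_mul]
  rw [← ENNReal.add_le_add_iff_right hXfin, ← mul_two]
  rwa [ENNReal.le_div_iff_mul_le (by simp) (by simp)] at hX2

namespace GoodAmp

/-- Local `L²` bound for superpositions of the oscillating amplitudes, by duality. -/
theorem exists_osc_superposition_local (hb : GoodAmp n K b) (hΦ : GoodPhase n K Φ)
    (hK : IsCompact K) : ∃ r₀ A : ℝ, 0 < r₀ ∧ 0 < A ∧ ∀ x₀ ∈ K, ∀ l : ℝ, 0 < l → ∀ g : Rn n → ℂ,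
      Continuous g → ∫⁻ z in Metric.ball x₀ r₀, ‖∫ v, osc b Φ l z v * g v‖ₑ ^ 2 ≤
        ENNReal.ofReal (A / l ^ n) * ∫⁻ v in ann n 4, ‖g v‖ₑ ^ 2 := by
  obtain ⟨r₀, C, hr0, hC0, hC⟩ := hb.exists_osc_gram hΦ
  obtain ⟨C₁, hC₁0, hC₁⟩ := exists_lintegral_inv_pow_le n
  obtain ⟨C₂, hC₂0, hC₂⟩ := hb.exists_norm_le
  refine ⟨r₀, C * C₁ + 1, hr0, by positivity, fun x₀ hx₀ l hl g hg => ?_⟩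
  set a : ℝ := (C * C₁ + 1) / l ^ n with ha
  have ha0 : 0 < a := by positivity
  set S : Rn n → ℂ := fun z => ∫ v, osc b Φ l z v * g v with hS
  set B := Metric.ball x₀ r₀ with hB
  have hBm : MeasurableSet B := Metric.isOpen_ball.measurableSet
  have hosc := hb.continuous_osc hΦ hl
  have hSc : Continuous S := continuous_integral_of_support
    (F := fun z v => osc b Φ l z v * g v) (hosc.mul (by fun_prop)) (isCompact_ann n 4)
    fun z v h => hb.mem_right l z v (osc_ne_zero (left_ne_zero_of_mul h))
  have hSK : ∀ z, S z ≠ 0 → z ∈ K := fun z hz => by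
    by_contra hc
    refine hz ?_
    simp only [hS]
    rw [← integral_zero (Rn n) ℂ]
    congr 1; ext v
    have : osc b Φ l z v = 0 := by
      by_contra h; exact hc (hb.mem_left l z v (osc_ne_zero h))
    simp [this]
  have hScs : HasCompactSupport S := HasCompactSupport.intro hK fun z hz => by
    by_contra h; exact hz (hSK z h)
  set h : Rn n → ℂ := B.indicator fun z => conj (S z) with hh
  have hhint : Integrable h := by
    refine Integrable.indicator ?_ hBm
    exact (continuous_conj.comp hSc).integrable_of_hasCompactSupport
      (hScs.comp_left (g := fun z : ℂ => conj z) (by simp))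
  have hX : ∫⁻ z, ‖h z‖ₑ ^ 2 = ∫⁻ z in B, ‖S z‖ₑ ^ 2 := by
    rw [← lintegral_indicator hBm]
    refine lintegral_congr fun z => ?_
    by_cases hz : z ∈ B
    · simp only [hh, Set.indicator_of_mem hz]
      rw [← ofReal_norm, RCLike.norm_conj, ofReal_norm]
    · simp [hh, Set.indicator_of_notMem hz]
  set G : Rn n → ℂ := fun v => ∫ x, h x * osc b Φ l x v with hG
  have hgram := lintegral_sq_integral_le_of_gram_decay hC₁ hosc (isCompact_ann n 4)
    (fun x v hv => hb.mem_right l x v (osc_ne_zero hv)) (C₀ := C₂)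
    (fun x v => by rw [norm_osc]; exact hC₂ l hl x v) hhint hC0 hl (fun x x' hx hx' => by
      have hmem : ∀ y, h y ≠ 0 → y ∈ B := fun y hy => by
        by_contra hc; exact hy (Set.indicator_of_notMem hc _)
      exact hC x₀ hx₀ l hl x (hmem x hx) x' (hmem x' hx'))
  rw [hX] at hgram
  set X := ∫⁻ z in B, ‖S z‖ₑ ^ 2 with hXdef
  have hSsq : Integrable fun z => ‖S z‖ ^ 2 := by
    refine Continuous.integrable_of_hasCompactSupport (by fun_prop)
      (HasCompactSupport.intro hK fun z hz => ?_)
    have : S z = 0 := by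
      by_contra h; exact hz (hSK z h)
    simp [this]
  have hXr : X = ENNReal.ofReal (∫ z in B, ‖S z‖ ^ 2) := by
    rw [ofReal_integral_eq_lintegral_ofReal hSsq.integrableOn
      (Filter.Eventually.of_forall fun z => by positivity)]
    refine lintegral_congr fun z => ?_
    rw [ENNReal.ofReal_pow (norm_nonneg _), ofReal_norm]
  have hXfin : X ≠ ⊤ := by rw [hXr]; exact ENNReal.ofReal_ne_top
  have hdual : ((∫ z in B, ‖S z‖ ^ 2 : ℝ) : ℂ) = ∫ v, g v * G v := by
    have h1 : ((∫ z in B, ‖S z‖ ^ 2 : ℝ) : ℂ) = ∫ z, h z * S z := by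
      rw [← integral_complex_ofReal, ← integral_indicator hBm]
      refine integral_congr_ae (Filter.Eventually.of_forall fun z => ?_)
      by_cases hz : z ∈ B
      · simp only [hh, Set.indicator_of_mem hz]
        rw [mul_comm, Complex.mul_conj, Complex.normSq_eq_norm_sq]
      · simp [hh, Set.indicator_of_notMem hz]
    have hint := hb.integrable_prod_osc hΦ hK hl
      (g := fun p : Rn n × Rn n => conj (S p.1) * g p.2)
      ((continuous_conj.comp (hSc.comp continuous_fst)).mul (hg.comp continuous_snd))
    have hint2 := hint.indicator (hBm.prod (MeasurableSet.univ (α := Rn n)))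
    rw [h1]
    simp only [hS, hG, ← integral_const_mul]
    rw [integral_integral_swap]
    · refine integral_congr_ae (Filter.Eventually.of_forall fun v => ?_)
      refine integral_congr_ae (Filter.Eventually.of_forall fun z => ?_)
      simp only; ring
    · refine hint2.congr (Filter.Eventually.of_forall fun p => ?_)
      simp only [Function.uncurry]
      by_cases hz : p.1 ∈ B
      · rw [Set.indicator_of_mem (by simp [hz])]
        simp only [hh, Set.indicator_of_mem hz]; ring
      · rw [Set.indicator_of_notMem (by simp [hz])]
        simp [hh, Set.indicator_of_notMem hz]
  have hG0 : ∀ v, v ∉ ann n 4 → G v = 0 := fun v hv => by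
    simp only [hG]
    rw [← integral_zero (Rn n) ℂ]
    congr 1; ext x
    have : osc b Φ l x v = 0 := by
      by_contra h; exact hv (hb.mem_right l x v (osc_ne_zero h))
    simp [this]
  refine le_of_enorm_integral_mul (isCompact_ann n 4).isClosed.measurableSet hg hG0 hXfin ?_ ha0
    (hgram.trans ?_)
  · rw [← hdual, ← ofReal_norm, norm_real,
      Real.norm_of_nonneg (integral_nonneg fun z => by positivity), hXr]
  · refine mul_le_mul_left (ENNReal.ofReal_le_ofReal ?_) _
    rw [ha]; gcongr; linarith

theorem exists_ker_ltwo (hb : GoodAmp n K b) (hΦ : GoodPhase n K Φ) (hK : IsCompact K) :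
    ∃ C : ℝ, 0 < C ∧ ∀ l : ℝ, 0 < l → ∀ f : Rn n → ℂ, Integrable f →
      ∫⁻ z, ‖∫ y, ker b Φ l z y * f y‖ₑ ^ 2 ≤
        ENNReal.ofReal (C / l ^ (2 * n)) * ∫⁻ y, ‖f y‖ₑ ^ 2 := by
  obtain ⟨r₀, A, hr0, hA0, hA⟩ := hb.exists_osc_superposition_local hΦ hK
  obtain ⟨B, hB0, hB⟩ := exists_fourier_restrict_le n
  obtain ⟨t, htK, ht⟩ := hK.elim_nhds_subcover (fun x => Metric.ball x r₀)
    fun x _ => Metric.ball_mem_nhds x hr0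
  obtain ⟨C₂, hC₂0, hC₂⟩ := hb.exists_norm_le
  refine ⟨t.card * (A * B) + 1, by positivity, fun l hl f hf => ?_⟩
  set g : Rn n → ℂ := fun v => ∫ y, f y * cexp (-(I * ((l * ⟪y, v⟫_ℝ : ℝ) : ℂ))) with hg
  have hgc : Continuous g := by
    refine continuous_of_dominated (bound := fun y => ‖f y‖) (fun v => ?_) (fun v => ?_) hf.norm ?_
    · exact hf.aestronglyMeasurable.mul (by fun_prop : Continuous fun y : Rn n =>
        cexp (-(I * ((l * ⟪y, v⟫_ℝ : ℝ) : ℂ)))).aestronglyMeasurable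
    · exact Filter.Eventually.of_forall fun y => (norm_mul_cexp_neg_I _ _).le
    · exact Filter.Eventually.of_forall fun y => by fun_prop
  have hosc := hb.continuous_osc hΦ hl
  have hT : ∀ z, ∫ y, ker b Φ l z y * f y = ∫ v, osc b Φ l z v * g v := fun z => by
    have hoz : Continuous fun v => osc b Φ l z v := hosc.comp (f := fun v => (z, v)) (by fun_prop)
    have hozi : Integrable fun v => osc b Φ l z v :=
      hoz.integrable_of_hasCompactSupport (HasCompactSupport.intro (isCompact_ann n 4)
        fun v hv => by
          by_contra h; exact hv (hb.mem_right l z v (osc_ne_zero h)))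
    simp only [ker, hg, ← integral_const_mul, ← integral_mul_const]
    rw [integral_integral_swap]
    · refine integral_congr_ae (Filter.Eventually.of_forall fun v => ?_)
      refine integral_congr_ae (Filter.Eventually.of_forall fun y => ?_)
      simp only; ring
    · have h1 := hf.mul_prod hozi
      refine (h1.bdd_mul (c := 1) (f := fun p : Rn n × Rn n =>
        cexp (-(I * ((l * ⟪p.1, p.2⟫_ℝ : ℝ) : ℂ))))
        (by fun_prop : Continuous _).aestronglyMeasurable
        (Filter.Eventually.of_forall fun p => ?_)).congr
        (Filter.Eventually.of_forall fun p => ?_)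
      · have := norm_mul_cexp_neg_I 1 (l * ⟪p.1, p.2⟫_ℝ)
        rw [one_mul, norm_one] at this
        exact this.le
      · simp only [Function.uncurry]; ring
  simp only [hT]
  have hsub : ∫⁻ z, ‖∫ v, osc b Φ l z v * g v‖ₑ ^ 2 ≤
      ∑ x ∈ t, ∫⁻ z in Metric.ball x r₀, ‖∫ v, osc b Φ l z v * g v‖ₑ ^ 2 := by
    calc ∫⁻ z, ‖∫ v, osc b Φ l z v * g v‖ₑ ^ 2
        = ∫⁻ z in ⋃ x : t, Metric.ball (x : Rn n) r₀, ‖∫ v, osc b Φ l z v * g v‖ₑ ^ 2 := by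
          refine (setLIntegral_eq_of_support_subset fun z hz => ?_).symm
          have ht' : K ⊆ ⋃ x : t, Metric.ball (x : Rn n) r₀ := by
            simpa [Set.iUnion_subtype] using ht
          refine ht' ?_
          by_contra hc
          refine hz ?_
          have : ∀ v, osc b Φ l z v = 0 := fun v => by
            by_contra h; exact hc (hb.mem_left l z v (osc_ne_zero h))
          simp [this]
      _ ≤ ∑' x : t, ∫⁻ z in Metric.ball (x : Rn n) r₀, ‖∫ v, osc b Φ l z v * g v‖ₑ ^ 2 :=
          lintegral_iUnion_le _ _
      _ = _ := by
          rw [tsum_fintype, Finset.sum_coe_sort t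
            fun x => ∫⁻ z in Metric.ball x r₀, ‖∫ v, osc b Φ l z v * g v‖ₑ ^ 2]
  refine hsub.trans ((Finset.sum_le_sum fun x hx => hA x (htK x hx) l hl g hgc).trans ?_)
  rw [Finset.sum_const, nsmul_eq_mul]
  calc (t.card : ℝ≥0∞) * (ENNReal.ofReal (A / l ^ n) * ∫⁻ v in ann n 4, ‖g v‖ₑ ^ 2)
      ≤ (t.card : ℝ≥0∞) * (ENNReal.ofReal (A / l ^ n) *
        (ENNReal.ofReal (B / l ^ n) * ∫⁻ y, ‖f y‖ₑ ^ 2)) := by gcongr; exact hB l hl f hf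
    _ = ENNReal.ofReal (t.card * (A * B) / l ^ (2 * n)) * ∫⁻ y, ‖f y‖ₑ ^ 2 := by
      rw [← mul_assoc, ← mul_assoc, ← ENNReal.ofReal_natCast, mul_assoc,
        ← ENNReal.ofReal_mul (by positivity), ← mul_assoc, ← ENNReal.ofReal_mul (by positivity)]
      congr 2
      field_simp
      ring
    _ ≤ _ := by gcongr; linarith

end GoodAmp
end LTwo

end

section
open scoped ContDiff

section Average
variable {n : ℕ}

/-- A smooth bump on the dilations `1 ≤ r ≤ 2`. -/
def dilBump : ContDiffBump (3 / 2 : ℝ) := ⟨1 / 4, 1 / 2, by norm_num, by norm_num⟩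

/-- A smooth bump on the unit ball of translations. -/
def transBump (n : ℕ) : ContDiffBump (0 : Rn n) := ⟨1 / 2, 1, by norm_num, by norm_num⟩

/-- The weight used to average over dilations and translations. -/
def avgWeight (n : ℕ) (p : ℝ × Rn n) : ℝ := dilBump p.1 * p.1 ^ n * transBump n p.2

/-- The box carrying `avgWeight`. -/
def avgBox (n : ℕ) : Set (ℝ × Rn n) := Set.Icc 1 2 ×ˢ Metric.closedBall 0 1

theorem isCompact_avgBox (n : ℕ) : IsCompact (avgBox n) :=
  isCompact_Icc.prod (isCompact_closedBall _ _)

theorem contDiff_avgWeight (n : ℕ) : ContDiff ℝ ∞ (avgWeight n) :=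
  (((dilBump.contDiff).comp contDiff_fst).mul (contDiff_fst.pow n)).mul
    ((transBump n).contDiff.comp contDiff_snd)

theorem avgWeight_ne_zero {p : ℝ × Rn n} (h : avgWeight n p ≠ 0) : p ∈ avgBox n := by
  have h1 : p.1 ∈ Function.support dilBump := left_ne_zero_of_mul (left_ne_zero_of_mul h)
  have h2 : p.2 ∈ Function.support (transBump n) := right_ne_zero_of_mul h
  rw [ContDiffBump.support_eq] at h1 h2
  have h3 := abs_le.1 (Real.dist_eq p.1 (3 / 2) ▸ (Metric.mem_ball.1 h1).le)
  refine ⟨⟨?_, ?_⟩, Metric.ball_subset_closedBall h2⟩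
  · have := h3.1; simp only [dilBump] at this; linarith
  · have := h3.2; simp only [dilBump] at this; linarith

theorem integral_avgWeight (n : ℕ) {F : Rn n → ℂ} (hF : Continuous F) (hc : HasCompactSupport F)
    (δ : ℝ) :
    ∫ v, ∫ p : ℝ × Rn n, (avgWeight n p : ℂ) * F (p.1 • (v + δ • p.2)) =
      (((∫ r, dilBump r) * ∫ t, transBump n t : ℝ) : ℂ) * ∫ v, F v := by
  obtain ⟨R, hR⟩ := hc.isBounded.subset_closedBall 0
  have hw := (contDiff_avgWeight n).continuous
  have hint : Integrable (Function.uncurry fun (v : Rn n) (p : ℝ × Rn n) =>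
      (avgWeight n p : ℂ) * F (p.1 • (v + δ • p.2))) (volume.prod volume) := by
    refine Continuous.integrable_of_hasCompactSupport ?_ (HasCompactSupport.intro
      ((isCompact_closedBall (0 : Rn n) (R + |δ|)).prod (isCompact_avgBox n)) fun q hq => ?_)
    · exact (continuous_ofReal.comp (hw.comp continuous_snd)).mul (hF.comp (by fun_prop))
    · by_contra hne
      simp only [Function.uncurry] at hne
      have h1 := avgWeight_ne_zero (p := q.2) (by
        have := left_ne_zero_of_mul hne; exact_mod_cast this)
      have h2 := hR (subset_tsupport _ (right_ne_zero_of_mul hne))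
      refine hq ⟨?_, h1⟩
      rw [mem_closedBall_zero_iff, norm_smul, Real.norm_eq_abs, abs_of_pos (by linarith [h1.1.1])]
        at h2
      have h3 : ‖q.1 + δ • q.2.2‖ ≤ R := by
        refine le_trans ?_ h2
        exact le_mul_of_one_le_left (norm_nonneg _) h1.1.1
      have h4 : ‖δ • q.2.2‖ ≤ |δ| := by
        rw [norm_smul, Real.norm_eq_abs]
        exact mul_le_of_le_one_right (abs_nonneg _) (by simpa using h1.2)
      rw [mem_closedBall_zero_iff]
      have := norm_sub_le (q.1 + δ • q.2.2) (δ • q.2.2)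
      rw [add_sub_cancel_right] at this
      linarith
  rw [integral_integral_swap hint]
  have h1 : ∀ p : ℝ × Rn n, ∫ v, (avgWeight n p : ℂ) * F (p.1 • (v + δ • p.2)) =
      ((dilBump p.1 * transBump n p.2 : ℝ) : ℂ) * ∫ v, F v := fun p => by
    rw [integral_const_mul, integral_add_right_eq_self (fun v => F (p.1 • v)),
      Measure.integral_comp_smul]
    by_cases h : avgWeight n p = 0
    · have : dilBump p.1 * transBump n p.2 = 0 := by
        by_contra hne
        have h5 : dilBump p.1 ≠ 0 := left_ne_zero_of_mul hne
        have h6 : p.1 ∈ Function.support dilBump := h5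
        rw [ContDiffBump.support_eq] at h6
        have h3 := (abs_lt.1 (Real.dist_eq p.1 (3 / 2) ▸ (Metric.mem_ball.1 h6))).1
        simp only [dilBump] at h3
        have : p.1 ^ n ≠ 0 := pow_ne_zero _ (by linarith)
        exact mul_ne_zero (mul_ne_zero h5 this) (right_ne_zero_of_mul hne) h
      rw [h, this]; simp
    · have h2 := (avgWeight_ne_zero h).1.1
      have hp : 0 < p.1 ^ n := by positivity
      rw [finrank_euclideanSpace_fin, abs_of_pos (inv_pos.2 hp), Complex.real_smul, ← mul_assoc,
        ← ofReal_mul]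
      congr 2
      rw [avgWeight]; field_simp
  simp only [h1]
  rw [integral_mul_const]
  congr 1
  rw [integral_complex_ofReal, Measure.volume_eq_prod, integral_prod_mul]

theorem avg_const_pos (n : ℕ) : 0 < (∫ r, dilBump r) * ∫ t, transBump n t :=
  mul_pos dilBump.integral_pos (transBump n).integral_pos

end Average

/-- The anisotropic size `λ|w·v| + √λ|w|` of `w` relative to the direction `v`. -/
def slabSize {n : ℕ} (l : ℝ) (v w : Rn n) : ℝ := l * |⟪w, v⟫_ℝ| + √l * ‖w‖

theorem slabSize_nonneg {n : ℕ} {l : ℝ} (hl : 0 ≤ l) (v w : Rn n) : 0 ≤ slabSize l v w := by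
  unfold slabSize; positivity

section Averaged
variable {n : ℕ} {K : Set (Rn n)} {Φ : Rn n → Rn n → ℝ} {b : ℝ → Rn n → Rn n → ℂ}

/-- The second-order Taylor remainder of the phase at scale `λ^{-1/2}`, times `λ`. -/
def phaseRem (Φ : Rn n → Rn n → ℝ) (l : ℝ) (z v θ : Rn n) : ℝ :=
  l * (Φ z (v + ((√l)⁻¹ / 16) • θ) - Φ z v - ⟪((√l)⁻¹ / 16) • kap Φ z v, θ⟫_ℝ)

theorem GoodPhase.ub_phaseRem (hΦ : GoodPhase n K Φ) : UB (Metric.closedBall (0 : Rn n) 1)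
    (fun (i : {l : ℝ // 1 ≤ l} × (Rn n × Rn n)) θ => phaseRem Φ i.1 i.2.1 i.2.2 θ) := by
  have hsm : ∀ x : Rn n, ContDiff ℝ ∞ (fun v => Φ x v) := fun x => hΦ.ub_right.1 x
  have hcd : ∀ i : {l : ℝ // 1 ≤ l} × (Rn n × Rn n),
      ContDiff ℝ ∞ (fun θ => phaseRem Φ i.1 i.2.1 i.2.2 θ) := fun i => by
    have := hsm i.2.1
    have h2 : ContDiff ℝ ∞ fun θ : Rn n => ⟪((√(i.1 : ℝ))⁻¹ / 16) • kap Φ i.2.1 i.2.2, θ⟫_ℝ :=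
      contDiff_const.inner ℝ contDiff_id
    unfold phaseRem
    fun_prop
  have hcd' : ∀ i : {l : ℝ // 1 ≤ l} × (Rn n × Rn n),
      ContDiff ℝ ∞ (fderiv ℝ (Φ i.2.1)) := fun i => (hsm i.2.1).fderiv_right (by simp)
  have hl : ∀ i : {l : ℝ // 1 ≤ l} × (Rn n × Rn n), 1 ≤ √(i.1 : ℝ) := fun i =>
    Real.one_le_sqrt.2 i.1.2
  have hsq : ∀ i : {l : ℝ // 1 ≤ l} × (Rn n × Rn n), (i.1 : ℝ) = √(i.1 : ℝ) * √(i.1 : ℝ) := fun i =>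
    (Real.mul_self_sqrt (by linarith [i.1.2])).symm
  obtain ⟨C, hC0, hC⟩ := hΦ.ub_right.bound 2
  have hd : ∀ i : {l : ℝ // 1 ≤ l} × (Rn n × Rn n), ∀ θ,
      HasFDerivAt (fun θ => phaseRem Φ i.1 i.2.1 i.2.2 θ)
        ((i.1 : ℝ) • ((√(i.1 : ℝ))⁻¹ / 16) • (fderiv ℝ (Φ i.2.1)
          (i.2.2 + ((√(i.1 : ℝ))⁻¹ / 16) • θ) - fderiv ℝ (Φ i.2.1) i.2.2)) θ := fun i θ => by
    have h0 : HasFDerivAt (fun θ : Rn n => i.2.2 + ((√(i.1 : ℝ))⁻¹ / 16) • θ)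
        (((√(i.1 : ℝ))⁻¹ / 16) • ContinuousLinearMap.id ℝ (Rn n)) θ :=
      (((√(i.1 : ℝ))⁻¹ / 16) • ContinuousLinearMap.id ℝ (Rn n)).hasFDerivAt.const_add _
    have h1 := (((hsm i.2.1).differentiable (by simp) _).hasFDerivAt.comp θ h0).sub_const
      (Φ i.2.1 i.2.2)
    have h2 : HasFDerivAt (fun θ : Rn n => ⟪((√(i.1 : ℝ))⁻¹ / 16) • kap Φ i.2.1 i.2.2, θ⟫_ℝ)
        (((√(i.1 : ℝ))⁻¹ / 16) • fderiv ℝ (Φ i.2.1) i.2.2) θ := by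
      have := (((√(i.1 : ℝ))⁻¹ / 16) • fderiv ℝ (Φ i.2.1) i.2.2).hasFDerivAt (x := θ)
      refine this.congr_of_eventuallyEq (Filter.Eventually.of_forall fun x => ?_)
      simp [inner_smul_left, inner_kap]
    refine ((h1.sub h2).const_mul (i.1 : ℝ)).congr_fderiv ?_
    ext e
    simp [mul_sub]
  have hfd : ∀ i : {l : ℝ // 1 ≤ l} × (Rn n × Rn n), ∀ θ ∈ Metric.closedBall (0 : Rn n) 1,
      ‖fderiv ℝ (fun θ => phaseRem Φ i.1 i.2.1 i.2.2 θ) θ‖ ≤ C := fun i θ hθ => by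
    rw [(hd i θ).fderiv, norm_smul, norm_smul]
    have h1 := convex_univ.norm_image_sub_le_of_norm_fderiv_le (𝕜 := ℝ)
      (f := fderiv ℝ (Φ i.2.1)) (C := C)
      (fun x _ => (hcd' i).differentiable (by simp) x)
      (fun x _ => by
        have := hC i.2.1 x trivial
        rwa [← norm_iteratedFDeriv_fderiv, norm_iteratedFDeriv_one] at this)
      (Set.mem_univ i.2.2) (Set.mem_univ (i.2.2 + ((√(i.1 : ℝ))⁻¹ / 16) • θ))
    rw [add_sub_cancel_left, norm_smul] at h1
    have h4 := hl i
    have hδ : ‖(√(i.1 : ℝ))⁻¹ / 16‖ = (√(i.1 : ℝ))⁻¹ / 16 := Real.norm_of_nonneg (by positivity)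
    rw [hδ] at h1 ⊢
    rw [Real.norm_of_nonneg (by linarith [i.1.2])]
    have hθ1 : ‖θ‖ ≤ 1 := by simpa using hθ
    calc (i.1 : ℝ) * ((√(i.1 : ℝ))⁻¹ / 16 * _)
        ≤ (i.1 : ℝ) * ((√(i.1 : ℝ))⁻¹ / 16 * (C * ((√(i.1 : ℝ))⁻¹ / 16 * 1))) := by
          have := i.1.2
          gcongr
          exact h1.trans (by gcongr)
      _ = C / 256 := by
          have : √(i.1 : ℝ) ≠ 0 := by positivity
          nth_rewrite 1 [hsq i]
          field_simp; norm_num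
      _ ≤ C := by linarith
  refine ⟨hcd, fun k => ?_⟩
  match k with
  | 0 =>
    refine ⟨C, fun i θ hθ => ?_⟩
    rw [norm_iteratedFDeriv_zero]
    have h1 := (convex_closedBall (0 : Rn n) 1).norm_image_sub_le_of_norm_fderiv_le (𝕜 := ℝ)
      (f := fun θ => phaseRem Φ i.1 i.2.1 i.2.2 θ) (fun x _ => (hd i x).differentiableAt)
      (fun x hx => hfd i x hx) (Metric.mem_closedBall_self zero_le_one) hθ
    have h2 : phaseRem Φ i.1 i.2.1 i.2.2 0 = 0 := by simp [phaseRem]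
    rw [h2, sub_zero, sub_zero] at h1
    refine h1.trans (mul_le_of_le_one_right hC0.le (by simpa using hθ))
  | 1 => exact ⟨C, fun i θ hθ => by rw [norm_iteratedFDeriv_one]; exact hfd i θ hθ⟩
  | k + 2 =>
    obtain ⟨D, hD0, hD⟩ := hΦ.ub_right.bound (k + 2)
    refine ⟨D, fun i θ _ => ?_⟩
    have h4 := hl i
    set δ := (√(i.1 : ℝ))⁻¹ / 16 with hδ
    have hδ0 : 0 ≤ δ := by positivity
    have h1 : (fun θ => phaseRem Φ i.1 i.2.1 i.2.2 θ) =
        (fun θ => (i.1 : ℝ) • Φ i.2.1 (i.2.2 + δ • θ)) - fun θ =>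
          (innerSL ℝ ((i.1 : ℝ) • δ • kap Φ i.2.1 i.2.2)) θ + (i.1 : ℝ) * Φ i.2.1 i.2.2 := by
      ext θ
      simp [phaseRem, inner_smul_left, ← hδ]
      ring
    have hcomp : ContDiff ℝ ∞ (fun w => Φ i.2.1 (i.2.2 + w)) := (hsm _).comp (by fun_prop)
    have hA : ContDiff ℝ ∞ fun θ => (i.1 : ℝ) • Φ i.2.1 (i.2.2 + δ • θ) := by
      have := hsm i.2.1
      fun_prop
    have hle : ((k + 2 : ℕ) : WithTop ℕ∞) ≤ ((⊤ : ℕ∞) : WithTop ℕ∞) := by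
      exact WithTop.coe_le_coe.2 (le_top : ((k + 2 : ℕ) : ℕ∞) ≤ ⊤)
    have hB : ContDiff ℝ ∞ fun θ => (innerSL ℝ ((i.1 : ℝ) • δ • kap Φ i.2.1 i.2.2)) θ +
        (i.1 : ℝ) * Φ i.2.1 i.2.2 := by fun_prop
    have hB2 : iteratedFDeriv ℝ (k + 2)
        (fun θ => (innerSL ℝ ((i.1 : ℝ) • δ • kap Φ i.2.1 i.2.2)) θ +
        (i.1 : ℝ) * Φ i.2.1 i.2.2) θ = 0 := by
      rw [← norm_eq_zero, ← norm_iteratedFDeriv_fderiv]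
      have : fderiv ℝ (fun θ => (innerSL ℝ ((i.1 : ℝ) • δ • kap Φ i.2.1 i.2.2)) θ +
        (i.1 : ℝ) * Φ i.2.1 i.2.2) = fun _ => innerSL ℝ ((i.1 : ℝ) • δ • kap Φ i.2.1 i.2.2) := by
        ext1 θ
        rw [fderiv_add_const, ContinuousLinearMap.fderiv]
      rw [this, iteratedFDeriv_succ_const]
      simp
    show ‖iteratedFDeriv ℝ (k + 2) (fun θ => phaseRem Φ i.1 i.2.1 i.2.2 θ) θ‖ ≤ D
    rw [h1, iteratedFDeriv_sub_apply (hA.of_le hle).contDiffAt (hB.of_le hle).contDiffAt, hB2,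
      sub_zero]
    have h5 : ContDiffAt ℝ ((k + 2 : ℕ) : WithTop ℕ∞)
        (fun θ => Φ i.2.1 (i.2.2 + δ • θ)) θ := by
      have : ContDiff ℝ ∞ (fun θ => Φ i.2.1 (i.2.2 + δ • θ)) := by
        have := hsm i.2.1
        fun_prop
      exact (this.of_le hle).contDiffAt
    rw [iteratedFDeriv_const_smul_apply' h5]
    rw [iteratedFDeriv_comp_const_smul δ (f := fun w => Φ i.2.1 (i.2.2 + w)) (hcomp.of_le hle)]
    beta_reduce
    rw [iteratedFDeriv_comp_add_left, norm_smul, norm_smul, norm_pow, Real.norm_of_nonneg hδ0,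
      Real.norm_of_nonneg (by linarith [i.1.2])]
    have h6 : (i.1 : ℝ) * δ ^ (k + 2) ≤ 1 := by
      have e1 : δ ≤ 1 := by
        have : (√(i.1 : ℝ))⁻¹ ≤ 1 := inv_le_one_of_one_le₀ h4
        simp only [hδ]; linarith
      have e2 : (i.1 : ℝ) * δ ^ 2 ≤ 1 := by
        have : √(i.1 : ℝ) ≠ 0 := by positivity
        have e3 : (i.1 : ℝ) * δ ^ 2 = 1 / 256 := by
          nth_rewrite 1 [hsq i]
          simp only [hδ]; field_simp; norm_num
        rw [e3]; norm_num
      calc (i.1 : ℝ) * δ ^ (k + 2) = ((i.1 : ℝ) * δ ^ 2) * δ ^ k := by ring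
        _ ≤ 1 * 1 := by
          have : δ ^ k ≤ 1 := pow_le_one₀ hδ0 e1
          gcongr
        _ = 1 := one_mul 1
    rw [← mul_assoc]
    exact (mul_le_mul h6 (hD i.2.1 _ trivial) (norm_nonneg _) zero_le_one).trans_eq (one_mul D)

end Averaged

section Averaged
variable {n : ℕ} {K : Set (Rn n)} {Φ : Rn n → Rn n → ℝ} {b : ℝ → Rn n → Rn n → ℂ}

/-- The parameters of an averaged kernel: a frequency `l`, points `z`, `y` and a direction `v`. -/
structure AvgIndex (n : ℕ) (K : Set (Rn n)) where
  l : ℝ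
  z : Rn n
  v : Rn n
  y : Rn n
  one_le : 1 ≤ l
  mem : z ∈ K
  mem_ann : v ∈ ann n 16

/-- The anisotropic distance between `κ_v(z)` and `y`. -/
def AvgIndex.size (Φ : Rn n → Rn n → ℝ) (i : AvgIndex n K) : ℝ :=
  slabSize i.l i.v (kap Φ i.z i.v - i.y)

/-- The normalized phase on a plate of directions. -/
def AvgIndex.phase (Φ : Rn n → Rn n → ℝ) (i : AvgIndex n K) (θ : Rn n) : ℝ :=
  (i.size Φ)⁻¹ * (i.l * ⟪kap Φ i.z i.v - i.y, i.v⟫_ℝ +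
    ⟪(√i.l / 16) • (kap Φ i.z i.v - i.y), θ⟫_ℝ + phaseRem Φ i.l i.z i.v θ)

/-- The rescaled dilate of a nearby direction. -/
def AvgIndex.point (i : AvgIndex n K) (p : ℝ × Rn n) : Rn n :=
  p.1 • (i.v + ((√i.l)⁻¹ / 16) • p.2)

theorem AvgIndex.sqrt_pos (i : AvgIndex n K) : 0 < √i.l :=
  Real.sqrt_pos.2 (zero_lt_one.trans_le i.one_le)

theorem AvgIndex.size_eq (Φ : Rn n → Rn n → ℝ) (i : AvgIndex n K) :
    i.size Φ = |i.l * ⟪kap Φ i.z i.v - i.y, i.v⟫_ℝ| +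
      16 * ‖(√i.l / 16) • (kap Φ i.z i.v - i.y)‖ := by
  have h1 := i.sqrt_pos
  have h2 := i.one_le
  rw [AvgIndex.size, slabSize, abs_mul, abs_of_pos (show 0 < i.l by linarith), norm_smul,
    Real.norm_of_nonneg (by positivity)]
  ring

theorem GoodAmp.ub_avg (hb : GoodAmp n K b) : UB (avgBox n) (fun (i : AvgIndex n K) p =>
    (avgWeight n p : ℂ) * b i.l i.z (i.point p)) := by
  refine UB.mul (UB.of_compact (ofRealCLM.contDiff.comp (contDiff_avgWeight n))
    (isCompact_avgBox n)) ?_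
  let W : (ℝ × Rn n) × (ℝ × Rn n) → Rn n := fun q => q.2.1 • (q.1.2 + q.1.1 • q.2.2)
  have hW : ContDiff ℝ ∞ W := by fun_prop
  let t : Set ((ℝ × Rn n) × (ℝ × Rn n)) := (Set.Icc 0 1 ×ˢ ann n 16) ×ˢ avgBox n
  have ht : IsCompact t := (isCompact_Icc.prod (isCompact_ann n 16)).prod (isCompact_avgBox n)
  have hδ : ∀ i : AvgIndex n K, (√i.l)⁻¹ / 16 ∈ Set.Icc (0 : ℝ) 1 := fun i => by
    have h1 : (√i.l)⁻¹ ≤ 1 := inv_le_one_of_one_le₀ (Real.one_le_sqrt.2 i.one_le)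
    have h2 := i.sqrt_pos
    constructor
    · positivity
    · linarith
  have hσ : UB (avgBox n) (fun (i : AvgIndex n K) (p : ℝ × Rn n) =>
      ((((√i.l)⁻¹ / 16, i.v), (0 : ℝ × Rn n)) + ((0 : ℝ × Rn n), p))) := by
    refine UB.add (UB.const (C := 16) fun i => ?_) (UB.of_compact (by fun_prop)
      (isCompact_avgBox n))
    have := hδ i
    simp only [Prod.norm_mk, norm_zero, sup_le_iff]
    refine ⟨⟨?_, i.mem_ann.2⟩, by simp⟩
    rw [Real.norm_of_nonneg this.1]
    linarith [this.2]
  have hP : UB (avgBox n) (fun (i : AvgIndex n K) p => i.point p) := by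
    have := (UB.of_compact (ι := AvgIndex n K) hW ht).comp hσ fun i p hp => by
      refine ⟨?_, by simpa using hp⟩
      simpa using ⟨hδ i, i.mem_ann⟩
    simpa [W, AvgIndex.point] using this
  exact (hb.ub_right.reindex fun i : AvgIndex n K =>
    ((⟨i.l, zero_lt_one.trans_le i.one_le⟩ : {l : ℝ // 0 < l}), i.z)).comp hP fun _ _ _ => trivial

theorem contDiff_avgPhase (hΦ : GoodPhase n K Φ) (i : AvgIndex n K) :
    ContDiff ℝ ∞ (i.phase Φ) := by
  have h1 := hΦ.ub_phaseRem.1 (⟨i.l, i.one_le⟩, (i.z, i.v))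
  have h2 : ContDiff ℝ ∞ fun θ : Rn n => ⟪(√i.l / 16) • (kap Φ i.z i.v - i.y), θ⟫_ℝ :=
    contDiff_const.inner ℝ contDiff_id
  unfold AvgIndex.phase
  fun_prop

theorem GoodPhase.ub_avgPhase (hΦ : GoodPhase n K Φ) : UB (avgBox n)
    (fun (i : {i : AvgIndex n K // 1 ≤ i.size Φ}) p => p.1 * i.1.phase Φ p.2) := by
  have hc := isCompact_avgBox n
  refine UB.mul (UB.of_compact (by fun_prop) hc) ?_
  have hmain : UB (Metric.closedBall (0 : Rn n) 1)
      (fun (i : {i : AvgIndex n K // 1 ≤ i.size Φ}) θ => i.1.phase Φ θ) := by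
    have hB := isCompact_closedBall (0 : Rn n) 1
    have h1 : UB (Metric.closedBall (0 : Rn n) 1)
        (fun (i : {i : AvgIndex n K // 1 ≤ i.size Φ}) (_ : Rn n) =>
          (i.1.size Φ)⁻¹ * (i.1.l * ⟪kap Φ i.1.z i.1.v - i.1.y, i.1.v⟫_ℝ)) := by
      refine UB.const (C := 1) fun i => ?_
      have h := i.1.size_eq Φ
      have h2 := i.2
      rw [norm_mul, norm_inv, Real.norm_of_nonneg (by linarith), Real.norm_eq_abs,
        inv_mul_le_iff₀ (by linarith), mul_one, h]
      linarith [norm_nonneg ((√i.1.l / 16) • (kap Φ i.1.z i.1.v - i.1.y))]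
    have h2 : UB (Metric.closedBall (0 : Rn n) 1)
        (fun (i : {i : AvgIndex n K // 1 ≤ i.size Φ}) (θ : Rn n) => ∑ j : Fin n,
          ((i.1.size Φ)⁻¹ * ((√i.1.l / 16) • (kap Φ i.1.z i.1.v - i.1.y)) j) * θ j) := by
      refine UB.sum (t := Finset.univ) fun j _ => UB.mul (UB.const (C := 1) fun i => ?_)
        (UB.of_compact (by fun_prop) hB)
      have h := i.1.size_eq Φ
      have h2 := i.2
      rw [norm_mul, norm_inv, Real.norm_of_nonneg (by linarith),
        inv_mul_le_iff₀ (by linarith), mul_one, h]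
      have h3 := PiLp.norm_apply_le ((√i.1.l / 16) • (kap Φ i.1.z i.1.v - i.1.y)) j
      have := abs_nonneg (i.1.l * ⟪kap Φ i.1.z i.1.v - i.1.y, i.1.v⟫_ℝ)
      linarith [norm_nonneg ((√i.1.l / 16) • (kap Φ i.1.z i.1.v - i.1.y))]
    have h3 : UB (Metric.closedBall (0 : Rn n) 1)
        (fun (i : {i : AvgIndex n K // 1 ≤ i.size Φ}) (θ : Rn n) =>
          (i.1.size Φ)⁻¹ * phaseRem Φ i.1.l i.1.z i.1.v θ) := by
      refine UB.mul (UB.const (C := 1) fun i => ?_) (hΦ.ub_phaseRem.reindex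
        fun i : {i : AvgIndex n K // 1 ≤ i.size Φ} => (⟨i.1.l, i.1.one_le⟩, (i.1.z, i.1.v)))
      rw [norm_inv, Real.norm_of_nonneg (by linarith [i.2])]
      exact inv_le_one_of_one_le₀ i.2
    have := (h1.add h2).add h3
    refine (congrArg (UB (Metric.closedBall (0 : Rn n) 1)) ?_).mpr this
    funext i θ
    rw [AvgIndex.phase, mul_add, mul_add]
    congr 2
    rw [PiLp.inner_apply, Finset.mul_sum]
    refine Finset.sum_congr rfl fun j _ => ?_
    simp
    ring
  exact hmain.comp (f := fun _ (p : ℝ × Rn n) => p.2) (UB.of_compact contDiff_snd hc)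
    fun i p hp => hp.2

theorem fderiv_mul_comp_snd {Q : Rn n → ℝ} (hQ : ContDiff ℝ ∞ Q) (p : ℝ × Rn n) (h : ℝ × Rn n) :
    fderiv ℝ (fun p : ℝ × Rn n => p.1 * Q p.2) p h = p.1 * fderiv ℝ Q p.2 h.2 + h.1 * Q p.2 := by
  have h1 : HasFDerivAt (fun p : ℝ × Rn n => Q p.2)
      ((fderiv ℝ Q p.2).comp (ContinuousLinearMap.snd ℝ ℝ (Rn n))) p :=
    (hQ.differentiable (by simp) p.2).hasFDerivAt.comp p hasFDerivAt_snd
  have h2 : HasFDerivAt (fun p : ℝ × Rn n => p.1 * Q p.2) _ p := hasFDerivAt_fst.mul h1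
  rw [h2.fderiv]
  simp [mul_comm]

/-- The coordinate directions of `ℝ × ℝⁿ`. -/
def prodBasis (n : ℕ) : Option (Fin n) → ℝ × Rn n
  | none => (1, 0)
  | some j => (0, EuclideanSpace.single j 1)

theorem GoodPhase.exists_avgPhase_gradient (hΦ : GoodPhase n K Φ) : ∃ M : ℝ, 1 ≤ M ∧
    ∀ i : AvgIndex n K, M ≤ i.size Φ → ∀ p ∈ avgBox n,
      (1 / 64 : ℝ) ^ 2 ≤ ∑ j, (fderiv ℝ (fun p : ℝ × Rn n => p.1 * i.phase Φ p.2) p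
        (prodBasis n j)) ^ 2 := by
  obtain ⟨C₀, h0, hC₀⟩ := hΦ.ub_phaseRem.bound_zero
  obtain ⟨C₁, h1, hC₁⟩ := hΦ.ub_phaseRem.bound 1
  refine ⟨64 * (C₀ + C₁ + 1), by linarith, fun i hi p hp => ?_⟩
  have hq := contDiff_avgPhase hΦ i
  have hs := i.size_eq Φ
  have hr := hC₀ (⟨i.l, i.one_le⟩, (i.z, i.v)) p.2 hp.2
  have hr' := hC₁ (⟨i.l, i.one_le⟩, (i.z, i.v)) p.2 hp.2
  rw [norm_iteratedFDeriv_one] at hr'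
  have hθ : ‖p.2‖ ≤ 1 := by simpa using hp.2
  set T := i.size Φ
  set B := (√i.l / 16) • (kap Φ i.z i.v - i.y) with hB
  set A := i.l * ⟪kap Φ i.z i.v - i.y, i.v⟫_ℝ with hA
  have hT : 0 < T := by linarith
  rw [Fintype.sum_option]
  simp only [fderiv_mul_comp_snd hq, prodBasis]
  simp only [map_zero, mul_zero, zero_add, one_mul, zero_mul, add_zero, mul_pow]
  rw [← Finset.mul_sum, sum_sq_apply_basis]
  have hp1 : 1 ≤ p.1 := hp.1.1
  by_cases hc : T / 2 ≤ 16 * ‖B‖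
  · have hd : HasFDerivAt (i.phase Φ) (T⁻¹ • (innerSL ℝ B +
        fderiv ℝ (fun θ => phaseRem Φ i.l i.z i.v θ) p.2)) p.2 := by
      have e1 : HasFDerivAt (fun θ => A + ⟪B, θ⟫_ℝ) (innerSL ℝ B) p.2 :=
        (innerSL ℝ B).hasFDerivAt.const_add A
      have e2 := ((hΦ.ub_phaseRem.1 (⟨i.l, i.one_le⟩, (i.z, i.v))).differentiable
        (by simp) p.2).hasFDerivAt
      exact (e1.add e2).const_mul _
    have h2 : 1 / 64 ≤ ‖fderiv ℝ (i.phase Φ) p.2‖ := by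
      rw [hd.fderiv, norm_smul, norm_inv, Real.norm_of_nonneg hT.le, le_inv_mul_iff₀ hT]
      have e1 : ‖innerSL ℝ B‖ = ‖B‖ := innerSL_apply_norm ℝ B
      have e2 := norm_add_le (innerSL ℝ B + fderiv ℝ (fun θ => phaseRem Φ i.l i.z i.v θ) p.2)
        (-fderiv ℝ (fun θ => phaseRem Φ i.l i.z i.v θ) p.2)
      rw [add_neg_cancel_right, norm_neg, e1] at e2
      have e3 : ‖fderiv ℝ (fun θ => phaseRem Φ i.l i.z i.v θ) p.2‖ ≤ C₁ := hr'
      linarith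
    calc (1 / 64 : ℝ) ^ 2 ≤ ‖fderiv ℝ (i.phase Φ) p.2‖ ^ 2 := by gcongr
      _ ≤ p.1 ^ 2 * ‖fderiv ℝ (i.phase Φ) p.2‖ ^ 2 :=
        le_mul_of_one_le_left (by positivity) (one_le_pow₀ hp1)
      _ ≤ _ := le_add_of_nonneg_left (sq_nonneg _)
  · push Not at hc
    have h2 : 1 / 64 ≤ |i.phase Φ p.2| := by
      have e0 : i.phase Φ p.2 = T⁻¹ * (A + ⟪B, p.2⟫_ℝ + phaseRem Φ i.l i.z i.v p.2) := rfl
      rw [e0, abs_mul, abs_inv, abs_of_pos hT, le_inv_mul_iff₀ hT]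
      have e1 : |⟪B, p.2⟫_ℝ| ≤ ‖B‖ :=
        (abs_real_inner_le_norm _ _).trans (mul_le_of_le_one_right (norm_nonneg _) hθ)
      have e2 : |phaseRem Φ i.l i.z i.v p.2| ≤ C₀ := hr
      have e3 := abs_sub_abs_le_abs_sub A (-(⟪B, p.2⟫_ℝ + phaseRem Φ i.l i.z i.v p.2))
      rw [sub_neg_eq_add, ← add_assoc, abs_neg] at e3
      have e4 := abs_add_le ⟪B, p.2⟫_ℝ (phaseRem Φ i.l i.z i.v p.2)
      linarith
    calc (1 / 64 : ℝ) ^ 2 ≤ |i.phase Φ p.2| ^ 2 := by gcongr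
      _ = i.phase Φ p.2 ^ 2 := sq_abs _
      _ ≤ _ := le_add_of_nonneg_right (by positivity)

theorem AvgIndex.point_phase (hΦ : GoodPhase n K Φ) (i : AvgIndex n K) (hi : i.size Φ ≠ 0)
    {p : ℝ × Rn n} (hp : p ∈ avgBox n) (hv : i.point p ∈ ann n 4) :
    i.l * (Φ i.z (i.point p) - ⟪i.y, i.point p⟫_ℝ) =
      i.size Φ * (p.1 * i.phase Φ p.2) := by
  have hz : i.z ∈ Metric.cthickening 1 K := Metric.self_subset_cthickening K i.mem
  have h1 := hp.1.1
  have h2 := hp.1.2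
  have hv1 : i.v + ((√i.l)⁻¹ / 16) • p.2 ∈ ann n 1024 := by
    have e := norm_smul p.1 (i.v + ((√i.l)⁻¹ / 16) • p.2)
    rw [Real.norm_of_nonneg (by linarith)] at e
    have e1 : (4 : ℝ)⁻¹ ≤ ‖i.point p‖ := hv.1
    have e2 : ‖i.point p‖ ≤ 4 := hv.2
    rw [AvgIndex.point, e] at e1 e2
    constructor
    · nlinarith [norm_nonneg (i.v + ((√i.l)⁻¹ / 16) • p.2)]
    · nlinarith [norm_nonneg (i.v + ((√i.l)⁻¹ / 16) • p.2)]
  have hom := hΦ.homog i.z hz _ p.1 (by linarith) hv1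
    (ann_mono (by norm_num) (by norm_num) hv)
  have hE := euler_kap hΦ.smooth hΦ.homog hz (ann_mono (by norm_num) (by norm_num) i.mem_ann)
  have hsq : i.l = √i.l * √i.l := (Real.mul_self_sqrt (by linarith [i.one_le])).symm
  have hs := i.sqrt_pos
  rw [AvgIndex.phase, phaseRem, AvgIndex.point, hom, ← hE]
  simp only [inner_smul_left, inner_smul_right, inner_add_right, inner_sub_left, conj_trivial]
  field_simp
  have h3 : √i.l ^ 2 = i.l := Real.sq_sqrt (by linarith [i.one_le])
  linear_combination (⟪kap Φ i.z i.v, p.2⟫_ℝ - ⟪i.y, p.2⟫_ℝ) * (-h3)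

/-- The average of the oscillating integrand over a plate of directions. -/
def AvgIndex.avg (b : ℝ → Rn n → Rn n → ℂ) (Φ : Rn n → Rn n → ℝ) (i : AvgIndex n K) : ℂ :=
  ∫ p : ℝ × Rn n, (avgWeight n p : ℂ) *
    (cexp (I * ((i.l * (Φ i.z (i.point p) - ⟪i.y, i.point p⟫_ℝ) : ℝ) : ℂ)) *
      b i.l i.z (i.point p))

theorem GoodAmp.exists_avg_le (hb : GoodAmp n K b) (hΦ : GoodPhase n K Φ) (N : ℕ) :
    ∃ C : ℝ, 0 ≤ C ∧ ∀ i : AvgIndex n K, ‖i.avg b Φ‖ ≤ C / (1 + i.size Φ) ^ N := by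
  obtain ⟨M, hM1, hM⟩ := hΦ.exists_avgPhase_gradient
  have hc := isCompact_avgBox n
  have hsupp : ∀ i : AvgIndex n K,
      tsupport (fun p => (avgWeight n p : ℂ) * b i.l i.z (i.point p)) ⊆ avgBox n := fun i =>
    closure_minimal (fun p hp => avgWeight_ne_zero fun h => hp (by simp [h])) hc.isClosed
  obtain ⟨C, hC0, hC⟩ := UB.exists_integral_bound (μ := volume) hc hb.ub_avg hsupp
  have hint : ∀ i : AvgIndex n K, ‖i.avg b Φ‖ ≤ C := fun i => by
    refine (norm_integral_le_integral_norm _).trans ((le_of_eq ?_).trans (hC i))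
    refine integral_congr_ae (Filter.Eventually.of_forall fun p => ?_)
    beta_reduce
    rw [norm_mul, norm_cexp_I_mul, norm_mul]
  let κ := {i : AvgIndex n K // M ≤ i.size Φ}
  have : (volume : Measure (ℝ × Rn n)).IsAddHaarMeasure :=
    inferInstanceAs ((volume : Measure ℝ).prod (volume : Measure (Rn n))).IsAddHaarMeasure
  obtain ⟨D, hD0, hD⟩ := nonstationary_phase (volume : Measure (ℝ × Rn n)) hc (prodBasis n)
    (Ψ := fun (i : κ) p => p.1 * i.1.phase Φ p.2)
    (fun i => contDiff_fst.mul ((contDiff_avgPhase hΦ i.1).comp contDiff_snd))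
    (fun j => (hΦ.ub_avgPhase.reindex fun i : κ => ⟨i.1, hM1.trans i.2⟩).fderiv_apply _)
    (show (0 : ℝ) < (1 / 64) ^ 2 by norm_num) N _ (hb.ub_avg.reindex fun i : κ => i.1)
    (fun i => hsupp i.1) (fun i p hp => hM i.1 i.2 p (hsupp i.1 hp))
  have hdec : ∀ i : AvgIndex n K, M ≤ i.size Φ → ‖i.avg b Φ‖ ≤ D / i.size Φ ^ N := fun i hi => by
    refine (le_of_eq ?_).trans (hD ⟨i, hi⟩ (i.size Φ) (by linarith))
    congr 1
    refine integral_congr_ae (Filter.Eventually.of_forall fun p => ?_)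
    dsimp only
    by_cases hw : avgWeight n p = 0
    · simp [hw]
    by_cases hv : b i.l i.z (i.point p) = 0
    · simp [hv]
    rw [AvgIndex.point_phase hΦ i (by linarith) (avgWeight_ne_zero hw) (hb.mem_right _ _ _ hv)]
    ring
  refine ⟨2 ^ N * (C * 1 + (D + C * M ^ N)), by positivity, fun i => ?_⟩
  refine div_pow_le_of_bounds (slabSize_nonneg (by linarith [i.one_le]) _ _) (by positivity)
    (by positivity) ((hint i).trans (by simp)) fun hX => ?_
  by_cases hi : M ≤ i.size Φ
  · refine (hdec i hi).trans ?_
    gcongr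
    linarith [show 0 ≤ C * M ^ N by positivity]
  · push Not at hi
    refine (hint i).trans ?_
    rw [le_div_iff₀ (by exact pow_pos hX N)]
    have : C * i.size Φ ^ N ≤ C * M ^ N := by gcongr
    exact this.trans (by linarith)

theorem GoodAmp.exists_ker_le_lintegral (hb : GoodAmp n K b) (hΦ : GoodPhase n K Φ) (N : ℕ) :
    ∃ C : ℝ, 0 ≤ C ∧ ∀ l : ℝ, 1 ≤ l → ∀ z ∈ K, ∀ y, ‖ker b Φ l z y‖ₑ ≤
      ∫⁻ v in ann n 16, ENNReal.ofReal (C / (1 + slabSize l v (kap Φ z v - y)) ^ N) := by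
  obtain ⟨C, hC0, hC⟩ := hb.exists_avg_le hΦ N
  have hw := avg_const_pos n
  set w := (∫ r, dilBump r) * ∫ t, transBump n t with hw'
  refine ⟨w⁻¹ * C, by positivity, fun l hl z hz y => ?_⟩
  let F : Rn n → ℂ := fun u => cexp (I * ((l * (Φ z u - ⟪y, u⟫_ℝ) : ℝ) : ℂ)) * b l z u
  have hF : Continuous F := by
    have h1 : Continuous fun u => b l z u :=
      (hb.cont l (by linarith)).comp (by fun_prop : Continuous fun u : Rn n => (z, u))
    have h2 : Continuous fun u => Φ z u := (hΦ.ub_right.1 z).continuous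
    fun_prop
  have hFc : HasCompactSupport F := HasCompactSupport.intro (isCompact_ann n 4) fun u hu => by
    have : b l z u = 0 := by
      by_contra h
      exact hu (hb.mem_right _ _ _ h)
    simp [F, this]
  have hid := integral_avgWeight n hF hFc ((√l)⁻¹ / 16)
  rw [← ker_eq, ← hw'] at hid
  have hk : ker b Φ l z y = (w : ℂ)⁻¹ * ∫ v : Rn n, ∫ p : ℝ × Rn n,
      (avgWeight n p : ℂ) * F (p.1 • (v + ((√l)⁻¹ / 16) • p.2)) := by
    rw [hid, inv_mul_cancel_left₀ (by exact_mod_cast hw.ne')]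
  have hvan : ∀ v : Rn n, v ∉ ann n 16 → ∫ p : ℝ × Rn n,
      (avgWeight n p : ℂ) * F (p.1 • (v + ((√l)⁻¹ / 16) • p.2)) = 0 := fun v hv => by
    refine integral_eq_zero_of_ae (Filter.Eventually.of_forall fun p => ?_)
    by_contra hne
    have h1 : avgWeight n p ≠ 0 := fun h => hne (by simp [h])
    have h2 : b l z (p.1 • (v + ((√l)⁻¹ / 16) • p.2)) ≠ 0 := fun h => hne (by
      simp only [F, h, mul_zero, Pi.zero_apply])
    have h3 := avgWeight_ne_zero h1
    have h4 := hb.mem_right _ _ _ h2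
    have e1 := h4.1
    have e2 := h4.2
    have hp0 := h3.1.1
    have hp1 := h3.1.2
    rw [norm_smul, Real.norm_of_nonneg (by linarith)] at e1 e2
    have e3 : ‖((√l)⁻¹ / 16) • p.2‖ ≤ 1 / 16 := by
      have : ‖p.2‖ ≤ 1 := by simpa using h3.2
      have hs : (√l)⁻¹ ≤ 1 := inv_le_one_of_one_le₀ (Real.one_le_sqrt.2 hl)
      have hs0 : 0 ≤ (√l)⁻¹ := by positivity
      rw [norm_smul, Real.norm_of_nonneg (by positivity)]
      nlinarith [norm_nonneg p.2]
    have e4 := norm_add_le v (((√l)⁻¹ / 16) • p.2)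
    have e5 := norm_sub_le (v + ((√l)⁻¹ / 16) • p.2) (((√l)⁻¹ / 16) • p.2)
    rw [add_sub_cancel_right] at e5
    refine hv ⟨?_, ?_⟩
    · nlinarith [norm_nonneg (v + ((√l)⁻¹ / 16) • p.2)]
    · nlinarith [norm_nonneg (v + ((√l)⁻¹ / 16) • p.2)]
  rw [hk, enorm_mul, ← setIntegral_eq_integral_of_forall_compl_eq_zero hvan]
  have hwe : ‖(w : ℂ)⁻¹‖ₑ = ENNReal.ofReal w⁻¹ := by
    rw [← ofReal_norm, norm_inv, Complex.norm_of_nonneg hw.le]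
  rw [hwe]
  have hm : MeasurableSet (ann n 16) := (isCompact_ann n 16).isClosed.measurableSet
  calc ENNReal.ofReal w⁻¹ * _
      ≤ ENNReal.ofReal w⁻¹ * ∫⁻ v in ann n 16,
          ENNReal.ofReal (C / (1 + slabSize l v (kap Φ z v - y)) ^ N) := by
        gcongr
        refine (enorm_integral_le_lintegral_enorm _).trans (setLIntegral_mono' hm fun v hv => ?_)
        rw [← ofReal_norm]
        exact ENNReal.ofReal_le_ofReal (hC ⟨l, z, v, y, hl, hz, hv⟩)
    _ = _ := by
        rw [← lintegral_const_mul' _ _ ENNReal.ofReal_ne_top]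
        congr 1
        ext1 v
        rw [← ENNReal.ofReal_mul (by positivity), mul_div_assoc]

end Averaged

section Slab
variable {n : ℕ}

theorem volume_inter_preimage_le_of_antilipschitz {f : Rn n → Rn n} {s : Set (Rn n)} {c : ℝ}
    (hc : 0 < c) (hf : ∀ x ∈ s, ∀ x' ∈ s, c * ‖x - x'‖ ≤ ‖f x - f x'‖) (A : Set (Rn n)) :
    volume (s ∩ f ⁻¹' A) ≤ ENNReal.ofReal (c⁻¹) ^ n * volume A := by
  have hinj : Set.InjOn f s := fun x hx x' hx' h => by
    have := hf x hx x' hx'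
    rw [h, sub_self, norm_zero] at this
    have h2 : ‖x - x'‖ ≤ 0 := by
      by_contra h3
      push Not at h3
      nlinarith
    exact sub_eq_zero.1 (norm_le_zero_iff.1 h2)
  have hL : LipschitzOnWith (Real.toNNReal c⁻¹) (Function.invFunOn f s) (f '' s) := by
    refine LipschitzOnWith.of_dist_le_mul ?_
    rintro _ ⟨x, hx, rfl⟩ _ ⟨x', hx', rfl⟩
    rw [hinj.leftInvOn_invFunOn hx, hinj.leftInvOn_invFunOn hx', dist_eq_norm, dist_eq_norm,
      Real.coe_toNNReal _ (by positivity), ← div_eq_inv_mul, le_div_iff₀ hc, mul_comm]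
    exact hf x hx x' hx'
  have himg : s ∩ f ⁻¹' A = Function.invFunOn f s '' (f '' (s ∩ f ⁻¹' A)) := by
    rw [Set.image_image]
    have : ∀ x ∈ s ∩ f ⁻¹' A, Function.invFunOn f s (f x) = id x :=
      fun x hx => hinj.leftInvOn_invFunOn hx.1
    rw [Set.image_congr this, Set.image_id]
  have hv : (volume : Measure (Rn n)) = Measure.euclideanHausdorffMeasure n :=
    (EuclideanSpace.euclideanHausdorffMeasure_eq_volume n).symm
  have hB : f '' (s ∩ f ⁻¹' A) ⊆ f '' s := Set.image_mono Set.inter_subset_left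
  have h1 := (hL.mono hB).hausdorffMeasure_image_le (d := (n : ℝ)) (by positivity)
  rw [← himg] at h1
  have hA : f '' (s ∩ f ⁻¹' A) ⊆ A := by
    rintro _ ⟨x, hx, rfl⟩
    exact hx.2
  rw [hv, Measure.euclideanHausdorffMeasure_def]
  simp only [Measure.smul_apply, ENNReal.smul_def, smul_eq_mul]
  rw [mul_left_comm]
  gcongr
  refine h1.trans ?_
  rw [ENNReal.rpow_natCast]
  gcongr
  exact le_of_eq rfl

theorem setLIntegral_comp_le_of_antilipschitz {f : Rn n → Rn n} (hfm : Measurable f)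
    {s : Set (Rn n)} {c : ℝ} (hc : 0 < c)
    (hf : ∀ x ∈ s, ∀ x' ∈ s, c * ‖x - x'‖ ≤ ‖f x - f x'‖) {F : Rn n → ℝ≥0∞} (hF : Measurable F) :
    ∫⁻ x in s, F (f x) ≤ ENNReal.ofReal (c⁻¹) ^ n * ∫⁻ w, F w := by
  rw [← lintegral_map hF hfm]
  refine (lintegral_mono' (ν := ENNReal.ofReal (c⁻¹) ^ n • volume)
    (Measure.le_iff.2 fun A hA => ?_) le_rfl).trans_eq (lintegral_smul_measure _ _)
  rw [Measure.map_apply hfm hA, Measure.restrict_apply (hfm hA), Set.inter_comm]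
  simpa using volume_inter_preimage_le_of_antilipschitz hc hf A

theorem continuous_slabSize_comp {X : Type*} [TopologicalSpace X] {l : ℝ} {f g : X → Rn n}
    (hf : Continuous f) (hg : Continuous g) : Continuous fun x => slabSize l (f x) (g x) := by
  unfold slabSize
  fun_prop

theorem lintegral_inv_one_add_abs_sq_le (a : ℝ) {β : ℝ} (hβ : 0 < β) :
    ∫⁻ τ : ℝ, ENNReal.ofReal (1 / (1 + |a + τ * β|) ^ 2) ≤ ENNReal.ofReal (Real.pi / β) := by
  have h1 : ∫ τ : ℝ, (1 + (a + τ * β) ^ 2)⁻¹ = Real.pi / β := by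
    have e1 := Measure.integral_comp_mul_right (fun x : ℝ => (1 + (a + x) ^ 2)⁻¹) β
    have e2 := integral_add_left_eq_self (μ := (volume : Measure ℝ))
      (fun x : ℝ => (1 + x ^ 2)⁻¹) a
    rw [e1, e2, integral_univ_inv_one_add_sq, abs_of_pos (by positivity), smul_eq_mul]
    ring
  have h2 : Integrable fun τ : ℝ => (1 + (a + τ * β) ^ 2)⁻¹ := by
    have e1 : Integrable fun τ : ℝ => (1 + (a + τ) ^ 2)⁻¹ :=
      integrable_inv_one_add_sq.comp_add_left a
    exact e1.comp_mul_right' hβ.ne'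
  rw [← h1, ofReal_integral_eq_lintegral_ofReal h2
    (Filter.Eventually.of_forall fun τ => by positivity)]
  refine lintegral_mono fun τ => ENNReal.ofReal_le_ofReal ?_
  rw [one_div]
  gcongr
  nlinarith [abs_nonneg (a + τ * β), sq_abs (a + τ * β)]

theorem exists_lintegral_slab_le (n : ℕ) : ∃ C : ℝ, 0 < C ∧ ∀ l : ℝ, 1 ≤ l → ∀ v ∈ ann n 64,
    ∫⁻ w : Rn n, ENNReal.ofReal (1 / (1 + slabSize l v w) ^ (n + 3)) ≤
      ENNReal.ofReal (C / √l ^ (n + 1)) := by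
  obtain ⟨C, hC0, hC⟩ := exists_lintegral_inv_pow_le n
  refine ⟨65 ^ (n + 1) * C * (Real.pi * 64 ^ 2), by positivity, fun l hl v hv => ?_⟩
  have hs : 1 ≤ √l := Real.one_le_sqrt.2 hl
  have hsl : √l * √l = l := Real.mul_self_sqrt (by linarith)
  have hv1 : (64 : ℝ)⁻¹ ≤ ‖v‖ := hv.1
  have hv2 : ‖v‖ ≤ 64 := hv.2
  let F : Rn n → ℝ≥0∞ := fun w => ENNReal.ofReal (1 / (1 + slabSize l v w) ^ (n + 3))
  have hF : Continuous F := by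
    have h := continuous_slabSize_comp (n := n) (l := l) (continuous_const (y := v)) continuous_id
    refine ENNReal.continuous_ofReal.comp (continuous_const.div (by fun_prop) fun w => ?_)
    have := slabSize_nonneg (by linarith : 0 ≤ l) v w
    positivity
  have hpt : ∀ w : Rn n, ∀ τ ∈ Set.Icc (0 : ℝ) 1, F (w + (τ * (√l)⁻¹) • v) ≤
      ENNReal.ofReal (65 ^ (n + 1) * (1 / (1 + √l * ‖w‖) ^ (n + 1))) *
        ENNReal.ofReal (1 / (1 + |l * ⟪w, v⟫_ℝ + τ * (√l * ‖v‖ ^ 2)|) ^ 2) := fun w τ hτ => by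
    rw [← ENNReal.ofReal_mul (by positivity)]
    refine ENNReal.ofReal_le_ofReal ?_
    have e1 : slabSize l v (w + (τ * (√l)⁻¹) • v) =
        |l * ⟪w, v⟫_ℝ + τ * (√l * ‖v‖ ^ 2)| + √l * ‖w + (τ * (√l)⁻¹) • v‖ := by
      rw [slabSize, inner_add_left, inner_smul_left, real_inner_self_eq_norm_sq,
        ← abs_of_pos (show 0 < l by linarith), ← abs_mul, abs_of_pos (show 0 < l by linarith)]
      have e2 : l * (√l)⁻¹ = √l := by
        rw [mul_inv_eq_iff_eq_mul₀ (by positivity), hsl]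
      congr 2
      simp only [conj_trivial]
      rw [mul_add, mul_assoc τ, mul_left_comm l τ, ← mul_assoc l, e2]
    rw [e1]
    set A := |l * ⟪w, v⟫_ℝ + τ * (√l * ‖v‖ ^ 2)|
    set B := √l * ‖w + (τ * (√l)⁻¹) • v‖ with hB
    have hA0 : 0 ≤ A := abs_nonneg _
    have hB0 : 0 ≤ B := by positivity
    have hBw : 1 + √l * ‖w‖ ≤ 65 * (1 + B) := by
      have e2 := norm_sub_le (w + (τ * (√l)⁻¹) • v) ((τ * (√l)⁻¹) • v)
      rw [add_sub_cancel_right, norm_smul, norm_mul, norm_inv, Real.norm_of_nonneg hτ.1,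
        Real.norm_of_nonneg (by positivity : 0 ≤ √l)] at e2
      have e3 : √l * ‖w‖ ≤ √l * (‖w + (τ * (√l)⁻¹) • v‖ + τ * (√l)⁻¹ * ‖v‖) := by gcongr
      have e4 : √l * (τ * (√l)⁻¹ * ‖v‖) = τ * ‖v‖ := by field_simp
      rw [mul_add, e4] at e3
      nlinarith [hτ.1, hτ.2]
    have e5 : (1 + √l * ‖w‖) ^ (n + 1) * (1 + A) ^ 2 ≤ 65 ^ (n + 1) * (1 + (A + B)) ^ (n + 3) := by
      calc (1 + √l * ‖w‖) ^ (n + 1) * (1 + A) ^ 2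
          ≤ (65 * (1 + (A + B))) ^ (n + 1) * (1 + (A + B)) ^ 2 := by
            gcongr
            · linarith
            · linarith
        _ = _ := by rw [mul_pow]; ring
    rw [mul_assoc, div_mul_div_comm, ← mul_div_assoc, mul_one, mul_one,
      div_le_div_iff₀ (by positivity) (by positivity),
      one_mul]
    exact e5
  have hinv : ∀ τ : ℝ, ∫⁻ w, F (w + (τ * (√l)⁻¹) • v) = ∫⁻ w, F w := fun τ =>
    lintegral_add_right_eq_self F _
  have hvol : volume (Set.Icc (0 : ℝ) 1) = 1 := by simp
  calc ∫⁻ w, F w = ∫⁻ τ in Set.Icc (0 : ℝ) 1, ∫⁻ w, F (w + (τ * (√l)⁻¹) • v) := by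
        simp only [hinv]
        rw [setLIntegral_const, hvol, mul_one]
    _ = ∫⁻ w, ∫⁻ τ in Set.Icc (0 : ℝ) 1, F (w + (τ * (√l)⁻¹) • v) := by
        refine lintegral_lintegral_swap (Measurable.aemeasurable ?_)
        exact (hF.comp (by fun_prop : Continuous fun q : ℝ × Rn n =>
          q.2 + (q.1 * (√l)⁻¹) • v)).measurable
    _ ≤ ∫⁻ w : Rn n, ENNReal.ofReal (65 ^ (n + 1) * (1 / (1 + √l * ‖w‖) ^ (n + 1))) *
          ENNReal.ofReal (Real.pi / (√l * ‖v‖ ^ 2)) := by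
        refine lintegral_mono fun w => ?_
        refine (setLIntegral_mono' measurableSet_Icc (hpt w)).trans ?_
        rw [lintegral_const_mul' _ _ ENNReal.ofReal_ne_top]
        gcongr
        exact (setLIntegral_le_lintegral _ _).trans
          (lintegral_inv_one_add_abs_sq_le _ (by positivity))
    _ = ENNReal.ofReal (65 ^ (n + 1)) * (∫⁻ w : Rn n,
          ENNReal.ofReal (1 / (1 + √l * ‖w‖) ^ (n + 1))) *
            ENNReal.ofReal (Real.pi / (√l * ‖v‖ ^ 2)) := by
        rw [lintegral_mul_const' _ _ ENNReal.ofReal_ne_top, ← lintegral_const_mul' _ _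
          ENNReal.ofReal_ne_top]
        congr 2
        ext1 w
        rw [← ENNReal.ofReal_mul (by positivity)]
    _ ≤ ENNReal.ofReal (65 ^ (n + 1)) * ENNReal.ofReal (C / √l ^ n) *
          ENNReal.ofReal (Real.pi / (√l * (64⁻¹) ^ 2)) := by
        gcongr
        exact hC _ (by positivity)
    _ = _ := by
        rw [← ENNReal.ofReal_mul (by positivity), ← ENNReal.ofReal_mul (by positivity)]
        congr 1
        field_simp
        exact pow_succ _ _

end Slab

section Kernel
variable {n : ℕ} {K : Set (Rn n)} {Φ : Rn n → Rn n → ℝ} {b : ℝ → Rn n → Rn n → ℂ}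

theorem GoodPhase.continuous_kap (hΦ : GoodPhase n K Φ) :
    Continuous fun q : Rn n × Rn n => kap Φ q.1 q.2 := (contDiff_kap hΦ.smooth).continuous

theorem GoodPhase.continuous_slab (hΦ : GoodPhase n K Φ) {l : ℝ} (hl : 0 ≤ l) (N : ℕ)
    {X : Type*} [TopologicalSpace X] {x v y : X → Rn n} (hx : Continuous x) (hv : Continuous v)
    (hy : Continuous y) (C : ℝ) : Continuous fun a => ENNReal.ofReal
      (C / (1 + slabSize l (v a) (kap Φ (x a) (v a) - y a)) ^ N) := by
  have h1 : Continuous fun a => kap Φ (x a) (v a) - y a :=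
    (hΦ.continuous_kap.comp (hx.prodMk hv)).sub hy
  refine ENNReal.continuous_ofReal.comp (continuous_const.div
    ((continuous_const.add (continuous_slabSize_comp hv h1)).pow N) fun a => ?_)
  have := slabSize_nonneg hl (v a) (kap Φ (x a) (v a) - y a)
  positivity

theorem GoodAmp.exists_lintegral_ker_right (hb : GoodAmp n K b) (hΦ : GoodPhase n K Φ) :
    ∃ C : ℝ, 0 < C ∧ ∀ l : ℝ, 1 ≤ l → ∀ z, ∫⁻ y, ‖ker b Φ l z y‖ₑ ≤
      ENNReal.ofReal (C / √l ^ (n + 1)) := by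
  obtain ⟨C, hC0, hC⟩ := hb.exists_ker_le_lintegral hΦ (n + 3)
  obtain ⟨D, hD0, hD⟩ := exists_lintegral_slab_le n
  have hfin : volume (ann n 16) < ⊤ := (isCompact_ann n 16).measure_lt_top
  refine ⟨(C + 1) * D * ((volume (ann n 16)).toReal + 1), by positivity, fun l hl z => ?_⟩
  have hs : 1 ≤ √l := Real.one_le_sqrt.2 hl
  by_cases hz : z ∈ K
  swap
  · have : ∀ y, ker b Φ l z y = 0 := fun y => by
      by_contra h
      exact hz (hb.ker_ne_zero h)
    simp [this]
  calc ∫⁻ y, ‖ker b Φ l z y‖ₑ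
      ≤ ∫⁻ y, ∫⁻ v in ann n 16,
          ENNReal.ofReal (C / (1 + slabSize l v (kap Φ z v - y)) ^ (n + 3)) :=
        lintegral_mono fun y => hC l hl z hz y
    _ = ∫⁻ v in ann n 16, ∫⁻ y,
          ENNReal.ofReal (C / (1 + slabSize l v (kap Φ z v - y)) ^ (n + 3)) := by
        refine lintegral_lintegral_swap (Measurable.aemeasurable ?_)
        exact (hΦ.continuous_slab (by linarith) _ continuous_const continuous_snd
          continuous_fst _).measurable
    _ ≤ ∫⁻ v in ann n 16, ENNReal.ofReal (C * (D / √l ^ (n + 1))) := by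
        refine setLIntegral_mono' (isCompact_ann n 16).isClosed.measurableSet fun v hv => ?_
        have h1 := lintegral_sub_left_eq_self (μ := (volume : Measure (Rn n)))
          (fun w => ENNReal.ofReal (C / (1 + slabSize l v w) ^ (n + 3))) (kap Φ z v)
        rw [h1]
        have h2 : ∀ w, ENNReal.ofReal (C / (1 + slabSize l v w) ^ (n + 3)) =
            ENNReal.ofReal C * ENNReal.ofReal (1 / (1 + slabSize l v w) ^ (n + 3)) := fun w => by
          rw [← ENNReal.ofReal_mul hC0, mul_one_div]
        simp only [h2]
        rw [lintegral_const_mul' _ _ ENNReal.ofReal_ne_top, ENNReal.ofReal_mul hC0]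
        gcongr
        exact hD l hl v (ann_mono (by norm_num) (by norm_num) hv)
    _ = ENNReal.ofReal (C * (D / √l ^ (n + 1)) * (volume (ann n 16)).toReal) := by
        rw [setLIntegral_const, ENNReal.ofReal_mul (p := C * (D / √l ^ (n + 1))) (by positivity),
          ENNReal.ofReal_toReal hfin.ne]
    _ ≤ _ := by
        refine ENNReal.ofReal_le_ofReal ?_
        rw [mul_div_assoc', div_mul_eq_mul_div]
        gcongr
        · linarith
        · linarith

theorem GoodPhase.exists_lintegral_slab_left (hΦ : GoodPhase n K Φ) (hK : IsCompact K) :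
    ∃ r C : ℝ, 0 < r ∧ r ≤ 1 ∧ 0 < C ∧ ∀ l : ℝ, 1 ≤ l → ∀ v ∈ ann n 64, ∀ y,
      ∫⁻ x in Metric.cthickening r K,
        ENNReal.ofReal (1 / (1 + slabSize l v (kap Φ x v - y)) ^ (n + 3)) ≤
          ENNReal.ofReal (C / √l ^ (n + 1)) := by
  obtain ⟨r₀, c, hr₀, hr₁, hc, hanti⟩ := hΦ.anti
  obtain ⟨D, hD0, hD⟩ := exists_lintegral_slab_le n
  obtain ⟨t, htK, ht⟩ := hK.elim_finite_subcover_image (b := K)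
    (c := fun x => Metric.ball x (r₀ / 2)) (fun x _ => Metric.isOpen_ball)
    (fun x hx => Set.mem_iUnion₂.2 ⟨x, hx, Metric.mem_ball_self (by linarith)⟩)
  obtain ⟨htf, ht⟩ := ht
  lift t to Finset (Rn n) using htf
  refine ⟨r₀ / 4, (t.card * (c⁻¹ ^ n * D) + 1), by linarith, by linarith, by positivity,
    fun l hl v hv y => ?_⟩
  have hs : 1 ≤ √l := Real.one_le_sqrt.2 hl
  have hsub : Metric.cthickening (r₀ / 4) K ⊆ ⋃ x : t, Metric.ball (x : Rn n) r₀ := fun x hx => by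
    rw [hK.cthickening_eq_biUnion_closedBall (by linarith)] at hx
    obtain ⟨z, hz, hxz⟩ := Set.mem_iUnion₂.1 hx
    obtain ⟨x₀, hx₀, hz'⟩ := Set.mem_iUnion₂.1 (ht hz)
    refine Set.mem_iUnion.2 ⟨⟨x₀, hx₀⟩, ?_⟩
    rw [Metric.mem_ball] at hz' ⊢
    rw [Metric.mem_closedBall] at hxz
    have := dist_triangle x z x₀
    dsimp only
    linarith
  let F : Rn n → ℝ≥0∞ := fun w => ENNReal.ofReal (1 / (1 + slabSize l v w) ^ (n + 3))
  have hF : Measurable fun w => F (w - y) := by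
    have h := continuous_slabSize_comp (n := n) (l := l) (continuous_const (y := v))
      (continuous_id.sub (continuous_const (y := y)))
    refine (ENNReal.continuous_ofReal.comp (continuous_const.div
      ((continuous_const.add h).pow _) fun w => ?_)).measurable
    have := slabSize_nonneg (by linarith : 0 ≤ l) v (w - y)
    exact (pow_pos (show (0 : ℝ) < 1 + slabSize l v (w - y) by linarith) _).ne'
  have hkm : Measurable fun x => kap Φ x v :=
    (hΦ.continuous_kap.comp (by fun_prop : Continuous fun x : Rn n => (x, v))).measurable
  have hball : ∀ x₀ ∈ t, ∫⁻ x in Metric.ball x₀ r₀, F (kap Φ x v - y) ≤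
      ENNReal.ofReal (c⁻¹ ^ n * (D / √l ^ (n + 1))) := fun x₀ hx₀ => by
    have h1 := setLIntegral_comp_le_of_antilipschitz (s := Metric.ball x₀ r₀) hkm hc
      (fun x hx x' hx' => hanti x₀ (htK hx₀) x hx x' hx' v hv) hF
    refine h1.trans ?_
    rw [lintegral_sub_right_eq_self F y, ENNReal.ofReal_mul (by positivity),
      ENNReal.ofReal_pow (by positivity)]
    gcongr
    exact hD l hl v hv
  calc ∫⁻ x in Metric.cthickening (r₀ / 4) K, F (kap Φ x v - y)
      ≤ ∫⁻ x in ⋃ x : t, Metric.ball (x : Rn n) r₀, F (kap Φ x v - y) := lintegral_mono_set hsub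
    _ ≤ ∑' x : t, ∫⁻ x in Metric.ball (x : Rn n) r₀, F (kap Φ x v - y) := lintegral_iUnion_le _ _
    _ = ∑ x ∈ t, ∫⁻ x in Metric.ball (x : Rn n) r₀, F (kap Φ x v - y) := by
        rw [tsum_fintype, Finset.sum_coe_sort t
          fun x₀ => ∫⁻ x in Metric.ball (x₀ : Rn n) r₀, F (kap Φ x v - y)]
    _ ≤ ∑ x ∈ t, ENNReal.ofReal (c⁻¹ ^ n * (D / √l ^ (n + 1))) := Finset.sum_le_sum hball
    _ ≤ _ := by
        rw [Finset.sum_const, nsmul_eq_mul, ← ENNReal.ofReal_natCast,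
          ← ENNReal.ofReal_mul (by positivity)]
        refine ENNReal.ofReal_le_ofReal ?_
        rw [mul_div_assoc', mul_div_assoc']
        gcongr
        linarith

end Kernel

section Tubes
variable {n : ℕ} {K : Set (Rn n)} {Φ : Rn n → Rn n → ℝ}

theorem GoodPhase.exists_lipschitz_kap (hΦ : GoodPhase n K Φ) :
    ∃ C : ℝ, 0 < C ∧ ∀ x x' v v' : Rn n, ‖kap Φ x v - kap Φ x' v'‖ ≤ C * (‖x - x'‖ + ‖v - v'‖) := by
  obtain ⟨C, hC⟩ := (contDiff_kap hΦ.smooth).lipschitzWith_of_hasCompactSupport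
    (hasCompactSupport_kap hΦ.smooth hΦ.supp) (by simp)
  refine ⟨C + 1, by positivity, fun x x' v v' => ?_⟩
  have h := hC.norm_sub_le (x, v) (x', v')
  refine h.trans ?_
  have h2 : ‖(x, v) - (x', v')‖ ≤ ‖x - x'‖ + ‖v - v'‖ := by
    rw [Prod.mk_sub_mk, Prod.norm_mk]
    exact max_le_add_of_nonneg (norm_nonneg _) (norm_nonneg _)
  have : 0 ≤ ‖x - x'‖ + ‖v - v'‖ := by positivity
  have hC0 := C.2
  calc (C : ℝ) * ‖(x, v) - (x', v')‖ ≤ C * (‖x - x'‖ + ‖v - v'‖) := by gcongr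
    _ ≤ _ := by nlinarith

theorem GoodPhase.kap_smul (hΦ : GoodPhase n K Φ) {x : Rn n} (hx : x ∈ Metric.cthickening 1 K)
    {v : Rn n} (hv : v ∈ ann n 16) {r : ℝ} (hr : r ∈ Set.Icc (1 : ℝ) 2) :
    kap Φ x (r • v) = kap Φ x v := by
  have hr0 : (0 : ℝ) < r := by linarith [hr.1]
  have hev : (fun w => Φ x (r • w)) =ᶠ[nhds v] fun w => r * Φ x w := by
    have h1 : ∀ᶠ w in nhds v, ‖w - v‖ < 1 / 32 := by
      have := (Metric.ball_mem_nhds v (by norm_num : (0 : ℝ) < 1 / 32))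
      filter_upwards [this] with w hw
      rwa [Metric.mem_ball, dist_eq_norm] at hw
    filter_upwards [h1] with w hw
    have h2 := norm_sub_norm_le v w
    have h3 := norm_sub_norm_le w v
    rw [norm_sub_rev] at h2
    have hv1 := hv.1
    have hv2 := hv.2
    refine hΦ.homog x hx w r hr0 ⟨by norm_num at *; linarith, by linarith⟩ ?_
    refine ⟨?_, ?_⟩
    · rw [norm_smul, Real.norm_of_nonneg hr0.le]
      norm_num at *
      nlinarith [hr.1, norm_nonneg w]
    · rw [norm_smul, Real.norm_of_nonneg hr0.le]
      nlinarith [hr.2, norm_nonneg w]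
  have h4 := hev.fderiv_eq (𝕜 := ℝ)
  have hd : Differentiable ℝ (Φ x) := (hΦ.ub_right.1 x).differentiable (by simp)
  rw [fderiv_const_mul (hd v), fderiv_comp_smul] at h4
  have h5 : fderiv ℝ (Φ x) (r • v) = fderiv ℝ (Φ x) v := smul_right_injective _ hr0.ne' h4
  refine ext_inner_right ℝ fun h => ?_
  rw [inner_kap, inner_kap, h5]

theorem GoodPhase.exists_slabSize_le_of_tube (hΦ : GoodPhase n K Φ) :
    ∃ C : ℝ, 1 ≤ C ∧ ∀ l : ℝ, 1 ≤ l → ∀ x ∈ Metric.cthickening 1 K, ∀ y, ∀ v₀ ∈ ann n 16,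
      ∀ r ∈ Set.Icc (1 : ℝ) 2, ∀ v, ‖v - r • v₀‖ ≤ 1 / (32 * √l) →
        v ∈ ann n 64 ∧ 1 + slabSize l v (kap Φ x v - y) ≤
          C * (1 + slabSize l v₀ (kap Φ x v₀ - y)) := by
  obtain ⟨C, hC0, hC⟩ := hΦ.exists_lipschitz_kap
  refine ⟨3 + 2 * C, by linarith, fun l hl x hx y v₀ hv₀ r hr v hv => ?_⟩
  have hs : 1 ≤ √l := Real.one_le_sqrt.2 hl
  have hs0 : (0 : ℝ) < √l := by linarith
  have hll : √l * √l = l := Real.mul_self_sqrt (by linarith)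
  set δ := 1 / (32 * √l) with hδ
  have hδ0 : 0 < δ := by positivity
  have hδs : √l * δ = 1 / 32 := by rw [hδ]; field_simp
  have hδ1 : δ ≤ 1 / 32 := by nlinarith
  have hr0 : (0 : ℝ) < r := by linarith [hr.1]
  have hrv : ‖r • v₀‖ = r * ‖v₀‖ := by rw [norm_smul, Real.norm_of_nonneg hr0.le]
  have hrv1 : 1 / 16 ≤ ‖r • v₀‖ := by
    rw [hrv]; have := hv₀.1; norm_num at this; nlinarith [hr.1, norm_nonneg v₀]
  have hrv2 : ‖r • v₀‖ ≤ 32 := by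
    rw [hrv]; have := hv₀.2; nlinarith [hr.2, norm_nonneg v₀]
  have h2 := norm_sub_norm_le v (r • v₀)
  have h3 := norm_sub_norm_le (r • v₀) v
  rw [norm_sub_rev] at h3
  have hv64 : v ∈ ann n 64 := ⟨by norm_num at *; linarith, by linarith⟩
  have hrv64 : r • v₀ ∈ ann n 64 := ⟨by norm_num at *; linarith, by linarith⟩
  have hv₀64 : v₀ ∈ ann n 64 := ann_mono (by norm_num) (by norm_num) hv₀
  refine ⟨hv64, ?_⟩
  have hκ := hΦ.kap_smul hx hv₀ hr
  have hw : ‖kap Φ x v - kap Φ x v₀‖ ≤ C * δ := by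
    rw [← hκ]
    refine (hC x x v (r • v₀)).trans ?_
    rw [sub_self, norm_zero, zero_add]
    gcongr
  have heul := euler_kap hΦ.smooth hΦ.homog hx hv64
  have heul' := euler_kap hΦ.smooth hΦ.homog hx hrv64
  have hd : Differentiable ℝ (Φ x) := (hΦ.ub_right.1 x).differentiable (by simp)
  have hT : ‖Φ x v - Φ x (r • v₀) - fderiv ℝ (Φ x) (r • v₀) (v - r • v₀)‖ ≤
      C * δ * ‖v - r • v₀‖ := by
    refine (convex_closedBall (r • v₀) δ).norm_image_sub_le_of_norm_fderiv_le' (𝕜 := ℝ)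
      (fun u _ => hd u) (fun u hu => ?_) (Metric.mem_closedBall_self hδ0.le)
      (by rwa [Metric.mem_closedBall, dist_eq_norm])
    refine ContinuousLinearMap.opNorm_le_bound _ (by positivity) fun h => ?_
    rw [sub_apply, ← inner_kap, ← inner_kap, ← inner_sub_left]
    refine (norm_inner_le_norm _ _).trans ?_
    gcongr
    refine (hC x x u (r • v₀)).trans ?_
    rw [sub_self, norm_zero, zero_add]
    rw [Metric.mem_closedBall, dist_eq_norm] at hu
    gcongr
  rw [← inner_kap, ← heul, ← heul', hκ] at hT
  have hid : ⟪kap Φ x v - y, v⟫_ℝ = (⟪kap Φ x v, v⟫_ℝ - ⟪kap Φ x v₀, r • v₀⟫_ℝ -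
      ⟪kap Φ x v₀, v - r • v₀⟫_ℝ) + r * ⟪kap Φ x v₀ - y, v₀⟫_ℝ +
        ⟪kap Φ x v₀ - y, v - r • v₀⟫_ℝ := by
    simp only [inner_sub_left, inner_sub_right, inner_smul_right]
    ring
  have hin : |⟪kap Φ x v₀ - y, v - r • v₀⟫_ℝ| ≤ ‖kap Φ x v₀ - y‖ * δ :=
    (abs_real_inner_le_norm _ _).trans (by gcongr)
  have hT2 : |⟪kap Φ x v, v⟫_ℝ - ⟪kap Φ x v₀, r • v₀⟫_ℝ - ⟪kap Φ x v₀, v - r • v₀⟫_ℝ| ≤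
      C * δ * δ := by
    rw [← Real.norm_eq_abs]
    exact hT.trans (by gcongr)
  have hA : |⟪kap Φ x v - y, v⟫_ℝ| ≤ C * δ * δ + 2 * |⟪kap Φ x v₀ - y, v₀⟫_ℝ| +
      ‖kap Φ x v₀ - y‖ * δ := by
    rw [hid]
    refine (abs_add_three _ _ _).trans ?_
    rw [abs_mul, abs_of_pos hr0]
    gcongr
    exact hr.2
  have hB : ‖kap Φ x v - y‖ ≤ C * δ + ‖kap Φ x v₀ - y‖ := by
    calc ‖kap Φ x v - y‖ = ‖(kap Φ x v - kap Φ x v₀) + (kap Φ x v₀ - y)‖ := by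
          rw [sub_add_sub_cancel]
      _ ≤ _ := (norm_add_le _ _).trans (by gcongr)
  unfold slabSize
  set A := |⟪kap Φ x v₀ - y, v₀⟫_ℝ|
  set B := ‖kap Φ x v₀ - y‖
  have hA0 : 0 ≤ A := abs_nonneg _
  have hB0 : 0 ≤ B := norm_nonneg _
  calc 1 + (l * |⟪kap Φ x v - y, v⟫_ℝ| + √l * ‖kap Φ x v - y‖)
      ≤ 1 + (l * (C * δ * δ + 2 * A + B * δ) + √l * (C * δ + B)) := by gcongr
    _ = 1 + (C * (√l * δ) * (√l * δ) + 2 * (l * A) + (√l * δ) * (√l * B) +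
          (C * (√l * δ) + √l * B)) := by
        linear_combination (-(C * δ * δ + B * δ)) * hll
    _ ≤ _ := by
        rw [hδs]
        have h1 : 0 ≤ l * A := by positivity
        have h2 : 0 ≤ √l * B := by positivity
        nlinarith [mul_nonneg hC0.le h1, mul_nonneg hC0.le h2]

/-- Lower bound for the volume of a `δ`-tube around the segment `[v₀, 2 v₀]`. -/
theorem le_volume_tube {v₀ : Rn n} (hv₀ : 1 / 16 ≤ ‖v₀‖) {δ : ℝ} (hδ : 0 ≤ δ) :
    ENNReal.ofReal (δ ^ n) * volume (Metric.closedBall (0 : Rn n) 1) ≤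
      ENNReal.ofReal (32 * δ) * volume {v : Rn n | ∃ r ∈ Set.Icc (1 : ℝ) 2, ‖v - r • v₀‖ ≤ δ} := by
  let S : Set (ℝ × Rn n) := {p | p.1 ∈ Set.Icc (1 : ℝ) 2 ∧ ‖p.2 - p.1 • v₀‖ ≤ δ}
  set E := {v : Rn n | ∃ r ∈ Set.Icc (1 : ℝ) 2, ‖v - r • v₀‖ ≤ δ}
  have hS : MeasurableSet S := by
    refine (IsClosed.inter (isClosed_Icc.preimage continuous_fst)
      (isClosed_le (f := fun p : ℝ × Rn n => ‖p.2 - p.1 • v₀‖) (by fun_prop)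
        continuous_const)).measurableSet
  have h1 : (volume : Measure ℝ).prod (volume : Measure (Rn n)) S =
      ENNReal.ofReal (δ ^ n) * volume (Metric.closedBall (0 : Rn n) 1) := by
    rw [Measure.prod_apply hS]
    have : ∀ r : ℝ, volume (Prod.mk r ⁻¹' S) = (Set.Icc (1 : ℝ) 2).indicator (fun _ =>
        ENNReal.ofReal (δ ^ n) * volume (Metric.closedBall (0 : Rn n) 1)) r := fun r => by
      by_cases hr : r ∈ Set.Icc (1 : ℝ) 2
      · rw [Set.indicator_of_mem hr]
        have : Prod.mk r ⁻¹' S = Metric.closedBall (r • v₀) δ := by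
          ext v
          simp only [Set.mem_preimage, Metric.mem_closedBall, dist_eq_norm]
          exact ⟨fun h => h.2, fun h => ⟨hr, h⟩⟩
        rw [this, Measure.addHaar_closedBall _ _ hδ,
          Measure.addHaar_unitClosedBall_eq_addHaar_unitBall]
        simp
      · rw [Set.indicator_of_notMem hr]
        have : Prod.mk r ⁻¹' S = ∅ := by
          ext v
          simp only [Set.mem_preimage, Set.mem_empty_iff_false, iff_false]
          exact fun h => hr h.1
        rw [this, measure_empty]
    simp only [this]
    rw [lintegral_indicator_const measurableSet_Icc, Real.volume_Icc]
    norm_num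
  rw [← h1, Measure.prod_apply_symm hS]
  have h2 : ∀ v : Rn n, volume ((fun r : ℝ => (r, v)) ⁻¹' S) ≤
      E.indicator (fun _ => ENNReal.ofReal (32 * δ)) v := fun v => by
    by_cases hv : v ∈ E
    · rw [Set.indicator_of_mem hv]
      refine (Real.volume_le_diam _).trans (Metric.ediam_le fun r hr r' hr' => ?_)
      rw [edist_dist]
      refine ENNReal.ofReal_le_ofReal ?_
      rw [Real.dist_eq]
      have h3 : ‖(r - r') • v₀‖ ≤ δ + δ := by
        have : (r - r') • v₀ = (v - r' • v₀) - (v - r • v₀) := by rw [sub_smul]; abel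
        rw [this]
        exact (norm_sub_le _ _).trans (add_le_add hr'.2 hr.2)
      rw [norm_smul, Real.norm_eq_abs] at h3
      nlinarith [abs_nonneg (r - r')]
    · rw [Set.indicator_of_notMem hv]
      have : (fun r : ℝ => (r, v)) ⁻¹' S = ∅ := by
        ext r
        simp only [Set.mem_preimage, Set.mem_empty_iff_false, iff_false]
        exact fun h => hv ⟨r, h.1, h.2⟩
      rw [this, measure_empty]
  refine (lintegral_mono h2).trans ?_
  exact lintegral_indicator_const_le _ _

theorem GoodPhase.exists_slab_le_average (hΦ : GoodPhase n K Φ) (M : ℕ) :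
    ∃ C : ℝ, 0 < C ∧ ∀ l : ℝ, 1 ≤ l → ∀ x ∈ Metric.cthickening 1 K, ∀ y, ∀ v₀ ∈ ann n 16,
      ENNReal.ofReal (1 / (1 + slabSize l v₀ (kap Φ x v₀ - y)) ^ M) ≤
        ENNReal.ofReal (C * (√l ^ n / √l)) *
          ∫⁻ v in ann n 64, ENNReal.ofReal (1 / (1 + slabSize l v (kap Φ x v - y)) ^ M) := by
  obtain ⟨C, hC1, hC⟩ := hΦ.exists_slabSize_le_of_tube
  set V := volume (Metric.closedBall (0 : Rn n) 1) with hV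
  have hVtop : V ≠ ⊤ := measure_closedBall_lt_top.ne
  have hV0 : 0 < V := Metric.measure_closedBall_pos _ _ one_pos
  have hVr : 0 < V.toReal := ENNReal.toReal_pos hV0.ne' hVtop
  refine ⟨C ^ M * 32 ^ n / V.toReal, by positivity, fun l hl x hx y v₀ hv₀ => ?_⟩
  have hs : 1 ≤ √l := Real.one_le_sqrt.2 hl
  have hl0 : 0 ≤ l := by linarith
  set δ := 1 / (32 * √l) with hδ
  have hδ0 : 0 < δ := by positivity
  set g : Rn n → ℝ≥0∞ := fun v => ENNReal.ofReal (1 / (1 + slabSize l v (kap Φ x v - y)) ^ M)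
  set E := {v : Rn n | ∃ r ∈ Set.Icc (1 : ℝ) 2, ‖v - r • v₀‖ ≤ δ} with hE
  have hEs : E ⊆ ann n 64 := fun v ⟨r, hr, hv⟩ => (hC l hl x hx y v₀ hv₀ r hr v hv).1
  have hv16 : 1 / 16 ≤ ‖v₀‖ := by have := hv₀.1; norm_num at *; linarith
  have hvol := le_volume_tube hv16 hδ0.le
  rw [← hE, ← hV] at hvol
  have hpos : ∀ v, 0 < 1 + slabSize l v (kap Φ x v - y) := fun v => by
    have := slabSize_nonneg hl0 v (kap Φ x v - y); linarith
  have hg : ∀ v ∈ E, g v₀ ≤ ENNReal.ofReal (C ^ M) * g v := fun v ⟨r, hr, hv⟩ => by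
    rw [← ENNReal.ofReal_mul (by positivity)]
    refine ENNReal.ofReal_le_ofReal ?_
    have h := (hC l hl x hx y v₀ hv₀ r hr v hv).2
    rw [mul_one_div, div_le_div_iff₀ (pow_pos (hpos _) _) (pow_pos (hpos _) _), one_mul,
      ← mul_pow]
    have := (hpos v).le
    gcongr
  have h1 : g v₀ * volume E ≤ ENNReal.ofReal (C ^ M) * ∫⁻ v in ann n 64, g v := by
    calc g v₀ * volume E = ∫⁻ v in E, g v₀ := (setLIntegral_const _ _).symm
      _ ≤ ∫⁻ v in E, ENNReal.ofReal (C ^ M) * g v := by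
          refine setLIntegral_mono ?_ hg
          exact ((hΦ.continuous_slab hl0 M continuous_const continuous_id continuous_const
            1).measurable).const_mul _
      _ = ENNReal.ofReal (C ^ M) * ∫⁻ v in E, g v :=
          lintegral_const_mul' _ _ ENNReal.ofReal_ne_top
      _ ≤ _ := by gcongr
  have h2 : ENNReal.ofReal (δ ^ n) * V * g v₀ ≤
      ENNReal.ofReal (32 * δ) * (ENNReal.ofReal (C ^ M) * ∫⁻ v in ann n 64, g v) := by
    calc ENNReal.ofReal (δ ^ n) * V * g v₀ ≤ ENNReal.ofReal (32 * δ) * volume E * g v₀ := by gcongr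
      _ = ENNReal.ofReal (32 * δ) * (g v₀ * volume E) := by ring
      _ ≤ _ := by gcongr
  rw [← ENNReal.ofReal_toReal hVtop, ← ENNReal.ofReal_mul (by positivity)] at h2
  have hc : 0 < δ ^ n * V.toReal := by positivity
  have h3 : g v₀ = ENNReal.ofReal (δ ^ n * V.toReal)⁻¹ *
      (ENNReal.ofReal (δ ^ n * V.toReal) * g v₀) := by
    rw [← mul_assoc, ← ENNReal.ofReal_mul (by positivity), inv_mul_cancel₀ hc.ne',
      ENNReal.ofReal_one, one_mul]
  refine h3.le.trans ?_
  calc _ ≤ ENNReal.ofReal (δ ^ n * V.toReal)⁻¹ *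
        (ENNReal.ofReal (32 * δ) * (ENNReal.ofReal (C ^ M) * ∫⁻ v in ann n 64, g v)) := by gcongr
    _ = _ := by
        rw [← mul_assoc, ← mul_assoc, ← ENNReal.ofReal_mul (by positivity),
          ← ENNReal.ofReal_mul (by positivity)]
        congr 2
        simp only [hδ, one_div, inv_pow, mul_pow]
        field_simp

end Tubes

section SlabPower
variable {n : ℕ} {K : Set (Rn n)} {Φ : Rn n → Rn n → ℝ} {b : ℝ → Rn n → Rn n → ℂ}
  {ψ0 : Rn n → ℝ}

theorem lintegral_rpow_le_of_le_average {α : Type*} [MeasurableSpace α] {μ : Measure α}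
    {s t : Set α} (hs : MeasurableSet s) (hst : s ⊆ t) {p : ℝ} (hp : 0 < p) (hp1 : p ≤ 1)
    {g G : α → ℝ≥0∞} {A : ℝ≥0∞} (hG : Measurable G)
    (hg : ∀ v ∈ s, g v ≤ G v ^ (1 / p)) (hA : ∀ v ∈ s, G v ≤ A * ∫⁻ w in t, G w ∂μ) :
    (∫⁻ v in s, g v ∂μ) ^ p ≤ A ^ (1 - p) * ∫⁻ w in t, G w ∂μ := by
  set J := ∫⁻ w in t, G w ∂μ
  have hq : 0 ≤ 1 / p - 1 := by rw [sub_nonneg, le_div_iff₀ hp]; linarith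
  have h1 : ∫⁻ v in s, g v ∂μ ≤ (A * J) ^ (1 / p - 1) * J := by
    calc ∫⁻ v in s, g v ∂μ ≤ ∫⁻ v in s, (A * J) ^ (1 / p - 1) * G v ∂μ := by
          refine setLIntegral_mono' hs fun v hv => ?_
          calc g v ≤ G v ^ (1 / p) := hg v hv
            _ = G v ^ (1 / p - 1) * G v := by
                conv_rhs => rw [← ENNReal.rpow_one (G v), ← ENNReal.rpow_mul, one_mul]
                rw [← ENNReal.rpow_add_of_nonneg _ _ hq zero_le_one, sub_add_cancel]
            _ ≤ _ := by gcongr; exact hA v hv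
      _ = (A * J) ^ (1 / p - 1) * ∫⁻ v in s, G v ∂μ := lintegral_const_mul _ hG
      _ ≤ _ := by gcongr; exact lintegral_mono_set hst
  calc (∫⁻ v in s, g v ∂μ) ^ p ≤ ((A * J) ^ (1 / p - 1) * J) ^ p := by gcongr
    _ = A ^ (1 - p) * (J ^ (1 - p) * J ^ p) := by
        rw [ENNReal.mul_rpow_of_nonneg _ _ hp.le, ← ENNReal.rpow_mul, sub_mul,
          one_div_mul_cancel hp.ne', one_mul, ENNReal.mul_rpow_of_nonneg _ _ (by linarith),
          mul_assoc]
    _ = _ := by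
        rw [← ENNReal.rpow_add_of_nonneg _ _ (by linarith) hp.le, sub_add_cancel, ENNReal.rpow_one]

theorem GoodPhase.exists_lintegral_slab_rpow_left (hΦ : GoodPhase n K Φ) (hK : IsCompact K)
    {p : ℝ} (hp : 0 < p) (hp1 : p ≤ 1) {N : ℕ} (hN : n + 3 ≤ N * p) :
    ∃ r C : ℝ, 0 < r ∧ r ≤ 1 ∧ 0 < C ∧ ∀ l : ℝ, 1 ≤ l → ∀ y,
      ∫⁻ x in Metric.cthickening r K,
        (∫⁻ v in ann n 16, ENNReal.ofReal (1 / (1 + slabSize l v (kap Φ x v - y)) ^ N)) ^ p ≤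
          ENNReal.ofReal (C * l ^ (-(1 + p * ((n - 1) / 2)))) := by
  obtain ⟨r, D, hr0, hr1, hD0, hD⟩ := hΦ.exists_lintegral_slab_left hK
  obtain ⟨A, hA0, hA⟩ := hΦ.exists_slab_le_average (n + 3)
  set V := (volume (ann n 64)).toReal
  have hV : 0 ≤ V := ENNReal.toReal_nonneg
  refine ⟨r, A ^ (1 - p) * (D * V) + 1, hr0, hr1, by positivity, fun l hl y => ?_⟩
  have hs : 0 < √l := by positivity
  have hl0 : 0 ≤ l := by linarith
  let G : Rn n → Rn n → ℝ≥0∞ := fun x v =>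
    ENNReal.ofReal (1 / (1 + slabSize l v (kap Φ x v - y)) ^ (n + 3))
  have hGc : Continuous fun q : Rn n × Rn n => G q.1 q.2 :=
    hΦ.continuous_slab hl0 _ continuous_fst continuous_snd continuous_const 1
  have hpt : ∀ x ∈ Metric.cthickening r K,
      (∫⁻ v in ann n 16, ENNReal.ofReal (1 / (1 + slabSize l v (kap Φ x v - y)) ^ N)) ^ p ≤
        ENNReal.ofReal (A * (√l ^ n / √l)) ^ (1 - p) * ∫⁻ v in ann n 64, G x v := fun x hx => by
    refine lintegral_rpow_le_of_le_average (isCompact_ann n 16).isClosed.measurableSet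
      (ann_mono (by norm_num) (by norm_num)) hp hp1
      (hGc.comp (by fun_prop : Continuous fun v : Rn n => (x, v))).measurable (fun v _ => ?_)
      (fun v hv => hA l hl x (Metric.cthickening_mono hr1 _ hx) y v hv)
    have h0 : 1 ≤ 1 + slabSize l v (kap Φ x v - y) := by
      have := slabSize_nonneg hl0 v (kap Φ x v - y); linarith
    have h1 : 0 < 1 + slabSize l v (kap Φ x v - y) := by linarith
    dsimp only [G]
    rw [ENNReal.ofReal_rpow_of_nonneg (by positivity) (by positivity)]
    refine ENNReal.ofReal_le_ofReal ?_
    rw [Real.div_rpow zero_le_one (by positivity), Real.one_rpow, ← Real.rpow_natCast,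
      ← Real.rpow_natCast, ← Real.rpow_mul h1.le]
    refine one_div_le_one_div_of_le (by positivity) (Real.rpow_le_rpow_of_exponent_le h0 ?_)
    rw [mul_one_div, div_le_iff₀ hp]
    push_cast
    exact hN
  calc _ ≤ ∫⁻ x in Metric.cthickening r K,
        ENNReal.ofReal (A * (√l ^ n / √l)) ^ (1 - p) * ∫⁻ v in ann n 64, G x v :=
        setLIntegral_mono' Metric.isClosed_cthickening.measurableSet hpt
    _ = ENNReal.ofReal (A * (√l ^ n / √l)) ^ (1 - p) *
          ∫⁻ x in Metric.cthickening r K, ∫⁻ v in ann n 64, G x v :=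
        lintegral_const_mul' _ _ (ENNReal.rpow_ne_top_of_nonneg (by linarith) ENNReal.ofReal_ne_top)
    _ = ENNReal.ofReal (A * (√l ^ n / √l)) ^ (1 - p) *
          ∫⁻ v in ann n 64, ∫⁻ x in Metric.cthickening r K, G x v := by
        rw [lintegral_lintegral_swap hGc.measurable.aemeasurable]
    _ ≤ ENNReal.ofReal (A * (√l ^ n / √l)) ^ (1 - p) *
          ∫⁻ v in ann n 64, ENNReal.ofReal (D / √l ^ (n + 1)) := by
        refine mul_le_mul' le_rfl ?_
        exact setLIntegral_mono' (isCompact_ann n 64).isClosed.measurableSet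
          fun v hv => hD l hl v hv y
    _ = ENNReal.ofReal ((A * (√l ^ n / √l)) ^ (1 - p) * (D / √l ^ (n + 1) * V)) := by
        rw [setLIntegral_const, ENNReal.ofReal_rpow_of_nonneg (by positivity) (by linarith),
          ENNReal.ofReal_mul (p := (A * (√l ^ n / √l)) ^ (1 - p)) (by positivity),
          ENNReal.ofReal_mul (p := D / √l ^ (n + 1)) (by positivity),
          ENNReal.ofReal_toReal (isCompact_ann n 64).measure_lt_top.ne]
    _ ≤ _ := by
        refine ENNReal.ofReal_le_ofReal ?_
        have e1 : √l ^ n / √l = √l ^ ((n : ℝ) - 1) := by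
          rw [Real.rpow_sub_one hs.ne', Real.rpow_natCast]
        have e2 : l ^ (-(1 + p * (((n : ℝ) - 1) / 2))) = √l ^ (-(2 + p * ((n : ℝ) - 1))) := by
          rw [Real.sqrt_eq_rpow, ← Real.rpow_mul hl0]; congr 1; ring
        have e3 : (A * (√l ^ n / √l)) ^ (1 - p) * (D / √l ^ (n + 1) * V) =
            A ^ (1 - p) * (D * V) * l ^ (-(1 + p * (((n : ℝ) - 1) / 2))) := by
          rw [e1, e2, Real.mul_rpow hA0.le (by positivity), ← Real.rpow_mul hs.le,
            show -(2 + p * ((n : ℝ) - 1)) = ((n : ℝ) - 1) * (1 - p) - ((n + 1 : ℕ) : ℝ) by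
              push_cast; ring, Real.rpow_sub hs, Real.rpow_natCast]
          ring
        rw [e3]
        gcongr
        linarith

theorem exists_lintegral_dilate_le (n : ℕ) : ∃ D : ℝ, 0 < D ∧ ∀ C t : ℝ, 0 ≤ C → 0 < t →
    ∀ x : Rn n, ∫⁻ z, ENNReal.ofReal (C * t ^ n / (1 + t * ‖x - z‖) ^ (n + 1)) ≤
      ENNReal.ofReal (C * D) := by
  obtain ⟨D, hD0, hD⟩ := exists_lintegral_inv_pow_le n
  refine ⟨D, hD0, fun C t hC ht x => ?_⟩
  rw [lintegral_sub_left_eq_self (fun w : Rn n =>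
    ENNReal.ofReal (C * t ^ n / (1 + t * ‖w‖) ^ (n + 1))) x]
  have h : ∀ w : Rn n, ENNReal.ofReal (C * t ^ n / (1 + t * ‖w‖) ^ (n + 1)) =
      ENNReal.ofReal (C * t ^ n) * ENNReal.ofReal (1 / (1 + t * ‖w‖) ^ (n + 1)) := fun w => by
    rw [← ENNReal.ofReal_mul (by positivity), mul_one_div]
  simp only [h]
  rw [lintegral_const_mul' _ _ ENNReal.ofReal_ne_top]
  calc _ ≤ ENNReal.ofReal (C * t ^ n) * ENNReal.ofReal (D / t ^ n) := by gcongr; exact hD t ht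
    _ = _ := by
        rw [← ENNReal.ofReal_mul (by positivity)]
        congr 1
        field_simp

theorem enorm_pieceKer_le (k : ℕ) (l : ℝ) (x y : Rn n) :
    ‖pieceKer ψ0 b Φ k l x y‖ₑ ≤
      ∫⁻ z, ‖invFT n (lpPiece n ψ0 k) (x - z)‖ₑ * ‖ker b Φ l z y‖ₑ := by
  refine (enorm_integral_le_lintegral_enorm _).trans (le_of_eq ?_)
  simp only [enorm_mul]

theorem GoodPhase.exists_slabSize_lipschitz (hΦ : GoodPhase n K Φ) :
    ∃ C : ℝ, 1 ≤ C ∧ ∀ l : ℝ, 1 ≤ l → ∀ x z y, ∀ v ∈ ann n 16,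
      1 + slabSize l v (kap Φ x v - y) ≤
        C * ((1 + slabSize l v (kap Φ z v - y)) * (1 + l * ‖x - z‖)) := by
  obtain ⟨C, hC0, hC⟩ := hΦ.exists_lipschitz_kap
  refine ⟨1 + 17 * C, by linarith, fun l hl x z y v hv => ?_⟩
  have hsl : √l ≤ l := by
    rw [Real.sqrt_le_left (by linarith)]; nlinarith
  have h1 : ‖kap Φ x v - kap Φ z v‖ ≤ C * ‖x - z‖ := by
    have := hC x z v v
    rwa [sub_self, norm_zero, add_zero] at this
  have hx : kap Φ x v - y = (kap Φ x v - kap Φ z v) + (kap Φ z v - y) := by abel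
  have h2 : |⟪kap Φ x v - y, v⟫_ℝ| ≤ C * ‖x - z‖ * 16 + |⟪kap Φ z v - y, v⟫_ℝ| := by
    rw [hx, inner_add_left]
    refine (abs_add_le _ _).trans (add_le_add_left ?_ _)
    refine (abs_real_inner_le_norm _ _).trans ?_
    gcongr
    exact hv.2
  have h3 : ‖kap Φ x v - y‖ ≤ C * ‖x - z‖ + ‖kap Φ z v - y‖ := by
    rw [hx]
    exact (norm_add_le _ _).trans (by gcongr)
  have h4 := slabSize_nonneg (by linarith : 0 ≤ l) v (kap Φ z v - y)
  have h5 : slabSize l v (kap Φ x v - y) ≤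
      17 * C * (l * ‖x - z‖) + slabSize l v (kap Φ z v - y) := by
    unfold slabSize
    calc _ ≤ l * (C * ‖x - z‖ * 16 + |⟪kap Φ z v - y, v⟫_ℝ|) +
          (l * (C * ‖x - z‖) + √l * ‖kap Φ z v - y‖) := by
          refine add_le_add (by gcongr) ?_
          calc √l * ‖kap Φ x v - y‖ ≤ √l * (C * ‖x - z‖ + ‖kap Φ z v - y‖) := by gcongr
            _ = √l * (C * ‖x - z‖) + √l * ‖kap Φ z v - y‖ := by ring
            _ ≤ _ := by gcongr
      _ = _ := by ring
  set T := slabSize l v (kap Φ z v - y)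
  have h6 : 0 ≤ l * ‖x - z‖ := by positivity
  nlinarith [mul_nonneg h4 h6, mul_nonneg hC0.le h4, mul_nonneg hC0.le (mul_nonneg h4 h6),
    mul_nonneg hC0.le h6]

theorem GoodAmp.exists_pieceKer_le_lintegral (hb : GoodAmp n K b) (hΦ : GoodPhase n K Φ)
    (hψ : IsLPBase n ψ0) {c : ℝ} (hc : 0 < c) (hc1 : c ≤ 1) (N : ℕ) :
    ∃ C : ℝ, 0 ≤ C ∧ ∀ (k : ℕ) (l : ℝ), 1 ≤ l → c * l ≤ 2 ^ k → ∀ x y,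
      ‖pieceKer ψ0 b Φ k l x y‖ₑ ≤ ENNReal.ofReal C *
        ∫⁻ v in ann n 16, ENNReal.ofReal (1 / (1 + slabSize l v (kap Φ x v - y)) ^ N) := by
  obtain ⟨A, hA0, hA⟩ := hb.exists_ker_le_lintegral hΦ N
  obtain ⟨B, hB0, hB⟩ := hψ.exists_kernel_decay (N + (n + 1))
  obtain ⟨L, hL1, hL⟩ := hΦ.exists_slabSize_lipschitz
  obtain ⟨D, hD0, hD⟩ := exists_lintegral_dilate_le n
  refine ⟨(B * A * (L / c) ^ N) * D, by positivity, fun k l hl hkl x y => ?_⟩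
  have hl0 : 0 ≤ l := by linarith
  have hTpos : ∀ z v, 0 < 1 + slabSize l v (kap Φ z v - y) := fun z v => by
    have := slabSize_nonneg hl0 v (kap Φ z v - y); linarith
  let g : Rn n → ℝ≥0∞ := fun v => ENNReal.ofReal (1 / (1 + slabSize l v (kap Φ x v - y)) ^ N)
  let w : Rn n → ℝ≥0∞ := fun z => ENNReal.ofReal
    ((B * A * (L / c) ^ N) * (2 ^ k) ^ n / (1 + 2 ^ k * ‖x - z‖) ^ (n + 1))
  have hpt : ∀ z, ‖invFT n (lpPiece n ψ0 k) (x - z)‖ₑ * ‖ker b Φ l z y‖ₑ ≤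
      w z * ∫⁻ v in ann n 16, g v := fun z => by
    by_cases hz : ker b Φ l z y = 0
    · simp [hz]
    have hz' := hb.ker_ne_zero hz
    have h1 : ‖invFT n (lpPiece n ψ0 k) (x - z)‖ₑ ≤
        ENNReal.ofReal (B * (2 ^ k) ^ n / (1 + 2 ^ k * ‖x - z‖) ^ (N + (n + 1))) := by
      rw [← ofReal_norm]
      exact ENNReal.ofReal_le_ofReal (hB k _)
    calc _ ≤ ENNReal.ofReal (B * (2 ^ k) ^ n / (1 + 2 ^ k * ‖x - z‖) ^ (N + (n + 1))) *
          ∫⁻ v in ann n 16, ENNReal.ofReal (A / (1 + slabSize l v (kap Φ z v - y)) ^ N) := by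
          gcongr
          exact hA l hl z hz' y
      _ = ∫⁻ v in ann n 16, ENNReal.ofReal (B * (2 ^ k) ^ n / (1 + 2 ^ k * ‖x - z‖) ^ (N + (n + 1)))
          * ENNReal.ofReal (A / (1 + slabSize l v (kap Φ z v - y)) ^ N) :=
          (lintegral_const_mul' _ _ ENNReal.ofReal_ne_top).symm
      _ ≤ ∫⁻ v in ann n 16, w z * g v := by
          refine setLIntegral_mono' (isCompact_ann n 16).isClosed.measurableSet fun v hv => ?_
          rw [← ENNReal.ofReal_mul (by positivity), ← ENNReal.ofReal_mul (by positivity)]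
          refine ENNReal.ofReal_le_ofReal ?_
          have h2 := hL l hl x z y v hv
          have hX := hTpos x v
          have hZ := hTpos z v
          set X := 1 + slabSize l v (kap Φ x v - y)
          set Z := 1 + slabSize l v (kap Φ z v - y)
          set Q := 1 + 2 ^ k * ‖x - z‖ with hQ
          have hQ0 : 0 < Q := by positivity
          have h3 : X ≤ L / c * (Z * Q) := by
            refine h2.trans ?_
            have : c * (1 + l * ‖x - z‖) ≤ Q := by
              rw [hQ]
              nlinarith [mul_le_mul_of_nonneg_right hkl (norm_nonneg (x - z))]
            rw [div_mul_eq_mul_div, le_div_iff₀ hc]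
            calc L * (Z * (1 + l * ‖x - z‖)) * c = L * Z * (c * (1 + l * ‖x - z‖)) := by ring
              _ ≤ L * Z * Q := by gcongr
              _ = _ := by ring
          have h4 : X ^ N ≤ (L / c) ^ N * (Z ^ N * Q ^ N) := by
            rw [← mul_pow, ← mul_pow]; gcongr
          rw [div_mul_div_comm, mul_one_div, div_div,
            div_le_div_iff₀ (by positivity) (by positivity)]
          calc B * (2 ^ k) ^ n * A * (Q ^ (n + 1) * X ^ N)
              ≤ B * (2 ^ k) ^ n * A * (Q ^ (n + 1) * ((L / c) ^ N * (Z ^ N * Q ^ N))) := by gcongr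
            _ = _ := by rw [pow_add]; ring
      _ = _ := lintegral_const_mul' _ _ ENNReal.ofReal_ne_top
  calc _ ≤ _ := enorm_pieceKer_le k l x y
    _ ≤ ∫⁻ z, w z * ∫⁻ v in ann n 16, g v := lintegral_mono hpt
    _ = (∫⁻ z, w z) * ∫⁻ v in ann n 16, g v := by
        refine lintegral_mul_const _ (Continuous.measurable ?_)
        refine ENNReal.continuous_ofReal.comp (Continuous.div (by fun_prop) (by fun_prop)
          fun z => ?_)
        positivity
    _ ≤ _ := by
        gcongr
        exact hD _ _ (by positivity) (by positivity) x

end SlabPower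

section NearPower
variable {n : ℕ} {K : Set (Rn n)} {Φ : Rn n → Rn n → ℝ} {b : ℝ → Rn n → Rn n → ℂ}
  {ψ0 : Rn n → ℝ}

theorem GoodAmp.exists_pieceKer_outer (hb : GoodAmp n K b) (hΦ : GoodPhase n K Φ)
    (hK : IsCompact K) (hψ : IsLPBase n ψ0) {r : ℝ} (hr : 0 < r) (N : ℕ) :
    ∃ C : ℝ, 0 ≤ C ∧ ∀ (k : ℕ) (l : ℝ), 0 < l → ∀ x ∉ Metric.cthickening r K, ∀ y,
      ‖pieceKer ψ0 b Φ k l x y‖ ≤ C * (2 ^ k) ^ n / (2 ^ k * (1 + ‖x‖)) ^ N := by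
  obtain ⟨A, hA0, hA⟩ := hb.exists_ker_decay hΦ 0
  obtain ⟨B, hB0, hB⟩ := hψ.exists_kernel_decay N
  obtain ⟨R, hR0, hR⟩ := hK.isBounded.exists_pos_norm_le
  set Q := (1 + R) / r + 1 with hQ
  have hQ0 : 0 < Q := by positivity
  refine ⟨B * Q ^ N * A * volume.real K, by positivity, fun k l hl x hx y => ?_⟩
  have hdist : ∀ z ∈ K, 2 ^ k * (1 + ‖x‖) ≤ Q * (1 + 2 ^ k * ‖x - z‖) := fun z hz => by
    have h1 : r < ‖x - z‖ := by
      by_contra h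
      exact hx (Metric.mem_cthickening_of_dist_le x z r K hz (by rw [dist_eq_norm]; linarith))
    have h2 : ‖x‖ ≤ R + ‖x - z‖ := by
      have := norm_sub_norm_le x z; linarith [hR z hz]
    have h3 : 1 + ‖x‖ ≤ Q * ‖x - z‖ := by
      have : 1 + R ≤ (1 + R) / r * ‖x - z‖ := by
        rw [div_mul_eq_mul_div, le_div_iff₀ hr]
        gcongr
      rw [hQ, add_mul, one_mul]
      linarith
    calc (2 : ℝ) ^ k * (1 + ‖x‖) ≤ 2 ^ k * (Q * ‖x - z‖) := by gcongr
      _ = Q * (2 ^ k * ‖x - z‖) := by ring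
      _ ≤ _ := by gcongr; linarith
  have hF : ∀ z ∈ K, ‖invFT n (lpPiece n ψ0 k) (x - z) * ker b Φ l z y‖ ≤
      B * (2 ^ k) ^ n * (Q ^ N / (2 ^ k * (1 + ‖x‖)) ^ N) * A := fun z hz => by
    rw [norm_mul]
    have h1 := hA l hl z y
    rw [pow_zero, pow_zero, mul_one, div_one] at h1
    refine mul_le_mul ((hB k (x - z)).trans ?_) h1 (norm_nonneg _) (by positivity)
    have h2 := hdist z hz
    rw [mul_div_assoc, mul_assoc B]
    refine mul_le_mul_of_nonneg_left ?_ hB0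
    rw [mul_div_assoc']
    rw [div_le_div_iff₀ (by positivity) (by positivity), mul_assoc, ← mul_pow]
    gcongr
  have := norm_integral_le_of_support hK (F := fun z => invFT n (lpPiece n ψ0 k) (x - z) *
    ker b Φ l z y) (fun z hz => hb.ker_ne_zero (right_ne_zero_of_mul hz)) hF
  refine this.trans (le_of_eq ?_)
  ring

theorem GoodAmp.exists_lintegral_pieceKer_rpow (hb : GoodAmp n K b) (hΦ : GoodPhase n K Φ)
    (hK : IsCompact K) (hψ : IsLPBase n ψ0) {p : ℝ} (hp : 0 < p) (hp1 : p ≤ 1)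
    {c : ℝ} (hc : 0 < c) (hc1 : c ≤ 1) :
    ∃ C : ℝ, 0 < C ∧ ∀ (k : ℕ) (l : ℝ), 1 ≤ l → c * l ≤ 2 ^ k → ∀ y,
      ∫⁻ x, ‖pieceKer ψ0 b Φ k l x y‖ₑ ^ p ≤
        ENNReal.ofReal (C * l ^ (-(1 + p * (((n : ℝ) - 1) / 2)))) := by
  obtain ⟨N, hN⟩ := exists_nat_ge ((2 * n + 3) / p)
  rw [div_le_iff₀ hp] at hN
  obtain ⟨r, A, hr0, -, hA0, hA⟩ := hΦ.exists_lintegral_slab_rpow_left hK hp hp1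
    (N := N) (by linarith [(Nat.cast_nonneg n : (0 : ℝ) ≤ n)])
  obtain ⟨B, hB0, hB⟩ := hb.exists_pieceKer_le_lintegral (ψ0 := ψ0) hΦ hψ hc hc1 N
  obtain ⟨D, hD0, hD⟩ := hb.exists_pieceKer_outer (ψ0 := ψ0) hΦ hK hψ hr0 N
  obtain ⟨M, hM0, hM⟩ := exists_lintegral_inv_pow_le n
  have hM1 := hM 1 one_pos
  rw [one_pow, div_one] at hM1
  refine ⟨B ^ p * A + D ^ p / c ^ (n + 3) * M + 1, by positivity, fun k l hl hkl y => ?_⟩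
  have hl0 : 0 < l := by linarith
  set E := 1 + p * (((n : ℝ) - 1) / 2) with hE
  have hn : (0 : ℝ) ≤ n := Nat.cast_nonneg n
  have hEn : E ≤ (n + 3 : ℕ) := by push_cast; rw [hE]; nlinarith
  have hμ : (1 : ℝ) ≤ 2 ^ k := one_le_pow₀ (by norm_num)
  have hin : ∫⁻ x in Metric.cthickening r K, ‖pieceKer ψ0 b Φ k l x y‖ₑ ^ p ≤
      ENNReal.ofReal (B ^ p * A * l ^ (-E)) := by
    calc _ ≤ ∫⁻ x in Metric.cthickening r K, ENNReal.ofReal (B ^ p) * (∫⁻ v in ann n 16,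
          ENNReal.ofReal (1 / (1 + slabSize l v (kap Φ x v - y)) ^ N)) ^ p := by
          refine lintegral_mono fun x => ?_
          rw [← ENNReal.ofReal_rpow_of_nonneg hB0 hp.le, ← ENNReal.mul_rpow_of_nonneg _ _ hp.le]
          gcongr
          exact hB k l hl hkl x y
      _ = ENNReal.ofReal (B ^ p) * ∫⁻ x in Metric.cthickening r K, (∫⁻ v in ann n 16,
          ENNReal.ofReal (1 / (1 + slabSize l v (kap Φ x v - y)) ^ N)) ^ p :=
          lintegral_const_mul' _ _ ENNReal.ofReal_ne_top
      _ ≤ ENNReal.ofReal (B ^ p) * ENNReal.ofReal (A * l ^ (-E)) := by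
          gcongr
          exact hA l hl y
      _ = _ := by rw [← ENNReal.ofReal_mul (by positivity), mul_assoc]
  have hout : ∫⁻ x in (Metric.cthickening r K)ᶜ, ‖pieceKer ψ0 b Φ k l x y‖ₑ ^ p ≤
      ENNReal.ofReal (D ^ p / c ^ (n + 3) * M * l ^ (-E)) := by
    calc _ ≤ ∫⁻ x in (Metric.cthickening r K)ᶜ, ENNReal.ofReal (D ^ p / c ^ (n + 3) * l ^ (-E)) *
          ENNReal.ofReal (1 / (1 + 1 * ‖x‖) ^ (n + 1)) := by
          refine setLIntegral_mono' Metric.isClosed_cthickening.measurableSet.compl fun x hx => ?_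
          rw [← ofReal_norm, ENNReal.ofReal_rpow_of_nonneg (norm_nonneg _) hp.le,
            ← ENNReal.ofReal_mul (by positivity)]
          refine ENNReal.ofReal_le_ofReal ?_
          rw [one_mul]
          set X := 1 + ‖x‖ with hX
          have hX1 : 1 ≤ X := by rw [hX]; linarith [norm_nonneg x]
          have hX0 : 0 < X := by linarith
          have h1 : (2 ^ k) ^ (2 * n + 3) * X ^ (n + 1) ≤ ((2 ^ k * X) ^ N) ^ p := by
            rw [← Real.rpow_natCast _ N, ← Real.rpow_mul (by positivity),
              Real.mul_rpow (by positivity) hX0.le]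
            gcongr
            · rw [← Real.rpow_natCast _ (2 * n + 3)]
              refine Real.rpow_le_rpow_of_exponent_le hμ ?_
              push_cast
              linarith
            · rw [← Real.rpow_natCast _ (n + 1)]
              refine Real.rpow_le_rpow_of_exponent_le hX1 ?_
              push_cast
              linarith
          have h2 : (((2 : ℝ) ^ k) ^ n) ^ p ≤ (2 ^ k) ^ n := by
            conv_rhs => rw [← Real.rpow_one (((2 : ℝ) ^ k) ^ n)]
            exact Real.rpow_le_rpow_of_exponent_le (one_le_pow₀ hμ) hp1
          have h3 : c ^ (n + 3) ≤ (2 ^ k) ^ (n + 3) * l ^ (-E) := by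
            calc c ^ (n + 3) = (c * l) ^ (n + 3) * l ^ (-((n + 3 : ℕ) : ℝ)) := by
                  rw [Real.rpow_neg hl0.le, Real.rpow_natCast, mul_pow]; field_simp
              _ ≤ _ := by
                  gcongr
          calc ‖pieceKer ψ0 b Φ k l x y‖ ^ p ≤ (D * (2 ^ k) ^ n / (2 ^ k * X) ^ N) ^ p := by
                gcongr
                exact hD k l hl0 x hx y
            _ = D ^ p * ((2 ^ k) ^ n) ^ p / ((2 ^ k * X) ^ N) ^ p := by
                rw [Real.div_rpow (by positivity) (by positivity),
                  Real.mul_rpow hD0 (by positivity)]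
            _ ≤ D ^ p * (2 ^ k) ^ n / ((2 ^ k) ^ (2 * n + 3) * X ^ (n + 1)) := by gcongr
            _ = D ^ p / (2 ^ k) ^ (n + 3) * (1 / X ^ (n + 1)) := by
                rw [show 2 * n + 3 = n + (n + 3) by ring, pow_add ((2 : ℝ) ^ k) n (n + 3)]
                field_simp
            _ ≤ _ := by
                gcongr ?_ * _
                rw [div_mul_eq_mul_div, div_le_div_iff₀ (by positivity) (by positivity), mul_assoc]
                gcongr
                rw [mul_comm]
                exact h3
      _ ≤ ∫⁻ x : Rn n, ENNReal.ofReal (D ^ p / c ^ (n + 3) * l ^ (-E)) *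
          ENNReal.ofReal (1 / (1 + 1 * ‖x‖) ^ (n + 1)) := setLIntegral_le_lintegral _ _
      _ = ENNReal.ofReal (D ^ p / c ^ (n + 3) * l ^ (-E)) * ∫⁻ x : Rn n,
          ENNReal.ofReal (1 / (1 + 1 * ‖x‖) ^ (n + 1)) :=
          lintegral_const_mul' _ _ ENNReal.ofReal_ne_top
      _ ≤ ENNReal.ofReal (D ^ p / c ^ (n + 3) * l ^ (-E)) * ENNReal.ofReal M := by gcongr
      _ = _ := by
          rw [← ENNReal.ofReal_mul (by positivity)]
          congr 1
          ring
  rw [← lintegral_add_compl _ (Metric.isClosed_cthickening (δ := r) (E := K)).measurableSet]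
  refine (add_le_add hin hout).trans ?_
  rw [← ENNReal.ofReal_add (by positivity) (by positivity), ← add_mul]
  refine ENNReal.ofReal_le_ofReal ?_
  exact mul_le_mul_of_nonneg_right (by linarith) (by positivity)

end NearPower

section Schur
variable {α β : Type*} [MeasurableSpace α] [MeasurableSpace β] {μ : Measure α} {ν : Measure β}

theorem rpow_lintegral_mul_le {p : ℝ} (hp : 1 ≤ p) {k u : β → ℝ≥0∞}
    (hk : AEMeasurable k ν) (hu : AEMeasurable u ν) :
    (∫⁻ y, k y * u y ∂ν) ^ p ≤ (∫⁻ y, k y ∂ν) ^ (p - 1) * ∫⁻ y, k y * u y ^ p ∂ν := by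
  rcases hp.eq_or_lt with rfl | hp
  · simp
  have hp0 : 0 < p := by linarith
  have hpq := Real.HolderConjugate.conjExponent hp
  have h1 : ∀ y, k y * u y = (k y ^ (1 / p) * u y) * k y ^ (1 / p.conjExponent) := fun y => by
    rw [mul_right_comm, ← ENNReal.rpow_add_of_nonneg _ _ (by positivity)
      (one_div_nonneg.2 hpq.symm.pos.le), one_div, one_div, hpq.inv_add_inv_eq_one,
      ENNReal.rpow_one]
  have h2 := ENNReal.lintegral_mul_le_Lp_mul_Lq ν hpq
    ((hk.pow_const (1 / p)).mul hu) (hk.pow_const (1 / p.conjExponent))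
  simp only [Pi.mul_apply] at h2
  calc (∫⁻ y, k y * u y ∂ν) ^ p
      = (∫⁻ y, (k y ^ (1 / p) * u y) * k y ^ (1 / p.conjExponent) ∂ν) ^ p := by simp only [← h1]
    _ ≤ ((∫⁻ y, (k y ^ (1 / p) * u y) ^ p ∂ν) ^ (1 / p) *
          (∫⁻ y, (k y ^ (1 / p.conjExponent)) ^ p.conjExponent ∂ν) ^ (1 / p.conjExponent)) ^ p := by
        gcongr
    _ = _ := by
        have e1 : ∀ y, (k y ^ (1 / p) * u y) ^ p = k y * u y ^ p := fun y => by
          rw [ENNReal.mul_rpow_of_nonneg _ _ hp0.le, ← ENNReal.rpow_mul,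
            one_div_mul_cancel hp0.ne', ENNReal.rpow_one]
        have e2 : ∀ y, (k y ^ (1 / p.conjExponent)) ^ p.conjExponent = k y := fun y => by
          rw [← ENNReal.rpow_mul, one_div_mul_cancel hpq.symm.pos.ne', ENNReal.rpow_one]
        simp only [e1, e2]
        rw [ENNReal.mul_rpow_of_nonneg _ _ hp0.le, ← ENNReal.rpow_mul, ← ENNReal.rpow_mul,
          one_div_mul_cancel hp0.ne', ENNReal.rpow_one, mul_comm]
        congr 2
        rw [Real.conjExponent]
        field_simp

theorem lintegral_rpow_le_schur [SFinite μ] [SFinite ν] {p : ℝ} (hp : 1 ≤ p)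
    {k : α → β → ℝ≥0∞} {u : β → ℝ≥0∞} (hk : Measurable fun q : α × β => k q.1 q.2)
    (hu : Measurable u) {A B : ℝ≥0∞} (hA : ∀ x, ∫⁻ y, k x y ∂ν ≤ A)
    (hB : ∀ y, ∫⁻ x, k x y ∂μ ≤ B) :
    ∫⁻ x, (∫⁻ y, k x y * u y ∂ν) ^ p ∂μ ≤ A ^ (p - 1) * B * ∫⁻ y, u y ^ p ∂ν := by
  have hp0 : 0 ≤ p - 1 := by linarith
  have hm : Measurable fun q : α × β => k q.1 q.2 * u q.2 ^ p :=
    hk.mul ((hu.comp measurable_snd).pow_const p)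
  calc _ ≤ ∫⁻ x, A ^ (p - 1) * ∫⁻ y, k x y * u y ^ p ∂ν ∂μ := by
        refine lintegral_mono fun x => (rpow_lintegral_mul_le hp
          (show Measurable fun y => k x y from hk.comp measurable_prodMk_left).aemeasurable
          hu.aemeasurable).trans ?_
        gcongr
        exact hA x
    _ = A ^ (p - 1) * ∫⁻ x, ∫⁻ y, k x y * u y ^ p ∂ν ∂μ :=
        lintegral_const_mul _ hm.lintegral_prod_right'
    _ = A ^ (p - 1) * ∫⁻ y, ∫⁻ x, k x y * u y ^ p ∂μ ∂ν := by
        rw [lintegral_lintegral_swap hm.aemeasurable]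
    _ ≤ A ^ (p - 1) * ∫⁻ y, B * u y ^ p ∂ν := by
        gcongr with y
        rw [lintegral_mul_const _ (show Measurable fun x => k x y from
          hk.comp measurable_prodMk_right)]
        gcongr
        exact hB y
    _ = _ := by
        rw [lintegral_const_mul _ (hu.pow_const p), mul_assoc]

end Schur

section PieceOperator
variable {n : ℕ} {K : Set (Rn n)} {Φ : Rn n → Rn n → ℝ} {b : ℝ → Rn n → Rn n → ℂ}
  {ψ0 : Rn n → ℝ}

theorem IsLPBase.continuous_kernel (hψ : IsLPBase n ψ0) (k : ℕ) :
    Continuous (invFT n (lpPiece n ψ0 k)) :=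
  continuous_invFT (hψ.contDiff_piece k) (hψ.hasCompactSupport_piece k)

theorem IsLPBase.exists_lintegral_kernel_le (hψ : IsLPBase n ψ0) :
    ∃ C : ℝ, 0 < C ∧ ∀ k x, ∫⁻ z, ‖invFT n (lpPiece n ψ0 k) (x - z)‖ₑ ≤ ENNReal.ofReal C := by
  obtain ⟨B, hB0, hB⟩ := hψ.exists_kernel_decay (n + 1)
  obtain ⟨D, hD0, hD⟩ := exists_lintegral_dilate_le n
  refine ⟨(B + 1) * D, by positivity, fun k x => ?_⟩
  refine le_trans (lintegral_mono fun z => ?_) (hD (B + 1) (2 ^ k)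
    (by positivity) (by positivity) x)
  rw [← ofReal_norm]
  refine ENNReal.ofReal_le_ofReal ((hB k _).trans ?_)
  gcongr
  linarith

theorem GoodAmp.exists_lintegral_pieceKer_right (hb : GoodAmp n K b) (hΦ : GoodPhase n K Φ)
    (hψ : IsLPBase n ψ0) :
    ∃ C : ℝ, 0 < C ∧ ∀ (k : ℕ) (l : ℝ), 1 ≤ l → ∀ x,
      ∫⁻ y, ‖pieceKer ψ0 b Φ k l x y‖ₑ ≤ ENNReal.ofReal (C / √l ^ (n + 1)) := by
  obtain ⟨A, hA0, hA⟩ := hb.exists_lintegral_ker_right hΦ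
  obtain ⟨B, hB0, hB⟩ := hψ.exists_lintegral_kernel_le
  refine ⟨B * A, by positivity, fun k l hl x => ?_⟩
  have hk := hb.continuous_ker hΦ (by linarith : 0 < l)
  have hψc := hψ.continuous_kernel k
  have hm : Measurable fun q : Rn n × Rn n =>
      ‖invFT n (lpPiece n ψ0 k) (x - q.2)‖ₑ * ‖ker b Φ l q.2 q.1‖ₑ :=
    ((hψc.comp (by fun_prop)).enorm.measurable).mul (hk.comp continuous_swap).enorm.measurable
  calc _ ≤ ∫⁻ y, ∫⁻ z, ‖invFT n (lpPiece n ψ0 k) (x - z)‖ₑ * ‖ker b Φ l z y‖ₑ :=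
        lintegral_mono fun y => enorm_pieceKer_le k l x y
    _ = ∫⁻ z, ∫⁻ y, ‖invFT n (lpPiece n ψ0 k) (x - z)‖ₑ * ‖ker b Φ l z y‖ₑ :=
        lintegral_lintegral_swap hm.aemeasurable
    _ ≤ ∫⁻ z, ‖invFT n (lpPiece n ψ0 k) (x - z)‖ₑ * ENNReal.ofReal (A / √l ^ (n + 1)) := by
        refine lintegral_mono fun z => ?_
        rw [lintegral_const_mul _ (show Measurable fun y => ‖ker b Φ l z y‖ₑ from
          (hk.comp (by fun_prop : Continuous fun y : Rn n => (z, y))).enorm.measurable)]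
        gcongr
        exact hA l hl z
    _ = (∫⁻ z, ‖invFT n (lpPiece n ψ0 k) (x - z)‖ₑ) * ENNReal.ofReal (A / √l ^ (n + 1)) :=
        lintegral_mul_const _ (hψc.comp (by fun_prop)).enorm.measurable
    _ ≤ ENNReal.ofReal B * ENNReal.ofReal (A / √l ^ (n + 1)) := by
        gcongr
        exact hB k x
    _ = _ := by rw [← ENNReal.ofReal_mul (by positivity), mul_div_assoc]

theorem GoodAmp.integral_pieceKer_mul (hb : GoodAmp n K b) (hΦ : GoodPhase n K Φ)
    (hψ : IsLPBase n ψ0) (k : ℕ) {l : ℝ} (hl : 0 < l) {f : Rn n → ℂ} (hf : Integrable f)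
    (x : Rn n) :
    ∫ y, pieceKer ψ0 b Φ k l x y * f y =
      ∫ z, invFT n (lpPiece n ψ0 k) (x - z) * ∫ y, ker b Φ l z y * f y := by
  obtain ⟨A, hA0, hA⟩ := hb.exists_ker_decay hΦ 0
  have hk := hb.continuous_ker hΦ hl
  have hψc := hψ.continuous_kernel k
  have hψi : Integrable fun z => invFT n (lpPiece n ψ0 k) (x - z) :=
    (integrable_invFT (hψ.contDiff_piece k) (hψ.hasCompactSupport_piece k)).comp_sub_left x
  have hint : Integrable (Function.uncurry fun y z : Rn n =>
      invFT n (lpPiece n ψ0 k) (x - z) * ker b Φ l z y * f y)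
      ((volume : Measure (Rn n)).prod volume) := by
    refine Integrable.mono' ((hf.norm.mul_prod hψi.norm).const_mul A) ?_
      (Filter.Eventually.of_forall fun q => ?_)
    · refine AEStronglyMeasurable.mul (Continuous.aestronglyMeasurable ?_)
        hf.aestronglyMeasurable.comp_fst
      exact (hψc.comp (by fun_prop)).mul (hk.comp continuous_swap)
    · have h := hA l hl q.2 q.1
      rw [pow_zero, pow_zero, mul_one, div_one] at h
      simp only [Function.uncurry, norm_mul]
      calc _ ≤ ‖invFT n (lpPiece n ψ0 k) (x - q.2)‖ * A * ‖f q.1‖ := by gcongr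
        _ = _ := by ring
  calc ∫ y, pieceKer ψ0 b Φ k l x y * f y
      = ∫ y, ∫ z, invFT n (lpPiece n ψ0 k) (x - z) * ker b Φ l z y * f y := by
        simp only [pieceKer, integral_mul_const]
    _ = ∫ z, ∫ y, invFT n (lpPiece n ψ0 k) (x - z) * ker b Φ l z y * f y :=
        integral_integral_swap hint
    _ = _ := by simp only [mul_assoc, integral_const_mul]

theorem GoodAmp.exists_pieceKer_ltwo (hb : GoodAmp n K b) (hΦ : GoodPhase n K Φ)
    (hK : IsCompact K) (hψ : IsLPBase n ψ0) :
    ∃ C : ℝ, 0 < C ∧ ∀ (k : ℕ) (l : ℝ), 0 < l → ∀ f : Rn n → ℂ, Integrable f →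
      ∫⁻ x, ‖∫ y, pieceKer ψ0 b Φ k l x y * f y‖ₑ ^ 2 ≤
        ENNReal.ofReal (C / l ^ (2 * n)) * ∫⁻ y, ‖f y‖ₑ ^ 2 := by
  obtain ⟨A, hA0, hA⟩ := hb.exists_ker_ltwo hΦ hK
  obtain ⟨B, hB0, hB⟩ := hψ.exists_lintegral_kernel_le
  refine ⟨B * B * A, by positivity, fun k l hl f hf => ?_⟩
  have hψc := hψ.continuous_kernel k
  let g : Rn n → ℂ := fun z => ∫ y, ker b Φ l z y * f y
  have hg : Continuous g := by
    obtain ⟨A', hA'0, hA'⟩ := hb.exists_ker_decay hΦ 0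
    have hk := hb.continuous_ker hΦ hl
    refine continuous_of_dominated (bound := fun y => A' * ‖f y‖) (fun z => ?_) (fun z => ?_)
      (hf.norm.const_mul A') (Filter.Eventually.of_forall fun y => ?_)
    · exact (hk.comp (by fun_prop : Continuous fun y : Rn n => (z, y))).aestronglyMeasurable.mul
        hf.aestronglyMeasurable
    · refine Filter.Eventually.of_forall fun y => ?_
      have h := hA' l hl z y
      rw [pow_zero, pow_zero, mul_one, div_one] at h
      rw [norm_mul]
      gcongr
    · exact (hk.comp (by fun_prop : Continuous fun z : Rn n => (z, y))).mul continuous_const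
  have hcol : ∀ z, ∫⁻ x, ‖invFT n (lpPiece n ψ0 k) (x - z)‖ₑ ≤ ENNReal.ofReal B := fun z => by
    have h := hB k 0
    rw [lintegral_sub_left_eq_self (fun z => ‖invFT n (lpPiece n ψ0 k) z‖ₑ)] at h
    rwa [lintegral_sub_right_eq_self (fun z => ‖invFT n (lpPiece n ψ0 k) z‖ₑ)]
  have hS := lintegral_rpow_le_schur (μ := (volume : Measure (Rn n))) one_le_two
    (k := fun x z => ‖invFT n (lpPiece n ψ0 k) (x - z)‖ₑ)
    (hψc.comp (by fun_prop : Continuous fun q : Rn n × Rn n => q.1 - q.2)).enorm.measurable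
    hg.enorm.measurable (hB k) hcol
  calc _ ≤ ∫⁻ x, (∫⁻ z, ‖invFT n (lpPiece n ψ0 k) (x - z)‖ₑ * ‖g z‖ₑ) ^ (2 : ℝ) := by
        refine lintegral_mono fun x => ?_
        rw [ENNReal.rpow_two, hb.integral_pieceKer_mul hΦ hψ k hl hf]
        gcongr
        refine (enorm_integral_le_lintegral_enorm _).trans_eq ?_
        simp only [enorm_mul, g]
    _ ≤ ENNReal.ofReal B ^ ((2 : ℝ) - 1) * ENNReal.ofReal B * ∫⁻ z, ‖g z‖ₑ ^ (2 : ℝ) := hS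
    _ = ENNReal.ofReal (B * B) * ∫⁻ z, ‖g z‖ₑ ^ 2 := by
        rw [show (2 : ℝ) - 1 = 1 by norm_num, ENNReal.rpow_one, ENNReal.ofReal_mul hB0.le]
        simp only [ENNReal.rpow_two]
    _ ≤ ENNReal.ofReal (B * B) * (ENNReal.ofReal (A / l ^ (2 * n)) * ∫⁻ y, ‖f y‖ₑ ^ 2) := by
        gcongr
        exact hA l hl f hf
    _ = _ := by
        rw [← mul_assoc, ← ENNReal.ofReal_mul (by positivity), mul_div_assoc]

end PieceOperator

section PowerIntegrals

theorem lintegral_Ioc_rpow {a S : ℝ} (ha : -1 < a) (hS : 0 ≤ S) :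
    ∫⁻ t in Set.Ioc 0 S, ENNReal.ofReal (t ^ a) = ENNReal.ofReal (S ^ (a + 1) / (a + 1)) := by
  have hi := (intervalIntegrable_iff_integrableOn_Ioc_of_le hS).1
    (intervalIntegral.intervalIntegrable_rpow' (a := 0) (b := S) ha)
  rw [← ofReal_integral_eq_lintegral_ofReal hi ((ae_restrict_iff' measurableSet_Ioc).2
    (Filter.Eventually.of_forall fun t ht => Real.rpow_nonneg ht.1.le _)),
    ← intervalIntegral.integral_of_le hS, integral_rpow (Or.inl ha),
    Real.zero_rpow (by linarith), sub_zero]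

theorem lintegral_Ioi_rpow {a S : ℝ} (ha : a < -1) (hS : 0 < S) :
    ∫⁻ t in Set.Ioi S, ENNReal.ofReal (t ^ a) = ENNReal.ofReal (-S ^ (a + 1) / (a + 1)) := by
  rw [← ofReal_integral_eq_lintegral_ofReal (integrableOn_Ioi_rpow_of_lt ha hS)
    ((ae_restrict_iff' measurableSet_Ioi).2
    (Filter.Eventually.of_forall fun t ht => Real.rpow_nonneg (hS.trans ht).le _)),
    integral_Ioi_rpow_of_lt ha hS]

variable {β : Type*} [MeasurableSpace β] {ν : Measure β} [SFinite ν]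

theorem lintegral_rpow_mul_lintegral_ge {a r γ : ℝ} (ha : -1 < a) (hγ : 0 < γ)
    {u : β → ℝ} (hu : Measurable u) (hu0 : ∀ y, 0 ≤ u y) :
    ∫⁻ t in Set.Ioi (0 : ℝ), ENNReal.ofReal (t ^ a) *
      (∫⁻ y, {y | γ * t ≤ u y}.indicator (fun y => ENNReal.ofReal (u y) ^ r) y ∂ν) ≤
    ENNReal.ofReal (γ ^ (-(a + 1)) / (a + 1)) * ∫⁻ y, ENNReal.ofReal (u y) ^ (r + (a + 1)) ∂ν := by
  have hind : Measurable fun q : ℝ × β =>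
      {y | γ * q.1 ≤ u y}.indicator (fun y => ENNReal.ofReal (u y) ^ r) q.2 := by
    have : MeasurableSet {q : ℝ × β | γ * q.1 ≤ u q.2} :=
      measurableSet_le (measurable_fst.const_mul γ) (hu.comp measurable_snd)
    exact (((hu.comp measurable_snd).ennreal_ofReal.pow_const r).indicator this :)
  have hpw : Measurable fun t : ℝ => ENNReal.ofReal (t ^ a) := by fun_prop
  calc _ = ∫⁻ t in Set.Ioi 0, ∫⁻ y, ENNReal.ofReal (t ^ a) *
        {y | γ * t ≤ u y}.indicator (fun y => ENNReal.ofReal (u y) ^ r) y ∂ν := by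
        refine lintegral_congr fun t => (lintegral_const_mul _ ?_).symm
        exact hind.comp measurable_prodMk_left
    _ = ∫⁻ y, (∫⁻ t in Set.Ioi (0 : ℝ), ENNReal.ofReal (t ^ a) *
        {y | γ * t ≤ u y}.indicator (fun y => ENNReal.ofReal (u y) ^ r) y) ∂ν :=
        lintegral_lintegral_swap ((hpw.comp measurable_fst).mul hind).aemeasurable
    _ ≤ ∫⁻ y, ENNReal.ofReal (γ ^ (-(a + 1)) / (a + 1)) *
          ENNReal.ofReal (u y) ^ (r + (a + 1)) ∂ν := by
        refine lintegral_mono fun y => ?_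
        rcases (hu0 y).eq_or_lt with h0 | h0
        · refine le_of_eq_of_le ?_ zero_le
          rw [setLIntegral_eq_zero measurableSet_Ioi fun t (ht : 0 < t) => ?_]
          have : y ∉ {y | γ * t ≤ u y} := by
            rw [Set.mem_ofPred_eq, ← h0, not_le]
            positivity
          simp [Set.indicator_of_notMem this]
        · calc _ = ∫⁻ t in Set.Ioi 0, (Set.Ioc 0 (u y / γ)).indicator (fun t =>
                  ENNReal.ofReal (t ^ a) * ENNReal.ofReal (u y) ^ r) t := by
                refine setLIntegral_congr_fun measurableSet_Ioi fun t (ht : 0 < t) => ?_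
                by_cases h : γ * t ≤ u y
                · rw [Set.indicator_of_mem (show y ∈ {y | γ * t ≤ u y} from h),
                    Set.indicator_of_mem (show t ∈ Set.Ioc 0 (u y / γ) from
                      ⟨ht, (le_div_iff₀' hγ).2 h⟩)]
                · rw [Set.indicator_of_notMem (show y ∉ {y | γ * t ≤ u y} from h),
                    Set.indicator_of_notMem (fun ht' : t ∈ Set.Ioc 0 (u y / γ) =>
                      h ((le_div_iff₀' hγ).1 ht'.2)), mul_zero]
            _ ≤ ∫⁻ t, (Set.Ioc 0 (u y / γ)).indicator (fun t =>
                  ENNReal.ofReal (t ^ a) * ENNReal.ofReal (u y) ^ r) t :=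
                setLIntegral_le_lintegral _ _
            _ = ENNReal.ofReal ((u y / γ) ^ (a + 1) / (a + 1)) * ENNReal.ofReal (u y) ^ r := by
                rw [lintegral_indicator measurableSet_Ioc, lintegral_mul_const _ hpw,
                  lintegral_Ioc_rpow ha (by positivity)]
            _ = _ := by
                rw [ENNReal.ofReal_rpow_of_pos h0, ENNReal.ofReal_rpow_of_pos h0,
                  ← ENNReal.ofReal_mul (div_nonneg (by positivity) (by linarith)),
                  ← ENNReal.ofReal_mul (div_nonneg (by positivity) (by linarith)),
                  Real.div_rpow h0.le hγ.le, Real.rpow_add h0 r (a + 1), Real.rpow_neg hγ.le]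
                congr 1
                field_simp
    _ = _ := lintegral_const_mul _ (hu.ennreal_ofReal.pow_const _)

theorem lintegral_rpow_mul_lintegral_lt {a r γ : ℝ} (ha : a < -1) (hr : 0 < r) (hγ : 0 < γ)
    {u : β → ℝ} (hu : Measurable u) (hu0 : ∀ y, 0 ≤ u y) :
    ∫⁻ t in Set.Ioi (0 : ℝ), ENNReal.ofReal (t ^ a) *
      (∫⁻ y, {y | u y < γ * t}.indicator (fun y => ENNReal.ofReal (u y) ^ r) y ∂ν) ≤
    ENNReal.ofReal (-γ ^ (-(a + 1)) / (a + 1)) *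
      ∫⁻ y, ENNReal.ofReal (u y) ^ (r + (a + 1)) ∂ν := by
  have hind : Measurable fun q : ℝ × β =>
      {y | u y < γ * q.1}.indicator (fun y => ENNReal.ofReal (u y) ^ r) q.2 := by
    have : MeasurableSet {q : ℝ × β | u q.2 < γ * q.1} :=
      measurableSet_lt (hu.comp measurable_snd) (measurable_fst.const_mul γ)
    exact (((hu.comp measurable_snd).ennreal_ofReal.pow_const r).indicator this :)
  have hpw : Measurable fun t : ℝ => ENNReal.ofReal (t ^ a) := by fun_prop
  have ha1 : a + 1 < 0 := by linarith
  calc _ = ∫⁻ t in Set.Ioi 0, ∫⁻ y, ENNReal.ofReal (t ^ a) *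
        {y | u y < γ * t}.indicator (fun y => ENNReal.ofReal (u y) ^ r) y ∂ν := by
        refine lintegral_congr fun t => (lintegral_const_mul _ ?_).symm
        exact hind.comp measurable_prodMk_left
    _ = ∫⁻ y, (∫⁻ t in Set.Ioi (0 : ℝ), ENNReal.ofReal (t ^ a) *
        {y | u y < γ * t}.indicator (fun y => ENNReal.ofReal (u y) ^ r) y) ∂ν :=
        lintegral_lintegral_swap ((hpw.comp measurable_fst).mul hind).aemeasurable
    _ ≤ ∫⁻ y, ENNReal.ofReal (-γ ^ (-(a + 1)) / (a + 1)) *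
          ENNReal.ofReal (u y) ^ (r + (a + 1)) ∂ν := by
        refine lintegral_mono fun y => ?_
        rcases (hu0 y).eq_or_lt with h0 | h0
        · refine le_of_eq_of_le ?_ zero_le
          rw [setLIntegral_eq_zero measurableSet_Ioi fun t (ht : 0 < t) => ?_]
          have : {y | u y < γ * t}.indicator (fun y => ENNReal.ofReal (u y) ^ r) y = 0 :=
            Set.indicator_apply_eq_zero.2 fun _ => by simp [← h0, hr]
          simp [this]
        · calc _ = ∫⁻ t in Set.Ioi 0, (Set.Ioi (u y / γ)).indicator (fun t =>
                  ENNReal.ofReal (t ^ a) * ENNReal.ofReal (u y) ^ r) t := by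
                refine setLIntegral_congr_fun measurableSet_Ioi fun t (ht : 0 < t) => ?_
                by_cases h : u y < γ * t
                · rw [Set.indicator_of_mem (show y ∈ {y | u y < γ * t} from h),
                    Set.indicator_of_mem (show t ∈ Set.Ioi (u y / γ) from
                      (div_lt_iff₀' hγ).2 h)]
                · rw [Set.indicator_of_notMem (show y ∉ {y | u y < γ * t} from h),
                    Set.indicator_of_notMem (fun ht' : t ∈ Set.Ioi (u y / γ) =>
                      h ((div_lt_iff₀' hγ).1 ht')), mul_zero]
            _ ≤ ∫⁻ t, (Set.Ioi (u y / γ)).indicator (fun t =>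
                  ENNReal.ofReal (t ^ a) * ENNReal.ofReal (u y) ^ r) t :=
                setLIntegral_le_lintegral _ _
            _ = ENNReal.ofReal (-(u y / γ) ^ (a + 1) / (a + 1)) * ENNReal.ofReal (u y) ^ r := by
                rw [lintegral_indicator measurableSet_Ioi, lintegral_mul_const _ hpw,
                  lintegral_Ioi_rpow ha (by positivity)]
            _ = _ := by
                rw [ENNReal.ofReal_rpow_of_pos h0, ENNReal.ofReal_rpow_of_pos h0,
                  ← ENNReal.ofReal_mul (div_nonneg_of_nonpos (by simp; positivity) ha1.le),
                  ← ENNReal.ofReal_mul (div_nonneg_of_nonpos (by simp; positivity) ha1.le),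
                  Real.div_rpow h0.le hγ.le, Real.rpow_add h0 r (a + 1), Real.rpow_neg hγ.le]
                congr 1
                field_simp
    _ = _ := lintegral_const_mul _ (hu.ennreal_ofReal.pow_const _)

end PowerIntegrals

section Interpolation
variable {α β : Type*} [MeasurableSpace α] [MeasurableSpace β] {μ : Measure α} {ν : Measure β}

theorem meas_lt_norm_le {g : α → ℂ} (hg : AEStronglyMeasurable g μ) (r : ℕ) {t : ℝ} (ht : 0 < t) :
    μ {x | t < ‖g x‖} ≤ ENNReal.ofReal ((1 / t) ^ r) * ∫⁻ x, ‖g x‖ₑ ^ r ∂μ := by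
  have h := mul_meas_ge_le_lintegral₀ (μ := μ) (hg.enorm.pow_const r) (ENNReal.ofReal (t ^ r))
  have hs : {x | t < ‖g x‖} ⊆ {x | ENNReal.ofReal (t ^ r) ≤ ‖g x‖ₑ ^ r} := fun x hx => by
    rw [Set.mem_ofPred_eq, ENNReal.ofReal_pow ht.le, ← ofReal_norm]
    gcongr
    exact le_of_lt hx
  calc μ {x | t < ‖g x‖} = ENNReal.ofReal ((1 / t) ^ r) * ENNReal.ofReal (t ^ r) *
        μ {x | t < ‖g x‖} := by
        rw [← ENNReal.ofReal_mul (by positivity), ← mul_pow, one_div_mul_cancel ht.ne', one_pow,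
          ENNReal.ofReal_one, one_mul]
    _ ≤ ENNReal.ofReal ((1 / t) ^ r) * (ENNReal.ofReal (t ^ r) *
        μ {x | ENNReal.ofReal (t ^ r) ≤ ‖g x‖ₑ ^ r}) := by
        rw [mul_assoc]
        gcongr
    _ ≤ _ := by gcongr

variable {T : (β → ℂ) → α → ℂ} [SFinite ν]

theorem lintegral_rpow_interpolation_top
    (hadd : ∀ f g, Integrable f ν → Integrable g ν → T (f + g) = T f + T g)
    (hmeas : ∀ f, Integrable f ν → AEStronglyMeasurable (T f) μ)
    {A B p : ℝ} (hA : 0 < A) (hB : 0 < B) (hp : 2 < p)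
    (htop : ∀ f c, Integrable f ν → (∀ y, ‖f y‖ ≤ c) → ∀ x, ‖T f x‖ ≤ A * c)
    (htwo : ∀ f, Integrable f ν → ∫⁻ x, ‖T f x‖ₑ ^ 2 ∂μ ≤ ENNReal.ofReal B * ∫⁻ y, ‖f y‖ₑ ^ 2 ∂ν)
    {f : β → ℂ} (hf : Integrable f ν) (hfm : Measurable f) :
    ∫⁻ x, ‖T f x‖ₑ ^ p ∂μ ≤
      ENNReal.ofReal (4 * p / (p - 2) * 2 ^ (p - 2) * (A ^ (p - 2) * B)) *
        ∫⁻ y, ‖f y‖ₑ ^ p ∂ν := by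
  have hp0 : 0 < p := by linarith
  have hγ : 0 < 1 / (2 * A) := by positivity
  set γ := 1 / (2 * A) with hγd
  have hcut : ∀ t : ℝ, MeasurableSet {y | γ * t ≤ ‖f y‖} := fun t =>
    measurableSet_le measurable_const hfm.norm
  have hwk : ∀ t : ℝ, 0 < t → μ {x | t < ‖T f x‖} ≤ ENNReal.ofReal (4 * B / t ^ 2) *
      ∫⁻ y, {y | γ * t ≤ ‖f y‖}.indicator (fun y => ENNReal.ofReal ‖f y‖ ^ (2 : ℝ)) y ∂ν := by
    intro t ht
    have h1 := hf.indicator (hcut t)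
    have h2 := hf.indicator (hcut t).compl
    have hT : T f = T ({y | γ * t ≤ ‖f y‖}.indicator f) + T ({y | γ * t ≤ ‖f y‖}ᶜ.indicator f) := by
      rw [← hadd _ _ h1 h2, Set.indicator_self_add_compl]
    have hb : ∀ x, ‖T ({y | γ * t ≤ ‖f y‖}ᶜ.indicator f) x‖ ≤ t / 2 := fun x => by
      refine (htop _ (γ * t) h2 (fun y => ?_) x).trans_eq ?_
      · by_cases h : γ * t ≤ ‖f y‖
        · rw [Set.indicator_of_notMem (by simpa using h), norm_zero]
          positivity
        · rw [Set.indicator_of_mem (by simpa using h)]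
          exact (not_le.1 h).le
      · rw [hγd]
        field_simp
    calc μ {x | t < ‖T f x‖} ≤ μ {x | t / 2 < ‖T ({y | γ * t ≤ ‖f y‖}.indicator f) x‖} := by
          refine measure_mono fun x (hx : t < ‖T f x‖) => ?_
          rw [Set.mem_ofPred_eq]
          rw [hT, Pi.add_apply] at hx
          linarith [norm_add_le (T ({y | γ * t ≤ ‖f y‖}.indicator f) x)
            (T ({y | γ * t ≤ ‖f y‖}ᶜ.indicator f) x), hb x]
      _ ≤ ENNReal.ofReal ((1 / (t / 2)) ^ 2) * (ENNReal.ofReal B *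
          ∫⁻ y, ‖{y | γ * t ≤ ‖f y‖}.indicator f y‖ₑ ^ 2 ∂ν) := by
          refine (meas_lt_norm_le (hmeas _ h1) 2 (by positivity)).trans ?_
          gcongr
          exact htwo _ h1
      _ = _ := by
          rw [← mul_assoc, ← ENNReal.ofReal_mul (by positivity)]
          congr 2
          · field_simp
            norm_num
          · refine funext fun y => ?_
            by_cases h : y ∈ {y | γ * t ≤ ‖f y‖}
            · rw [Set.indicator_of_mem h, Set.indicator_of_mem h, ENNReal.rpow_two, ofReal_norm]
            · rw [Set.indicator_of_notMem h, Set.indicator_of_notMem h]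
              simp
  have hlc := lintegral_rpow_eq_lintegral_meas_lt_mul μ
    (Filter.Eventually.of_forall fun x => norm_nonneg (T f x)) (hmeas f hf).norm.aemeasurable hp0
  have hL := lintegral_rpow_mul_lintegral_ge (ν := ν) (r := 2) (a := p - 3) (by linarith) hγ
    hfm.norm (fun y => norm_nonneg _)
  calc ∫⁻ x, ‖T f x‖ₑ ^ p ∂μ = ∫⁻ x, ENNReal.ofReal (‖T f x‖ ^ p) ∂μ := by
        simp only [← ofReal_norm, ENNReal.ofReal_rpow_of_nonneg (norm_nonneg _) hp0.le]
    _ = _ := hlc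
    _ ≤ ENNReal.ofReal p * ∫⁻ t in Set.Ioi 0, ENNReal.ofReal (4 * B) *
          (ENNReal.ofReal (t ^ (p - 3)) *
        ∫⁻ y, {y | γ * t ≤ ‖f y‖}.indicator (fun y => ENNReal.ofReal ‖f y‖ ^ (2 : ℝ)) y ∂ν) := by
        refine mul_le_mul' le_rfl (setLIntegral_mono' measurableSet_Ioi fun t (ht : 0 < t) => ?_)
        refine (mul_le_mul' (hwk t ht) le_rfl).trans_eq ?_
        rw [mul_right_comm, ← mul_assoc, ← ENNReal.ofReal_mul (by positivity),
          ← ENNReal.ofReal_mul (by positivity)]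
        congr 2
        rw [show p - 3 = p - 1 - 2 by ring, Real.rpow_sub ht (p - 1) 2, Real.rpow_two]
        field_simp
    _ ≤ ENNReal.ofReal p * (ENNReal.ofReal (4 * B) *
        (ENNReal.ofReal (γ ^ (-(p - 3 + 1)) / (p - 3 + 1)) *
          ∫⁻ y, ENNReal.ofReal ‖f y‖ ^ (2 + (p - 3 + 1)) ∂ν)) := by
        rw [lintegral_const_mul' _ _ ENNReal.ofReal_ne_top]
        gcongr
    _ = _ := by
        rw [show (2 : ℝ) + (p - 3 + 1) = p by ring, show p - 3 + 1 = p - 2 by ring]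
        have : 0 < p - 2 := by linarith
        simp only [ofReal_norm, ← mul_assoc]
        rw [← ENNReal.ofReal_mul (by positivity), ← ENNReal.ofReal_mul (by positivity)]
        congr 2
        rw [hγd, one_div, Real.inv_rpow (by positivity), Real.rpow_neg (by positivity), inv_inv,
          Real.mul_rpow (by norm_num) hA.le]
        field_simp

theorem lintegral_rpow_interpolation_one
    (hadd : ∀ f g, Integrable f ν → Integrable g ν → T (f + g) = T f + T g)
    (hmeas : ∀ f, Integrable f ν → AEStronglyMeasurable (T f) μ)
    {A B p : ℝ} (hA : 0 < A) (hB : 0 < B) (hp1 : 1 < p) (hp : p < 2)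
    (hone : ∀ f, Integrable f ν → ∫⁻ x, ‖T f x‖ₑ ∂μ ≤ ENNReal.ofReal A * ∫⁻ y, ‖f y‖ₑ ∂ν)
    (htwo : ∀ f, Integrable f ν → ∫⁻ x, ‖T f x‖ₑ ^ 2 ∂μ ≤ ENNReal.ofReal B * ∫⁻ y, ‖f y‖ₑ ^ 2 ∂ν)
    {f : β → ℂ} (hf : Integrable f ν) (hfm : Measurable f) :
    ∫⁻ x, ‖T f x‖ₑ ^ p ∂μ ≤
      ENNReal.ofReal ((2 * p / (p - 1) + 4 * p / (2 - p)) * (A ^ (2 - p) * B ^ (p - 1))) *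
        ∫⁻ y, ‖f y‖ₑ ^ p ∂ν := by
  have hp0 : 0 < p := by linarith
  have hγ : 0 < A / B := by positivity
  set γ := A / B with hγd
  have hcut : ∀ t : ℝ, MeasurableSet {y | γ * t ≤ ‖f y‖} := fun t =>
    measurableSet_le measurable_const hfm.norm
  have hcompl : ∀ t : ℝ, {y | γ * t ≤ ‖f y‖}ᶜ = {y | ‖f y‖ < γ * t} := fun t => by
    ext y
    simp
  have hwk : ∀ t : ℝ, 0 < t → μ {x | t < ‖T f x‖} ≤ ENNReal.ofReal (2 * A / t) *
      (∫⁻ y, {y | γ * t ≤ ‖f y‖}.indicator (fun y => ENNReal.ofReal ‖f y‖ ^ (1 : ℝ)) y ∂ν) +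
      ENNReal.ofReal (4 * B / t ^ 2) *
      ∫⁻ y, {y | ‖f y‖ < γ * t}.indicator (fun y => ENNReal.ofReal ‖f y‖ ^ (2 : ℝ)) y ∂ν := by
    intro t ht
    have h1 := hf.indicator (hcut t)
    have h2 := hf.indicator (hcut t).compl
    have hT : T f = T ({y | γ * t ≤ ‖f y‖}.indicator f) + T ({y | γ * t ≤ ‖f y‖}ᶜ.indicator f) := by
      rw [← hadd _ _ h1 h2, Set.indicator_self_add_compl]
    calc μ {x | t < ‖T f x‖} ≤ μ ({x | t / 2 < ‖T ({y | γ * t ≤ ‖f y‖}.indicator f) x‖} ∪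
            {x | t / 2 < ‖T ({y | γ * t ≤ ‖f y‖}ᶜ.indicator f) x‖}) := by
          refine measure_mono fun x (hx : t < ‖T f x‖) => ?_
          rw [Set.mem_union, Set.mem_ofPred_eq, Set.mem_ofPred_eq]
          rw [hT, Pi.add_apply] at hx
          by_contra! hcon
          linarith [norm_add_le (T ({y | γ * t ≤ ‖f y‖}.indicator f) x)
            (T ({y | γ * t ≤ ‖f y‖}ᶜ.indicator f) x)]
      _ ≤ _ := measure_union_le _ _
      _ ≤ ENNReal.ofReal ((1 / (t / 2)) ^ 1) * (ENNReal.ofReal A *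
          ∫⁻ y, ‖{y | γ * t ≤ ‖f y‖}.indicator f y‖ₑ ∂ν) +
          ENNReal.ofReal ((1 / (t / 2)) ^ 2) * (ENNReal.ofReal B *
          ∫⁻ y, ‖{y | γ * t ≤ ‖f y‖}ᶜ.indicator f y‖ₑ ^ 2 ∂ν) := by
          refine add_le_add ((meas_lt_norm_le (hmeas _ h1) 1 (by positivity)).trans ?_)
            ((meas_lt_norm_le (hmeas _ h2) 2 (by positivity)).trans ?_)
          · simp only [pow_one]
            gcongr
            exact hone _ h1
          · gcongr
            exact htwo _ h2
      _ = _ := by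
          rw [← mul_assoc, ← mul_assoc, ← ENNReal.ofReal_mul (by positivity),
            ← ENNReal.ofReal_mul (by positivity), ← hcompl]
          congr 3
          · field_simp
          · refine funext fun y => ?_
            by_cases h : y ∈ {y | γ * t ≤ ‖f y‖}
            · rw [Set.indicator_of_mem h, Set.indicator_of_mem h, ENNReal.rpow_one, ofReal_norm]
            · rw [Set.indicator_of_notMem h, Set.indicator_of_notMem h]
              simp
          · field_simp
            norm_num
          · refine funext fun y => ?_
            by_cases h : y ∈ {y | γ * t ≤ ‖f y‖}ᶜ
            · rw [Set.indicator_of_mem h, Set.indicator_of_mem h, ENNReal.rpow_two, ofReal_norm]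
            · rw [Set.indicator_of_notMem h, Set.indicator_of_notMem h]
              simp
  have hlc := lintegral_rpow_eq_lintegral_meas_lt_mul μ
    (Filter.Eventually.of_forall fun x => norm_nonneg (T f x)) (hmeas f hf).norm.aemeasurable hp0
  have hL := lintegral_rpow_mul_lintegral_ge (ν := ν) (r := 1) (a := p - 2) (by linarith) hγ
    hfm.norm (fun y => norm_nonneg _)
  have hL' := lintegral_rpow_mul_lintegral_lt (ν := ν) (r := 2) (a := p - 3) (by linarith)
    (by norm_num) hγ hfm.norm (fun y => norm_nonneg _)
  have hind : Measurable fun q : ℝ × β =>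
      {y | γ * q.1 ≤ ‖f y‖}.indicator (fun y => ENNReal.ofReal ‖f y‖ ^ (1 : ℝ)) q.2 := by
    have : MeasurableSet {q : ℝ × β | γ * q.1 ≤ ‖f q.2‖} :=
      measurableSet_le (measurable_fst.const_mul γ) (hfm.norm.comp measurable_snd)
    exact (((hfm.norm.comp measurable_snd).ennreal_ofReal.pow_const (1 : ℝ)).indicator this :)
  calc ∫⁻ x, ‖T f x‖ₑ ^ p ∂μ = ∫⁻ x, ENNReal.ofReal (‖T f x‖ ^ p) ∂μ := by
        simp only [← ofReal_norm, ENNReal.ofReal_rpow_of_nonneg (norm_nonneg _) hp0.le]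
    _ = _ := hlc
    _ ≤ ENNReal.ofReal p * ∫⁻ t in Set.Ioi 0, (ENNReal.ofReal (2 * A) *
          (ENNReal.ofReal (t ^ (p - 2)) *
        ∫⁻ y, {y | γ * t ≤ ‖f y‖}.indicator (fun y => ENNReal.ofReal ‖f y‖ ^ (1 : ℝ)) y ∂ν) +
        ENNReal.ofReal (4 * B) * (ENNReal.ofReal (t ^ (p - 3)) *
        ∫⁻ y, {y | ‖f y‖ < γ * t}.indicator (fun y => ENNReal.ofReal ‖f y‖ ^ (2 : ℝ)) y ∂ν)) := by
        refine mul_le_mul' le_rfl (setLIntegral_mono' measurableSet_Ioi fun t (ht : 0 < t) => ?_)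
        refine (mul_le_mul' (hwk t ht) le_rfl).trans_eq ?_
        rw [add_mul]
        congr 1
        · rw [mul_right_comm, ← mul_assoc, ← ENNReal.ofReal_mul (by positivity),
            ← ENNReal.ofReal_mul (by positivity)]
          congr 2
          rw [show p - 2 = p - 1 - 1 by ring, Real.rpow_sub ht (p - 1) 1, Real.rpow_one]
          field_simp
        · rw [mul_right_comm, ← mul_assoc, ← ENNReal.ofReal_mul (by positivity),
            ← ENNReal.ofReal_mul (by positivity)]
          congr 2
          rw [show p - 3 = p - 1 - 2 by ring, Real.rpow_sub ht (p - 1) 2, Real.rpow_two]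
          field_simp
    _ ≤ ENNReal.ofReal p * (ENNReal.ofReal (2 * A) *
        (ENNReal.ofReal (γ ^ (-(p - 2 + 1)) / (p - 2 + 1)) *
          ∫⁻ y, ENNReal.ofReal ‖f y‖ ^ (1 + (p - 2 + 1)) ∂ν) + ENNReal.ofReal (4 * B) *
        (ENNReal.ofReal (-γ ^ (-(p - 3 + 1)) / (p - 3 + 1)) *
          ∫⁻ y, ENNReal.ofReal ‖f y‖ ^ (2 + (p - 3 + 1)) ∂ν)) := by
        have hm1 : Measurable fun t : ℝ => ENNReal.ofReal (2 * A) * (ENNReal.ofReal (t ^ (p - 2)) *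
            ∫⁻ y, {y | γ * t ≤ ‖f y‖}.indicator (fun y => ENNReal.ofReal ‖f y‖ ^ (1 : ℝ)) y ∂ν) :=
          Measurable.const_mul (Measurable.mul (by fun_prop) hind.lintegral_prod_right') _
        rw [lintegral_add_left hm1, lintegral_const_mul' _ _ ENNReal.ofReal_ne_top,
          lintegral_const_mul' _ _ ENNReal.ofReal_ne_top]
        gcongr
    _ = _ := by
        rw [show (2 : ℝ) + (p - 3 + 1) = p by ring, show (1 : ℝ) + (p - 2 + 1) = p by ring,
          show p - 3 + 1 = -(2 - p) by ring, show p - 2 + 1 = p - 1 by ring, neg_neg,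
          neg_div_neg_eq]
        have h1 : 0 < p - 1 := by linarith
        have h2 : 0 < 2 - p := by linarith
        simp only [ofReal_norm, ← mul_assoc]
        rw [← ENNReal.ofReal_mul (by positivity), ← ENNReal.ofReal_mul (by positivity),
          ← add_mul, ← ENNReal.ofReal_add (by positivity) (by positivity), ← mul_assoc,
          ← ENNReal.ofReal_mul (by positivity)]
        congr 2
        have e1 : γ ^ (-(p - 1)) * A = A ^ (2 - p) * B ^ (p - 1) := by
          rw [hγd, Real.rpow_neg (by positivity), ← Real.inv_rpow (by positivity), inv_div,
            Real.div_rpow hB.le hA.le, show 2 - p = 1 - (p - 1) by ring, Real.rpow_sub hA 1 (p - 1),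
            Real.rpow_one]
          field_simp
        have e2 : γ ^ (2 - p) * B = A ^ (2 - p) * B ^ (p - 1) := by
          rw [hγd, Real.div_rpow hA.le hB.le, show p - 1 = 1 - (2 - p) by ring,
            Real.rpow_sub hB 1 (2 - p),
            Real.rpow_one]
          field_simp
        calc _ = 2 * p / (p - 1) * (γ ^ (-(p - 1)) * A) + 4 * p / (2 - p) * (γ ^ (2 - p) * B) := by
              field_simp
          _ = _ := by rw [e1, e2]; ring

end Interpolation

end

section
open scoped ContDiff FourierTransform SchwartzMap

section BandLimited
variable {n : ℕ} {ψ0 : Rn n → ℝ}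

theorem ftransform_dilate (G : Rn n → ℂ) (ξ : Rn n) :
    ∫ x : Rn n, cexp (-(I * ((⟪x, ξ⟫_ℝ : ℝ) : ℂ))) * G ((2 * Real.pi)⁻¹ • x) =
      ((((2 * Real.pi) ^ n) : ℝ) : ℂ) * 𝓕 G ξ := by
  have hpi : 0 < 2 * Real.pi := by positivity
  have h := Measure.integral_comp_smul (volume : Measure (Rn n))
    (fun u => cexp (-(I * ((2 * Real.pi * ⟪u, ξ⟫_ℝ : ℝ) : ℂ))) * G u) (2 * Real.pi)⁻¹
  rw [finrank_euclideanSpace, Fintype.card_fin, inv_pow, inv_inv, abs_of_pos (by positivity)] at h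
  rw [Real.fourier_eq']
  convert h using 1
  · refine integral_congr_ae (Filter.Eventually.of_forall fun x => ?_)
    simp only [inner_smul_left]
    congr 5
    simp only [conj_trivial]
    rw [← mul_assoc, mul_inv_cancel₀ hpi.ne', one_mul]
  · rw [Complex.real_smul]
    congr 1
    refine integral_congr_ae (Filter.Eventually.of_forall fun x => ?_)
    simp only [smul_eq_mul]
    congr 2
    push_cast
    ring

theorem ftransform_invFT {h : Rn n → ℝ} (hs : ContDiff ℝ ∞ h) (hc : HasCompactSupport h)
    (ξ : Rn n) : ftransform n (invFT n h) ξ = (h ξ : ℂ) := by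
  set g := 𝓕⁻ (testSchwartz hs hc) with hg
  have hpi : ((((2 * Real.pi) ^ n) : ℝ) : ℂ) ≠ 0 := by
    exact_mod_cast (by positivity : (2 * Real.pi) ^ n ≠ 0)
  calc _ = ((((2 * Real.pi) ^ n)⁻¹ : ℝ) : ℂ) *
        ∫ x : Rn n, cexp (-(I * ((⟪x, ξ⟫_ℝ : ℝ) : ℂ))) * g ((2 * Real.pi)⁻¹ • x) := by
        rw [ftransform, ← integral_const_mul]
        refine integral_congr_ae (Filter.Eventually.of_forall fun x => ?_)
        simp only [invFT_eq_schwartz hs hc, ← hg]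
        ring
    _ = 𝓕 (g : Rn n → ℂ) ξ := by
        rw [ftransform_dilate, ← mul_assoc, ofReal_inv, inv_mul_cancel₀ hpi, one_mul]
    _ = (𝓕 g) ξ := by rw [SchwartzMap.fourier_coe]
    _ = _ := by
        rw [hg, FourierTransform.fourier_fourierInv_eq]
        rfl

theorem integral_invFT_mul_cexp {h : Rn n → ℝ} (hs : ContDiff ℝ ∞ h) (hc : HasCompactSupport h)
    (y θ : Rn n) : ∫ w, invFT n h (y - w) * cexp (I * ((⟪w, θ⟫_ℝ : ℝ) : ℂ)) =
      (h θ : ℂ) * cexp (I * ((⟪y, θ⟫_ℝ : ℝ) : ℂ)) := by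
  rw [← ftransform_invFT hs hc θ, ftransform, ← integral_mul_const,
    ← integral_sub_left_eq_self (fun w => cexp (-(I * ((⟪w, θ⟫_ℝ : ℝ) : ℂ))) * invFT n h w *
      cexp (I * ((⟪y, θ⟫_ℝ : ℝ) : ℂ))) volume y]
  refine integral_congr_ae (Filter.Eventually.of_forall fun w => ?_)
  simp only [inner_sub_left]
  rw [mul_right_comm, ← Complex.exp_add, mul_comm]
  congr 2
  push_cast
  ring

theorem IsLPBase.exists_nikolskii (hψ : IsLPBase n ψ0) :
    ∃ C : ℝ, 0 < C ∧ ∀ {α : Type} [MeasurableSpace α] (μ : Measure α) [SFinite μ] (G : α → ℂ)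
      (θ : α → Rn n) (L : ℝ), 0 < L → Integrable G μ → Measurable θ →
      (∀ a, G a ≠ 0 → ‖θ a‖ ≤ L) → ∀ y,
      ‖∫ a, G a * cexp (I * ((⟪y, θ a⟫_ℝ : ℝ) : ℂ)) ∂μ‖ₑ ≤ ENNReal.ofReal (C * L ^ n) *
        ∫⁻ w, ‖∫ a, G a * cexp (I * ((⟪w, θ a⟫_ℝ : ℝ) : ℂ)) ∂μ‖ₑ := by
  obtain ⟨C, hC0, hC⟩ := exists_invFT_decay hψ.1 hψ.hasCompactSupport 0
  refine ⟨C + 1, by positivity, fun {α} _ μ _ G θ L hL hG hθ hsupp y => ?_⟩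
  have hs : ContDiff ℝ ∞ fun ξ => ψ0 (L⁻¹ • ξ) := hψ.1.comp (contDiff_const_smul _)
  have hc : HasCompactSupport fun ξ => ψ0 (L⁻¹ • ξ) :=
    hψ.hasCompactSupport.comp_smul (inv_ne_zero hL.ne')
  set η := invFT n fun ξ => ψ0 (L⁻¹ • ξ) with hη
  have hηi : Integrable η := integrable_invFT hs hc
  have hηb : ∀ w, ‖η w‖ₑ ≤ ENNReal.ofReal ((C + 1) * L ^ n) := fun w => by
    rw [hη, invFT_dilate _ hL, ← ofReal_norm, norm_mul, Complex.norm_real,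
      Real.norm_of_nonneg (by positivity), mul_comm]
    refine ENNReal.ofReal_le_ofReal ?_
    gcongr
    have := hC (L • w)
    rw [pow_zero, div_one] at this
    linarith
  have hint : Integrable (Function.uncurry fun (w : Rn n) (a : α) =>
      η (y - w) * (G a * cexp (I * ((⟪w, θ a⟫_ℝ : ℝ) : ℂ))))
      ((volume : Measure (Rn n)).prod μ) := by
    refine Integrable.mono' ((hηi.comp_sub_left y).norm.mul_prod hG.norm) ?_
      (Filter.Eventually.of_forall fun q => ?_)
    · refine AEStronglyMeasurable.mul
        (hηi.comp_sub_left y).aestronglyMeasurable.comp_fst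
        (hG.aestronglyMeasurable.comp_snd.mul ?_)
      have h1 : Measurable fun q : Rn n × α => ⟪q.1, θ q.2⟫_ℝ :=
        measurable_fst.inner (hθ.comp measurable_snd)
      exact (Complex.measurable_exp.comp
        ((Complex.measurable_ofReal.comp h1).const_mul I)).aestronglyMeasurable
    · show ‖η (y - q.1) * (G q.2 * cexp (I * ((⟪q.1, θ q.2⟫_ℝ : ℝ) : ℂ)))‖ ≤
        ‖η (y - q.1)‖ * ‖G q.2‖
      rw [norm_mul, mul_comm (G q.2), norm_cexp_I_mul]
  have hrep : ∫ a, G a * cexp (I * ((⟪y, θ a⟫_ℝ : ℝ) : ℂ)) ∂μ =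
      ∫ w, η (y - w) * ∫ a, G a * cexp (I * ((⟪w, θ a⟫_ℝ : ℝ) : ℂ)) ∂μ := by
    calc _ = ∫ a, (∫ w, η (y - w) * (G a * cexp (I * ((⟪w, θ a⟫_ℝ : ℝ) : ℂ)))) ∂μ := by
          refine integral_congr_ae (Filter.Eventually.of_forall fun a => ?_)
          have h1 := integral_invFT_mul_cexp hs hc y (θ a)
          simp only [mul_left_comm (η _)]
          rw [integral_const_mul, h1]
          by_cases hGa : G a = 0
          · simp [hGa]
          · rw [hψ.2.1 (L⁻¹ • θ a), ofReal_one, one_mul]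
            rw [norm_smul, Real.norm_of_nonneg (by positivity), inv_mul_le_iff₀ hL, mul_one]
            exact hsupp a hGa
      _ = ∫ w, ∫ a, η (y - w) * (G a * cexp (I * ((⟪w, θ a⟫_ℝ : ℝ) : ℂ))) ∂μ :=
          (integral_integral_swap hint).symm
      _ = _ := by simp only [integral_const_mul]
  rw [hrep]
  calc _ ≤ ∫⁻ w, ‖η (y - w) * ∫ a, G a * cexp (I * ((⟪w, θ a⟫_ℝ : ℝ) : ℂ)) ∂μ‖ₑ :=
        enorm_integral_le_lintegral_enorm _
    _ ≤ ∫⁻ w, ENNReal.ofReal ((C + 1) * L ^ n) *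
          ‖∫ a, G a * cexp (I * ((⟪w, θ a⟫_ℝ : ℝ) : ℂ)) ∂μ‖ₑ := by
        refine lintegral_mono fun w => ?_
        rw [enorm_mul]
        gcongr
        exact hηb _
    _ = _ := lintegral_const_mul' _ _ ENNReal.ofReal_ne_top

theorem rpow_lintegral_le_of_sup_le {α : Type*} [MeasurableSpace α] {μ : Measure α} {p : ℝ}
    (hp : 0 < p) (hp1 : p ≤ 1) {u : α → ℝ≥0∞} {M : ℝ} (hM : 0 < M)
    (hsup : ∀ y, u y ≤ ENNReal.ofReal M * ∫⁻ w, u w ∂μ) (hfin : ∫⁻ w, u w ∂μ ≠ ⊤) :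
    (∫⁻ w, u w ∂μ) ^ p ≤ ENNReal.ofReal (M ^ (1 - p)) * ∫⁻ w, u w ^ p ∂μ := by
  set S := ∫⁻ w, u w ∂μ with hS
  rcases eq_or_ne S 0 with h0 | h0
  · rw [h0, ENNReal.zero_rpow_of_pos hp]
    exact zero_le
  have h1 : S ≤ ENNReal.ofReal (M ^ (1 - p)) * S ^ (1 - p) * ∫⁻ w, u w ^ p ∂μ := by
    have hne : ENNReal.ofReal (M ^ (1 - p)) * S ^ (1 - p) ≠ ⊤ :=
      ENNReal.mul_ne_top ENNReal.ofReal_ne_top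
        (ENNReal.rpow_ne_top_of_nonneg (by linarith) hfin)
    rw [← lintegral_const_mul' _ _ hne]
    refine lintegral_mono fun w => ?_
    calc u w = u w ^ (1 - p) * u w ^ p := by
          rw [← ENNReal.rpow_add_of_nonneg _ _ (by linarith) hp.le, sub_add_cancel,
            ENNReal.rpow_one]
      _ ≤ (ENNReal.ofReal M * S) ^ (1 - p) * u w ^ p := by
          gcongr
          exact hsup w
      _ = _ := by
          rw [ENNReal.mul_rpow_of_nonneg _ _ (by linarith), ENNReal.ofReal_rpow_of_pos hM]
  have h2 : S = S ^ (1 - p) * S ^ p := by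
    rw [← ENNReal.rpow_add_of_nonneg _ _ (by linarith) hp.le, sub_add_cancel, ENNReal.rpow_one]
  have h3 : S ^ (1 - p) ≠ 0 := by
    rw [Ne, ENNReal.rpow_eq_zero_iff]
    rintro (⟨h, -⟩ | ⟨h, -⟩)
    · exact h0 h
    · exact hfin h
  have h4 : S ^ (1 - p) ≠ ⊤ := ENNReal.rpow_ne_top_of_nonneg (by linarith) hfin
  refine (ENNReal.mul_le_mul_iff_right h3 h4).1 ?_
  rw [← h2]
  refine h1.trans_eq ?_
  ring

end BandLimited

end

section
open scoped ContDiff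

/-- An integrable continuous function whose Fourier transform is supported in a ball. -/
structure BandLimited (n : ℕ) (L : ℝ) (f : Rn n → ℂ) : Prop where
  cont : Continuous f
  int : Integrable f
  rep : ∃ G : Rn n → ℂ, Integrable G ∧ (∀ ξ, G ξ ≠ 0 → ‖ξ‖ ≤ L) ∧
    ∀ y, f y = ∫ ξ, G ξ * cexp (I * ((⟪y, ξ⟫_ℝ : ℝ) : ℂ))

section PieceOperator
variable {n : ℕ} {K : Set (Rn n)} {Φ : Rn n → Rn n → ℝ} {b : ℝ → Rn n → Rn n → ℂ}
  {ψ0 : Rn n → ℝ}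

theorem GoodAmp.integrable_pieceOsc (hb : GoodAmp n K b) (hΦ : GoodPhase n K Φ) (hK : IsCompact K)
    (hψ : IsLPBase n ψ0) (k : ℕ) {l : ℝ} (hl : 0 < l) (x : Rn n) :
    Integrable (pieceOsc ψ0 b Φ k l x) := by
  have h1 := hψ.continuous_kernel k
  have hint := (hb.integrable_prod_osc hΦ hK hl (g := fun p : Rn n × Rn n =>
    invFT n (lpPiece n ψ0 k) (x - p.1)) (by fun_prop)).integral_prod_right
  refine hint.congr (Filter.Eventually.of_forall fun v => ?_)
  simp only [pieceOsc]
  refine integral_congr_ae (Filter.Eventually.of_forall fun z => ?_)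
  simp only [mul_comm]

theorem GoodAmp.exists_norm_pieceKer_le (hb : GoodAmp n K b) (hΦ : GoodPhase n K Φ)
    (hK : IsCompact K) (hψ : IsLPBase n ψ0) (k : ℕ) {l : ℝ} (hl : 0 < l) (x : Rn n) :
    ∃ C : ℝ, ∀ y, ‖pieceKer ψ0 b Φ k l x y‖ ≤ C := by
  refine ⟨∫ v, ‖pieceOsc ψ0 b Φ k l x v‖, fun y => ?_⟩
  rw [hb.pieceKer_eq hΦ hK hψ k hl]
  refine (norm_integral_le_integral_norm _).trans_eq ?_
  simp only [norm_mul_cexp_neg_I]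

theorem GoodAmp.integrable_pieceKer_mul (hb : GoodAmp n K b) (hΦ : GoodPhase n K Φ)
    (hK : IsCompact K) (hψ : IsLPBase n ψ0) (k : ℕ) {l : ℝ} (hl : 0 < l) (x : Rn n)
    {f : Rn n → ℂ} (hf : Integrable f) :
    Integrable fun y => pieceKer ψ0 b Φ k l x y * f y := by
  obtain ⟨C, hC⟩ := hb.exists_norm_pieceKer_le hΦ hK hψ k hl x
  exact hf.bdd_mul ((hb.continuous_pieceKer hΦ hK hψ k hl).comp
    (by fun_prop : Continuous fun y : Rn n => (x, y))).aestronglyMeasurable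
    (Filter.Eventually.of_forall hC)

theorem GoodAmp.exists_rpow_integral_pieceKer_le (hb : GoodAmp n K b) (hΦ : GoodPhase n K Φ)
    (hK : IsCompact K) (hψ : IsLPBase n ψ0) {p : ℝ} (hp : 0 < p) (hp1 : p ≤ 1) :
    ∃ C : ℝ, 0 < C ∧ ∀ (k : ℕ) (l L : ℝ), 0 < l → 0 < L → ∀ f, BandLimited n L f → ∀ x,
      ‖∫ y, pieceKer ψ0 b Φ k l x y * f y‖ₑ ^ p ≤
        ENNReal.ofReal ((C * (4 * l + L) ^ n) ^ (1 - p)) *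
          ∫⁻ y, ‖pieceKer ψ0 b Φ k l x y‖ₑ ^ p * ‖f y‖ₑ ^ p := by
  obtain ⟨C, hC0, hC⟩ := hψ.exists_nikolskii
  refine ⟨C, hC0, fun k l L hl hL f hf x => ?_⟩
  obtain ⟨G, hG, hGs, hGf⟩ := hf.rep
  have hO := hb.integrable_pieceOsc hΦ hK hψ k hl x
  have hrep : ∀ y, pieceKer ψ0 b Φ k l x y * f y =
      ∫ a : Rn n × Rn n, pieceOsc ψ0 b Φ k l x a.1 * G a.2 *
        cexp (I * ((⟪y, a.2 - l • a.1⟫_ℝ : ℝ) : ℂ)) ∂(volume.prod volume) := fun y => by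
    rw [hb.pieceKer_eq hΦ hK hψ k hl, hGf, ← integral_prod_mul]
    refine integral_congr_ae (Filter.Eventually.of_forall fun a => ?_)
    simp only
    rw [mul_mul_mul_comm, ← Complex.exp_add]
    congr 2
    rw [inner_sub_right, inner_smul_right]
    push_cast
    ring
  have hfin : ∫⁻ y, ‖pieceKer ψ0 b Φ k l x y * f y‖ₑ ≠ ⊤ :=
    (hb.integrable_pieceKer_mul hΦ hK hψ k hl x hf.int).2.ne
  have hsup : ∀ y, ‖pieceKer ψ0 b Φ k l x y * f y‖ₑ ≤ ENNReal.ofReal (C * (4 * l + L) ^ n) *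
      ∫⁻ w, ‖pieceKer ψ0 b Φ k l x w * f w‖ₑ := fun y => by
    simp only [hrep]
    refine hC (volume.prod volume) _ _ (4 * l + L) (by positivity) (hO.mul_prod hG)
      (by fun_prop) (fun a ha => ?_) y
    have h1 : a.1 ∈ ann n 4 := by
      by_contra h
      exact left_ne_zero_of_mul ha (hb.pieceOsc_eq_zero h)
    have h2 := hGs _ (right_ne_zero_of_mul ha)
    refine (norm_sub_le _ _).trans ?_
    rw [norm_smul, Real.norm_of_nonneg hl.le, mul_comm]
    nlinarith [h1.2]
  calc _ ≤ (∫⁻ y, ‖pieceKer ψ0 b Φ k l x y * f y‖ₑ) ^ p := by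
        gcongr
        exact enorm_integral_le_lintegral_enorm _
    _ ≤ _ := rpow_lintegral_le_of_sup_le hp hp1 (by positivity) hsup hfin
    _ = _ := by simp only [enorm_mul, ENNReal.mul_rpow_of_nonneg _ _ hp.le]

theorem GoodAmp.exists_lintegral_rpow_pieceKer_le (hb : GoodAmp n K b) (hΦ : GoodPhase n K Φ)
    (hK : IsCompact K) (hψ : IsLPBase n ψ0) {p : ℝ} (hp : 0 < p) (hp1 : p ≤ 1) :
    ∃ C : ℝ, 0 < C ∧ ∀ (k : ℕ) (l L : ℝ), 0 < l → 0 < L → ∀ f, BandLimited n L f → ∀ M : ℝ≥0∞,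
      (∀ y, ∫⁻ x, ‖pieceKer ψ0 b Φ k l x y‖ₑ ^ p ≤ M) →
      ∫⁻ x, ‖∫ y, pieceKer ψ0 b Φ k l x y * f y‖ₑ ^ p ≤
        ENNReal.ofReal ((C * (4 * l + L) ^ n) ^ (1 - p)) * M * ∫⁻ y, ‖f y‖ₑ ^ p := by
  obtain ⟨C, hC0, hC⟩ := hb.exists_rpow_integral_pieceKer_le hΦ hK hψ hp hp1
  refine ⟨C, hC0, fun k l L hl hL f hf M hM => ?_⟩
  have hk := hb.continuous_pieceKer hΦ hK hψ k hl
  have hkm : Measurable fun q : Rn n × Rn n => ‖pieceKer ψ0 b Φ k l q.1 q.2‖ₑ ^ p :=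
    hk.enorm.measurable.pow_const p
  have hfm : Measurable fun y => ‖f y‖ₑ ^ p := hf.cont.enorm.measurable.pow_const p
  have hS := lintegral_rpow_le_schur (μ := (volume : Measure (Rn n)))
    (ν := (volume : Measure (Rn n))) le_rfl (A := ⊤)
    (k := fun x y => ‖pieceKer ψ0 b Φ k l x y‖ₑ ^ p) hkm hfm (fun _ => le_top) hM
  simp only [ENNReal.rpow_one, sub_self, ENNReal.rpow_zero, one_mul] at hS
  calc _ ≤ ∫⁻ x, ENNReal.ofReal ((C * (4 * l + L) ^ n) ^ (1 - p)) *
          ∫⁻ y, ‖pieceKer ψ0 b Φ k l x y‖ₑ ^ p * ‖f y‖ₑ ^ p :=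
        lintegral_mono fun x => hC k l L hl hL f hf x
    _ = ENNReal.ofReal ((C * (4 * l + L) ^ n) ^ (1 - p)) *
          ∫⁻ x, ∫⁻ y, ‖pieceKer ψ0 b Φ k l x y‖ₑ ^ p * ‖f y‖ₑ ^ p :=
        lintegral_const_mul' _ _ ENNReal.ofReal_ne_top
    _ ≤ _ := by
        rw [mul_assoc]
        gcongr

theorem GoodAmp.exists_piece_off (hb : GoodAmp n K b) (hΦ : GoodPhase n K Φ)
    (hK : IsCompact K) (hψ : IsLPBase n ψ0) {p : ℝ} (hp : 0 < p) :
    ∃ C₁ c₁ : ℝ, 1 ≤ C₁ ∧ 0 < c₁ ∧ ∀ N : ℕ, ∃ C : ℝ, 0 < C ∧ ∀ (k : ℕ) (l : ℝ), 0 < l →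
      OffDiag C₁ c₁ k l → ∀ f, BandLimited n (2 * max 1 l) f →
      ∫⁻ x, ‖∫ y, pieceKer ψ0 b Φ k l x y * f y‖ₑ ^ p ≤
        ENNReal.ofReal (C * l ^ (-(n * max (p - 1) 0)) / (1 + (l + 2 ^ k)) ^ N) *
          ∫⁻ y, ‖f y‖ₑ ^ p := by
  obtain ⟨C₁, c₁, hC₁, hc₁, hoff⟩ := hb.exists_pieceKer_off hΦ hK hψ
  refine ⟨C₁, c₁, hC₁, hc₁, fun N => ?_⟩
  obtain ⟨D, hD0, hD⟩ := exists_lintegral_inv_pow_le n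
  have hD1 := hD 1 one_pos
  simp only [one_pow, div_one, one_mul] at hD1
  rcases le_total p 1 with hp1 | hp1
  · obtain ⟨N0, hN0⟩ := exists_nat_ge (((N : ℝ) + n + 1) / p)
    rw [div_le_iff₀ hp] at hN0
    obtain ⟨B, hB0, hB⟩ := hoff N0
    obtain ⟨A, hA0, hA⟩ := hb.exists_lintegral_rpow_pieceKer_le hΦ hK hψ hp hp1
    refine ⟨(A * 6 ^ n) ^ (1 - p) * ((B + 1) ^ p * D), by positivity,
      fun k l hl hkl f hf => ?_⟩
    have hW : 1 ≤ 1 + (l + 2 ^ k) := by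
      have : (0 : ℝ) < 2 ^ k := by positivity
      linarith
    set W := 1 + (l + 2 ^ k) with hWd
    have hM : ∀ y, ∫⁻ x, ‖pieceKer ψ0 b Φ k l x y‖ₑ ^ p ≤
        ENNReal.ofReal ((B + 1) ^ p * D / W ^ (N + n)) := fun y => by
      calc _ ≤ ∫⁻ x : Rn n, ENNReal.ofReal ((B + 1) ^ p / W ^ (N + n)) *
            ENNReal.ofReal (1 / (1 + ‖x‖) ^ (n + 1)) := by
            refine lintegral_mono fun x => ?_
            rw [← ofReal_norm, ENNReal.ofReal_rpow_of_nonneg (norm_nonneg _) hp.le,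
              ← ENNReal.ofReal_mul (by positivity)]
            refine ENNReal.ofReal_le_ofReal ?_
            have hX : 1 ≤ 1 + ‖x‖ := by linarith [norm_nonneg x]
            have hY : 1 ≤ 1 + l * ‖y‖ := by
              have : 0 ≤ l * ‖y‖ := by positivity
              linarith
            calc _ ≤ ((B + 1) / (W ^ N0 * (1 + ‖x‖) ^ N0)) ^ p := by
                  refine Real.rpow_le_rpow (norm_nonneg _) ((hB k l hl hkl x y).trans ?_) hp.le
                  have : 1 ≤ (1 + l * ‖y‖) ^ N0 := one_le_pow₀ hY
                  exact div_le_div₀ (by linarith) (by linarith) (by positivity)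
                    (le_mul_of_one_le_right (by positivity) this)
              _ = (B + 1) ^ p / (W ^ ((N0 : ℝ) * p) * (1 + ‖x‖) ^ ((N0 : ℝ) * p)) := by
                  rw [Real.div_rpow (by positivity) (by positivity),
                    Real.mul_rpow (by positivity) (by positivity),
                    ← Real.rpow_natCast, ← Real.rpow_natCast, ← Real.rpow_mul (by positivity),
                    ← Real.rpow_mul (by positivity)]
              _ ≤ (B + 1) ^ p / (W ^ (N + n) * (1 + ‖x‖) ^ (n + 1)) := by
                  have h1 : W ^ (N + n) ≤ W ^ ((N0 : ℝ) * p) := by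
                    rw [← Real.rpow_natCast]
                    refine Real.rpow_le_rpow_of_exponent_le hW ?_
                    push_cast
                    linarith
                  have h2 : (1 + ‖x‖) ^ (n + 1) ≤ (1 + ‖x‖) ^ ((N0 : ℝ) * p) := by
                    rw [← Real.rpow_natCast]
                    refine Real.rpow_le_rpow_of_exponent_le hX ?_
                    push_cast
                    linarith [(Nat.cast_nonneg N : (0 : ℝ) ≤ N)]
                  gcongr
              _ = _ := by field_simp
        _ = ENNReal.ofReal ((B + 1) ^ p / W ^ (N + n)) *
            ∫⁻ x : Rn n, ENNReal.ofReal (1 / (1 + ‖x‖) ^ (n + 1)) :=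
            lintegral_const_mul' _ _ ENNReal.ofReal_ne_top
        _ ≤ ENNReal.ofReal ((B + 1) ^ p / W ^ (N + n)) * ENNReal.ofReal D := by gcongr
        _ = _ := by
            rw [← ENNReal.ofReal_mul (by positivity)]
            congr 1
            ring
    refine (hA k l _ hl (by positivity) f hf _ hM).trans ?_
    rw [← ENNReal.ofReal_mul (by positivity)]
    gcongr
    rw [show max (p - 1) 0 = 0 from max_eq_right (by linarith), mul_zero, neg_zero, Real.rpow_zero,
      mul_one]
    have h1 : 4 * l + 2 * max 1 l ≤ 6 * W := by
      have : (0 : ℝ) < 2 ^ k := by positivity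
      rcases max_cases 1 l with ⟨h, -⟩ | ⟨h, -⟩ <;> rw [h] <;> linarith
    calc _ ≤ (A * (6 * W) ^ n) ^ (1 - p) * ((B + 1) ^ p * D / W ^ (N + n)) := by
          gcongr
      _ = (A * 6 ^ n) ^ (1 - p) * (W ^ n) ^ (1 - p) * ((B + 1) ^ p * D / W ^ (N + n)) := by
          rw [mul_pow, ← mul_assoc, Real.mul_rpow (by positivity) (by positivity)]
      _ ≤ (A * 6 ^ n) ^ (1 - p) * (W ^ n) ^ (1 : ℝ) * ((B + 1) ^ p * D / W ^ (N + n)) := by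
          gcongr
          · exact one_le_pow₀ hW
          · linarith
      _ = _ := by
          rw [Real.rpow_one, pow_add]
          field_simp
  · obtain ⟨B, hB0, hB⟩ := hoff (N + n + 1)
    refine ⟨(B + 1) ^ p * D ^ p, by positivity, fun k l hl hkl f hf => ?_⟩
    have hW : 1 ≤ 1 + (l + 2 ^ k) := by
      have : (0 : ℝ) < 2 ^ k := by positivity
      linarith
    set W := 1 + (l + 2 ^ k) with hWd
    have hker : ∀ x y : Rn n, ‖pieceKer ψ0 b Φ k l x y‖ ≤
        (B + 1) / W ^ N * (1 / ((1 + ‖x‖) ^ (n + 1) * (1 + l * ‖y‖) ^ (n + 1))) := fun x y => by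
      have hX : 1 ≤ 1 + ‖x‖ := by linarith [norm_nonneg x]
      have hY : 1 ≤ 1 + l * ‖y‖ := by
        have : 0 ≤ l * ‖y‖ := by positivity
        linarith
      calc _ ≤ _ := hB k l hl hkl x y
        _ ≤ (B + 1) / (W ^ N * (1 + ‖x‖) ^ (n + 1) * (1 + l * ‖y‖) ^ (n + 1)) := by
            gcongr
            · linarith
            · omega
            · omega
            · omega
        _ = _ := by field_simp
    have hx : ∀ x, ∫⁻ y, ‖pieceKer ψ0 b Φ k l x y‖ₑ ≤
        ENNReal.ofReal ((B + 1) / W ^ N * (D / l ^ n)) := fun x => by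
      calc _ ≤ ∫⁻ y : Rn n, ENNReal.ofReal ((B + 1) / W ^ N) *
            ENNReal.ofReal (1 / (1 + l * ‖y‖) ^ (n + 1)) := by
            refine lintegral_mono fun y => ?_
            rw [← ofReal_norm, ← ENNReal.ofReal_mul (by positivity)]
            refine ENNReal.ofReal_le_ofReal ((hker x y).trans ?_)
            have hX : 1 ≤ (1 + ‖x‖) ^ (n + 1) := one_le_pow₀ (by linarith [norm_nonneg x])
            gcongr
            exact le_mul_of_one_le_left (by positivity) hX
        _ = ENNReal.ofReal ((B + 1) / W ^ N) *
            ∫⁻ y : Rn n, ENNReal.ofReal (1 / (1 + l * ‖y‖) ^ (n + 1)) :=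
            lintegral_const_mul' _ _ ENNReal.ofReal_ne_top
        _ ≤ ENNReal.ofReal ((B + 1) / W ^ N) * ENNReal.ofReal (D / l ^ n) := by
            gcongr
            exact hD l hl
        _ = _ := by rw [← ENNReal.ofReal_mul (by positivity)]
    have hy : ∀ y, ∫⁻ x, ‖pieceKer ψ0 b Φ k l x y‖ₑ ≤
        ENNReal.ofReal ((B + 1) / W ^ N * D) := fun y => by
      calc _ ≤ ∫⁻ x : Rn n, ENNReal.ofReal ((B + 1) / W ^ N) *
            ENNReal.ofReal (1 / (1 + ‖x‖) ^ (n + 1)) := by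
            refine lintegral_mono fun x => ?_
            rw [← ofReal_norm, ← ENNReal.ofReal_mul (by positivity)]
            refine ENNReal.ofReal_le_ofReal ((hker x y).trans ?_)
            have hY : 1 ≤ (1 + l * ‖y‖) ^ (n + 1) := one_le_pow₀ (by
              have : 0 ≤ l * ‖y‖ := by positivity
              linarith)
            gcongr
            exact le_mul_of_one_le_right (by positivity) hY
        _ = ENNReal.ofReal ((B + 1) / W ^ N) *
            ∫⁻ x : Rn n, ENNReal.ofReal (1 / (1 + ‖x‖) ^ (n + 1)) :=
            lintegral_const_mul' _ _ ENNReal.ofReal_ne_top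
        _ ≤ ENNReal.ofReal ((B + 1) / W ^ N) * ENNReal.ofReal D := by gcongr
        _ = _ := by rw [← ENNReal.ofReal_mul (by positivity)]
    have hS := lintegral_rpow_le_schur hp1 (k := fun x y => ‖pieceKer ψ0 b Φ k l x y‖ₑ)
      (hb.continuous_pieceKer hΦ hK hψ k hl).enorm.measurable hf.cont.enorm.measurable hx hy
    calc _ ≤ ∫⁻ x, (∫⁻ y, ‖pieceKer ψ0 b Φ k l x y‖ₑ * ‖f y‖ₑ) ^ p := by
          refine lintegral_mono fun x => ?_
          gcongr
          refine (enorm_integral_le_lintegral_enorm _).trans_eq ?_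
          simp only [enorm_mul]
      _ ≤ _ := hS
      _ ≤ _ := by
          rw [ENNReal.ofReal_rpow_of_pos (by positivity), ← ENNReal.ofReal_mul (by positivity)]
          gcongr
          rw [max_eq_left (by linarith)]
          have e1 : ((B + 1) / W ^ N * (D / l ^ n)) ^ (p - 1) =
              ((B + 1) / W ^ N * D) ^ (p - 1) * l ^ (-(n * (p - 1))) := by
            rw [← mul_div_assoc, Real.div_rpow (by positivity) (by positivity),
              ← Real.rpow_natCast l n, ← Real.rpow_mul hl.le, Real.rpow_neg hl.le, div_eq_mul_inv]
          have e2 : ((B + 1) / W ^ N * D) ^ (p - 1) * ((B + 1) / W ^ N * D) =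
              ((B + 1) / W ^ N * D) ^ p := by
            rw [← Real.rpow_add_one (by positivity), sub_add_cancel]
          rw [e1, mul_right_comm, e2, Real.mul_rpow (by positivity) hD0.le,
            Real.div_rpow (by positivity) (by positivity)]
          have h3 : W ^ N ≤ (W ^ N) ^ p := by
            conv_lhs => rw [← Real.rpow_one (W ^ N)]
            exact Real.rpow_le_rpow_of_exponent_le (one_le_pow₀ hW) hp1
          calc _ = (B + 1) ^ p * D ^ p * l ^ (-(n * (p - 1))) / (W ^ N) ^ p := by ring
            _ ≤ _ := by gcongr

end PieceOperator

theorem ofReal_mul_rpow_le {l e e' C D : ℝ} (hl : 0 < l) (h : C ≤ D * l ^ e')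
    (he : e' = e) {u v : ℝ≥0∞} (huv : u ≤ ENNReal.ofReal C * v) :
    u ≤ ENNReal.ofReal ((D + 1) * l ^ e) * v := by
  refine huv.trans (mul_le_mul_left (ENNReal.ofReal_le_ofReal (h.trans ?_)) _)
  rw [he]
  have := Real.rpow_pos_of_pos hl e
  nlinarith

section NearDiagonal
variable {n : ℕ} {K : Set (Rn n)} {Φ : Rn n → Rn n → ℝ} {b : ℝ → Rn n → Rn n → ℂ}
  {ψ0 : Rn n → ℝ}

/-- The estimate of a frequency-localized piece whose output frequency is comparable to `l`. -/
theorem GoodAmp.exists_piece_near (hb : GoodAmp n K b) (hΦ : GoodPhase n K Φ)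
    (hK : IsCompact K) (hψ : IsLPBase n ψ0) {p : ℝ} (hp : 0 < p) {c : ℝ} (hc : 0 < c)
    (hc1 : c ≤ 1) :
    ∃ C : ℝ, 0 < C ∧ ∀ (k : ℕ) (l : ℝ), 1 ≤ l → c * l ≤ 2 ^ k →
      ∀ f, BandLimited n (2 * max 1 l) f →
      ∫⁻ x, ‖∫ y, pieceKer ψ0 b Φ k l x y * f y‖ₑ ^ p ≤
        ENNReal.ofReal (C * l ^ (-(n * p) + ((n : ℝ) - 1) * |1 - p / 2|)) *
          ∫⁻ y, ‖f y‖ₑ ^ p := by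
  obtain ⟨C₂, hC₂, htwo⟩ := hb.exists_pieceKer_ltwo hΦ hK hψ
  have hadd : ∀ (k : ℕ) {l : ℝ}, 0 < l → ∀ f g : Rn n → ℂ, Integrable f → Integrable g →
      (fun x => ∫ y, pieceKer ψ0 b Φ k l x y * (f + g) y) =
        (fun x => ∫ y, pieceKer ψ0 b Φ k l x y * f y) +
          fun x => ∫ y, pieceKer ψ0 b Φ k l x y * g y := by
    intro k l hl f g hf hg
    funext x
    simp only [Pi.add_apply, mul_add]
    exact integral_add (hb.integrable_pieceKer_mul hΦ hK hψ k hl x hf)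
      (hb.integrable_pieceKer_mul hΦ hK hψ k hl x hg)
  have hmeas : ∀ (k : ℕ) {l : ℝ}, 0 < l → ∀ f : Rn n → ℂ, Integrable f →
      AEStronglyMeasurable (fun x => ∫ y, pieceKer ψ0 b Φ k l x y * f y) volume := by
    intro k l hl f hf
    exact ((hb.continuous_pieceKer hΦ hK hψ k hl).aestronglyMeasurable.mul
      hf.1.comp_snd).integral_prod_right'
  have hpow : ∀ {l : ℝ}, 0 < l → C₂ / l ^ (2 * n) = C₂ * l ^ (-(2 * (n : ℝ))) := by
    intro l hl
    rw [Real.rpow_neg hl.le, div_eq_mul_inv]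
    congr 2
    exact_mod_cast (Real.rpow_natCast l (2 * n)).symm
  rcases le_or_gt p 1 with hp1 | hp1
  · obtain ⟨A, hA0, hA⟩ := hb.exists_lintegral_rpow_pieceKer_le hΦ hK hψ hp hp1
    obtain ⟨B, hB0, hB⟩ := hb.exists_lintegral_pieceKer_rpow hΦ hK hψ hp hp1 hc hc1
    refine ⟨(A * 6 ^ n) ^ (1 - p) * B + 1, by positivity, fun k l hl hkl f hf => ?_⟩
    have hl0 : 0 < l := by linarith
    have := hA k l _ hl0 (by positivity) f hf _ (hB k l hl hkl)
    rw [← ENNReal.ofReal_mul (by positivity)] at this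
    refine ofReal_mul_rpow_le hl0
      (e' := n * (1 - p) + -(1 + p * (((n : ℝ) - 1) / 2))) (le_of_eq ?_) ?_ this
    · rw [max_eq_right hl, show 4 * l + 2 * l = 6 * l by ring, mul_pow, ← mul_assoc A,
        Real.mul_rpow (by positivity) (by positivity), ← Real.rpow_natCast l n,
        ← Real.rpow_mul hl0.le, Real.rpow_add hl0]
      ring
    · rw [abs_of_nonneg (by linarith)]
      ring
  rcases lt_trichotomy p 2 with hp2 | rfl | hp2
  · obtain ⟨B, hB0, hB⟩ := hb.exists_lintegral_pieceKer_rpow hΦ hK hψ one_pos le_rfl hc hc1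
    have hP : 0 < 2 * p / (p - 1) + 4 * p / (2 - p) := by
      have h1 : 0 < p - 1 := by linarith
      have h2 : 0 < 2 - p := by linarith
      positivity
    refine ⟨(2 * p / (p - 1) + 4 * p / (2 - p)) * (B ^ (2 - p) * C₂ ^ (p - 1)) + 1, by positivity,
      fun k l hl hkl f hf => ?_⟩
    have hl0 : 0 < l := by linarith
    have hk := hb.continuous_pieceKer hΦ hK hψ k hl0
    have hone : ∀ g : Rn n → ℂ, Integrable g →
        ∫⁻ x, ‖∫ y, pieceKer ψ0 b Φ k l x y * g y‖ₑ ≤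
          ENNReal.ofReal (B * l ^ (-(1 + 1 * (((n : ℝ) - 1) / 2)))) * ∫⁻ y, ‖g y‖ₑ := by
      intro g hg
      calc _ ≤ ∫⁻ x, ∫⁻ y, ‖pieceKer ψ0 b Φ k l x y‖ₑ * ‖g y‖ₑ := by
            refine lintegral_mono fun x => (enorm_integral_le_lintegral_enorm _).trans_eq ?_
            simp only [enorm_mul]
        _ = ∫⁻ y, ∫⁻ x, ‖pieceKer ψ0 b Φ k l x y‖ₑ * ‖g y‖ₑ :=
            lintegral_lintegral_swap (hk.enorm.measurable.aemeasurable.mul hg.1.comp_snd.enorm)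
        _ ≤ ∫⁻ y, ENNReal.ofReal (B * l ^ (-(1 + 1 * (((n : ℝ) - 1) / 2)))) * ‖g y‖ₑ := by
            refine lintegral_mono fun y => ?_
            rw [lintegral_mul_const' _ _ enorm_ne_top]
            gcongr
            have := hB k l hl hkl y
            simpa only [ENNReal.rpow_one] using this
        _ = _ := lintegral_const_mul' _ _ ENNReal.ofReal_ne_top
    have := lintegral_rpow_interpolation_one (hadd k hl0) (hmeas k hl0)
      (by positivity) (by positivity) hp1 hp2 hone (htwo k l hl0) hf.int hf.cont.measurable
    refine ofReal_mul_rpow_le hl0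
      (e' := -(1 + 1 * (((n : ℝ) - 1) / 2)) * (2 - p) + -(2 * (n : ℝ)) * (p - 1))
      (le_of_eq ?_) ?_ this
    · rw [hpow hl0, Real.mul_rpow (by positivity) (by positivity),
        Real.mul_rpow (by positivity) (by positivity), ← Real.rpow_mul hl0.le,
        ← Real.rpow_mul hl0.le, Real.rpow_add hl0]
      ring
    · rw [abs_of_nonneg (by linarith)]
      ring
  · refine ⟨C₂ + 1, by positivity, fun k l hl hkl f hf => ?_⟩
    have hl0 : 0 < l := by linarith
    have := htwo k l hl0 f hf.int
    simp only [← ENNReal.rpow_natCast] at this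
    refine ofReal_mul_rpow_le hl0 (le_of_eq (hpow hl0)) ?_ (by exact_mod_cast this)
    norm_num
    ring
  · obtain ⟨B, hB0, hB⟩ := hb.exists_lintegral_pieceKer_right hΦ hψ
    have hp20 : 0 < p - 2 := by linarith
    refine ⟨4 * p / (p - 2) * 2 ^ (p - 2) * (B ^ (p - 2) * C₂) + 1, by positivity,
      fun k l hl hkl f hf => ?_⟩
    have hl0 : 0 < l := by linarith
    have htop : ∀ (g : Rn n → ℂ) (M : ℝ), Integrable g → (∀ y, ‖g y‖ ≤ M) → ∀ x,
        ‖∫ y, pieceKer ψ0 b Φ k l x y * g y‖ ≤ B / √l ^ (n + 1) * M := by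
      intro g M hg hM x
      have hM0 : 0 ≤ M := (norm_nonneg _).trans (hM 0)
      rw [← ENNReal.ofReal_le_ofReal_iff (by positivity), ofReal_norm]
      calc _ ≤ ∫⁻ y, ‖pieceKer ψ0 b Φ k l x y‖ₑ * ‖g y‖ₑ := by
            refine (enorm_integral_le_lintegral_enorm _).trans_eq ?_
            simp only [enorm_mul]
        _ ≤ ∫⁻ y, ‖pieceKer ψ0 b Φ k l x y‖ₑ * ENNReal.ofReal M := by
            gcongr with y
            rw [← ofReal_norm]
            exact ENNReal.ofReal_le_ofReal (hM y)
        _ = (∫⁻ y, ‖pieceKer ψ0 b Φ k l x y‖ₑ) * ENNReal.ofReal M :=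
            lintegral_mul_const' _ _ ENNReal.ofReal_ne_top
        _ ≤ _ := by
            rw [ENNReal.ofReal_mul (by positivity)]
            gcongr
            exact hB k l hl x
    have := lintegral_rpow_interpolation_top (hadd k hl0) (hmeas k hl0)
      (by positivity) (by positivity) hp2 htop (htwo k l hl0) hf.int hf.cont.measurable
    refine ofReal_mul_rpow_le hl0
      (e' := -(((n : ℝ) + 1) / 2) * (p - 2) + -(2 * (n : ℝ))) (le_of_eq ?_) ?_ this
    · have h1 : B / √l ^ (n + 1) = B * l ^ (-(((n : ℝ) + 1) / 2)) := by
        rw [Real.rpow_neg hl0.le, div_eq_mul_inv, Real.sqrt_eq_rpow, ← Real.rpow_natCast,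
          ← Real.rpow_mul hl0.le]
        congr 3
        push_cast
        ring
      rw [hpow hl0, h1, Real.mul_rpow (by positivity) (by positivity),
        ← Real.rpow_mul hl0.le, Real.rpow_add hl0]
      ring
    · rw [abs_of_nonpos (by linarith)]
      ring

end NearDiagonal

theorem rpow_le_of_comparable {x y B : ℝ} (hx : 0 < x) (hB : 1 ≤ B) (h1 : x / B ≤ y)
    (h2 : y ≤ B * x) (e : ℝ) : y ^ e ≤ B ^ |e| * x ^ e := by
  have hB0 : 0 < B := by linarith
  have hy : 0 < y := lt_of_lt_of_le (by positivity) h1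
  rcases le_total 0 e with he | he
  · rw [abs_of_nonneg he, ← Real.mul_rpow hB0.le hx.le]
    gcongr
  · rw [abs_of_nonpos he]
    refine (Real.rpow_le_rpow_of_nonpos (by positivity) h1 he).trans_eq ?_
    rw [Real.div_rpow hx.le hB0.le, Real.rpow_neg hB0.le]
    ring

theorem UB.univ_of_support {ι E F : Type*} [NormedAddCommGroup E] [NormedSpace ℝ E]
    [NormedAddCommGroup F] [NormedSpace ℝ F] {s : Set E} {f : ι → E → F} (hf : UB s f)
    (hs : IsClosed s) (h : ∀ i x, f i x ≠ 0 → x ∈ s) : UB Set.univ f := by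
  refine ⟨hf.1, fun k => ?_⟩
  obtain ⟨C, hC0, hC⟩ := hf.bound k
  refine ⟨C, fun i x _ => ?_⟩
  by_cases hx : x ∈ s
  · exact hC i x hx
  have : Filter.EventuallyEq (nhds x) (f i) fun _ => 0 := by
    filter_upwards [hs.isOpen_compl.mem_nhds hx] with y hy
    by_contra h0
    exact hy (h i y h0)
  rw [(this.iteratedFDeriv ℝ k).eq_of_nhds]
  simpa using hC0.le

section Amplitude
variable {n : ℕ} {K : Set (Rn n)} {m : ℝ} {a : Rn n → Rn n → ℂ}

theorem SymbolClass.ub_right (ha : SymbolClass n m a) :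
    UB (ann n 4) fun (i : {l : ℝ // 0 < l} × Rn n) v =>
      (1 + (i.1 : ℝ)) ^ (-m) • a i.2 ((i.1 : ℝ) • v) := by
  have hsm : ∀ z, ContDiff ℝ ∞ (a z) := fun z =>
    ha.1.comp (contDiff_const.prodMk contDiff_id : ContDiff ℝ ∞ fun v : Rn n => (z, v))
  have hsm' : ∀ z (l : ℝ), ContDiff ℝ ∞ fun v => a z (l • v) := fun z l =>
    (hsm z).comp (contDiff_const_smul l)
  refine ⟨fun i => (hsm' _ _).const_smul _, fun k => ?_⟩
  obtain ⟨C, hC⟩ := ha.2 k 0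
  refine ⟨|C| * 32 ^ |(m - k) / 2|, fun ⟨⟨l, hl⟩, z⟩ v hv => ?_⟩
  have hk : ((k : ℕ) : WithTop ℕ∞) ≤ ((⊤ : ℕ∞) : WithTop ℕ∞) :=
    WithTop.coe_le_coe.2 (le_top : ((k : ℕ) : ℕ∞) ≤ ⊤)
  have hW : 0 < 1 + l := by linarith
  have hval : ‖iteratedFDeriv ℝ k (a z) (l • v)‖ ≤
      |C| * (1 + ‖l • v‖ ^ 2) ^ ((m - (k : ℝ)) / 2) := by
    have := hC z (l • v)
    have e : (fun ξ' => iteratedFDeriv ℝ 0 (fun x' => a x' ξ') z) =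
        (continuousMultilinearCurryFin0 ℝ (Rn n) ℂ).symm ∘ a z := by
      funext ξ'
      rw [iteratedFDeriv_zero_eq_comp]
      rfl
    rw [e, LinearIsometryEquiv.norm_iteratedFDeriv_comp_left] at this
    exact this.trans (by gcongr; exact le_abs_self C)
  have hlv : ‖l • v‖ = l * ‖v‖ := by rw [norm_smul, Real.norm_of_nonneg hl.le]
  have h1 : (1 / 4 : ℝ) * l ≤ ‖l • v‖ := by
    rw [hlv]
    have := hv.1
    norm_num at this
    nlinarith
  have h2 : ‖l • v‖ ≤ 4 * l := by
    rw [hlv]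
    nlinarith [hv.2]
  have hcomp := rpow_le_of_comparable (x := (1 + l) ^ 2) (y := 1 + ‖l • v‖ ^ 2) (B := 32)
    (by positivity) (by norm_num) (by nlinarith [sq_nonneg (l - 1), norm_nonneg (l • v)])
    (by nlinarith [norm_nonneg (l • v)]) ((m - k) / 2)
  have hsq : ((1 + l) ^ 2) ^ ((m - k) / 2) = (1 + l) ^ m * ((1 + l) ^ k)⁻¹ := by
    rw [← Real.rpow_natCast, ← Real.rpow_natCast, ← Real.rpow_neg hW.le, ← Real.rpow_mul hW.le,
      ← Real.rpow_add hW]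
    congr 1
    push_cast
    ring
  simp only
  rw [iteratedFDeriv_const_smul_apply' ((hsm' z l).of_le hk).contDiffAt,
    iteratedFDeriv_comp_const_smul _ ((hsm z).of_le hk), norm_smul, norm_smul, norm_pow,
    Real.norm_of_nonneg hl.le, Real.norm_of_nonneg (by positivity)]
  calc _ ≤ (1 + l) ^ (-m) * (l ^ k * (|C| * (32 ^ |(m - k) / 2| *
        ((1 + l) ^ m * ((1 + l) ^ k)⁻¹)))) := by
        gcongr
        refine hval.trans ?_
        rw [← hsq]
        gcongr
    _ = |C| * 32 ^ |(m - k) / 2| * (l / (1 + l)) ^ k := by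
        rw [Real.rpow_neg hW.le, div_pow]
        field_simp
    _ ≤ |C| * 32 ^ |(m - k) / 2| * 1 := by
        gcongr
        exact pow_le_one₀ (by positivity) ((div_le_one hW).2 (by linarith))
    _ = _ := mul_one _

theorem SymbolClass.exists_left_bound (ha : SymbolClass n m a) (k : ℕ) :
    ∃ C : ℝ, 0 ≤ C ∧ ∀ l : ℝ, 0 < l → ∀ v ∈ ann n 4, ∀ x,
      (1 + l) ^ (-m) * ‖iteratedFDeriv ℝ k (fun x' => a x' (l • v)) x‖ ≤ C := by
  obtain ⟨C, hC⟩ := ha.2 0 k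
  refine ⟨|C| * 32 ^ |m / 2|, by positivity, fun l hl v hv x => ?_⟩
  have hW : 0 < 1 + l := by linarith
  have hlv : ‖l • v‖ = l * ‖v‖ := by rw [norm_smul, Real.norm_of_nonneg hl.le]
  have h1 : (1 / 4 : ℝ) * l ≤ ‖l • v‖ := by
    rw [hlv]
    have := hv.1
    norm_num at this
    nlinarith
  have h2 : ‖l • v‖ ≤ 4 * l := by
    rw [hlv]
    nlinarith [hv.2]
  have hcomp := rpow_le_of_comparable (x := (1 + l) ^ 2) (y := 1 + ‖l • v‖ ^ 2) (B := 32)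
    (by positivity) (by norm_num) (by nlinarith [sq_nonneg (l - 1), norm_nonneg (l • v)])
    (by nlinarith [norm_nonneg (l • v)]) (m / 2)
  have hsq : ((1 + l) ^ 2) ^ (m / 2) = (1 + l) ^ m := by
    rw [← Real.rpow_natCast, ← Real.rpow_mul hW.le]
    congr 1
    push_cast
    ring
  have := hC x (l • v)
  rw [norm_iteratedFDeriv_zero, Nat.cast_zero, sub_zero] at this
  calc _ ≤ (1 + l) ^ (-m) * (|C| * (32 ^ |m / 2| * (1 + l) ^ m)) := by
        rw [← hsq]
        gcongr
        exact this.trans (by gcongr; exact le_abs_self C)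
    _ = |C| * 32 ^ |m / 2| := by
        rw [Real.rpow_neg hW.le]
        field_simp

/-- The normalized amplitude localized to frequencies of size `l`. -/
def localAmp (m : ℝ) (a : Rn n → Rn n → ℂ) (χ : Rn n → ℝ) (l : ℝ) (z v : Rn n) : ℂ :=
  (1 + l) ^ (-m) • a z (l • v) * (χ v : ℂ)

theorem SymbolClass.goodAmp (ha : SymbolClass n m a) (haK : ∀ x, x ∉ K → ∀ ξ, a x ξ = 0)
    {χ : Rn n → ℝ} (hχ : ContDiff ℝ ∞ χ) (hs : ∀ v, χ v ≠ 0 → v ∈ ann n 4) :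
    GoodAmp n K (localAmp m a χ) where
  ub_right := by
    refine UB.univ_of_support (s := ann n 4) (f := fun (i : {l : ℝ // 0 < l} × Rn n) v =>
      localAmp m a χ i.1 i.2 v) ?_ (isCompact_ann n 4).isClosed fun i v h => hs v fun h0 => h ?_
    · exact ha.ub_right.mul (UB.of_compact (hχ) (isCompact_ann n 4)).ofReal
    · simp [localAmp, h0]
  ub_left := by
    have hsm : ∀ ξ, ContDiff ℝ ∞ fun z => a z ξ := fun ξ =>
      ha.1.comp (contDiff_id.prodMk contDiff_const : ContDiff ℝ ∞ fun z : Rn n => (z, ξ))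
    obtain ⟨D, hD⟩ := (isCompact_ann n 4).exists_bound_of_continuousOn hχ.continuous.continuousOn
    have hform : ∀ (l : ℝ) (v : Rn n), (fun z => localAmp m a χ l z v) =
        ((1 + l) ^ (-m) * χ v) • fun z => a z (l • v) := fun l v => by
      funext z
      simp only [localAmp, Pi.smul_apply, Complex.real_smul, Complex.ofReal_mul]
      ring
    refine ⟨fun i => ?_, fun k => ?_⟩
    · simp only [hform]
      exact contDiff_const.smul (hsm _)
    obtain ⟨C, hC0, hC⟩ := ha.exists_left_bound k
    refine ⟨|D| * C, fun ⟨⟨l, hl⟩, v⟩ x _ => ?_⟩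
    have hk : ((k : ℕ) : WithTop ℕ∞) ≤ ((⊤ : ℕ∞) : WithTop ℕ∞) :=
    WithTop.coe_le_coe.2 (le_top : ((k : ℕ) : ℕ∞) ≤ ⊤)
    simp only
    rw [hform, iteratedFDeriv_const_smul_apply ((hsm _).of_le hk).contDiffAt, norm_smul, norm_mul,
      Real.norm_of_nonneg (by positivity : 0 ≤ (1 + l) ^ (-m))]
    by_cases h : χ v = 0
    · simp only [h, norm_zero, mul_zero, zero_mul]
      positivity
    calc _ = ‖χ v‖ * ((1 + l) ^ (-m) * ‖iteratedFDeriv ℝ k (fun x' => a x' (l • v)) x‖) := by ring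
      _ ≤ |D| * C := by
          gcongr
          · exact (hD v (hs v h)).trans (le_abs_self D)
          · exact hC l hl v (hs v h) x
  cont l hl := by
    have h1 : Continuous fun q : Rn n × Rn n => a q.1 (l • q.2) :=
      ha.1.continuous.comp (by fun_prop : Continuous fun q : Rn n × Rn n => (q.1, l • q.2))
    have h2 := hχ.continuous
    exact (h1.const_smul ((1 + l) ^ (-m))).mul
      (Complex.continuous_ofReal.comp (h2.comp continuous_snd))
  mem_left l z v h := by
    by_contra hz
    exact h (by simp [localAmp, haK z hz])
  mem_right l z v h := hs v fun h0 => h (by simp [localAmp, h0])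

end Amplitude

section FourierPieces
variable {n : ℕ} {h : Rn n → ℝ} {f : Rn n → ℂ}

theorem norm_cexp_neg_I (r : ℝ) : ‖cexp (-(I * (r : ℂ)))‖ = 1 := by
  simpa using norm_mul_cexp_neg_I 1 r

theorem continuous_ftransform (hf : Integrable f) : Continuous (ftransform n f) := by
  refine continuous_of_dominated (bound := fun x => ‖f x‖) (fun ξ => ?_) (fun ξ => ?_) hf.norm ?_
  · exact (Continuous.aestronglyMeasurable (by fun_prop)).mul hf.1
  · exact Filter.Eventually.of_forall fun x => by rw [norm_mul, norm_cexp_neg_I, one_mul]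
  · exact Filter.Eventually.of_forall fun x => by fun_prop

theorem integrable_of_cut {u : Rn n → ℂ} (hh : Continuous h) (hc : HasCompactSupport h)
    (hu : Continuous u) : Integrable fun ξ => (h ξ : ℂ) * u ξ :=
  Continuous.integrable_of_hasCompactSupport (by fun_prop)
    (HasCompactSupport.intro hc fun ξ hξ => by simp [image_eq_zero_of_notMem_tsupport hξ])

theorem smoothOp_eq_convolution (h : Rn n → ℝ) (f : Rn n → ℂ) :
    smoothOp n h f = convolution f (invFT n h) (ContinuousLinearMap.mul ℝ ℂ) volume := by
  funext x
  simp only [smoothOp, convolution, ContinuousLinearMap.mul_apply', mul_comm]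

/-- A smooth compactly supported Fourier multiplier is given by the expected integral. -/
theorem smoothOp_eq (hs : ContDiff ℝ ∞ h) (hc : HasCompactSupport h) (hf : Integrable f)
    (y : Rn n) :
    smoothOp n h f y = ∫ ξ, ((((2 * Real.pi) ^ n)⁻¹ : ℝ) : ℂ) * ((h ξ : ℂ) * ftransform n f ξ) *
      cexp (I * ((⟪y, ξ⟫_ℝ : ℝ) : ℂ)) := by
  have hi : Integrable fun ξ => (h ξ : ℂ) := by
    simpa using integrable_of_cut hs.continuous hc (continuous_const (y := (1 : ℂ)))
  have hint : Integrable (Function.uncurry fun w ξ : Rn n =>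
      cexp (I * ((⟪y - w, ξ⟫_ℝ : ℝ) : ℂ)) * (h ξ : ℂ) * f w)
      ((volume : Measure (Rn n)).prod volume) := by
    refine (hf.mul_prod hi).mono ?_ (Filter.Eventually.of_forall fun q => ?_)
    · refine AEStronglyMeasurable.mul (Continuous.aestronglyMeasurable ?_) hf.1.comp_fst
      have := hs.continuous
      fun_prop
    · simp only [Function.uncurry, norm_mul]
      rw [mul_comm I, Complex.norm_exp_ofReal_mul_I, one_mul, mul_comm]
  calc smoothOp n h f y
      = ∫ w, ∫ ξ, ((((2 * Real.pi) ^ n)⁻¹ : ℝ) : ℂ) *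
          (cexp (I * ((⟪y - w, ξ⟫_ℝ : ℝ) : ℂ)) * (h ξ : ℂ) * f w) := by
        simp only [smoothOp, invFT, integral_const_mul, integral_mul_const]
        rw [← integral_const_mul]
        simp only [mul_assoc]
    _ = ∫ ξ, ∫ w, ((((2 * Real.pi) ^ n)⁻¹ : ℝ) : ℂ) *
          (cexp (I * ((⟪y - w, ξ⟫_ℝ : ℝ) : ℂ)) * (h ξ : ℂ) * f w) :=
        integral_integral_swap (hint.const_mul _)
    _ = _ := by
        refine integral_congr_ae (Filter.Eventually.of_forall fun ξ => ?_)
        simp only [ftransform]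
        rw [integral_const_mul, mul_assoc, ← integral_const_mul (h ξ : ℂ), ← integral_mul_const]
        congr 1
        refine integral_congr_ae (Filter.Eventually.of_forall fun w => ?_)
        simp only
        rw [inner_sub_left, Complex.ofReal_sub, mul_sub, sub_eq_neg_add, Complex.exp_add]
        ring

theorem ftransform_smoothOp (hs : ContDiff ℝ ∞ h) (hc : HasCompactSupport h) (hf : Integrable f)
    (ξ : Rn n) : ftransform n (smoothOp n h f) ξ = (h ξ : ℂ) * ftransform n f ξ := by
  have hi := integrable_invFT hs hc
  have hint : Integrable (Function.uncurry fun x y : Rn n =>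
      cexp (-(I * ((⟪x, ξ⟫_ℝ : ℝ) : ℂ))) * (invFT n h (x - y) * f y))
      ((volume : Measure (Rn n)).prod volume) := by
    refine (hf.convolution_integrand (ContinuousLinearMap.mul ℝ ℂ) hi).mono ?_
      (Filter.Eventually.of_forall fun q => ?_)
    · refine AEStronglyMeasurable.mul (Continuous.aestronglyMeasurable (by fun_prop)) ?_
      exact ((continuous_invFT hs hc).comp
        (continuous_fst.sub continuous_snd)).aestronglyMeasurable.mul hf.1.comp_snd
    · simp only [Function.uncurry, norm_mul, norm_cexp_neg_I, one_mul,
        ContinuousLinearMap.mul_apply']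
      rw [mul_comm]
  calc ftransform n (smoothOp n h f) ξ
      = ∫ x, ∫ y, cexp (-(I * ((⟪x, ξ⟫_ℝ : ℝ) : ℂ))) * (invFT n h (x - y) * f y) := by
        simp only [ftransform, smoothOp, integral_const_mul]
    _ = ∫ y, ∫ x, cexp (-(I * ((⟪x, ξ⟫_ℝ : ℝ) : ℂ))) * (invFT n h (x - y) * f y) :=
        integral_integral_swap hint
    _ = ∫ y, (h ξ : ℂ) * (cexp (-(I * ((⟪y, ξ⟫_ℝ : ℝ) : ℂ))) * f y) := by
        refine integral_congr_ae (Filter.Eventually.of_forall fun y => ?_)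
        simp only
        rw [← integral_add_right_eq_self _ y, ← ftransform_invFT hs hc ξ, ftransform,
          ← integral_mul_const]
        refine integral_congr_ae (Filter.Eventually.of_forall fun x => ?_)
        simp only [inner_add_left, Complex.ofReal_add, mul_add, neg_add, Complex.exp_add,
          add_sub_cancel_right]
        ring
    _ = _ := by rw [integral_const_mul, ftransform]

theorem BandLimited.of_smoothOp (hs : ContDiff ℝ ∞ h) (hc : HasCompactSupport h)
    (hf : Integrable f) {L : ℝ} (hL : ∀ ξ, h ξ ≠ 0 → ‖ξ‖ ≤ L) :
    BandLimited n L (smoothOp n h f) where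
  cont := by
    obtain ⟨C, -, hC⟩ := exists_invFT_decay hs hc 0
    rw [smoothOp_eq_convolution]
    refine BddAbove.continuous_convolution_right_of_integrable _ ⟨C, ?_⟩ hf (continuous_invFT hs hc)
    rintro _ ⟨x, rfl⟩
    simpa using hC x
  int := by
    rw [smoothOp_eq_convolution]
    exact hf.integrable_convolution _ (integrable_invFT hs hc)
  rep := ⟨_, (integrable_of_cut hs.continuous hc (continuous_ftransform hf)).const_mul _,
    fun ξ hξ => hL ξ fun h0 => hξ (by simp [h0]), smoothOp_eq hs hc hf⟩

theorem BandLimited.mono {L L' : ℝ} (hf : BandLimited n L f) (hL : L ≤ L') : BandLimited n L' f :=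
  ⟨hf.cont, hf.int, hf.rep.imp fun _ h => ⟨h.1, fun ξ hξ => (h.2.1 ξ hξ).trans hL, h.2.2⟩⟩

end FourierPieces

section PieceIdentity
variable {n : ℕ} {K : Set (Rn n)} {Φ φ : Rn n → Rn n → ℝ} {b : ℝ → Rn n → Rn n → ℂ}
  {m : ℝ} {a : Rn n → Rn n → ℂ} {χ : Rn n → ℝ}

theorem GoodAmp.integral_ker_mul (hb : GoodAmp n K b) (hΦ : GoodPhase n K Φ) {l : ℝ} (hl : 0 < l)
    {u : Rn n → ℂ} (hu : Integrable u) (z : Rn n) :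
    ∫ y, ker b Φ l z y * u y = ∫ v, osc b Φ l z v * ftransform n u (l • v) := by
  have hosc : Continuous (osc b Φ l z) :=
    (hb.continuous_osc hΦ hl).comp (by fun_prop : Continuous fun v : Rn n => (z, v))
  have hoi : Integrable (osc b Φ l z) :=
    hosc.integrable_of_hasCompactSupport (HasCompactSupport.intro (isCompact_ann n 4)
      fun v hv => by_contra fun h0 => hv (hb.mem_right l z v (osc_ne_zero h0)))
  have hint : Integrable (Function.uncurry fun y v : Rn n =>
      osc b Φ l z v * cexp (-(I * ((l * ⟪y, v⟫_ℝ : ℝ) : ℂ))) * u y)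
      ((volume : Measure (Rn n)).prod volume) := by
    refine (hu.mul_prod hoi).mono ?_ (Filter.Eventually.of_forall fun q => ?_)
    · exact AEStronglyMeasurable.mul (Continuous.aestronglyMeasurable (by fun_prop)) hu.1.comp_fst
    · simp only [Function.uncurry, norm_mul, norm_cexp_neg_I, mul_one]
      rw [mul_comm]
  calc ∫ y, ker b Φ l z y * u y
      = ∫ y, ∫ v, osc b Φ l z v * cexp (-(I * ((l * ⟪y, v⟫_ℝ : ℝ) : ℂ))) * u y := by
        simp only [ker, integral_mul_const]
    _ = ∫ v, ∫ y, osc b Φ l z v * cexp (-(I * ((l * ⟪y, v⟫_ℝ : ℝ) : ℂ))) * u y :=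
        integral_integral_swap hint
    _ = _ := by simp only [mul_assoc, integral_const_mul, ftransform, inner_smul_right]

theorem SymbolClass.integral_piece_eq (ha : SymbolClass n m a)
    (haK : ∀ x, x ∉ K → ∀ ξ, a x ξ = 0) (hχ : ContDiff ℝ ∞ χ) (hs : ∀ v, χ v ≠ 0 → v ∈ ann n 4)
    (hφ : PhaseSmoothHomog n φ) (hΦ : GoodPhase n K Φ)
    (hΦφ : ∀ x ∈ K, ∀ v ∈ ann n 64, Φ x v = φ x v) {l : ℝ} (hl : 0 < l)
    {u : Rn n → ℂ} (hu : Integrable u) (z : Rn n) :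
    ∫ ξ, a z ξ * cexp (I * ((φ z ξ : ℝ) : ℂ)) * ((χ (l⁻¹ • ξ) : ℂ) * ftransform n u ξ) =
      ((l ^ n * (1 + l) ^ m : ℝ) : ℂ) * ∫ y, ker (localAmp m a χ) Φ l z y * u y := by
  rw [(ha.goodAmp haK hχ hs).integral_ker_mul hΦ hl hu z]
  have hl0 := hl.ne'
  have hln : (l ^ n : ℝ) ≠ 0 := by positivity
  have h1 := Measure.integral_comp_smul_of_nonneg (volume : Measure (Rn n)) (fun ξ =>
    a z ξ * cexp (I * ((φ z ξ : ℝ) : ℂ)) * ((χ (l⁻¹ • ξ) : ℂ) * ftransform n u ξ)) l (hR := hl.le)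
  rw [finrank_euclideanSpace_fin] at h1
  rw [← inv_smul_eq_iff₀ (inv_ne_zero hln), inv_inv] at h1
  rw [← h1, ← integral_const_mul, ← integral_smul]
  refine integral_congr_ae (Filter.Eventually.of_forall fun v => ?_)
  simp only [smul_smul, inv_mul_cancel₀ hl0, one_smul, Complex.real_smul]
  by_cases hz : z ∈ K
  · by_cases hv : χ v = 0
    · simp [osc, localAmp, hv]
    have hW : (1 + l) ^ m * (1 + l) ^ (-m) = 1 := by
      rw [← Real.rpow_add (by linarith), add_neg_cancel, Real.rpow_zero]
    have hW' : (((1 + l) ^ m : ℝ) : ℂ) * (((1 + l) ^ (-m) : ℝ) : ℂ) = 1 := by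
      rw [← Complex.ofReal_mul, hW, Complex.ofReal_one]
    rw [hφ.2 z v l hl, ← hΦφ z hz v (ann_mono (by norm_num) (by norm_num) (hs v hv))]
    simp only [osc, localAmp, Complex.real_smul]
    rw [Complex.ofReal_mul (l ^ n)]
    linear_combination -(((l ^ n : ℝ) : ℂ) * (a z (l • v) * cexp (I * ((l * Φ z v : ℝ) : ℂ)) *
      ((χ v : ℂ) * ftransform n u (l • v)))) * hW'
  · simp [osc, localAmp, haK z hz]

end PieceIdentity

section Multiplier
variable {n : ℕ} {ψ0 : Rn n → ℝ}

/-- A cutoff equal to one on the support of `lpProfile ψ0`. -/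
def wideProfile (ψ0 : Rn n → ℝ) (ξ : Rn n) : ℝ := ψ0 ((1 / 2 : ℝ) • ξ) - ψ0 ((4 : ℝ) • ξ)

namespace IsLPBase

theorem contDiff_wideProfile (h : IsLPBase n ψ0) : ContDiff ℝ ∞ (wideProfile ψ0) :=
  (h.1.comp (contDiff_const_smul (1 / 2 : ℝ))).sub (h.1.comp (contDiff_const_smul (4 : ℝ)))

theorem profile_mem_ann (h : IsLPBase n ψ0) (ξ : Rn n) (hξ : lpProfile ψ0 ξ ≠ 0) :
    ξ ∈ ann n 4 := by
  have := h.profile_ne_zero hξ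
  constructor <;> norm_num <;> linarith

theorem wideProfile_mem_ann (h : IsLPBase n ψ0) (ξ : Rn n) (hξ : wideProfile ψ0 ξ ≠ 0) :
    ξ ∈ ann n 4 := by
  constructor
  · by_contra! hc
    refine hξ ?_
    rw [wideProfile, h.2.1, h.2.1, sub_self] <;> rw [norm_smul] <;> norm_num at hc ⊢ <;> linarith
  · by_contra! hc
    refine hξ ?_
    rw [wideProfile, h.2.2, h.2.2, sub_self] <;> rw [norm_smul] <;> norm_num at hc ⊢ <;> linarith

theorem wideProfile_mul (h : IsLPBase n ψ0) (ξ : Rn n) :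
    wideProfile ψ0 ξ * lpProfile ψ0 ξ = lpProfile ψ0 ξ := by
  by_cases h0 : lpProfile ψ0 ξ = 0
  · simp [h0]
  have h1 := (h.profile_ne_zero h0).2
  have h2 : 1 / 2 < ‖ξ‖ := by
    by_contra! hc
    refine h0 ?_
    rw [lpProfile, h.2.1 _ (by linarith), h.2.1, sub_self]
    rw [norm_smul]
    norm_num
    linarith
  rw [wideProfile, h.2.1, h.2.2, sub_zero, one_mul] <;> rw [norm_smul] <;> norm_num <;> linarith

end IsLPBase

/-- The partial sums of the dyadic decomposition of the identity. -/
def partialMult (ψ0 : Rn n → ℝ) (M : ℕ) (ξ : Rn n) : ℝ :=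
  ∑ N ∈ Finset.range M, (lpProfile ψ0 ((2 / 2 ^ N : ℝ)⁻¹ • ξ) * lpPiece n ψ0 0 ξ +
    wideProfile ψ0 (((2 : ℝ) ^ (N + 1))⁻¹ • ξ) * lpPiece n ψ0 (N + 1) ξ)

namespace IsLPBase

theorem partialMult_eq (h : IsLPBase n ψ0) (M : ℕ) (ξ : Rn n) :
    partialMult ψ0 M ξ = ψ0 (((2 : ℝ) ^ M)⁻¹ • ξ) - ψ0 ((2 ^ M / 2 : ℝ) • ξ) * ψ0 ξ := by
  have h1 : ∀ N : ℕ, lpProfile ψ0 ((2 / 2 ^ N : ℝ)⁻¹ • ξ) * lpPiece n ψ0 0 ξ =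
      ψ0 ((2 ^ N / 2 : ℝ) • ξ) * ψ0 ξ - ψ0 ((2 ^ (N + 1) / 2 : ℝ) • ξ) * ψ0 ξ := fun N => by
    rw [lpProfile, lpPiece_zero, smul_smul, inv_div, sub_mul, pow_succ, mul_div_assoc,
      mul_comm (2 : ℝ), div_mul_eq_mul_div, mul_div_assoc]
  have h2 : ∀ N : ℕ, wideProfile ψ0 (((2 : ℝ) ^ (N + 1))⁻¹ • ξ) * lpPiece n ψ0 (N + 1) ξ =
      ψ0 (((2 : ℝ) ^ (N + 1))⁻¹ • ξ) - ψ0 (((2 : ℝ) ^ N)⁻¹ • ξ) := fun N => by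
    rw [lpPiece_of_ne N.succ_ne_zero, h.wideProfile_mul, lpProfile, smul_smul, pow_succ, mul_inv,
      mul_comm (2 : ℝ), inv_mul_cancel_right₀ two_ne_zero]
  simp only [partialMult, h1, h2]
  rw [Finset.sum_add_distrib, Finset.sum_range_sub', Finset.sum_range_sub fun N =>
    ψ0 (((2 : ℝ) ^ N)⁻¹ • ξ)]
  have h3 : ψ0 ((2 ^ 0 / 2 : ℝ) • ξ) * ψ0 ξ = ψ0 ξ := by
    by_cases h0 : ‖ξ‖ ≤ 2
    · rw [h.2.1, one_mul]
      rw [norm_smul]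
      norm_num
      linarith
    · rw [h.2.2 ξ (not_le.1 h0), mul_zero]
  rw [h3]
  simp

theorem exists_partialMult_le (h : IsLPBase n ψ0) :
    ∃ B : ℝ, 0 ≤ B ∧ ∀ M ξ, |partialMult ψ0 M ξ| ≤ B := by
  obtain ⟨B, hB⟩ := h.hasCompactSupport.exists_bound_of_continuous h.1.continuous
  have hB0 : 0 ≤ B := (norm_nonneg _).trans (hB 0)
  refine ⟨B + B * B, by positivity, fun M ξ => ?_⟩
  rw [h.partialMult_eq]
  refine (abs_sub _ _).trans (add_le_add (hB _) ?_)
  rw [abs_mul]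
  exact mul_le_mul (hB _) (hB _) (abs_nonneg _) hB0

theorem continuous_partialMult (h : IsLPBase n ψ0) (M : ℕ) : Continuous (partialMult ψ0 M) := by
  have := h.1.continuous
  rw [funext (h.partialMult_eq M)]
  fun_prop

theorem tendsto_partialMult (h : IsLPBase n ψ0) {ξ : Rn n} (hξ : ξ ≠ 0) :
    Filter.Tendsto (fun M => partialMult ψ0 M ξ) Filter.atTop (nhds 1) := by
  have hp := tendsto_pow_atTop_atTop_of_one_lt (one_lt_two : (1 : ℝ) < 2)
  have hξ' : 0 < ‖ξ‖ := norm_pos_iff.2 hξ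
  refine tendsto_const_nhds.congr' ?_
  filter_upwards [hp.eventually_ge_atTop ‖ξ‖, hp.eventually_gt_atTop (4 / ‖ξ‖)] with M h1 h2
  rw [div_lt_iff₀ hξ'] at h2
  have h3 : (0 : ℝ) < 2 ^ M := by positivity
  rw [h.partialMult_eq, h.2.1, h.2.2 ((2 ^ M / 2 : ℝ) • ξ)]
  · simp
  · rw [norm_smul, Real.norm_of_nonneg (by positivity)]
    linarith
  · rw [norm_smul, Real.norm_of_nonneg (by positivity), inv_mul_le_iff₀ h3]
    linarith

end IsLPBase

end Multiplier

section Decomposition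
variable {n : ℕ} {K : Set (Rn n)} {Φ φ : Rn n → Rn n → ℝ} {b : ℝ → Rn n → Rn n → ℂ}
  {m : ℝ} {a : Rn n → Rn n → ℂ} {χ ψ0 : Rn n → ℝ}

theorem SymbolClass.exists_integrable_bound (ha : SymbolClass n m a) (f : SchwartzMap (Rn n) ℂ) :
    ∃ g : Rn n → ℝ, Integrable g ∧ ∀ z ξ, ‖a z ξ‖ * ‖ftransform n f ξ‖ ≤ g ξ := by
  obtain ⟨C, hC⟩ := ha.2 0 0
  set N := ⌈|m / 2|⌉₊
  have hF : (fun ξ => ftransform n f ξ) = fun ξ =>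
      (FourierTransform.fourier f : SchwartzMap (Rn n) ℂ) ((2 * Real.pi)⁻¹ • ξ) := by
    funext ξ
    rw [SchwartzMap.fourier_coe, ftransform_eq_fourier]
  have hI : ∀ k : ℕ, Integrable fun ξ => ‖ξ‖ ^ k * ‖ftransform n f ξ‖ := fun k => by
    have h1 := ((FourierTransform.fourier f : SchwartzMap (Rn n) ℂ).integrable_pow_mul volume
      k).comp_smul (inv_ne_zero Real.two_pi_pos.ne')
    refine (h1.const_mul ((2 * Real.pi) ^ k)).congr (Filter.Eventually.of_forall fun ξ => ?_)
    have h2 := congrFun hF ξ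
    simp only at h2 ⊢
    rw [h2, norm_smul, Real.norm_of_nonneg (by positivity), mul_pow (2 * Real.pi)⁻¹, inv_pow]
    have := Real.pi_pos.ne'
    field_simp
  refine ⟨fun ξ => |C| * (2 ^ (N - 1) * (‖ξ‖ ^ 0 * ‖ftransform n f ξ‖ +
    ‖ξ‖ ^ (2 * N) * ‖ftransform n f ξ‖)), (((hI 0).add (hI (2 * N))).const_mul _).const_mul _,
    fun z ξ => ?_⟩
  have h1 : ‖a z ξ‖ ≤ C * (1 + ‖ξ‖ ^ 2) ^ (m / 2) := by simpa using hC z ξ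
  have h2 : (1 + ‖ξ‖ ^ 2) ^ (m / 2) ≤ 2 ^ (N - 1) * (1 + ‖ξ‖ ^ (2 * N)) :=
    calc (1 + ‖ξ‖ ^ 2) ^ (m / 2) ≤ (1 + ‖ξ‖ ^ 2) ^ (N : ℝ) :=
          Real.rpow_le_rpow_of_exponent_le (by nlinarith [sq_nonneg ‖ξ‖])
            ((le_abs_self _).trans (Nat.le_ceil _))
      _ = (1 + ‖ξ‖ ^ 2) ^ N := Real.rpow_natCast _ _
      _ ≤ _ := by
          refine (add_pow_le zero_le_one (by positivity) N).trans_eq ?_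
          rw [one_pow, pow_mul]
  calc ‖a z ξ‖ * ‖ftransform n f ξ‖
      ≤ (|C| * (2 ^ (N - 1) * (1 + ‖ξ‖ ^ (2 * N)))) * ‖ftransform n f ξ‖ := by
        gcongr
        refine h1.trans ((mul_le_mul_of_nonneg_right (le_abs_self C) (by positivity)).trans ?_)
        gcongr
    _ = _ := by ring

/-- The part at frequency scale `l` of the operator, followed by a Littlewood–Paley piece. -/
def pieceOp (ψ0 : Rn n → ℝ) (m : ℝ) (a : Rn n → Rn n → ℂ) (χ : Rn n → ℝ) (Φ : Rn n → Rn n → ℝ)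
    (k : ℕ) (l : ℝ) (u : Rn n → ℂ) (x : Rn n) : ℂ :=
  ((l ^ n * (1 + l) ^ m : ℝ) : ℂ) * ∫ y, pieceKer ψ0 (localAmp m a χ) Φ k l x y * u y

theorem GoodAmp.integrable_kernel_mul (hb : GoodAmp n K b) (hΦ : GoodPhase n K Φ)
    (hK : IsCompact K) (hψ : IsLPBase n ψ0) (k : ℕ) {l : ℝ} (hl : 0 < l) {u : Rn n → ℂ}
    (hu : Integrable u) (x : Rn n) :
    Integrable fun z => invFT n (lpPiece n ψ0 k) (x - z) * ∫ y, ker b Φ l z y * u y := by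
  obtain ⟨C, hC0, hC⟩ := hb.exists_ker_decay hΦ 0
  have hk := hb.continuous_ker hΦ hl
  have hc : Continuous fun z => ∫ y, ker b Φ l z y * u y := by
    refine continuous_of_dominated (bound := fun y => C * ‖u y‖) (fun z => ?_) (fun z => ?_)
      (hu.norm.const_mul C) ?_
    · exact (hk.comp (by fun_prop : Continuous fun y : Rn n => (z, y))).aestronglyMeasurable.mul
        hu.1
    · refine Filter.Eventually.of_forall fun y => ?_
      rw [norm_mul]
      gcongr
      simpa using hC l hl z y
    · exact Filter.Eventually.of_forall fun y =>
        (hk.comp (by fun_prop : Continuous fun z : Rn n => (z, y))).mul continuous_const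
  refine Continuous.integrable_of_hasCompactSupport
    (((hψ.continuous_kernel k).comp (by fun_prop)).mul hc)
      (HasCompactSupport.intro hK fun z hz => ?_)
  have : ∀ y, ker b Φ l z y = 0 := fun y => by_contra fun h => hz (hb.ker_ne_zero h)
  simp [this]

theorem SymbolClass.integral_mult_eq (ha : SymbolClass n m a)
    (haK : ∀ x, x ∉ K → ∀ ξ, a x ξ = 0) (hφ : PhaseSmoothHomog n φ) (hΦ : GoodPhase n K Φ)
    (hΦφ : ∀ x ∈ K, ∀ v ∈ ann n 64, Φ x v = φ x v) (hK : IsCompact K) (hψ : IsLPBase n ψ0)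
    {f : Rn n → ℂ} (hf : Integrable f)
    (hint : ∀ z, ∀ h : Rn n → ℝ, Continuous h → HasCompactSupport h →
      Integrable fun ξ => a z ξ * cexp (I * ((φ z ξ : ℝ) : ℂ)) * ((h ξ : ℂ) * ftransform n f ξ))
    (M k : ℕ) (x : Rn n) :
    ∫ z, invFT n (lpPiece n ψ0 k) (x - z) * ∫ ξ, a z ξ * cexp (I * ((φ z ξ : ℝ) : ℂ)) *
        ((partialMult ψ0 M ξ : ℂ) * ftransform n f ξ) =
      ∑ N ∈ Finset.range M,
        (pieceOp ψ0 m a (lpProfile ψ0) Φ k (2 / 2 ^ N) (smoothOp n (lpPiece n ψ0 0) f) x +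
        pieceOp ψ0 m a (wideProfile ψ0) Φ k (2 ^ (N + 1))
          (smoothOp n (lpPiece n ψ0 (N + 1)) f) x) := by
  have hu : ∀ j, Integrable (smoothOp n (lpPiece n ψ0 j) f) := fun j =>
    (BandLimited.of_smoothOp (hψ.contDiff_piece j) (hψ.hasCompactSupport_piece j) hf
      fun ξ hξ => (hψ.piece_ne_zero hξ).2).int
  have hL : ∀ N : ℕ, (0 : ℝ) < 2 / 2 ^ N := fun N => by positivity
  have hH : ∀ N : ℕ, (0 : ℝ) < 2 ^ (N + 1) := fun N => by positivity
  have hbL := ha.goodAmp haK hψ.contDiff_profile hψ.profile_mem_ann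
  have hbH := ha.goodAmp haK hψ.contDiff_wideProfile hψ.wideProfile_mem_ann
  have key : ∀ z, ∫ ξ, a z ξ * cexp (I * ((φ z ξ : ℝ) : ℂ)) *
        ((partialMult ψ0 M ξ : ℂ) * ftransform n f ξ) =
      ∑ N ∈ Finset.range M,
        ((((2 / 2 ^ N) ^ n * (1 + 2 / 2 ^ N) ^ m : ℝ) : ℂ) *
            (∫ y, ker (localAmp m a (lpProfile ψ0)) Φ (2 / 2 ^ N) z y *
              smoothOp n (lpPiece n ψ0 0) f y) +
          (((2 ^ (N + 1)) ^ n * (1 + 2 ^ (N + 1)) ^ m : ℝ) : ℂ) *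
            ∫ y, ker (localAmp m a (wideProfile ψ0)) Φ (2 ^ (N + 1)) z y *
              smoothOp n (lpPiece n ψ0 (N + 1)) f y) := by
    intro z
    have hcut : ∀ (g : Rn n → ℝ) (t : ℝ) (j : ℕ), Continuous g →
        Integrable fun ξ => a z ξ * cexp (I * ((φ z ξ : ℝ) : ℂ)) *
          ((g (t • ξ) : ℂ) * ftransform n (smoothOp n (lpPiece n ψ0 j) f) ξ) := fun g t j hg => by
      have h1 := (hψ.contDiff_piece j).continuous
      refine (hint z (fun ξ => g (t • ξ) * lpPiece n ψ0 j ξ) (by fun_prop)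
        ((hψ.hasCompactSupport_piece j).mul_left)).congr (Filter.Eventually.of_forall fun ξ => ?_)
      simp only
      rw [ftransform_smoothOp (hψ.contDiff_piece j) (hψ.hasCompactSupport_piece j) hf]
      push_cast
      ring
    rw [← Finset.sum_congr rfl fun N _ => congrArg₂ (· + ·)
      (ha.integral_piece_eq haK hψ.contDiff_profile hψ.profile_mem_ann hφ hΦ hΦφ (hL N) (hu 0) z)
      (ha.integral_piece_eq haK hψ.contDiff_wideProfile hψ.wideProfile_mem_ann hφ hΦ hΦφ (hH N)
        (hu (N + 1)) z)]
    have hcL := fun N : ℕ => hcut (lpProfile ψ0) (2 / 2 ^ N)⁻¹ 0 hψ.contDiff_profile.continuous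
    have hcH := fun N : ℕ => hcut (wideProfile ψ0) (2 ^ (N + 1))⁻¹ (N + 1)
      hψ.contDiff_wideProfile.continuous
    simp_rw [← fun N : ℕ => integral_add (hcL N) (hcH N)]
    refine Eq.trans ?_ (integral_finsetSum (Finset.range M) fun N _ => (hcL N).add (hcH N))
    refine integral_congr_ae (Filter.Eventually.of_forall fun ξ => ?_)
    simp only [partialMult,
      ftransform_smoothOp (hψ.contDiff_piece _) (hψ.hasCompactSupport_piece _) hf,
      Complex.ofReal_sum, Finset.sum_mul, Finset.mul_sum]
    refine Finset.sum_congr rfl fun N _ => ?_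
    push_cast
    ring
  simp only [key, Finset.mul_sum]
  have hiL := fun N : ℕ => (hbL.integrable_kernel_mul hΦ hK hψ k (hL N) (hu 0) x).const_mul
    ((((2 / 2 ^ N) ^ n * (1 + 2 / 2 ^ N) ^ m : ℝ) : ℂ))
  have hiH := fun N : ℕ => (hbH.integrable_kernel_mul hΦ hK hψ k (hH N) (hu (N + 1)) x).const_mul
    ((((2 ^ (N + 1)) ^ n * (1 + 2 ^ (N + 1)) ^ m : ℝ) : ℂ))
  simp only [mul_add, mul_left_comm (invFT n (lpPiece n ψ0 k) (x - _))]
  refine (integral_finsetSum _ fun N _ => (hiL N).add (hiH N)).trans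
    (Finset.sum_congr rfl fun N _ => (integral_add (hiL N) (hiH N)).trans ?_)
  rw [integral_const_mul, integral_const_mul, pieceOp, pieceOp,
    hbL.integral_pieceKer_mul hΦ hψ k (hL N) (hu 0),
    hbH.integral_pieceKer_mul hΦ hψ k (hH N) (hu (N + 1))]

theorem PhaseSmoothHomog.continuousOn_symbol (hφ : PhaseSmoothHomog n φ) (ha : SymbolClass n m a) :
    ContinuousOn (fun q : Rn n × Rn n => a q.1 q.2 * cexp (I * ((φ q.1 q.2 : ℝ) : ℂ)))
      (Set.univ ×ˢ {0}ᶜ) := by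
  have h1 : ContinuousOn (fun q : Rn n × Rn n => φ q.1 q.2) (Set.univ ×ˢ {0}ᶜ) :=
    hφ.1.continuousOn.mono fun q hq => hq.2
  exact ha.1.continuous.continuousOn.mul (Complex.continuous_exp.comp_continuousOn
    (continuousOn_const.mul (Complex.continuous_ofReal.comp_continuousOn h1)))

/-- Pointwise domination of a Littlewood–Paley piece of the operator by its dyadic pieces. -/
theorem SymbolClass.enorm_smoothOp_fio_le (hn : 1 ≤ n) (ha : SymbolClass n m a)
    (haK : ∀ x, x ∉ K → ∀ ξ, a x ξ = 0) (hφ : PhaseSmoothHomog n φ) (hΦ : GoodPhase n K Φ)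
    (hΦφ : ∀ x ∈ K, ∀ v ∈ ann n 64, Φ x v = φ x v) (hK : IsCompact K) (hψ : IsLPBase n ψ0)
    (f : SchwartzMap (Rn n) ℂ) (k : ℕ) (x : Rn n) :
    ‖smoothOp n (lpPiece n ψ0 k) (fio n a φ f) x‖ₑ ≤ ENNReal.ofReal ((2 * Real.pi) ^ n)⁻¹ *
      ∑' N : ℕ,
        (‖pieceOp ψ0 m a (lpProfile ψ0) Φ k (2 / 2 ^ N) (smoothOp n (lpPiece n ψ0 0) f) x‖ₑ +
        ‖pieceOp ψ0 m a (wideProfile ψ0) Φ k (2 ^ (N + 1))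
          (smoothOp n (lpPiece n ψ0 (N + 1)) f) x‖ₑ) := by
  have : Nonempty (Fin n) := ⟨⟨0, hn⟩⟩
  have : Nontrivial (Rn n) := inferInstance
  have hf : Integrable f := f.integrable
  have hfc := continuous_ftransform hf
  obtain ⟨g, hg, hag⟩ := ha.exists_integrable_bound f
  obtain ⟨B, hB0, hB⟩ := hψ.exists_partialMult_le
  have hc := hφ.continuousOn_symbol ha
  have hm1 : ∀ z, AEStronglyMeasurable (fun ξ => a z ξ * cexp (I * ((φ z ξ : ℝ) : ℂ))) :=
    fun z => by
    have h1 : ContinuousOn (fun ξ => a z ξ * cexp (I * ((φ z ξ : ℝ) : ℂ))) {0}ᶜ :=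
      hc.comp (f := fun ξ : Rn n => (z, ξ)) (by fun_prop) fun ξ hξ => ⟨trivial, hξ⟩
    simpa [restrict_compl_singleton] using
      h1.aestronglyMeasurable (μ := volume) (measurableSet_singleton (0 : Rn n)).compl
  have hm2 : AEStronglyMeasurable (fun q : Rn n × Rn n =>
      a q.1 q.2 * cexp (I * ((φ q.1 q.2 : ℝ) : ℂ))) ((volume : Measure (Rn n)).prod volume) := by
    have h1 := hc.aestronglyMeasurable (μ := (volume : Measure (Rn n)).prod volume)
      (MeasurableSet.univ.prod (measurableSet_singleton (0 : Rn n)).compl)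
    rwa [← Measure.prod_restrict, Measure.restrict_univ, restrict_compl_singleton] at h1
  have hnorm : ∀ z ξ (r : ℝ), ‖a z ξ * cexp (I * ((φ z ξ : ℝ) : ℂ)) *
      ((r : ℂ) * ftransform n f ξ)‖ ≤ |r| * g ξ := fun z ξ r => by
    rw [norm_mul, norm_mul, mul_comm I, Complex.norm_exp_ofReal_mul_I, mul_one, norm_mul,
      Complex.norm_real, Real.norm_eq_abs, mul_left_comm]
    exact mul_le_mul_of_nonneg_left (hag z ξ) (abs_nonneg r)
  have hg0 : ∀ ξ, 0 ≤ g ξ := fun ξ => le_trans (by positivity) (hag 0 ξ)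
  have hint : ∀ z, ∀ h : Rn n → ℝ, Continuous h → HasCompactSupport h →
      Integrable fun ξ => a z ξ * cexp (I * ((φ z ξ : ℝ) : ℂ)) *
        ((h ξ : ℂ) * ftransform n f ξ) := fun z h hh hhc => by
    obtain ⟨D, hD⟩ := hhc.exists_bound_of_continuous hh
    refine (hg.const_mul D).mono' ((hm1 z).mul
      (Continuous.aestronglyMeasurable (by fun_prop))) (Filter.Eventually.of_forall fun ξ => ?_)
    exact (hnorm z ξ (h ξ)).trans (mul_le_mul_of_nonneg_right (hD ξ) (hg0 ξ))
  set T : ℕ → Rn n → ℂ := fun M z => ∫ ξ, a z ξ * cexp (I * ((φ z ξ : ℝ) : ℂ)) *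
    ((partialMult ψ0 M ξ : ℂ) * ftransform n f ξ) with hT
  set T' : Rn n → ℂ := fun z => ∫ ξ, a z ξ * cexp (I * ((φ z ξ : ℝ) : ℂ)) * ftransform n f ξ
    with hT'
  have hSf : ∀ M, Continuous fun ξ => (partialMult ψ0 M ξ : ℂ) * ftransform n f ξ := fun M => by
    have := hψ.continuous_partialMult M
    fun_prop
  have hlim : ∀ z, Filter.Tendsto (fun M => T M z) Filter.atTop (nhds (T' z)) := fun z => by
    refine tendsto_integral_of_dominated_convergence (fun ξ => B * g ξ)
      (fun M => (hm1 z).mul (hSf M).aestronglyMeasurable) (hg.const_mul B) (fun M => ?_) ?_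
    · exact Filter.Eventually.of_forall fun ξ =>
        (hnorm z ξ _).trans (mul_le_mul_of_nonneg_right (hB M ξ) (hg0 ξ))
    · have h0 : ∀ᵐ ξ : Rn n, ξ ≠ 0 := by
        rw [ae_iff]
        simp
      filter_upwards [h0] with ξ hξ
      have h1 := ((Complex.continuous_ofReal.tendsto 1).comp (hψ.tendsto_partialMult hξ)).mul_const
        (ftransform n f ξ)
      simpa using h1.const_mul (a z ξ * cexp (I * ((φ z ξ : ℝ) : ℂ)))
  have hTb : ∀ M z, ‖T M z‖ ≤ B * ∫ ξ, g ξ := fun M z => by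
    rw [← integral_const_mul]
    exact norm_integral_le_of_norm_le (hg.const_mul B) (Filter.Eventually.of_forall fun ξ =>
      (hnorm z ξ _).trans (mul_le_mul_of_nonneg_right (hB M ξ) (hg0 ξ)))
  have hTm : ∀ M, AEStronglyMeasurable (T M) := fun M =>
    (hm2.mul ((hSf M).comp continuous_snd).aestronglyMeasurable).integral_prod_right'
  have hΨ := (integrable_invFT (hψ.contDiff_piece k) (hψ.hasCompactSupport_piece k)).comp_sub_left x
  have hlim2 : Filter.Tendsto (fun M => ∫ z, invFT n (lpPiece n ψ0 k) (x - z) * T M z)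
      Filter.atTop (nhds (∫ z, invFT n (lpPiece n ψ0 k) (x - z) * T' z)) := by
    refine tendsto_integral_of_dominated_convergence
      (fun z => ‖invFT n (lpPiece n ψ0 k) (x - z)‖ * (B * ∫ ξ, g ξ))
      (fun M => hΨ.1.mul (hTm M)) (hΨ.norm.mul_const _) (fun M => ?_) ?_
    · refine Filter.Eventually.of_forall fun z => ?_
      rw [norm_mul]
      exact mul_le_mul_of_nonneg_left (hTb M z) (norm_nonneg _)
    · exact Filter.Eventually.of_forall fun z => (hlim z).const_mul _
  have hfio : smoothOp n (lpPiece n ψ0 k) (fio n a φ f) x =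
      ((((2 * Real.pi) ^ n)⁻¹ : ℝ) : ℂ) * ∫ z, invFT n (lpPiece n ψ0 k) (x - z) * T' z := by
    simp only [smoothOp, fio, hT']
    rw [← integral_const_mul]
    simp only [mul_left_comm]
  have hc0 : ‖((((2 * Real.pi) ^ n)⁻¹ : ℝ) : ℂ)‖ₑ = ENNReal.ofReal ((2 * Real.pi) ^ n)⁻¹ := by
    rw [← ofReal_norm, Complex.norm_real, Real.norm_of_nonneg (by positivity)]
  rw [hfio, enorm_mul, hc0]
  gcongr
  refine le_of_tendsto' ((continuous_enorm.tendsto _).comp hlim2) fun M => ?_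
  simp only [Function.comp, hT]
  rw [ha.integral_mult_eq haK hφ hΦ hΦφ hK hψ hf hint]
  refine (enorm_sum_le _ _).trans (le_trans ?_ (ENNReal.sum_le_tsum (Finset.range M)))
  exact Finset.sum_le_sum fun N _ => enorm_add_le _ _

end Decomposition

section ScaleArithmetic

theorem rpow_le_rpow_of_le_of_abs {y W e : ℝ} (hy : 1 ≤ y) (hyW : y ≤ W) : y ^ e ≤ W ^ |e| :=
  (Real.rpow_le_rpow_of_exponent_le hy (le_abs_self e)).trans
    (Real.rpow_le_rpow (by linarith) hyW (abs_nonneg e))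

theorem scale_off_le {n N : ℕ} {m s p x l : ℝ} (hx : 1 ≤ x) (hl : 0 < l)
    (hN : |m * p| + 2 * |s * p| + n + 2 ≤ N) :
    x ^ (s * p) * ((l ^ n * (1 + l) ^ m) ^ p * (l ^ (-(n * max (p - 1) 0)) / (1 + (l + x)) ^ N)) ≤
      l ^ (n * min p 1) * (1 + (l + x)) ^ (-(|s * p| + n + 2)) := by
  set W := 1 + (l + x) with hW
  have hW1 : 1 ≤ W := by linarith
  have hW0 : 0 < W := by linarith
  have hl1 : 0 < 1 + l := by linarith
  have h1 : x ^ (s * p) ≤ W ^ |s * p| := rpow_le_rpow_of_le_of_abs hx (by linarith)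
  have h2 : (1 + l) ^ (m * p) ≤ W ^ |m * p| := rpow_le_rpow_of_le_of_abs (by linarith) (by linarith)
  have h3 : (l ^ n * (1 + l) ^ m) ^ p = l ^ (n * p) * (1 + l) ^ (m * p) := by
    rw [Real.mul_rpow (by positivity) (by positivity), ← Real.rpow_natCast, ← Real.rpow_mul hl.le,
      ← Real.rpow_mul hl1.le]
  have h4 : l ^ (n * p) * l ^ (-(n * max (p - 1) 0)) = l ^ (n * min p 1) := by
    rw [← Real.rpow_add hl]
    congr 1
    rcases le_total p 1 with h | h
    · rw [max_eq_right (by linarith), min_eq_left h]; ring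
    · rw [max_eq_left (by linarith), min_eq_right h]; ring
  calc x ^ (s * p) * ((l ^ n * (1 + l) ^ m) ^ p * (l ^ (-(n * max (p - 1) 0)) / W ^ N))
      = l ^ (n * min p 1) * (x ^ (s * p) * (1 + l) ^ (m * p) * (W ^ N)⁻¹) := by
        rw [h3, ← h4]; ring
    _ ≤ l ^ (n * min p 1) * (W ^ |s * p| * W ^ |m * p| * (W ^ N)⁻¹) := by gcongr
    _ = l ^ (n * min p 1) * W ^ (|s * p| + |m * p| - N) := by
        rw [Real.rpow_sub hW0, Real.rpow_add hW0, Real.rpow_natCast]; ring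
    _ ≤ _ := by
        gcongr
        linarith

theorem scale_near_le {n : ℕ} {m s p x l κ η B : ℝ} (hx : 1 ≤ x) (hl : 1 ≤ l) (hB : 1 ≤ B)
    (h1 : x ≤ B * l) (h2 : l / B ≤ x) (hη : 0 ≤ η) (hκ : m * p + κ = -(2 * η)) :
    x ^ (s * p) * ((l ^ n * (1 + l) ^ m) ^ p * l ^ (-(n * p) + κ)) ≤
      B ^ |s * p| * 2 ^ |m * p| * B ^ η * ((x * l) ^ (-η) * l ^ (s * p)) := by
  have hl0 : 0 < l := by linarith
  have hx0 : 0 < x := by linarith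
  have hB0 : 0 < B := by linarith
  have hl1 : 0 < 1 + l := by linarith
  have e1 : x ^ (s * p) ≤ B ^ |s * p| * l ^ (s * p) := rpow_le_of_comparable hl0 hB h2 h1 _
  have e2 : (1 + l) ^ (m * p) ≤ 2 ^ |m * p| * l ^ (m * p) :=
    rpow_le_of_comparable hl0 one_le_two (by linarith) (by linarith) _
  have e3 : l ^ (-η) ≤ B ^ η * x ^ (-η) := by
    have := rpow_le_of_comparable hx0 hB (by rwa [div_le_iff₀' hB0])
      (by rwa [div_le_iff₀' hB0] at h2)
      (-η) (y := l)
    rwa [abs_neg, abs_of_nonneg hη] at this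
  have h3 : (l ^ n * (1 + l) ^ m) ^ p = l ^ (n * p) * (1 + l) ^ (m * p) := by
    rw [Real.mul_rpow (by positivity) (by positivity), ← Real.rpow_natCast, ← Real.rpow_mul hl0.le,
      ← Real.rpow_mul hl1.le]
  have h4 : l ^ (n * p) * l ^ (m * p) * l ^ (-(n * p) + κ) = l ^ (-η) * l ^ (-η) := by
    rw [← Real.rpow_add hl0, ← Real.rpow_add hl0, ← Real.rpow_add hl0]
    congr 1
    linarith
  calc x ^ (s * p) * ((l ^ n * (1 + l) ^ m) ^ p * l ^ (-(n * p) + κ))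
      = x ^ (s * p) * (l ^ (n * p) * (1 + l) ^ (m * p) * l ^ (-(n * p) + κ)) := by rw [h3]
    _ ≤ B ^ |s * p| * l ^ (s * p) *
        (l ^ (n * p) * (2 ^ |m * p| * l ^ (m * p)) * l ^ (-(n * p) + κ)) := by gcongr
    _ = B ^ |s * p| * 2 ^ |m * p| * l ^ (s * p) *
        (l ^ (n * p) * l ^ (m * p) * l ^ (-(n * p) + κ)) := by ring
    _ ≤ B ^ |s * p| * 2 ^ |m * p| * l ^ (s * p) * ((B ^ η * x ^ (-η)) * l ^ (-η)) := by
        rw [h4]; gcongr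
    _ = _ := by rw [Real.mul_rpow hx0.le hl0.le]; ring

end ScaleArithmetic

section PairEstimates
variable {n : ℕ} {K : Set (Rn n)} {Φ : Rn n → Rn n → ℝ} {m s p : ℝ} {a : Rn n → Rn n → ℂ}
  {χ ψ0 : Rn n → ℝ}

theorem mul_lintegral_pieceOp_le {k : ℕ} {l A c : ℝ} (hp : 0 < p) (hl : 0 < l) (hc : 0 ≤ c)
    {u : Rn n → ℂ} {X : ℝ≥0∞}
    (h : ∫⁻ x, ‖∫ y, pieceKer ψ0 (localAmp m a χ) Φ k l x y * u y‖ₑ ^ p ≤ ENNReal.ofReal A * X) :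
    ENNReal.ofReal c * ∫⁻ x, ‖pieceOp ψ0 m a χ Φ k l u x‖ₑ ^ p ≤
      ENNReal.ofReal (c * ((l ^ n * (1 + l) ^ m) ^ p * A)) * X := by
  have hl1 : 0 < 1 + l := by linarith
  have e : ∀ x, ‖pieceOp ψ0 m a χ Φ k l u x‖ₑ ^ p = ENNReal.ofReal ((l ^ n * (1 + l) ^ m) ^ p) *
      ‖∫ y, pieceKer ψ0 (localAmp m a χ) Φ k l x y * u y‖ₑ ^ p := fun x => by
    rw [pieceOp, enorm_mul, ENNReal.mul_rpow_of_nonneg _ _ hp.le, ← ofReal_norm (_ : ℂ),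
      Complex.norm_real, Real.norm_of_nonneg (by positivity),
      ENNReal.ofReal_rpow_of_nonneg (by positivity) hp.le]
  simp only [e]
  rw [lintegral_const_mul' _ _ ENNReal.ofReal_ne_top, ENNReal.ofReal_mul hc,
    ENNReal.ofReal_mul (by positivity), mul_assoc, mul_assoc]
  gcongr

theorem two_pow_mul_rpow_neg (k N : ℕ) (δ : ℝ) :
    ((2 : ℝ) ^ k * 2 ^ N) ^ (-δ) = (2 ^ (-δ)) ^ (k + N) := by
  rw [← pow_add, ← Real.rpow_natCast, ← Real.rpow_natCast, ← Real.rpow_mul two_pos.le,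
    ← Real.rpow_mul two_pos.le, mul_comm]

theorem SymbolClass.exists_low_bound (hp : 0 < p) (ha : SymbolClass n m a)
    (haK : ∀ x, x ∉ K → ∀ ξ, a x ξ = 0) (hΦ : GoodPhase n K Φ) (hK : IsCompact K)
    (hψ : IsLPBase n ψ0) (s : ℝ) {δ : ℝ} (hδ1 : δ ≤ 1) (hδ2 : δ ≤ n * min p 1) :
    ∃ C : ℝ, 0 < C ∧ ∀ k N : ℕ, ∀ u, BandLimited n 2 u →
      ENNReal.ofReal ((2 ^ k : ℝ) ^ (s * p)) *
          ∫⁻ x, ‖pieceOp ψ0 m a (lpProfile ψ0) Φ k (2 / 2 ^ N) u x‖ₑ ^ p ≤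
        ENNReal.ofReal (C * (2 ^ (-δ)) ^ (k + N)) * ∫⁻ x, ‖u x‖ₑ ^ p := by
  have hb := ha.goodAmp haK hψ.contDiff_profile hψ.profile_mem_ann
  obtain ⟨C₁, c₁, -, -, hoff⟩ := hb.exists_piece_off hΦ hK hψ hp
  set N0 := ⌈|m * p| + 2 * |s * p| + n + 2⌉₊ with hN0
  obtain ⟨C, hC0, hC⟩ := hoff N0
  refine ⟨C * 2 ^ (n * min p 1), by positivity, fun k N u hu => ?_⟩
  have hx : (1 : ℝ) ≤ 2 ^ k := one_le_pow₀ one_le_two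
  have hy : (1 : ℝ) ≤ 2 ^ N := one_le_pow₀ one_le_two
  have hl : (0 : ℝ) < 2 / 2 ^ N := by positivity
  have hl2 : (2 : ℝ) / 2 ^ N ≤ 2 := div_le_self zero_le_two hy
  refine (mul_lintegral_pieceOp_le hp hl (by positivity) (hC k _ hl (Or.inr (Or.inr hl2)) u
    (hu.mono (by linarith [le_max_left 1 ((2 : ℝ) / 2 ^ N)])))).trans
    (mul_le_mul' (ENNReal.ofReal_le_ofReal ?_) le_rfl)
  have h1 := scale_off_le (m := m) (s := s) (N := N0) hx hl (Nat.le_ceil _)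
  have hρ : 0 ≤ n * min p 1 := by positivity
  have hW : (1 : ℝ) ≤ 1 + (2 / 2 ^ N + 2 ^ k) := by linarith
  have hW2 : (1 + (2 / 2 ^ N + 2 ^ k) : ℝ) ^ (-(|s * p| + n + 2)) ≤ (2 ^ k : ℝ) ^ (-δ) := by
    have hn' : (0 : ℝ) ≤ n := by positivity
    have he : -(|s * p| + n + 2) ≤ -1 := by linarith [abs_nonneg (s * p)]
    refine (Real.rpow_le_rpow_of_exponent_le hW he).trans ?_
    refine le_trans ?_ (Real.rpow_le_rpow_of_exponent_le hx (by linarith : -1 ≤ -δ))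
    exact Real.rpow_le_rpow_of_nonpos (by positivity) (by linarith) (by norm_num)
  calc (2 ^ k : ℝ) ^ (s * p) * (((2 / 2 ^ N) ^ n * (1 + 2 / 2 ^ N) ^ m) ^ p *
        (C * (2 / 2 ^ N) ^ (-(n * max (p - 1) 0)) / (1 + (2 / 2 ^ N + 2 ^ k)) ^ N0))
      = C * ((2 ^ k : ℝ) ^ (s * p) * (((2 / 2 ^ N) ^ n * (1 + 2 / 2 ^ N) ^ m) ^ p *
        ((2 / 2 ^ N) ^ (-(n * max (p - 1) 0)) / (1 + (2 / 2 ^ N + 2 ^ k)) ^ N0))) := by ring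
    _ ≤ C * ((2 / 2 ^ N) ^ (n * min p 1) * (2 ^ k : ℝ) ^ (-δ)) := by
        exact mul_le_mul_of_nonneg_left (h1.trans
          (mul_le_mul_of_nonneg_left hW2 (by positivity))) hC0.le
    _ = C * (2 ^ (n * min p 1) * ((2 ^ N) ^ (-(n * min p 1)) * (2 ^ k : ℝ) ^ (-δ))) := by
        rw [Real.div_rpow two_pos.le (by positivity), Real.rpow_neg (x := 2 ^ N) (by positivity)]
        ring
    _ ≤ C * (2 ^ (n * min p 1) * ((2 ^ N) ^ (-δ) * (2 ^ k : ℝ) ^ (-δ))) := by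
        gcongr
    _ = _ := by
        rw [← Real.mul_rpow (by positivity) (by positivity), mul_comm ((2 : ℝ) ^ N),
          two_pow_mul_rpow_neg]
        ring

theorem SymbolClass.exists_high_bound (hp : 0 < p) (ha : SymbolClass n m a)
    (haK : ∀ x, x ∉ K → ∀ ξ, a x ξ = 0) (hΦ : GoodPhase n K Φ) (hK : IsCompact K)
    (hψ : IsLPBase n ψ0) (s : ℝ) {δ η : ℝ} (hδ0 : 0 ≤ δ) (hδ1 : δ ≤ 1) (hδ2 : δ ≤ η)
    (hη : m * p + ((n : ℝ) - 1) * |1 - p / 2| = -(2 * η)) :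
    ∃ C : ℝ, 0 < C ∧ ∀ k N : ℕ, ∀ u, BandLimited n (2 * 2 ^ (N + 1)) u →
      ENNReal.ofReal ((2 ^ k : ℝ) ^ (s * p)) *
          ∫⁻ x, ‖pieceOp ψ0 m a (wideProfile ψ0) Φ k (2 ^ (N + 1)) u x‖ₑ ^ p ≤
        ENNReal.ofReal (C * (2 ^ (-δ)) ^ (k + N) * (2 ^ (N + 1) : ℝ) ^ (s * p)) *
          ∫⁻ x, ‖u x‖ₑ ^ p := by
  have hb := ha.goodAmp haK hψ.contDiff_wideProfile hψ.wideProfile_mem_ann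
  obtain ⟨C₁, c₁, hC₁, hc₁, hoff⟩ := hb.exists_piece_off hΦ hK hψ hp
  set N0 := ⌈|m * p| + 2 * |s * p| + n + 2⌉₊ with hN0
  obtain ⟨C, hC0, hC⟩ := hoff N0
  obtain ⟨D, hD0, hD⟩ := hb.exists_piece_near hΦ hK hψ hp (c := min 1 (c₁ / 2)) (by positivity)
    (min_le_left _ _)
  set B := max (2 * C₁) (2 / c₁) with hBdef
  have hB : 1 ≤ B := le_max_of_le_left (by linarith)
  set E := C + D * (B ^ |s * p| * 2 ^ |m * p| * B ^ η) with hE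
  have hE0 : 0 < D * (B ^ |s * p| * 2 ^ |m * p| * B ^ η) := by positivity
  refine ⟨E, by positivity, fun k N u hu => ?_⟩
  set l : ℝ := 2 ^ (N + 1) with hldef
  set x : ℝ := 2 ^ k with hxdef
  have hx : 1 ≤ x := one_le_pow₀ one_le_two
  have hl : 1 ≤ l := one_le_pow₀ one_le_two
  have hl0 : 0 < l := by linarith
  have hx0 : 0 < x := by linarith
  have hxl1 : 1 ≤ x * l := one_le_mul_of_one_le_of_one_le hx hl
  have hu' : BandLimited n (2 * max 1 l) u := by rwa [max_eq_right hl]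
  have hxl : ∀ e : ℝ, δ ≤ e → (x * l) ^ (-e) ≤ (2 ^ (-δ)) ^ (k + N) := fun e he =>
    calc (x * l) ^ (-e) ≤ (x * l) ^ (-δ) := Real.rpow_le_rpow_of_exponent_le hxl1 (by linarith)
      _ = (2 ^ (-δ)) ^ (k + N + 1) := two_pow_mul_rpow_neg k (N + 1) δ
      _ ≤ _ := pow_le_pow_of_le_one (by positivity)
          (Real.rpow_le_one_of_one_le_of_nonpos one_le_two (by linarith)) (Nat.le_succ _)
  by_cases hod : OffDiag C₁ c₁ k l
  · refine (mul_lintegral_pieceOp_le hp hl0 (by positivity) (hC k _ hl0 hod u hu')).trans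
      (mul_le_mul' (ENNReal.ofReal_le_ofReal ?_) le_rfl)
    have h1 := scale_off_le (m := m) (s := s) (N := N0) hx hl0 (Nat.le_ceil _)
    set W := 1 + (l + x) with hW
    have hW1 : 1 ≤ W := by linarith
    have hW0 : 0 < W := by linarith
    have h2 : l ^ (n * min p 1) ≤ W ^ (n : ℝ) :=
      (Real.rpow_le_rpow_of_exponent_le hl (mul_le_of_le_one_right (by positivity)
        (min_le_right p 1))).trans (Real.rpow_le_rpow hl0.le (by linarith) (by positivity))
    have h3 : W ^ (-|s * p|) ≤ l ^ (s * p) := by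
      rw [Real.rpow_neg hW0.le, inv_le_comm₀ (by positivity) (by positivity),
        ← Real.rpow_neg hl0.le]
      simpa using rpow_le_rpow_of_le_of_abs (e := -(s * p)) hl (by linarith : l ≤ W)
    have h4 : W ^ (-2 : ℝ) ≤ (x * l) ^ (-1 : ℝ) := by
      rw [Real.rpow_neg hW0.le, Real.rpow_neg_one, Real.rpow_two]
      gcongr
      nlinarith
    calc x ^ (s * p) * ((l ^ n * (1 + l) ^ m) ^ p * (C * l ^ (-(n * max (p - 1) 0)) / W ^ N0))
        = C * (x ^ (s * p) * ((l ^ n * (1 + l) ^ m) ^ p *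
            (l ^ (-(n * max (p - 1) 0)) / W ^ N0))) := by ring
      _ ≤ C * (W ^ (n : ℝ) * W ^ (-(|s * p| + n + 2))) := by
          exact mul_le_mul_of_nonneg_left (h1.trans
            (mul_le_mul_of_nonneg_right h2 (by positivity))) hC0.le
      _ = C * (W ^ (-2 : ℝ) * W ^ (-|s * p|)) := by
          rw [← Real.rpow_add hW0, ← Real.rpow_add hW0]
          ring_nf
      _ ≤ C * ((2 ^ (-δ)) ^ (k + N) * l ^ (s * p)) := by
          gcongr
          exact h4.trans (hxl 1 hδ1)
      _ ≤ E * ((2 ^ (-δ)) ^ (k + N) * l ^ (s * p)) := by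
          gcongr
          linarith
      _ = _ := by ring
  · simp only [OffDiag, not_or, not_le] at hod
    obtain ⟨ho1, ho2, -⟩ := hod
    have hnear : min 1 (c₁ / 2) * l ≤ 2 ^ k :=
      (mul_le_mul_of_nonneg_right (min_le_right _ _) hl0.le).trans (by linarith)
    refine (mul_lintegral_pieceOp_le hp hl0 (by positivity) (hD k l hl hnear u hu')).trans
      (mul_le_mul' (ENNReal.ofReal_le_ofReal ?_) le_rfl)
    have hxB : x ≤ B * l := by
      refine le_trans (by linarith) (mul_le_mul_of_nonneg_right (le_max_left _ _) hl0.le)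
    have hlB : l / B ≤ x := by
      rw [div_le_iff₀ (by linarith)]
      refine le_trans ?_ (mul_le_mul_of_nonneg_left (le_max_right _ _) hx0.le)
      rw [mul_div_assoc', le_div_iff₀ hc₁]
      linarith
    calc x ^ (s * p) * ((l ^ n * (1 + l) ^ m) ^ p *
          (D * l ^ (-(n * p) + ((n : ℝ) - 1) * |1 - p / 2|)))
        = D * (x ^ (s * p) * ((l ^ n * (1 + l) ^ m) ^ p *
          l ^ (-(n * p) + ((n : ℝ) - 1) * |1 - p / 2|))) := by ring
      _ ≤ D * (B ^ |s * p| * 2 ^ |m * p| * B ^ η * ((x * l) ^ (-η) * l ^ (s * p))) :=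
          mul_le_mul_of_nonneg_left
            (scale_near_le hx hl hB hxB hlB (hδ0.trans hδ2) hη) hD0.le
      _ ≤ D * (B ^ |s * p| * 2 ^ |m * p| * B ^ η * ((2 ^ (-δ)) ^ (k + N) * l ^ (s * p))) := by
          gcongr
          exact hxl η hδ2
      _ = D * (B ^ |s * p| * 2 ^ |m * p| * B ^ η) * ((2 ^ (-δ)) ^ (k + N) * l ^ (s * p)) := by ring
      _ ≤ E * ((2 ^ (-δ)) ^ (k + N) * l ^ (s * p)) := by
          gcongr
          linarith
      _ = _ := by ring

end PairEstimates

end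

section SequenceNorm

theorem lqSum_mono (q : ℝ≥0∞) {u v : ℕ → ℝ≥0∞} (h : ∀ k, u k ≤ v k) : lqSum q u ≤ lqSum q v := by
  rw [lqSum, lqSum]
  split_ifs
  · exact iSup_mono h
  · gcongr with k
    exact h k

theorem le_lqSum {q : ℝ≥0∞} (hq : 0 < q) (u : ℕ → ℝ≥0∞) (j : ℕ) : u j ≤ lqSum q u := by
  rw [lqSum]
  split_ifs with h
  · exact le_iSup u j
  · have hq0 : 0 < q.toReal := ENNReal.toReal_pos hq.ne' h
    calc u j = (u j ^ q.toReal) ^ (1 / q.toReal) := by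
          rw [← ENNReal.rpow_mul, mul_one_div_cancel hq0.ne', ENNReal.rpow_one]
      _ ≤ _ := by
          gcongr
          exact ENNReal.le_tsum j

theorem exists_lqSum_geometric_le {q ρ : ℝ≥0∞} (hq : 0 < q) (hρ : ρ < 1) :
    ∃ A : ℝ≥0∞, A ≠ ∞ ∧ ∀ S, (lqSum q fun k => ρ ^ k * S) ≤ A * S := by
  by_cases h : q = ∞
  · refine ⟨1, ENNReal.one_ne_top, fun S => ?_⟩
    rw [lqSum, if_pos h]
    exact iSup_le fun k => by gcongr; exact pow_le_one₀ bot_le hρ.le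
  · have hq0 : 0 < q.toReal := ENNReal.toReal_pos hq.ne' h
    refine ⟨((1 - ρ ^ q.toReal)⁻¹) ^ (1 / q.toReal), ?_, fun S => ?_⟩
    · refine ENNReal.rpow_ne_top_of_nonneg (by positivity) (ENNReal.inv_ne_top.2 ?_)
      exact (tsub_pos_of_lt (ENNReal.rpow_lt_one hρ hq0)).ne'
    · have e : ∀ k : ℕ, (ρ ^ k * S) ^ q.toReal = (ρ ^ q.toReal) ^ k * S ^ q.toReal := fun k => by
        rw [ENNReal.mul_rpow_of_nonneg _ _ hq0.le, ← ENNReal.rpow_natCast, ← ENNReal.rpow_natCast,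
          ← ENNReal.rpow_mul, ← ENNReal.rpow_mul, mul_comm (k : ℝ)]
      rw [lqSum, if_neg h]
      simp only [e]
      rw [ENNReal.tsum_mul_right, ENNReal.tsum_geometric,
        ENNReal.mul_rpow_of_nonneg _ _ (by positivity), ← ENNReal.rpow_mul,
        mul_one_div_cancel hq0.ne', ENNReal.rpow_one]

/-- An off-diagonal geometric gain sums up in `L^p(ℓ^q)`, for all exponents. -/
theorem exists_lintegral_lqSum_le {α : Type*} [MeasurableSpace α] (μ : Measure α) {q t : ℝ≥0∞}
    (hq : 0 < q) {p : ℝ} (hp : 0 < p) (ht0 : t ≠ 0) (ht1 : t < 1) :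
    ∃ A : ℝ≥0∞, A ≠ ∞ ∧ ∀ (V : ℕ → α → ℝ≥0∞) (v : ℕ → ℕ → α → ℝ≥0∞) (X : ℝ≥0∞),
      (∀ k i, AEMeasurable (v k i) μ) → (∀ k x, V k x ≤ ∑' i, v k i x) →
      (∀ k i, ∫⁻ x, v k i x ^ p ∂μ ≤ (t * t) ^ (k + i) * X) →
      ∫⁻ x, (lqSum q fun k => V k x) ^ p ∂μ ≤ A * X := by
  have htt : t ≠ ∞ := (ht1.trans ENNReal.one_lt_top).ne
  set ρ := t ^ (1 / p) with hρdef
  have hρ : ρ < 1 := ENNReal.rpow_lt_one ht1 (by positivity)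
  obtain ⟨A, hA, hAS⟩ := exists_lqSum_geometric_le hq hρ
  set G := (1 - ρ)⁻¹ with hG
  have hGt : G ≠ ∞ := ENNReal.inv_ne_top.2 (tsub_pos_of_lt hρ).ne'
  set H := (1 - t)⁻¹ with hH
  have hHt : H ≠ ∞ := ENNReal.inv_ne_top.2 (tsub_pos_of_lt ht1).ne'
  refine ⟨(A * G) ^ p * (H * H), ENNReal.mul_ne_top (ENNReal.rpow_ne_top_of_nonneg hp.le
    (ENNReal.mul_ne_top hA hGt)) (ENNReal.mul_ne_top hHt hHt), fun V v X hv hV hX => ?_⟩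
  set Z : α → ℝ≥0∞ := fun x => ∑' k, ∑' i, (t ^ (k + i))⁻¹ * v k i x ^ p with hZ
  have hpow0 : ∀ j : ℕ, t ^ j ≠ 0 := fun j => pow_ne_zero j ht0
  have hpowt : ∀ j : ℕ, t ^ j ≠ ∞ := fun j => ENNReal.pow_ne_top htt
  have h1 : ∀ k i x, v k i x ≤ ρ ^ k * (ρ ^ i * Z x ^ (1 / p)) := fun k i x => by
    have h2 : (t ^ (k + i))⁻¹ * v k i x ^ p ≤ Z x :=
      (ENNReal.le_tsum (f := fun i => (t ^ (k + i))⁻¹ * v k i x ^ p) i).trans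
        (ENNReal.le_tsum (f := fun k => ∑' i, (t ^ (k + i))⁻¹ * v k i x ^ p) k)
    rw [ENNReal.inv_mul_le_iff (hpow0 _) (hpowt _)] at h2
    calc v k i x = (v k i x ^ p) ^ (1 / p) := by
          rw [← ENNReal.rpow_mul, mul_one_div_cancel hp.ne', ENNReal.rpow_one]
      _ ≤ (t ^ (k + i) * Z x) ^ (1 / p) := by gcongr
      _ = _ := by
          rw [ENNReal.mul_rpow_of_nonneg _ _ (by positivity), ← mul_assoc, ← pow_add, hρdef,
            ← ENNReal.rpow_natCast, ← ENNReal.rpow_natCast, ← ENNReal.rpow_mul,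
            ← ENNReal.rpow_mul, mul_comm (1 / p)]
  have h3 : ∀ x, (lqSum q fun k => V k x) ^ p ≤ (A * G) ^ p * Z x := fun x => by
    have h4 : ∀ k, V k x ≤ ρ ^ k * (G * Z x ^ (1 / p)) := fun k => by
      refine (hV k x).trans ((ENNReal.tsum_le_tsum fun i => h1 k i x).trans_eq ?_)
      rw [ENNReal.tsum_mul_left, ENNReal.tsum_mul_right, ENNReal.tsum_geometric]
    calc (lqSum q fun k => V k x) ^ p ≤ (A * (G * Z x ^ (1 / p))) ^ p := by
          gcongr
          exact (lqSum_mono q h4).trans (hAS _)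
      _ = _ := by
          rw [← mul_assoc, ENNReal.mul_rpow_of_nonneg _ _ hp.le, ← ENNReal.rpow_mul,
            one_div_mul_cancel hp.ne', ENNReal.rpow_one]
  have hm : ∀ k i, AEMeasurable (fun x => (t ^ (k + i))⁻¹ * v k i x ^ p) μ := fun k i =>
    ((hv k i).pow_const p).const_mul _
  calc ∫⁻ x, (lqSum q fun k => V k x) ^ p ∂μ ≤ ∫⁻ x, (A * G) ^ p * Z x ∂μ := lintegral_mono h3
    _ = (A * G) ^ p * ∑' k, ∑' i, (t ^ (k + i))⁻¹ * ∫⁻ x, v k i x ^ p ∂μ := by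
        rw [lintegral_const_mul' _ _ (ENNReal.rpow_ne_top_of_nonneg hp.le
          (ENNReal.mul_ne_top hA hGt)), hZ, lintegral_tsum fun k =>
            AEMeasurable.tsum fun i => hm k i]
        simp only [lintegral_tsum fun i => hm _ i,
          lintegral_const_mul' _ _ (ENNReal.inv_ne_top.2 (hpow0 _))]
    _ ≤ (A * G) ^ p * ∑' k : ℕ, ∑' i : ℕ, t ^ k * (t ^ i * X) := by
        refine mul_le_mul' le_rfl (ENNReal.tsum_le_tsum fun k =>
          ENNReal.tsum_le_tsum fun i => ?_)
        rw [ENNReal.inv_mul_le_iff (hpow0 _) (hpowt _)]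
        refine (hX k i).trans_eq ?_
        rw [mul_pow]
        ring
    _ = _ := by
        simp only [ENNReal.tsum_mul_left, ENNReal.tsum_mul_right, ENNReal.tsum_geometric]
        ring

end SequenceNorm

section Assembly
variable {n : ℕ} {K : Set (Rn n)} {Φ φ : Rn n → Rn n → ℝ} {m p : ℝ} {a : Rn n → Rn n → ℂ}
  {ψ0 : Rn n → ℝ}

theorem aemeasurable_pieceOp {χ : Rn n → ℝ} (hb : GoodAmp n K (localAmp m a χ))
    (hΦ : GoodPhase n K Φ) (hK : IsCompact K) (hψ : IsLPBase n ψ0) (k : ℕ) {l : ℝ} (hl : 0 < l)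
    {u : Rn n → ℂ} (hu : Integrable u) :
    AEMeasurable fun x => ‖pieceOp ψ0 m a χ Φ k l u x‖ₑ :=
  ((((hb.continuous_pieceKer hΦ hK hψ k hl).aestronglyMeasurable.mul
    hu.1.comp_snd).integral_prod_right').const_mul _).enorm

theorem ofReal_two_rpow_rpow (k : ℕ) (s : ℝ) (hp : 0 ≤ p) :
    ENNReal.ofReal ((2 : ℝ) ^ ((k : ℝ) * s)) ^ p = ENNReal.ofReal ((2 ^ k : ℝ) ^ (s * p)) := by
  rw [ENNReal.ofReal_rpow_of_nonneg (by positivity) hp, ← Real.rpow_mul zero_le_two,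
    ← Real.rpow_natCast, ← Real.rpow_mul zero_le_two, mul_assoc]

theorem add_rpow_le_two_rpow_mul (hp : 0 ≤ p) (x y : ℝ≥0∞) :
    (x + y) ^ p ≤ 2 ^ p * (x ^ p + y ^ p) := by
  have h : x + y ≤ 2 * max x y := by
    rw [two_mul]
    exact add_le_add (le_max_left _ _) (le_max_right _ _)
  refine (ENNReal.rpow_le_rpow h hp).trans ?_
  rw [ENNReal.mul_rpow_of_nonneg _ _ hp]
  gcongr
  rcases le_total x y with h | h
  · rw [max_eq_right h]; exact le_add_self
  · rw [max_eq_left h]; exact le_self_add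

theorem lintegral_weight_mul_add_rpow_le {α : Type*} [MeasurableSpace α] {μ : Measure α}
    (hp : 0 ≤ p) {w c X Y : ℝ≥0∞} (hw : w ≠ ∞) (hc : c ≠ ∞) {f g : α → ℝ≥0∞}
    (hf : AEMeasurable f μ) (hX : w ^ p * ∫⁻ x, f x ^ p ∂μ ≤ X)
    (hY : w ^ p * ∫⁻ x, g x ^ p ∂μ ≤ Y) :
    ∫⁻ x, (w * (c * (f x + g x))) ^ p ∂μ ≤ (c * 2) ^ p * (X + Y) := by
  have hc2 : (c * 2) ^ p ≠ ∞ :=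
    ENNReal.rpow_ne_top_of_nonneg hp (ENNReal.mul_ne_top hc ENNReal.ofNat_ne_top)
  calc ∫⁻ x, (w * (c * (f x + g x))) ^ p ∂μ
      ≤ ∫⁻ x, (c * 2) ^ p * (w ^ p * (f x ^ p + g x ^ p)) ∂μ := by
        refine lintegral_mono fun x => ?_
        rw [ENNReal.mul_rpow_of_nonneg _ _ hp, ENNReal.mul_rpow_of_nonneg _ _ hp,
          ENNReal.mul_rpow_of_nonneg _ _ hp]
        refine (mul_le_mul' le_rfl (mul_le_mul' le_rfl
          (add_rpow_le_two_rpow_mul hp (f x) (g x)))).trans_eq ?_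
        ring
    _ = (c * 2) ^ p * (w ^ p * (∫⁻ x, f x ^ p ∂μ) + w ^ p * ∫⁻ x, g x ^ p ∂μ) := by
        rw [lintegral_const_mul' _ _ hc2,
          lintegral_const_mul' _ _ (ENNReal.rpow_ne_top_of_nonneg hp hw),
          lintegral_add_left' (hf.pow_const p), mul_add]
    _ ≤ _ := mul_le_mul' le_rfl (add_le_add hX hY)

theorem SymbolClass.exists_lintegral_lqSum_fio_le (hn : 1 ≤ n) (hp : 0 < p) {q : ℝ≥0∞}
    (hq : 0 < q) (ha : SymbolClass n m a) (haK : ∀ x, x ∉ K → ∀ ξ, a x ξ = 0)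
    (hφ : PhaseSmoothHomog n φ) (hnd : NonDegenerateOn n φ K) (hK : IsCompact K)
    (hψ : IsLPBase n ψ0) (s : ℝ) {η : ℝ} (hη0 : 0 < η)
    (hη : m * p + ((n : ℝ) - 1) * |1 - p / 2| = -(2 * η)) :
    ∃ A : ℝ≥0∞, A ≠ ∞ ∧ ∀ f : SchwartzMap (Rn n) ℂ,
      ∫⁻ x, (lqSum q fun j => ENNReal.ofReal ((2 : ℝ) ^ ((j : ℝ) * s)) *
        ‖smoothOp n (lpPiece n ψ0 j) (fio n a φ f) x‖ₑ) ^ p ≤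
      A * ∫⁻ x, (lqSum q fun j => ENNReal.ofReal ((2 : ℝ) ^ ((j : ℝ) * s)) *
        ‖smoothOp n (lpPiece n ψ0 j) f x‖ₑ) ^ p := by
  obtain ⟨Φ, hΦ, hΦφ⟩ := exists_goodPhase hφ hK hnd
  set δ : ℝ := min 1 (min (n * min p 1) η) with hδ
  have hn0 : (0 : ℝ) < n := by exact_mod_cast hn
  have hδ0 : 0 < δ := by positivity
  have hδ1 : δ ≤ 1 := min_le_left _ _
  have hδ2 : δ ≤ n * min p 1 := (min_le_right _ _).trans (min_le_left _ _)
  have hδ3 : δ ≤ η := (min_le_right _ _).trans (min_le_right _ _)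
  obtain ⟨CL, hCL0, hL⟩ := ha.exists_low_bound hp haK hΦ hK hψ s hδ1 hδ2
  obtain ⟨CH, hCH0, hH⟩ := ha.exists_high_bound hp haK hΦ hK hψ s hδ0.le hδ1 hδ3 hη
  have hbL := ha.goodAmp haK hψ.contDiff_profile hψ.profile_mem_ann
  have hbH := ha.goodAmp haK hψ.contDiff_wideProfile hψ.wideProfile_mem_ann
  set t : ℝ≥0∞ := ENNReal.ofReal (2 ^ (-(δ / 2))) with ht
  have htt : t * t = ENNReal.ofReal (2 ^ (-δ)) := by
    rw [ht, ← ENNReal.ofReal_mul (by positivity), ← Real.rpow_add two_pos]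
    congr 2
    ring
  have ht0 : t ≠ 0 := (ENNReal.ofReal_pos.2 (by positivity)).ne'
  have ht1 : t < 1 := by
    rw [ht, ENNReal.ofReal_lt_one]
    exact Real.rpow_lt_one_of_one_lt_of_neg one_lt_two (by linarith)
  obtain ⟨A, hA, hAS⟩ := exists_lintegral_lqSum_le (volume : Measure (Rn n)) hq hp ht0 ht1
  set c : ℝ≥0∞ := ENNReal.ofReal ((2 * Real.pi) ^ n)⁻¹ with hc
  have hct : c ≠ ∞ := ENNReal.ofReal_ne_top
  have hB : (c * 2) ^ p * ENNReal.ofReal (CL + CH) ≠ ∞ := ENNReal.mul_ne_top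
    (ENNReal.rpow_ne_top_of_nonneg hp.le (ENNReal.mul_ne_top hct ENNReal.ofNat_ne_top))
    ENNReal.ofReal_ne_top
  refine ⟨A * ((c * 2) ^ p * ENNReal.ofReal (CL + CH)), ENNReal.mul_ne_top hA hB, fun f => ?_⟩
  set w : ℕ → ℝ≥0∞ := fun j => ENNReal.ofReal ((2 : ℝ) ^ ((j : ℝ) * s)) with hw
  set u : ℕ → Rn n → ℂ := fun j => smoothOp n (lpPiece n ψ0 j) f with hu
  set X : ℝ≥0∞ := ∫⁻ x, (lqSum q fun j => w j * ‖u j x‖ₑ) ^ p with hX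
  have hwt : ∀ j, w j ≠ ∞ := fun j => ENNReal.ofReal_ne_top
  have hwp : ∀ j, w j ^ p = ENNReal.ofReal ((2 ^ j : ℝ) ^ (s * p)) := fun j =>
    ofReal_two_rpow_rpow j s hp.le
  have hband : ∀ j, BandLimited n (2 * 2 ^ j) (u j) := fun j =>
    BandLimited.of_smoothOp (hψ.contDiff_piece j) (hψ.hasCompactSupport_piece j) f.integrable
      fun ξ hξ => (hψ.piece_ne_zero hξ).2
  have hpiece : ∀ j, w j ^ p * ∫⁻ x, ‖u j x‖ₑ ^ p ≤ X := fun j => by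
    rw [← lintegral_const_mul' _ _ (ENNReal.rpow_ne_top_of_nonneg hp.le (hwt j))]
    refine lintegral_mono fun x => ?_
    rw [← ENNReal.mul_rpow_of_nonneg _ _ hp.le]
    exact ENNReal.rpow_le_rpow (le_lqSum hq (fun j => w j * ‖u j x‖ₑ) j) hp.le
  have hpiece0 : ∫⁻ x, ‖u 0 x‖ₑ ^ p ≤ X := by simpa [hw] using hpiece 0
  rw [mul_assoc]
  refine hAS _ (fun k i x => w k * (c *
    (‖pieceOp ψ0 m a (lpProfile ψ0) Φ k (2 / 2 ^ i) (u 0) x‖ₑ +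
      ‖pieceOp ψ0 m a (wideProfile ψ0) Φ k (2 ^ (i + 1)) (u (i + 1)) x‖ₑ))) _
    (fun k i => ?_) (fun k x => ?_) fun k i => ?_
  · exact (((aemeasurable_pieceOp hbL hΦ hK hψ k (by positivity) (hband 0).int).add
      (aemeasurable_pieceOp hbH hΦ hK hψ k (by positivity) (hband (i + 1)).int)).const_mul
        c).const_mul (w k)
  · rw [ENNReal.tsum_mul_left, ENNReal.tsum_mul_left]
    exact mul_le_mul' le_rfl (ha.enorm_smoothOp_fio_le hn haK hφ hΦ hΦφ hK hψ f k x)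
  · refine (lintegral_weight_mul_add_rpow_le hp.le (hwt k) hct
      (aemeasurable_pieceOp hbL hΦ hK hψ k (by positivity) (hband 0).int)
      (X := ENNReal.ofReal CL * (t * t) ^ (k + i) * X)
      (Y := ENNReal.ofReal CH * (t * t) ^ (k + i) * X) ?_ ?_).trans_eq ?_
    · have h := hL k i (u 0) ((hband 0).mono (by norm_num))
      rw [ENNReal.ofReal_mul hCL0.le, ENNReal.ofReal_pow (by positivity), ← htt, ← hwp] at h
      exact h.trans (mul_le_mul' le_rfl hpiece0)
    · have h := hH k i (u (i + 1)) (hband (i + 1))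
      rw [ENNReal.ofReal_mul (by positivity), ENNReal.ofReal_mul hCH0.le,
        ENNReal.ofReal_pow (by positivity), ← htt, ← hwp, ← hwp, mul_assoc] at h
      exact h.trans (mul_le_mul' le_rfl (hpiece (i + 1)))
    · rw [ENNReal.ofReal_add hCL0.le hCH0.le]
      ring

end Assembly

/-- Local Triebel–Lizorkin boundedness below the critical order: if
`m < m_c(p)`, a compactly supported amplitude in `S^m` and a non-degenerate homogeneous
phase give `T_a^φ : F^s_{p,q} → F^s_{p,q}` for `0 < p < ∞`, `0 < q ≤ ∞`, `s ∈ ℝ`. -/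
theorem local_triebel_lizorkin_boundedness_below_critical
    (n : ℕ) (hn : 1 ≤ n) (s m : ℝ) (p q : ℝ≥0∞)
    (hp : 0 < p) (hp' : p ≠ ∞) (hq : 0 < q) (hm : m < criticalOrder n p)
    (ψ0 : Rn n → ℝ) (hψ0 : IsLPBase n ψ0)
    (a : Rn n → Rn n → ℂ) (ha : SymbolClass n m a)
    (K : Set (Rn n)) (hK : IsCompact K) (haK : ∀ x ξ : Rn n, x ∉ K → a x ξ = 0)
    (φ : Rn n → Rn n → ℝ) (hφ : PhaseSmoothHomog n φ) (hφnd : NonDegenerateOn n φ K) :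
    ∃ C : ℝ≥0, ∀ f : SchwartzMap (Rn n) ℂ,
      tlNorm n ψ0 s p q (fio n a φ ⇑f) ≤ (C : ℝ≥0∞) * tlNorm n ψ0 s p q ⇑f := by
  have hP : 0 < p.toReal := ENNReal.toReal_pos hp.ne' hp'
  have hmP : m * p.toReal + ((n : ℝ) - 1) * |1 - p.toReal / 2| < 0 := by
    have h : p.toReal * |p⁻¹.toReal - 1 / 2| = |1 - p.toReal / 2| := by
      nth_rewrite 1 [← abs_of_pos hP]
      rw [← abs_mul, ENNReal.toReal_inv, mul_sub, mul_inv_cancel₀ hP.ne', mul_one_div]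
    have h2 := mul_lt_mul_of_pos_right hm hP
    rw [criticalOrder] at h2
    rw [← h]
    linarith
  obtain ⟨A, hA, hAf⟩ := ha.exists_lintegral_lqSum_fio_le hn hP hq
    (fun x hx ξ => haK x ξ hx) hφ hφnd hK hψ0 s
    (η := -(m * p.toReal + ((n : ℝ) - 1) * |1 - p.toReal / 2|) / 2) (by linarith) (by ring)
  refine ⟨(A ^ (1 / p.toReal)).toNNReal, fun f => ?_⟩
  rw [ENNReal.coe_toNNReal (ENNReal.rpow_ne_top_of_nonneg (by positivity) hA), tlNorm, tlNorm,
    if_neg hp', if_neg hp', ← ENNReal.mul_rpow_of_nonneg _ _ (by positivity)]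
  exact ENNReal.rpow_le_rpow (hAf f) (by positivity)
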